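/- Let N_n = α R_n + β K_n + γ S_n with real constants α, β, γ ≥ 0, not all zero, where S_n is the size of the G-trie built from n random labelings, K_n is the number of external nodes occurring in exactly one labeling, and R_n is the number of external nodes occurring in no labeling. Exclude the degenerate case ρ = 1 with α = γ = 0 (where K_n = n is deterministic). Then there exist a > 1 and continuous positive 1-periodic functions Q_E, Q_V : ℝ → ℝ such that E(N_n) = Q_E(log_a n) n^ρ (1+o(1)); Var(N_n) = Q_V(log_a n) n^ρ (1+o(1)) if p_j = 1/A for all j, and Var(N_n) = Q_V(log_a n) n^{2ρ-1} (1+o(1)) otherwise; and (N_n - E(N_n))/sqrt(Var(N_n)) converges in distribution to the standard normal distribution N(0,1). -/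

import Mathlib

open MeasureTheory ProbabilityTheory Filter Topology

/-- A word `w` over `{1,…,M}×{1,…,A}` occurs in the labeling `L` of the infinite rooted
`M`-ary tree (nodes are identified with words over `Fin M`; the value of `L` on the root `[]`
is irrelevant) if along the path determined by the first components the labels are the
second components. -/
def Occurs {M A : ℕ} (L : List (Fin M) → Fin A) (w : List (Fin M × Fin A)) : Prop :=
  ∀ t : Fin w.length, L ((w.take (t.1 + 1)).map Prod.fst) = (w.get t).2

/-- The number of labelings among `Ls` in which the word `w` occurs. -/
noncomputable def occCount {M A n : ℕ} (Ls : Fin n → List (Fin M) → Fin A)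
    (w : List (Fin M × Fin A)) : ℕ :=
  Nat.card {i : Fin n // Occurs (Ls i) w}

/-- The G-trie built from the labelings `Ls`: all words occurring in at least two of them. -/
def GTrie {M A n : ℕ} (Ls : Fin n → List (Fin M) → Fin A) : Set (List (Fin M × Fin A)) :=
  {w | 2 ≤ occCount Ls w}

/-- The size of the G-trie built from the labelings `Ls` (as a real number). -/
noncomputable def gtrieSize {M A n : ℕ} (Ls : Fin n → List (Fin M) → Fin A) : ℝ :=
  (GTrie Ls).ncard

/-- `μL` is the distribution of a random labeling of the infinite rooted `M`-ary tree where
all labels are independent with `P(letter = j) = p j`: every finite cylinder set has the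
product probability. -/
def IsLabelingMeasure {M A : ℕ} (p : Fin A → ℝ) (μL : Measure (List (Fin M) → Fin A)) : Prop :=
  ∀ (s : Finset (List (Fin M))) (f : List (Fin M) → Fin A),
    μL {L | ∀ w ∈ s, L w = f w} = ∏ w ∈ s, ENNReal.ofReal (p (f w))

/-- `w` is an external node of the G-trie built from `Ls`: it occurs in at most one of the
labelings while every proper prefix occurs in at least two of them. -/
def IsExternalNode {M A n : ℕ} (Ls : Fin n → List (Fin M) → Fin A)
    (w : List (Fin M × Fin A)) : Prop :=
  occCount Ls w ≤ 1 ∧ ∀ u, u <+: w → u ≠ w → 2 ≤ occCount Ls u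

/-- `K_n`: the number of external nodes occurring in exactly one labeling. -/
noncomputable def extOneCount {M A n : ℕ} (Ls : Fin n → List (Fin M) → Fin A) : ℝ :=
  {w | IsExternalNode Ls w ∧ occCount Ls w = 1}.ncard

/-- `R_n`: the number of external nodes occurring in no labeling. -/
noncomputable def extZeroCount {M A n : ℕ} (Ls : Fin n → List (Fin M) → Fin A) : ℝ :=
  {w | IsExternalNode Ls w ∧ occCount Ls w = 0}.ncard

section Part1
open Finset

/-! ## Binomial and multinomial expectations -/

/-- Binomial expectation. -/
noncomputable def Eb (p : ℝ) : ℕ → (ℕ → ℝ) → ℝ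
  | 0, f => f 0
  | n + 1, f => p * Eb p n (fun k => f (k + 1)) + (1 - p) * Eb p n f

theorem Eb_zero (p : ℝ) (f : ℕ → ℝ) : Eb p 0 f = f 0 := rfl
theorem Eb_succ (p : ℝ) (n : ℕ) (f : ℕ → ℝ) :
    Eb p (n + 1) f = p * Eb p n (fun k => f (k + 1)) + (1 - p) * Eb p n f := rfl

theorem Eb_add (p : ℝ) (n : ℕ) : ∀ (f g : ℕ → ℝ),
    Eb p n (fun k => f k + g k) = Eb p n f + Eb p n g := by
  induction n with
  | zero => intro f g; simp [Eb_zero]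
  | succ n ih => intro f g; rw [Eb_succ, Eb_succ, Eb_succ, ih, ih]; ring

theorem Eb_smul (p : ℝ) (n : ℕ) (a : ℝ) : ∀ (f : ℕ → ℝ),
    Eb p n (fun k => a * f k) = a * Eb p n f := by
  induction n with
  | zero => intro f; simp [Eb_zero]
  | succ n ih => intro f; rw [Eb_succ, Eb_succ, ih, ih]; ring

theorem Eb_neg (p : ℝ) (n : ℕ) (f : ℕ → ℝ) :
    Eb p n (fun k => - f k) = - Eb p n f := by
  have := Eb_smul p n (-1) f
  simpa using this

theorem Eb_sub (p : ℝ) (n : ℕ) (f g : ℕ → ℝ) :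
    Eb p n (fun k => f k - g k) = Eb p n f - Eb p n g := by
  have := Eb_add p n f (fun k => - g k)
  rw [Eb_neg] at this
  simpa [sub_eq_add_neg] using this

theorem Eb_const (p : ℝ) (n : ℕ) (a : ℝ) : Eb p n (fun _ => a) = a := by
  induction n with
  | zero => rfl
  | succ n ih => rw [Eb_succ, ih]; ring

theorem Eb_congr (p : ℝ) (n : ℕ) : ∀ {f g : ℕ → ℝ}, (∀ k ≤ n, f k = g k) →
    Eb p n f = Eb p n g := by
  induction n with
  | zero => intro f g h; exact h 0 le_rfl
  | succ n ih =>
    intro f g h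
    rw [Eb_succ, Eb_succ, ih (fun k hk => h (k + 1) (by omega)), ih (fun k hk => h k (by omega))]

theorem Eb_mono {p : ℝ} (h0 : 0 ≤ p) (h1 : p ≤ 1) (n : ℕ) : ∀ {f g : ℕ → ℝ},
    (∀ k ≤ n, f k ≤ g k) → Eb p n f ≤ Eb p n g := by
  induction n with
  | zero => intro f g h; exact h 0 le_rfl
  | succ n ih =>
    intro f g h
    rw [Eb_succ, Eb_succ]
    have := ih (f := fun k => f (k+1)) (g := fun k => g (k+1)) (fun k hk => h (k + 1) (by omega))
    have h2 := ih (f := f) (g := g) (fun k hk => h k (by omega))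
    have h3 : 0 ≤ 1 - p := by linarith
    gcongr

theorem Eb_nonneg {p : ℝ} (h0 : 0 ≤ p) (h1 : p ≤ 1) (n : ℕ) {f : ℕ → ℝ}
    (h : ∀ k ≤ n, 0 ≤ f k) : 0 ≤ Eb p n f := by
  have := Eb_mono h0 h1 n h
  rwa [Eb_const] at this

theorem Eb_abs_le {p : ℝ} (h0 : 0 ≤ p) (h1 : p ≤ 1) (n : ℕ) (f : ℕ → ℝ) :
    |Eb p n f| ≤ Eb p n (fun k => |f k|) := by
  rw [abs_le]
  constructor
  · rw [← Eb_neg]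
    exact Eb_mono h0 h1 n (fun k _ => neg_abs_le _)
  · exact Eb_mono h0 h1 n (fun k _ => le_abs_self _)

/-- difference identity -/
theorem Eb_diff (p : ℝ) (n : ℕ) (f : ℕ → ℝ) :
    Eb p (n + 1) f - Eb p n f = p * Eb p n (fun k => f (k + 1) - f k) := by
  rw [Eb_succ, Eb_sub]; ring

/-- size-bias identity -/
theorem Eb_size (p : ℝ) (n : ℕ) : ∀ (g : ℕ → ℝ),
    Eb p (n + 1) (fun k => (k : ℝ) * g k) = ((n : ℝ) + 1) * p * Eb p n (fun k => g (k + 1)) := by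
  induction n with
  | zero => intro g; simp [Eb_succ, Eb_zero]
  | succ n ih =>
    intro g
    rw [Eb_succ, ih g, Eb_succ (n := n) (f := fun k => g (k+1))]
    have : (fun k : ℕ => ((k + 1 : ℕ) : ℝ) * g (k + 1)) =
        fun k : ℕ => (k : ℝ) * g (k + 1) + g (k + 1) := by
      funext k; push_cast; ring
    rw [this, Eb_add, ih (fun k => g (k + 1)), Eb_succ]
    push_cast
    ring

theorem Eb_self_le {p : ℝ} (h0 : 0 ≤ p) (h1 : p ≤ 1) (n : ℕ) : ∀ {g : ℕ → ℝ},
    (∀ k < n, g k ≤ 0) → Eb p n g ≤ p ^ n * g n := by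
  induction n with
  | zero => intro g _; simp [Eb_zero]
  | succ n ih =>
    intro g h
    rw [Eb_succ]
    have e1 := ih (g := fun k => g (k + 1)) (fun k hk => h (k + 1) (by omega))
    have e2 : Eb p n g ≤ 0 := by
      have := Eb_mono h0 h1 n (f := g) (g := fun _ => 0) (fun k hk => h k (by omega))
      rwa [Eb_const] at this
    have h3 : 0 ≤ 1 - p := by linarith
    calc p * Eb p n (fun k => g (k + 1)) + (1 - p) * Eb p n g
        ≤ p * (p ^ n * g (n + 1)) + (1 - p) * 0 := by gcongr
      _ = p ^ (n + 1) * g (n + 1) := by ring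

/-- splitting the self term -/
theorem Eb_split (p : ℝ) (n : ℕ) (f : ℕ → ℝ) :
    Eb p n f = p ^ n * f n + Eb p n (fun k => if k = n then 0 else f k) := by
  have key : ∀ (n : ℕ) (f : ℕ → ℝ), Eb p n (fun k => if k = n then f k else 0) = p ^ n * f n := by
    intro n
    induction n with
    | zero => intro f; simp [Eb_zero]
    | succ n ih =>
      intro f
      rw [Eb_succ]
      have e1 : Eb p n (fun k => if k = n + 1 then f k else 0) = 0 := by
        rw [Eb_congr p n (g := fun _ => 0), Eb_const]
        intro k hk
        simp [show k ≠ n + 1 by omega]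
      have e2 : (fun k => if k + 1 = n + 1 then f (k + 1) else 0) =
          fun k => if k = n then f (k + 1) else 0 := by
        funext k; simp
      rw [e1, e2, ih (fun k => f (k + 1))]; ring
  rw [← key, ← Eb_add]
  apply Eb_congr
  intro k _
  split_ifs <;> simp

/-- probability of zero -/
theorem Eb_ind_zero (p : ℝ) (n : ℕ) : Eb p n (fun k => if k = 0 then 1 else 0) = (1 - p) ^ n := by
  induction n with
  | zero => simp [Eb_zero]
  | succ n ih =>
    rw [Eb_succ, ih]
    simp only [Nat.add_eq_zero_iff, one_ne_zero, and_false, if_false, Eb_const]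
    ring

theorem Eb_ind_one (p : ℝ) (n : ℕ) :
    Eb p (n + 1) (fun k => if k = 1 then 1 else 0) = (n + 1) * p * (1 - p) ^ n := by
  have := Eb_size p n (fun k => if k = 1 then 1 else 0)
  rw [← Eb_ind_zero]
  simp only [Nat.add_eq_right] at this
  rw [← this]
  apply Eb_congr
  intro k _
  split_ifs with h <;> simp [h]

theorem Eb_id (p : ℝ) (n : ℕ) : Eb p n (fun k => (k : ℝ)) = n * p := by
  cases n with
  | zero => simp [Eb_zero]
  | succ n =>
    have := Eb_size p n (fun _ => 1)
    simp only [mul_one, Eb_const] at this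
    rw [this]; push_cast; ring

/-- weighted-mean representation for Jensen -/
theorem Eb_rep {p : ℝ} (h0 : 0 ≤ p) (h1 : p ≤ 1) (n : ℕ) :
    ∃ w : ℕ → ℝ, (∀ k, 0 ≤ w k) ∧ (∑ k ∈ range (n + 1), w k = 1) ∧
      ∀ f : ℕ → ℝ, Eb p n f = ∑ k ∈ range (n + 1), w k * f k := by
  have hw : ∀ f : ℕ → ℝ, Eb p n f =
      ∑ k ∈ range (n + 1), Eb p n (fun i => if i = k then 1 else 0) * f k := by
    intro f
    have hs : ∀ (s : Finset ℕ) (F : ℕ → ℕ → ℝ), Eb p n (fun i => ∑ k ∈ s, F k i) =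
        ∑ k ∈ s, Eb p n (F k) := by
      intro s F
      induction s using Finset.induction_on with
      | empty => simp [Eb_const]
      | insert a s ha ih =>
        simp only [Finset.sum_insert ha]
        rw [Eb_add, ih]
    have : ∀ k, Eb p n (fun i => if i = k then 1 else 0) * f k =
        Eb p n (fun i => f k * (if i = k then 1 else 0)) := by
      intro k; rw [Eb_smul]; ring
    simp_rw [this]
    rw [← hs]
    apply Eb_congr
    intro i hi
    simp [Finset.sum_ite_eq, show i < n + 1 by omega]
  refine ⟨fun k => Eb p n (fun i => if i = k then 1 else 0), ?_, ?_, hw⟩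
  · intro k
    apply Eb_nonneg h0 h1
    intro i _
    split_ifs <;> norm_num
  · have := hw (fun _ => 1)
    rw [Eb_const] at this
    simpa using this.symm

theorem Eb_jensen_concave {p : ℝ} (h0 : 0 ≤ p) (h1 : p ≤ 1) (n : ℕ) {s : Set ℝ} {φ : ℝ → ℝ}
    (hφ : ConcaveOn ℝ s φ) (f : ℕ → ℝ) (hf : ∀ k, f k ∈ s) :
    Eb p n (fun k => φ (f k)) ≤ φ (Eb p n f) := by
  obtain ⟨w, w0, w1, hw⟩ := Eb_rep h0 h1 n
  rw [hw, hw]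
  have := hφ.le_map_sum (t := range (n+1)) (w := w) (p := f) (fun k _ => w0 k) w1 (fun k _ => hf k)
  simpa using this

theorem Eb_jensen_convex {p : ℝ} (h0 : 0 ≤ p) (h1 : p ≤ 1) (n : ℕ) {s : Set ℝ} {φ : ℝ → ℝ}
    (hφ : ConvexOn ℝ s φ) (f : ℕ → ℝ) (hf : ∀ k, f k ∈ s) :
    φ (Eb p n f) ≤ Eb p n (fun k => φ (f k)) := by
  obtain ⟨w, w0, w1, hw⟩ := Eb_rep h0 h1 n
  rw [hw, hw]
  have := hφ.map_sum_le (t := range (n+1)) (w := w) (p := f) (fun k _ => w0 k) w1 (fun k _ => hf k)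
  simpa using this

/-- comparison principle -/
theorem comparison {A : ℕ} {p c : Fin A → ℝ} (hp0 : ∀ j, 0 ≤ p j) (hp1 : ∀ j, p j ≤ 1)
    (hc : ∀ j, 0 ≤ c j) {n0 : ℕ} (hcs : ∀ n ≥ n0, ∑ j, c j * p j ^ n < 1)
    {f b a : ℕ → ℝ} {N : ℕ} (hf : ∀ n ≥ n0, n < N → f n ≤ ∑ j, c j * Eb (p j) n f + a n)
    (hb : ∀ n ≥ n0, n < N → ∑ j, c j * Eb (p j) n b + a n ≤ b n)
    (hi : ∀ n < n0, f n ≤ b n) : ∀ n < N, f n ≤ b n := by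
  intro n
  induction n using Nat.strong_induction_on with
  | _ n ih =>
    intro hN
    by_cases hn : n < n0
    · exact hi n hn
    push Not at hn
    have h1 := hf n hn hN
    have h2 := hb n hn hN
    have h3 := hcs n hn
    have h4 : ∑ j, c j * Eb (p j) n f - ∑ j, c j * Eb (p j) n b ≤
        (∑ j, c j * p j ^ n) * (f n - b n) := by
      rw [← Finset.sum_sub_distrib, Finset.sum_mul]
      apply Finset.sum_le_sum
      intro j _
      have : Eb (p j) n (fun k => f k - b k) ≤ p j ^ n * (f n - b n) := by
        apply Eb_self_le (hp0 j) (hp1 j) n (g := fun k => f k - b k)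
        intro k hk
        have := ih k hk (hk.trans hN)
        linarith
      rw [Eb_sub] at this
      have := mul_le_mul_of_nonneg_left this (hc j)
      linarith
    have : f n - b n ≤ (∑ j, c j * p j ^ n) * (f n - b n) := by linarith
    by_contra hcon
    push Not at hcon
    nlinarith

theorem comparison' {A : ℕ} {p c : Fin A → ℝ} (hp0 : ∀ j, 0 ≤ p j) (hp1 : ∀ j, p j ≤ 1)
    (hc : ∀ j, 0 ≤ c j) {n0 : ℕ} (hcs : ∀ n ≥ n0, ∑ j, c j * p j ^ n < 1)
    {f b a : ℕ → ℝ} (hf : ∀ n ≥ n0, f n ≤ ∑ j, c j * Eb (p j) n f + a n)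
    (hb : ∀ n ≥ n0, ∑ j, c j * Eb (p j) n b + a n ≤ b n)
    (hi : ∀ n < n0, f n ≤ b n) : ∀ n, f n ≤ b n := fun n =>
  comparison hp0 hp1 hc hcs (N := n + 1) (fun k hk _ => hf k hk) (fun k hk _ => hb k hk) hi n
    (Nat.lt_succ_self n)

/-- existence of solutions of the recursion -/
theorem exists_sol {A : ℕ} {p c : Fin A → ℝ} {n0 : ℕ}
    (hcs : ∀ n ≥ n0, ∑ j, c j * p j ^ n < 1) (a : ℕ → ℝ) :
    ∃ f : ℕ → ℝ, (∀ n < n0, f n = 0) ∧ ∀ n ≥ n0, f n = ∑ j, c j * Eb (p j) n f + a n := by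
  classical
  have hex : ∀ N : ℕ, ∃ f : ℕ → ℝ, (∀ n < n0, f n = 0) ∧
      ∀ n ≥ n0, n < N → f n = ∑ j, c j * Eb (p j) n f + a n := by
    intro N
    induction N with
    | zero => exact ⟨fun _ => 0, fun _ _ => rfl, fun n _ h => absurd h (by omega)⟩
    | succ N ih =>
      obtain ⟨f, h0, hf⟩ := ih
      by_cases hN : N < n0
      · exact ⟨f, h0, fun n h1 h2 => absurd h2 (by omega)⟩
      push Not at hN
      set x : ℝ := (∑ j, c j * Eb (p j) N (fun k => if k = N then 0 else f k) + a N) /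
        (1 - ∑ j, c j * p j ^ N) with hx
      have hpos : 0 < 1 - ∑ j, c j * p j ^ N := by linarith [hcs N hN]
      refine ⟨fun k => if k = N then x else f k, ?_, ?_⟩
      · intro n hn; simp only [show n ≠ N by omega, if_false]; exact h0 n hn
      · intro n hn hn'
        by_cases hnN : n = N
        · subst hnN
          simp only [if_true]
          have : ∀ j, Eb (p j) n (fun k => if k = n then x else f k) =
              p j ^ n * x + Eb (p j) n (fun k => if k = n then 0 else f k) := by
            intro j
            rw [Eb_split]
            simp only [if_true]
            congr 1
            apply Eb_congr; intro k _; split_ifs <;> rfl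
          simp_rw [this, mul_add, Finset.sum_add_distrib]
          have h5 : ∑ j, c j * (p j ^ n * x) = (∑ j, c j * p j ^ n) * x := by
            rw [Finset.sum_mul]; apply Finset.sum_congr rfl; intro j _; ring
          rw [h5]
          have : (1 - ∑ j, c j * p j ^ n) * x =
              (∑ j, c j * Eb (p j) n (fun k => if k = n then 0 else f k) + a n) := by
            rw [hx]; field_simp
          linarith
        · simp only [hnN, if_false]
          rw [hf n hn (by omega)]
          congr 1
          apply Finset.sum_congr rfl; intro j _
          congr 1
          apply Eb_congr
          intro k hk
          simp [show k ≠ N by omega]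
  choose F hF0 hF using hex
  have huniq : ∀ N N' n, n < N → n < N' → F N n = F N' n := by
    intro N N' n
    induction n using Nat.strong_induction_on with
    | _ n ih =>
      intro h1 h2
      by_cases hn : n < n0
      · rw [hF0 N n hn, hF0 N' n hn]
      push Not at hn
      have e1 := hF N n hn h1
      have e2 := hF N' n hn h2
      have : ∀ j, Eb (p j) n (F N) - Eb (p j) n (F N') = p j ^ n * (F N n - F N' n) := by
        intro j
        rw [Eb_split _ _ (F N), Eb_split _ _ (F N')]
        have : Eb (p j) n (fun k => if k = n then 0 else F N k) =
            Eb (p j) n (fun k => if k = n then 0 else F N' k) := by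
          apply Eb_congr
          intro k hk
          split_ifs with h
          · rfl
          · exact ih k (by omega) (by omega) (by omega)
        rw [this]; ring
      have h3 : F N n - F N' n = (∑ j, c j * p j ^ n) * (F N n - F N' n) := by
        have : ∑ j, c j * Eb (p j) n (F N) - ∑ j, c j * Eb (p j) n (F N') =
            (∑ j, c j * p j ^ n) * (F N n - F N' n) := by
          rw [← Finset.sum_sub_distrib, Finset.sum_mul]
          apply Finset.sum_congr rfl; intro j _
          rw [← mul_sub, this]; ring
        linarith
      have h4 := hcs n hn
      have h5 : (1 - ∑ j, c j * p j ^ n) * (F N n - F N' n) = 0 := by linarith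
      rcases mul_eq_zero.mp h5 with h | h
      · linarith
      · linarith
  refine ⟨fun n => F (n + 1) n, fun n hn => hF0 _ n hn, fun n hn => ?_⟩
  show F (n + 1) n = _
  rw [hF (n + 1) n hn (Nat.lt_succ_self n)]
  congr 1
  apply Finset.sum_congr rfl; intro j _
  congr 1
  apply Eb_congr
  intro k hk
  exact huniq _ _ _ (by omega) (by omega)

/-! ### Multinomial expectation -/

/-- Expectation over random colorings. -/
noncomputable def EE {A : ℕ} {E : Type*} [AddCommMonoid E] [Module ℝ E] (p : Fin A → ℝ) (n : ℕ)
    (F : (Fin n → Fin A) → E) : E :=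
  ∑ c : Fin n → Fin A, (∏ k, p (c k)) • F c

/-- Number of indices of color `j`. -/
def cnt {A n : ℕ} (c : Fin n → Fin A) (j : Fin A) : ℕ := (univ.filter (fun k => c k = j)).card

section EEsec
variable {A : ℕ} {p : Fin A → ℝ}

theorem EE_succ {E : Type*} [AddCommMonoid E] [Module ℝ E] (n : ℕ) (F : (Fin (n+1) → Fin A) → E) :
    EE p (n + 1) F = ∑ j, p j • EE p n (fun c => F (Fin.cons j c)) := by
  unfold EE
  rw [← (Fin.consEquiv (fun _ : Fin (n+1) => Fin A)).sum_comp, Fintype.sum_prod_type]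
  apply Finset.sum_congr rfl; intro j _
  rw [Finset.smul_sum]
  apply Finset.sum_congr rfl; intro c _
  rw [smul_smul]
  simp [Fin.consEquiv, Fin.prod_univ_succ]

theorem cnt_cons {n : ℕ} (c : Fin n → Fin A) (i j : Fin A) :
    cnt (Fin.cons i c : Fin (n+1) → Fin A) j = cnt c j + if i = j then 1 else 0 := by
  unfold cnt
  simp only [Finset.card_filter, Fin.sum_univ_succ, Fin.cons_zero, Fin.cons_succ]
  ring

theorem EE_add {E : Type*} [AddCommMonoid E] [Module ℝ E] (n : ℕ) (F G : (Fin n → Fin A) → E) :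
    EE p n (fun c => F c + G c) = EE p n F + EE p n G := by
  simp [EE, Finset.sum_add_distrib]

theorem EE_sub {E : Type*} [AddCommGroup E] [Module ℝ E] (n : ℕ) (F G : (Fin n → Fin A) → E) :
    EE p n (fun c => F c - G c) = EE p n F - EE p n G := by
  simp [EE, Finset.sum_sub_distrib, smul_sub]

theorem EE_sum {E ι : Type*} [AddCommMonoid E] [Module ℝ E] (n : ℕ) (s : Finset ι)
    (F : ι → (Fin n → Fin A) → E) :
    EE p n (fun c => ∑ i ∈ s, F i c) = ∑ i ∈ s, EE p n (F i) := by
  simp only [EE, Finset.smul_sum]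
  rw [Finset.sum_comm]

theorem EE_mul (n : ℕ) (a : ℝ) (F : (Fin n → Fin A) → ℝ) :
    EE p n (fun c => a * F c) = a * EE p n F := by
  simp only [EE, Finset.mul_sum, smul_eq_mul]
  apply Finset.sum_congr rfl; intro c _; ring

theorem EE_mulC (n : ℕ) (a : ℂ) (F : (Fin n → Fin A) → ℂ) :
    EE p n (fun c => a * F c) = a * EE p n F := by
  simp only [EE, Finset.mul_sum]
  apply Finset.sum_congr rfl; intro c _; rw [mul_smul_comm]

theorem EE_const {E : Type*} [AddCommGroup E] [Module ℝ E] (hps : ∑ j, p j = 1) (n : ℕ) (a : E) :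
    EE p n (fun _ => a) = a := by
  induction n with
  | zero => simp [EE]
  | succ n ih =>
    rw [EE_succ]
    simp only [ih]
    rw [← Finset.sum_smul, hps, one_smul]

theorem EE_mono (hp : ∀ j, 0 ≤ p j) (n : ℕ) {F G : (Fin n → Fin A) → ℝ} (h : ∀ c, F c ≤ G c) :
    EE p n F ≤ EE p n G := by
  unfold EE
  apply Finset.sum_le_sum; intro c _
  exact mul_le_mul_of_nonneg_left (h c) (Finset.prod_nonneg fun k _ => hp _)

theorem EE_nonneg (hp : ∀ j, 0 ≤ p j) (n : ℕ) {F : (Fin n → Fin A) → ℝ} (h : ∀ c, 0 ≤ F c) :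
    0 ≤ EE p n F :=
  Finset.sum_nonneg fun c _ => mul_nonneg (Finset.prod_nonneg fun k _ => hp _) (h c)

theorem EE_norm_le {E : Type*} [NormedAddCommGroup E] [NormedSpace ℝ E]
    (hp : ∀ j, 0 ≤ p j) (n : ℕ) (F : (Fin n → Fin A) → E) :
    ‖EE p n F‖ ≤ EE p n (fun c => ‖F c‖) := by
  unfold EE
  refine (norm_sum_le _ _).trans ?_
  apply Finset.sum_le_sum; intro c _
  rw [norm_smul, Real.norm_of_nonneg (Finset.prod_nonneg fun k _ => hp _), smul_eq_mul]

theorem EE_ofReal (n : ℕ) (F : (Fin n → Fin A) → ℝ) :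
    EE p n (fun c => ((F c : ℝ) : ℂ)) = ((EE p n F : ℝ) : ℂ) := by
  simp [EE]

theorem EE_cauchy (hp : ∀ j, 0 ≤ p j) (n : ℕ) (F G : (Fin n → Fin A) → ℝ) :
    (EE p n (fun c => F c * G c)) ^ 2 ≤ EE p n (fun c => F c ^ 2) * EE p n (fun c => G c ^ 2) := by
  unfold EE
  have := Finset.sum_mul_sq_le_sq_mul_sq (univ : Finset (Fin n → Fin A))
    (fun c => √(∏ k, p (c k)) * F c) (fun c => √(∏ k, p (c k)) * G c)
  have hs : ∀ c : Fin n → Fin A, √(∏ k, p (c k)) * √(∏ k, p (c k)) = ∏ k, p (c k) :=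
    fun c => Real.mul_self_sqrt (Finset.prod_nonneg fun k _ => hp _)
  have e : ∀ (F G : (Fin n → Fin A) → ℝ), ∑ c, (√(∏ k, p (c k)) * F c) * (√(∏ k, p (c k)) * G c) =
      ∑ c, (∏ k, p (c k)) • (F c * G c) := by
    intro F G
    apply Finset.sum_congr rfl; intro c _
    rw [smul_eq_mul]
    conv_rhs => rw [← hs c]
    ring
  simp only [sq] at this ⊢
  rw [e, e, e] at this
  exact this

theorem EE_cnt (hps : ∑ j, p j = 1) (j : Fin A) (n : ℕ) : ∀ f : ℕ → ℝ,
    EE p n (fun c => f (cnt c j)) = Eb (p j) n f := by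
  induction n with
  | zero => intro f; simp [EE, Eb_zero, cnt]
  | succ n ih =>
    intro f
    rw [EE_succ, Eb_succ]
    simp only [cnt_cons]
    rw [← Finset.add_sum_erase _ _ (Finset.mem_univ j)]
    simp only [if_true, smul_eq_mul]
    rw [ih (fun k => f (k + 1))]
    congr 1
    have : ∀ i ∈ univ.erase j, p i * EE p n (fun c => f (cnt c j + if i = j then 1 else 0)) =
        p i * Eb (p j) n f := by
      intro i hi
      have := Finset.ne_of_mem_erase hi
      simp only [this, if_false, add_zero, ih f]
    rw [Finset.sum_congr rfl this, ← Finset.sum_mul]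
    congr 1
    rw [← hps, ← Finset.add_sum_erase _ _ (Finset.mem_univ j)]; ring

/-- products over independent colors -/
theorem EE_prod_pi (n : ℕ) (u : Fin A → ℂ) :
    EE p n (fun c => ∏ k, u (c k)) = (∑ j, (p j : ℂ) * u j) ^ n := by
  induction n with
  | zero => simp [EE]
  | succ n ih =>
    rw [EE_succ, pow_succ', Finset.sum_mul]
    apply Finset.sum_congr rfl; intro j _
    simp only [Fin.prod_univ_succ, Fin.cons_zero, Fin.cons_succ]
    rw [EE_mulC, ih]
    simp; ring

theorem EE_prod_piR (n : ℕ) (u : Fin A → ℝ) :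
    EE p n (fun c => ∏ k, u (c k)) = (∑ j, p j * u j) ^ n := by
  induction n with
  | zero => simp [EE]
  | succ n ih =>
    rw [EE_succ, pow_succ', Finset.sum_mul]
    apply Finset.sum_congr rfl; intro j _
    simp only [Fin.prod_univ_succ, Fin.cons_zero, Fin.cons_succ]
    rw [EE_mul, ih]
    simp; ring

theorem sum_color {n : ℕ} (c : Fin n → Fin A) (x : Fin A → ℝ) :
    ∑ k, x (c k) = ∑ j, x j * cnt c j := by
  have : ∀ k, x (c k) = ∑ j, if c k = j then x j else 0 := by intro k; simp
  simp_rw [this]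
  rw [Finset.sum_comm]
  apply Finset.sum_congr rfl; intro j _
  rw [cnt, ← Finset.sum_filter, Finset.sum_const, nsmul_eq_mul]; ring

theorem sum_cnt {n : ℕ} (c : Fin n → Fin A) : ∑ j, (cnt c j : ℝ) = n := by
  have := sum_color c (fun _ => 1)
  simp at this
  exact this.symm

theorem cnt_le {n : ℕ} (c : Fin n → Fin A) (j : Fin A) : cnt c j ≤ n := by
  have := Finset.card_filter_le (univ : Finset (Fin n)) (fun k => c k = j)
  simpa [cnt] using this

/-- second moment of a centered sum -/
theorem EE_lin_sq (hps : ∑ j, p j = 1) (x : Fin A → ℝ) (hx : ∑ j, p j * x j = 0) (n : ℕ) :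
    EE p n (fun c => ∑ k, x (c k)) = 0 ∧
    EE p n (fun c => (∑ k, x (c k)) ^ 2) = n * ∑ j, p j * x j ^ 2 := by
  induction n with
  | zero => simp [EE]
  | succ n ih =>
    obtain ⟨i1, i2⟩ := ih
    constructor
    · rw [EE_succ]
      simp only [Fin.sum_univ_succ, Fin.cons_zero, Fin.cons_succ, EE_add, EE_const hps, i1,
        smul_eq_mul, add_zero, hx]
    · rw [EE_succ]
      have : ∀ j, EE p n (fun c => (∑ k, x ((Fin.cons j c : Fin (n+1) → Fin A) k)) ^ 2) =
          x j ^ 2 + n * ∑ j, p j * x j ^ 2 := by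
        intro j
        simp only [Fin.sum_univ_succ, Fin.cons_zero, Fin.cons_succ]
        have : (fun c : Fin n → Fin A => (x j + ∑ k, x (c k)) ^ 2) = fun c =>
            (x j ^ 2 + (2 * x j) * ∑ k, x (c k)) + (∑ k, x (c k)) ^ 2 := by
          funext c; ring
        rw [this, EE_add, EE_add, EE_mul, EE_const hps, i1, i2]; ring
      simp_rw [this, smul_eq_mul, mul_add, Finset.sum_add_distrib]
      rw [← Finset.sum_mul, hps]; push_cast; ring

end EEsec
end Part1

section Part2
open Finset

/-- The standing assumptions. -/
structure Par (M A : ℕ) (p : Fin A → ℝ) (ρ : ℝ) : Prop where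
  hM : 1 ≤ M
  hA : 2 ≤ A
  p0 : ∀ j, 0 < p j
  p1 : ∀ j, p j < 1
  ps : ∑ j, p j = 1
  hs : (M : ℝ) * ∑ j, p j ^ 2 < 1
  hρ : (M : ℝ) * ∑ j, p j ^ ρ = 1
  r1 : 1 ≤ ρ
  r2 : ρ < 2

namespace Par
variable {M A : ℕ} {p : Fin A → ℝ} {ρ : ℝ}

theorem p0' (P : Par M A p ρ) (j) : 0 ≤ p j := (P.p0 j).le
theorem p1' (P : Par M A p ρ) (j) : p j ≤ 1 := (P.p1 j).le
theorem Mpos (P : Par M A p ρ) : (0 : ℝ) < M := by exact_mod_cast P.hM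
theorem ne (P : Par M A p ρ) : Nonempty (Fin A) := ⟨⟨0, by have := P.hA; omega⟩⟩

theorem powlt (P : Par M A p ρ) {n : ℕ} (hn : 2 ≤ n) : ∑ j, (M : ℝ) * p j ^ n < 1 := by
  refine lt_of_le_of_lt ?_ P.hs
  rw [Finset.mul_sum]
  apply Finset.sum_le_sum; intro j _
  have := pow_le_pow_of_le_one (P.p0' j) (P.p1' j) hn
  have := P.Mpos
  gcongr

theorem pi_sum (P : Par M A p ρ) : ∑ j, (M : ℝ) * p j ^ ρ = 1 := by rw [← Finset.mul_sum]; exact P.hρ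

theorem rlt (P : Par M A p ρ) {x : ℝ} (hx : ρ < x) : ∑ j, (M : ℝ) * p j ^ x < 1 := by
  rw [← P.pi_sum]
  have := P.ne
  apply Finset.sum_lt_sum_of_nonempty Finset.univ_nonempty
  intro j _
  have := Real.rpow_lt_rpow_of_exponent_gt (P.p0 j) (P.p1 j) hx
  have := P.Mpos
  gcongr

theorem rgt (P : Par M A p ρ) {x : ℝ} (hx : x < ρ) : 1 < ∑ j, (M : ℝ) * p j ^ x := by
  rw [← P.pi_sum]
  have := P.ne
  apply Finset.sum_lt_sum_of_nonempty Finset.univ_nonempty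
  intro j _
  have := Real.rpow_lt_rpow_of_exponent_gt (P.p0 j) (P.p1 j) hx
  have := P.Mpos
  gcongr
end Par

theorem Par.mk' {M A : ℕ} {p : Fin A → ℝ} {ρ : ℝ} (hM : 1 ≤ M) (hA : 2 ≤ A)
    (hp0 : ∀ j, 0 < p j) (hp1 : ∀ j, p j < 1)
    (hpsum : ∑ j, p j = 1)
    (hnonexp : ∑ j, (p j) ^ 2 < 1 / (M : ℝ))
    (hρ : ∑ j, (p j) ^ ρ = 1 / (M : ℝ)) : Par M A p ρ := by
  have hMp : (0:ℝ) < M := by exact_mod_cast hM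
  have : Nonempty (Fin A) := ⟨⟨0, by omega⟩⟩
  have hanti : ∀ x y : ℝ, x < y → ∑ j, p j ^ y < ∑ j, p j ^ x := by
    intro x y hxy
    apply Finset.sum_lt_sum_of_nonempty Finset.univ_nonempty
    intro j _
    exact Real.rpow_lt_rpow_of_exponent_gt (hp0 j) (hp1 j) hxy
  refine ⟨hM, hA, hp0, hp1, hpsum, ?_, ?_, ?_, ?_⟩
  · rw [lt_div_iff₀ hMp] at hnonexp; linarith
  · rw [hρ]; field_simp
  · by_contra h
    push Not at h
    have h1 := hanti _ _ h
    simp only [Real.rpow_one, hpsum, hρ] at h1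
    rw [lt_div_iff₀ hMp] at h1
    have : (1:ℝ) ≤ M := by exact_mod_cast hM
    linarith
  · by_contra h
    push Not at h
    have h1 : ∑ j, p j ^ ρ ≤ ∑ j, p j ^ (2:ℝ) := by
      rcases h.eq_or_lt with h | h
      · rw [h]
      · exact (hanti _ _ h).le
    simp only [Real.rpow_two] at h1
    linarith

theorem Eb_inv_le {p : ℝ} (h0 : 0 < p) (h1 : p ≤ 1) (n : ℕ) :
    Eb p n (fun k => 1 / ((k : ℝ) + 1)) ≤ 1 / (((n : ℝ) + 1) * p) := by
  have h := Eb_size p n (fun k => 1 / (k : ℝ))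
  have h2 : Eb p (n + 1) (fun k => (k : ℝ) * (1 / (k : ℝ))) ≤ 1 := by
    have := Eb_mono h0.le h1 (n + 1) (f := fun k => (k : ℝ) * (1 / (k : ℝ))) (g := fun _ => 1)
      (fun k _ => by rw [mul_one_div]; exact div_self_le_one _)
    rwa [Eb_const] at this
  rw [h] at h2
  push_cast at h2
  rw [le_div_iff₀ (by positivity)]
  linarith

theorem Eb_rpow_neg_le {p : ℝ} (h0 : 0 < p) (h1 : p ≤ 1) (n : ℕ) {η : ℝ} (h2 : -1 ≤ η) (h3 : η ≤ 0) :
    Eb p n (fun k => ((k : ℝ) + 1) ^ η) ≤ p ^ η * ((n : ℝ) + 1) ^ η := by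
  have hj := Eb_jensen_concave h0.le h1 n (Real.concaveOn_rpow (p := -η) (by linarith) (by linarith))
    (fun k => 1 / ((k : ℝ) + 1)) (fun k => by simp only [Set.mem_Ici]; positivity)
  have e : ∀ x : ℝ, 0 < x → (1 / x) ^ (-η) = x ^ η := by
    intro x hx
    rw [one_div, Real.inv_rpow hx.le, Real.rpow_neg hx.le, inv_inv]
  calc Eb p n (fun k => ((k : ℝ) + 1) ^ η)
      = Eb p n (fun k => (1 / ((k : ℝ) + 1)) ^ (-η)) := by
        apply Eb_congr; intro k _; rw [e _ (by positivity)]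
    _ ≤ _ := hj
    _ ≤ (1 / (((n : ℝ) + 1) * p)) ^ (-η) := by
        apply Real.rpow_le_rpow _ (Eb_inv_le h0 h1 n) (by linarith)
        apply Eb_nonneg h0.le h1; intro k _; positivity
    _ = _ := by
        rw [e _ (by positivity), Real.mul_rpow (by positivity) h0.le]; ring

theorem Eb_rpow_le {p : ℝ} (h0 : 0 ≤ p) (h1 : p ≤ 1) (n : ℕ) {η : ℝ} (h2 : 0 ≤ η) (h3 : η ≤ 1) :
    Eb p n (fun k => (k : ℝ) ^ η) ≤ p ^ η * (n : ℝ) ^ η := by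
  have hj := Eb_jensen_concave h0 h1 n (Real.concaveOn_rpow (p := η) h2 h3)
    (fun k => (k : ℝ)) (fun k => by simp only [Set.mem_Ici]; positivity)
  rw [Eb_id] at hj
  rw [← Real.mul_rpow h0 (by positivity), mul_comm p]
  exact hj

theorem bound_e {M A : ℕ} {p : Fin A → ℝ} {ρ : ℝ} (P : Par M A p ρ) {e : ℕ → ℝ}
    (he : ∀ n ≥ 2, e n = ∑ j, (M : ℝ) * p j ^ 2 * Eb (p j) n e) :
    ∃ C > 0, ∀ n, |e n| ≤ C * ((n : ℝ) + 1) ^ (ρ - 2) := by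
  have hM := P.Mpos
  set C : ℝ := (|e 0| + |e 1| + 1) * 2 with hC
  have hCpos : 0 < C := by positivity
  refine ⟨C, hCpos, ?_⟩
  apply comparison' (n0 := 2) (fun j => P.p0' j) (fun j => P.p1' j)
    (c := fun j => (M : ℝ) * p j ^ 2) (a := fun _ => 0)
    (f := fun n => |e n|) (b := fun n => C * ((n : ℝ) + 1) ^ (ρ - 2))
  · intro j; positivity
  · intro n hn
    have := P.powlt (n := n + 2) (by omega)
    refine lt_of_le_of_lt (le_of_eq ?_) this
    apply Finset.sum_congr rfl; intro j _; ring
  · intro n hn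
    rw [he n hn, add_zero]
    refine (Finset.abs_sum_le_sum_abs _ _).trans ?_
    apply Finset.sum_le_sum; intro j _
    rw [abs_mul, abs_of_nonneg (by positivity : (0:ℝ) ≤ (M : ℝ) * p j ^ 2)]
    have := Eb_abs_le (P.p0' j) (P.p1' j) n e
    gcongr
  · intro n hn
    rw [add_zero]
    simp_rw [Eb_smul]
    calc ∑ j, (M : ℝ) * p j ^ 2 * (C * Eb (p j) n (fun k => ((k : ℝ) + 1) ^ (ρ - 2)))
        ≤ ∑ j, (M : ℝ) * p j ^ 2 * (C * (p j ^ (ρ - 2) * ((n : ℝ) + 1) ^ (ρ - 2))) := by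
          apply Finset.sum_le_sum; intro j _
          have := Eb_rpow_neg_le (P.p0 j) (P.p1' j) n (η := ρ - 2) (by linarith [P.r1]) (by linarith [P.r2])
          gcongr
      _ = (∑ j, (M : ℝ) * p j ^ ρ) * (C * ((n : ℝ) + 1) ^ (ρ - 2)) := by
          rw [Finset.sum_mul]
          apply Finset.sum_congr rfl; intro j _
          have : p j ^ ρ = p j ^ 2 * p j ^ (ρ - 2) := by
            rw [← Real.rpow_two, ← Real.rpow_add (P.p0 j)]; congr 1; ring
          rw [this]; ring
      _ = _ := by rw [P.pi_sum, one_mul]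
  · intro n hn
    have h1 : n = 0 ∨ n = 1 := by omega
    rcases h1 with rfl | rfl
    · simp only [hC, Nat.cast_zero, zero_add, Real.one_rpow, mul_one]
      linarith [abs_nonneg (e 0), abs_nonneg (e 1)]
    · have : (1 / 2 : ℝ) ≤ (((1:ℕ) : ℝ) + 1) ^ (ρ - 2) := by
        have h2 : ((2:ℝ)) ^ (-1 : ℝ) ≤ 2 ^ (ρ - 2) :=
          Real.rpow_le_rpow_of_exponent_le (by norm_num) (by linarith [P.r1])
        rw [Real.rpow_neg_one] at h2
        norm_num at h2 ⊢
        exact h2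
      have h3 : |e 1| ≤ C * (1 / 2) := by
        simp only [hC]; linarith [abs_nonneg (e 0)]
      exact h3.trans (by gcongr)

theorem rpow_sum_step {a : ℝ} (h0 : 0 < a) (h1 : a ≤ 1) (k : ℕ) :
    a * ((k : ℝ) + 1) ^ (a - 1) ≤ ((k : ℝ) + 1) ^ a - (k : ℝ) ^ a := by
  have hk : (0:ℝ) < (k : ℝ) + 1 := by positivity
  have hb := rpow_one_add_le_one_add_mul_self (s := - (1 / ((k : ℝ) + 1))) (p := a)
    (by
      have : 1 / ((k : ℝ) + 1) ≤ 1 := by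
        rw [div_le_one hk]; linarith [(Nat.cast_nonneg k : (0:ℝ) ≤ k)]
      linarith) h0.le h1
  have e1 : (1 : ℝ) + - (1 / ((k : ℝ) + 1)) = k / ((k : ℝ) + 1) := by field_simp; ring
  rw [e1, Real.div_rpow (by positivity) hk.le, div_le_iff₀ (by positivity)] at hb
  have e2 : ((k : ℝ) + 1) ^ (a - 1) = ((k : ℝ) + 1) ^ a / ((k : ℝ) + 1) := by
    rw [Real.rpow_sub hk, Real.rpow_one]
  rw [e2]
  have : (1 + a * -(1 / ((k : ℝ) + 1))) * ((k : ℝ) + 1) ^ a =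
     ((k : ℝ) + 1) ^ a - a * (((k : ℝ) + 1) ^ a / ((k : ℝ) + 1)) := by field_simp; ring
  linarith

theorem bound_d {M A : ℕ} {p : Fin A → ℝ} {ρ : ℝ} (P : Par M A p ρ) {d : ℕ → ℝ}
    (hd : ∀ n ≥ 2, d n = ∑ j, (M : ℝ) * p j * Eb (p j) n d) {C : ℝ}
    (hC : ∀ n, |d (n + 1) - d n| ≤ C * ((n : ℝ) + 1) ^ (ρ - 2)) :
    ∃ C' > 0, ∀ n, |d n| ≤ C' * ((n : ℝ) + 1) ^ (ρ - 1) := by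
  have hM := P.Mpos
  rcases P.r1.eq_or_lt with h1 | h1
  · -- ρ = 1
    have hM1 : ∑ j, (M : ℝ) * p j = 1 := by
      have := P.pi_sum
      rw [← h1] at this
      simpa using this
    set C : ℝ := |d 0| + |d 1| + 1 with hC
    refine ⟨C, by positivity, ?_⟩
    rw [← h1]
    simp only [sub_self, Real.rpow_zero, mul_one]
    apply comparison' (n0 := 2) (fun j => P.p0' j) (fun j => P.p1' j)
      (c := fun j => (M : ℝ) * p j) (a := fun _ => 0)
      (f := fun n => |d n|) (b := fun n => C)
    · intro j; have := P.p0' j; positivity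
    · intro n hn
      have := P.powlt (n := n + 1) (by omega)
      refine lt_of_le_of_lt (le_of_eq ?_) this
      apply Finset.sum_congr rfl; intro j _; ring
    · intro n hn
      rw [hd n hn, add_zero]
      refine (Finset.abs_sum_le_sum_abs _ _).trans ?_
      apply Finset.sum_le_sum; intro j _
      have := P.p0' j
      rw [abs_mul, abs_of_nonneg (by positivity : (0:ℝ) ≤ (M : ℝ) * p j)]
      have := Eb_abs_le (P.p0' j) (P.p1' j) n d
      gcongr
    · intro n hn
      simp_rw [Eb_const]
      rw [add_zero, ← Finset.sum_mul, hM1, one_mul]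
    · intro n hn
      have h1 : n = 0 ∨ n = 1 := by omega
      rcases h1 with rfl | rfl <;> simp only [hC] <;> linarith [abs_nonneg (d 0), abs_nonneg (d 1)]
  · have hCn : 0 ≤ C := by
      have := (abs_nonneg _).trans (hC 0)
      simpa using this
    have ha : 0 < ρ - 1 := by linarith
    refine ⟨|d 0| + C / (ρ - 1) + 1, by positivity, ?_⟩
    have key : ∀ n : ℕ, |d n| ≤ |d 0| + C / (ρ - 1) * (n : ℝ) ^ (ρ - 1) := by
      intro n
      induction n with
      | zero => simp [Real.zero_rpow ha.ne']
      | succ n ih =>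
        have h2 := hC n
        have h3 := rpow_sum_step ha (by linarith [P.r2]) n
        have h4 : C * ((n : ℝ) + 1) ^ (ρ - 2) ≤
            C / (ρ - 1) * (((n : ℝ) + 1) ^ (ρ - 1) - (n : ℝ) ^ (ρ - 1)) := by
          rw [show ρ - 1 - 1 = ρ - 2 by ring] at h3
          have := mul_le_mul_of_nonneg_left h3 (by positivity : 0 ≤ C / (ρ - 1))
          have e : C / (ρ - 1) * ((ρ - 1) * ((n:ℝ) + 1) ^ (ρ - 2)) = C * ((n:ℝ) + 1) ^ (ρ - 2) := by
            field_simp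
          linarith
        have h5 : |d (n + 1)| ≤ |d n| + |d (n + 1) - d n| := by
          have := abs_add_le (d n) (d (n + 1) - d n)
          simpa using this
        push_cast
        nlinarith
    intro n
    have h6 : (1 : ℝ) ≤ ((n : ℝ) + 1) ^ (ρ - 1) :=
      Real.one_le_rpow (by linarith [(Nat.cast_nonneg n : (0:ℝ) ≤ n)]) ha.le
    have h7 : (n : ℝ) ^ (ρ - 1) ≤ ((n : ℝ) + 1) ^ (ρ - 1) :=
      Real.rpow_le_rpow (by positivity) (by linarith) ha.le
    have h8 : 0 ≤ C / (ρ - 1) := by positivity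
    have := key n
    nlinarith [abs_nonneg (d 0)]

/-! ### Normalized deviations -/

/-- total normalized deviation -/
noncomputable def Ud {A : ℕ} (p : Fin A → ℝ) (n : ℕ) (c : Fin n → Fin A) : ℝ :=
  1 + ∑ j, |(cnt c j : ℝ) - n * p j| / √n

theorem Ud_one_le {A : ℕ} (p : Fin A → ℝ) (n : ℕ) (c : Fin n → Fin A) : 1 ≤ Ud p n c := by
  unfold Ud
  have : 0 ≤ ∑ j, |(cnt c j : ℝ) - n * p j| / √n := Finset.sum_nonneg fun j _ => by positivity
  linarith

theorem dev_le_Ud {A : ℕ} (p : Fin A → ℝ) (n : ℕ) (c : Fin n → Fin A) (j : Fin A) :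
    1 + |(cnt c j : ℝ) - n * p j| / √n ≤ Ud p n c := by
  unfold Ud
  have := Finset.single_le_sum (f := fun j => |(cnt c j : ℝ) - n * p j| / √n)
    (fun j _ => by positivity) (Finset.mem_univ j)
  linarith

theorem exp_moment {A : ℕ} {p : Fin A → ℝ} (hp : ∀ j, 0 ≤ p j) (hps : ∑ j, p j = 1)
    (x : Fin A → ℝ) (hx : ∑ j, p j * x j = 0) (hx1 : ∀ j, |x j| ≤ 1) {n : ℕ} (l : ℝ)
    (hl : |l| ≤ 1) (hl2 : n * l ^ 2 ≤ 1) :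
    EE p n (fun c => Real.exp (l * ∑ k, x (c k))) ≤ Real.exp 1 := by
  have e1 : (fun c : Fin n → Fin A => Real.exp (l * ∑ k, x (c k))) =
      fun c => ∏ k, (fun j => Real.exp (l * x j)) (c k) := by
    funext c; rw [Finset.mul_sum, Real.exp_sum]
  rw [e1, EE_prod_piR n (fun j => Real.exp (l * x j))]
  have h1 : ∑ j, p j * Real.exp (l * x j) ≤ Real.exp (l ^ 2) := by
    calc ∑ j, p j * Real.exp (l * x j) ≤ ∑ j, p j * (1 + l * x j + l ^ 2) := by
          apply Finset.sum_le_sum; intro j _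
          apply mul_le_mul_of_nonneg_left _ (hp j)
          have hlx : |l * x j| ≤ 1 := by
            rw [abs_mul]; exact mul_le_one₀ hl (abs_nonneg _) (hx1 j)
          have := (abs_le.mp (Real.abs_exp_sub_one_sub_id_le hlx)).2
          have h2 : (l * x j) ^ 2 ≤ l ^ 2 := by
            rw [mul_pow, ← sq_abs (x j)]
            have := pow_le_one₀ (n := 2) (abs_nonneg _) (hx1 j)
            nlinarith [sq_nonneg l]
          linarith
      _ = 1 + l ^ 2 := by
          simp only [mul_add, Finset.sum_add_distrib, mul_one, hps]
          have : ∑ j, p j * (l * x j) = l * ∑ j, p j * x j := by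
            rw [Finset.mul_sum]; apply Finset.sum_congr rfl; intro j _; ring
          rw [this, hx, ← Finset.sum_mul, hps]; ring
      _ ≤ _ := by linarith [Real.add_one_le_exp (l ^ 2)]
  calc (∑ j, p j * Real.exp (l * x j)) ^ n ≤ (Real.exp (l ^ 2)) ^ n := by
        apply pow_le_pow_left₀ _ h1
        exact Finset.sum_nonneg fun j _ => mul_nonneg (hp j) (Real.exp_pos _).le
    _ = Real.exp (n * l ^ 2) := by rw [← Real.exp_nat_mul]
    _ ≤ _ := Real.exp_le_exp.mpr hl2

theorem dev_moment {A : ℕ} {p : Fin A → ℝ} (hp : ∀ j, 0 ≤ p j) (hp1 : ∀ j, p j ≤ 1)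
    (hps : ∑ j, p j = 1) (K : ℕ) (j : Fin A) {n : ℕ} (hn : 1 ≤ n) :
    EE p n (fun c => (|(cnt c j : ℝ) - n * p j| / √n) ^ K) ≤ K.factorial * (2 * Real.exp 1) := by
  have hn' : (1:ℝ) ≤ n := by exact_mod_cast hn
  have hsq : 0 < √(n:ℝ) := Real.sqrt_pos.mpr (by linarith)
  set x : Fin A → ℝ := fun i => (if i = j then 1 else 0) - p j with hxdef
  have hx : ∑ i, p i * x i = 0 := by
    simp only [hxdef, mul_sub, Finset.sum_sub_distrib, mul_ite, mul_one, mul_zero]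
    rw [← Finset.sum_mul, hps]; simp
  have hx1 : ∀ i, |x i| ≤ 1 := by
    intro i; simp only [hxdef]; rw [abs_le]
    have := hp j; have := hp1 j
    split_ifs <;> constructor <;> linarith
  have hsum : ∀ c : Fin n → Fin A, ∑ k, x (c k) = (cnt c j : ℝ) - n * p j := by
    intro c
    simp only [hxdef, Finset.sum_sub_distrib, Finset.sum_const, Finset.card_univ, Fintype.card_fin,
      nsmul_eq_mul]
    congr 1
    simp [cnt]
  have hl : |(1 / √(n:ℝ))| ≤ 1 := by
    rw [abs_of_pos (by positivity), div_le_one hsq]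
    exact Real.one_le_sqrt.mpr hn'
  have hl2 : (n:ℝ) * (1 / √(n:ℝ)) ^ 2 ≤ 1 := by
    rw [div_pow, Real.sq_sqrt (by linarith)]; field_simp; norm_num
  have m1 := exp_moment hp hps x hx hx1 (n := n) (1 / √(n:ℝ)) hl hl2
  have m2 := exp_moment hp hps x hx hx1 (n := n) (-(1 / √(n:ℝ))) (by rwa [abs_neg])
    (by rwa [neg_sq])
  calc EE p n (fun c => (|(cnt c j : ℝ) - n * p j| / √n) ^ K)
      ≤ EE p n (fun c => (K.factorial : ℝ) * (Real.exp (1 / √(n:ℝ) * ∑ k, x (c k)) +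
          Real.exp (-(1 / √(n:ℝ)) * ∑ k, x (c k)))) := by
        apply EE_mono hp
        intro c
        have h0 : 0 ≤ |(cnt c j : ℝ) - n * p j| / √n := by positivity
        have h1 := Real.pow_div_factorial_le_exp _ h0 K
        rw [div_le_iff₀ (by positivity)] at h1
        refine h1.trans ?_
        rw [mul_comm]
        gcongr
        rw [hsum]
        rcases abs_cases ((cnt c j : ℝ) - n * p j) with ⟨h, _⟩ | ⟨h, _⟩
        · rw [h]
          have : ((cnt c j : ℝ) - n * p j) / √n = 1 / √(n:ℝ) * ((cnt c j : ℝ) - n * p j) := by ring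
          rw [this]
          linarith [Real.exp_pos (-(1 / √(n:ℝ)) * ((cnt c j : ℝ) - n * p j))]
        · rw [h]
          have : -((cnt c j : ℝ) - n * p j) / √n = -(1 / √(n:ℝ)) * ((cnt c j : ℝ) - n * p j) := by ring
          rw [this]
          linarith [Real.exp_pos ((1 / √(n:ℝ)) * ((cnt c j : ℝ) - n * p j))]
    _ ≤ _ := by
        rw [EE_mul, EE_add]
        gcongr
        linarith

theorem Ud_moment {A : ℕ} {p : Fin A → ℝ} (hp : ∀ j, 0 ≤ p j) (hp1 : ∀ j, p j ≤ 1)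
    (hps : ∑ j, p j = 1) (K : ℕ) :
    ∃ C > 0, ∀ n : ℕ, 1 ≤ n → EE p n (fun c => Ud p n c ^ K) ≤ C := by
  refine ⟨((A:ℝ)+1) ^ K * (1 + A * (K.factorial * (2 * Real.exp 1))), by positivity, ?_⟩
  intro n hn
  have hpt : ∀ c : Fin n → Fin A, Ud p n c ^ K ≤ ((A:ℝ)+1) ^ K *
      (1 + ∑ j, (|(cnt c j : ℝ) - n * p j| / √n) ^ K) := by
    intro c
    have hnn : ∀ j, 0 ≤ (|(cnt c j : ℝ) - n * p j| / √n) := fun j => by positivity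
    -- max
    have hex : ∃ m : ℝ, 0 ≤ m ∧ 1 ≤ m ∧ (∀ j, |(cnt c j : ℝ) - n * p j| / √n ≤ m) ∧
        m ^ K ≤ 1 + ∑ j, (|(cnt c j : ℝ) - n * p j| / √n) ^ K := by
      by_cases h : ∀ j, |(cnt c j : ℝ) - n * p j| / √n ≤ 1
      · refine ⟨1, by norm_num, le_rfl, h, ?_⟩
        rw [one_pow]
        have := Finset.sum_nonneg (s := univ) fun j _ => pow_nonneg (hnn j) K
        linarith
      · push Not at h
        obtain ⟨j0, hj0⟩ := h
        obtain ⟨j, _, hj⟩ := Finset.exists_max_image univ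
          (fun j => |(cnt c j : ℝ) - n * p j| / √n) ⟨j0, Finset.mem_univ _⟩
        refine ⟨_, hnn j, (hj0.trans_le (hj j0 (Finset.mem_univ _))).le,
          fun i => hj i (Finset.mem_univ _), ?_⟩
        have := Finset.single_le_sum (f := fun j => (|(cnt c j : ℝ) - n * p j| / √n) ^ K)
          (fun j _ => pow_nonneg (hnn j) K) (Finset.mem_univ j)
        linarith
    obtain ⟨m, m0, m1, m2, m3⟩ := hex
    have hU : Ud p n c ≤ ((A:ℝ) + 1) * m := by
      unfold Ud
      have : ∑ j, |(cnt c j : ℝ) - n * p j| / √n ≤ ∑ _j : Fin A, m :=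
        Finset.sum_le_sum fun j _ => m2 j
      simp at this
      linarith
    calc Ud p n c ^ K ≤ (((A:ℝ) + 1) * m) ^ K :=
          pow_le_pow_left₀ (by linarith [Ud_one_le p n c]) hU K
      _ = ((A:ℝ) + 1) ^ K * m ^ K := mul_pow _ _ _
      _ ≤ _ := by gcongr
  refine (EE_mono hp n hpt).trans ?_
  rw [EE_mul, EE_add, EE_const hps, EE_sum]
  gcongr
  refine (Finset.sum_le_sum fun j _ => dev_moment hp hp1 hps K j hn).trans ?_
  simp

theorem dev_rpow {p η : ℝ} (hp : 0 < p) (hp1 : p ≤ 1) (h1 : -1 ≤ η) (h2 : η ≤ 1) {n : ℕ}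
    (hn : 1 ≤ n) (k : ℕ) :
    ((k : ℝ) + 1) ^ η ≤ 4 / p ^ 2 * (n : ℝ) ^ η * (1 + |(k : ℝ) - n * p| / √n) ^ 2 := by
  have hn' : (1:ℝ) ≤ n := by exact_mod_cast hn
  have hn0 : (0:ℝ) < n := by linarith
  have hsq1 : 1 ≤ √(n:ℝ) := Real.one_le_sqrt.mpr hn'
  have hsq : 0 < √(n:ℝ) := by linarith
  have hss : √(n:ℝ) * √(n:ℝ) = n := Real.mul_self_sqrt hn0.le
  set u := |(k : ℝ) - n * p| / √n with hu
  have hu0 : 0 ≤ u := by positivity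
  have hk : (0:ℝ) ≤ k := Nat.cast_nonneg k
  have hus : |(k : ℝ) - n * p| = u * √n := by rw [hu]; field_simp
  have hp2 : (1:ℝ) ≤ 1 / p ^ 2 := by
    rw [le_div_iff₀ (by positivity)]; nlinarith
  set r : ℝ := ((k:ℝ) + 1) / n with hr
  have hr0 : 0 < r := by positivity
  have hB1 : (1:ℝ) ≤ 4 / p ^ 2 * (1 + u) ^ 2 := by
    have : (1:ℝ) ≤ (1 + u) ^ 2 := by nlinarith
    have e : 4 / p ^ 2 = 4 * (1 / p ^ 2) := by ring
    rw [e]; nlinarith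
  have hrB : r ≤ 4 / p ^ 2 * (1 + u) ^ 2 := by
    have h3 : (k : ℝ) ≤ n * p + u * √n := by
      have := le_abs_self ((k : ℝ) - n * p); linarith
    have h4 : r ≤ 2 + u := by
      rw [hr, div_le_iff₀ hn0]
      have h5 : u * √n ≤ u * n := by
        apply mul_le_mul_of_nonneg_left _ hu0
        nlinarith
      have h6 : n * p ≤ n * 1 := by gcongr
      linarith
    have e : 4 / p ^ 2 = 4 * (1 / p ^ 2) := by ring
    rw [e]
    nlinarith [sq_nonneg u, mul_nonneg (sub_nonneg.mpr hp2) (sq_nonneg (1+u))]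
  have hrB' : r⁻¹ ≤ 4 / p ^ 2 * (1 + u) ^ 2 := by
    rw [hr, inv_div, div_le_iff₀ (by positivity)]
    by_cases h : n * p / 2 ≤ k + 1
    · have : (n:ℝ) ≤ 2 / p * (k + 1) := by
        rw [div_mul_eq_mul_div, le_div_iff₀ hp]; linarith
      refine this.trans ?_
      gcongr
      have h5 : 2 / p ≤ 4 / p ^ 2 := by
        rw [div_le_div_iff₀ hp (by positivity)]; nlinarith
      have : (1:ℝ) ≤ (1 + u) ^ 2 := by nlinarith
      have h6 : 0 < 4 / p ^ 2 := by positivity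
      nlinarith
    · push Not at h
      have h5 : n * p / 2 ≤ u * √n := by
        rw [← hus, abs_sub_comm]
        have := le_abs_self (n * p - (k:ℝ)); linarith
      have h6 : √(n:ℝ) * p / 2 ≤ u := by
        have : √(n:ℝ) * p / 2 * √n ≤ u * √n := by
          calc √(n:ℝ) * p / 2 * √n = (√(n:ℝ) * √n) * p / 2 := by ring
            _ = n * p / 2 := by rw [hss]
            _ ≤ _ := h5
        exact le_of_mul_le_mul_right this hsq
      have h7 : (n:ℝ) ≤ 4 / p ^ 2 * u ^ 2 := by
        have h8 : (√(n:ℝ) * p / 2) ^ 2 ≤ u ^ 2 := by gcongr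
        have h9 : (√(n:ℝ) * p / 2) ^ 2 = n * p ^ 2 / 4 := by
          rw [div_pow, mul_pow, sq, hss]; ring
        rw [h9] at h8
        rw [div_mul_eq_mul_div, le_div_iff₀ (by positivity)]
        linarith
      calc (n:ℝ) ≤ 4 / p ^ 2 * u ^ 2 := h7
        _ ≤ 4 / p ^ 2 * (1 + u) ^ 2 * 1 := by
            rw [mul_one]; gcongr; linarith
        _ ≤ _ := by gcongr; linarith
  have hfin : r ^ η ≤ 4 / p ^ 2 * (1 + u) ^ 2 := by
    rcases le_total 1 r with h | h
    · calc r ^ η ≤ r ^ (1:ℝ) := Real.rpow_le_rpow_of_exponent_le h h2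
        _ = r := Real.rpow_one _
        _ ≤ _ := hrB
    · calc r ^ η ≤ r ^ (-1:ℝ) := Real.rpow_le_rpow_of_exponent_ge hr0 h h1
        _ = r⁻¹ := Real.rpow_neg_one _
        _ ≤ _ := hrB'
  have e : ((k:ℝ) + 1) ^ η = n ^ η * r ^ η := by
    rw [← Real.mul_rpow hn0.le hr0.le, hr]; congr 1; field_simp
  rw [e]
  calc (n:ℝ) ^ η * r ^ η ≤ n ^ η * (4 / p ^ 2 * (1 + u) ^ 2) := by gcongr
    _ = _ := by ring
end Part2

section Part3
open Finset

theorem disc_lip {f : ℕ → ℝ} {B : ℝ} {k l : ℕ}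
    (h : ∀ i, min k l ≤ i → i < max k l → |f (i + 1) - f i| ≤ B) :
    |f k - f l| ≤ B * |(k : ℝ) - l| := by
  have key : ∀ (a m : ℕ), (∀ i, a ≤ i → i < a + m → |f (i + 1) - f i| ≤ B) →
      |f (a + m) - f a| ≤ B * m := by
    intro a m
    induction m with
    | zero => intro _; simp
    | succ m ih =>
      intro h
      have h1 := ih (fun i h1 h2 => h i h1 (by omega))
      have h2 := h (a + m) (by omega) (by omega)
      have h3 := abs_add_le (f (a + m + 1) - f (a + m)) (f (a + m) - f a)
      have e : f (a + (m + 1)) - f a = f (a + m + 1) - f (a + m) + (f (a + m) - f a) := by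
        rw [← add_assoc]; ring
      rw [e]; push_cast; linarith
  rcases le_total l k with hlk | hlk
  · obtain ⟨m, rfl⟩ := Nat.exists_eq_add_of_le hlk
    have := key l m (fun i h1 h2 => h i (by simp [h1]) (by simp [h2]))
    push_cast
    rw [add_sub_cancel_left, abs_of_nonneg (Nat.cast_nonneg m : (0:ℝ) ≤ (m:ℝ))]
    exact this
  · obtain ⟨m, rfl⟩ := Nat.exists_eq_add_of_le hlk
    have := key k m (fun i h1 h2 => h i (by simp [h1]) (by simp [h2]))
    push_cast
    rw [abs_sub_comm, abs_sub_comm (k:ℝ), add_sub_cancel_left, abs_of_nonneg (Nat.cast_nonneg m : (0:ℝ) ≤ (m:ℝ))]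
    exact this

theorem between_rpow {η : ℝ} {k l i : ℕ} (h1 : min k l ≤ i) (h2 : i ≤ max k l) :
    ((i : ℝ) + 1) ^ η ≤ ((k : ℝ) + 1) ^ η + ((l : ℝ) + 1) ^ η := by
  have key : ∀ a b : ℕ, a ≤ i → i ≤ b →
      ((i : ℝ) + 1) ^ η ≤ ((a : ℝ) + 1) ^ η + ((b : ℝ) + 1) ^ η := by
    intro a b ha hb
    have ha' : (a:ℝ) ≤ i := by exact_mod_cast ha
    have hb' : (i:ℝ) ≤ b := by exact_mod_cast hb
    have pa : 0 < ((a : ℝ) + 1) ^ η := by positivity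
    have pb : 0 < ((b : ℝ) + 1) ^ η := by positivity
    rcases le_total 0 η with h | h
    · have : ((i : ℝ) + 1) ^ η ≤ ((b : ℝ) + 1) ^ η :=
        Real.rpow_le_rpow (by positivity) (by linarith) h
      linarith
    · have : ((i : ℝ) + 1) ^ η ≤ ((a : ℝ) + 1) ^ η :=
        Real.rpow_le_rpow_of_nonpos (by positivity) (by linarith) h
      linarith
  rcases le_total k l with h | h
  · rw [min_eq_left h] at h1; rw [max_eq_right h] at h2; exact key k l h1 h2
  · rw [min_eq_right h] at h1; rw [max_eq_left h] at h2
    have := key l k h1 h2; linarith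

/-- the local bound near `np` -/
theorem dev_local {p η : ℝ} (hp : 0 < p) (hp1 : p ≤ 1) (h1 : -1 ≤ η) (h2 : η ≤ 1) {n : ℕ}
    (hn : 1 ≤ n) (k l : ℕ) (hl : |(l : ℝ) - n * p| ≤ 2) :
    ((k : ℝ) + 1) ^ η + ((l : ℝ) + 1) ^ η ≤
      40 / p ^ 2 * (n : ℝ) ^ η * (1 + |(k : ℝ) - n * p| / √n) ^ 2 ∧
    |(k : ℝ) - l| ≤ 2 * √n * (1 + |(k : ℝ) - n * p| / √n) := by
  have hn' : (1:ℝ) ≤ n := by exact_mod_cast hn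
  have hsq1 : 1 ≤ √(n:ℝ) := Real.one_le_sqrt.mpr hn'
  have hsq : 0 < √(n:ℝ) := by linarith
  have a1 := dev_rpow hp hp1 h1 h2 hn k
  have a2 := dev_rpow hp hp1 h1 h2 hn l
  set u := |(k : ℝ) - n * p| / √n with hu
  have hu0 : 0 ≤ u := by positivity
  have hus : |(k : ℝ) - n * p| = u * √n := by rw [hu]; field_simp
  have hx : 0 < 4 / p ^ 2 * (n:ℝ) ^ η := by positivity
  have h3 : |(l : ℝ) - n * p| / √n ≤ 2 := by
    rw [div_le_iff₀ hsq]; linarith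
  have h4 : (1 + |(l : ℝ) - n * p| / √n) ^ 2 ≤ 9 := by
    have : 0 ≤ |(l : ℝ) - n * p| / √n := by positivity
    nlinarith
  have h5 : (1:ℝ) ≤ (1 + u) ^ 2 := by nlinarith
  constructor
  · calc _ ≤ 4 / p ^ 2 * (n:ℝ) ^ η * (1 + u) ^ 2 + 4 / p ^ 2 * (n:ℝ) ^ η * 9 := by
          refine add_le_add a1 (a2.trans ?_); gcongr
      _ ≤ 4 / p ^ 2 * (n:ℝ) ^ η * (1 + u) ^ 2 + 4 / p ^ 2 * (n:ℝ) ^ η * (9 * (1 + u) ^ 2) := by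
          gcongr; linarith
      _ = _ := by ring
  · have := abs_sub_le (k:ℝ) (n * p) l
    rw [abs_sub_comm (n * p) (l:ℝ), hus] at this
    nlinarith

theorem approx1 {p η C : ℝ} (hp : 0 < p) (hp1 : p ≤ 1) (h1 : -1 ≤ η) (h2 : η ≤ 1) {f : ℕ → ℝ}
    (hC : 0 ≤ C) (hf : ∀ k : ℕ, |f (k + 1) - f k| ≤ C * ((k : ℝ) + 1) ^ η) {n : ℕ}
    (hn : 1 ≤ n) (k l : ℕ) (hl : |(l : ℝ) - n * p| ≤ 2) :
    |f k - f l| ≤ C * (80 / p ^ 2) * (n : ℝ) ^ (η + 1/2) * (1 + |(k : ℝ) - n * p| / √n) ^ 3 := by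
  obtain ⟨b1, b2⟩ := dev_local hp hp1 h1 h2 hn k l hl
  have hn' : (1:ℝ) ≤ n := by exact_mod_cast hn
  have h := disc_lip (f := f) (k := k) (l := l) (B := C * (((k : ℝ) + 1) ^ η + ((l : ℝ) + 1) ^ η))
    (fun i hi1 hi2 => (hf i).trans (by
      apply mul_le_mul_of_nonneg_left (between_rpow hi1 hi2.le) hC))
  refine h.trans ?_
  set u := |(k : ℝ) - n * p| / √n with hu
  have hu0 : 0 ≤ u := by positivity
  calc C * (((k : ℝ) + 1) ^ η + ((l : ℝ) + 1) ^ η) * |(k:ℝ) - l|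
      ≤ C * (40 / p ^ 2 * (n : ℝ) ^ η * (1 + u) ^ 2) * (2 * √n * (1 + u)) := by gcongr
    _ = C * (80 / p ^ 2) * ((n : ℝ) ^ η * √n) * (1 + u) ^ 3 := by ring
    _ = _ := by rw [Real.sqrt_eq_rpow, ← Real.rpow_add (by linarith)]

theorem approx2 {p η C : ℝ} (hp : 0 < p) (hp1 : p ≤ 1) (h1 : -1 ≤ η) (h2 : η ≤ 1) {f : ℕ → ℝ}
    (hC : 0 ≤ C) (hf : ∀ k : ℕ, |(f (k + 2) - f (k + 1)) - (f (k + 1) - f k)| ≤ C * ((k : ℝ) + 1) ^ η)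
    {n : ℕ} (hn : 1 ≤ n) (k l : ℕ) (hl : |(l : ℝ) - n * p| ≤ 2) :
    |f k - f l - (f (l + 1) - f l) * ((k : ℝ) - l)| ≤
      C * (160 / p ^ 2) * (n : ℝ) ^ (η + 1) * (1 + |(k : ℝ) - n * p| / √n) ^ 4 := by
  obtain ⟨b1, b2⟩ := dev_local hp hp1 h1 h2 hn k l hl
  have hn' : (1:ℝ) ≤ n := by exact_mod_cast hn
  set B := C * (((k : ℝ) + 1) ^ η + ((l : ℝ) + 1) ^ η) with hB
  have hB0 : 0 ≤ B := by positivity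
  have hd : ∀ i, min k l ≤ i → i ≤ max k l →
      |(f (i + 1) - f i) - (f (l + 1) - f l)| ≤ B * |(k:ℝ) - l| := by
    intro i hi1 hi2
    have h := disc_lip (f := fun i => f (i + 1) - f i) (k := i) (l := l) (B := B)
      (fun i' hi1' hi2' => (hf i').trans (by
        apply mul_le_mul_of_nonneg_left _ hC
        apply between_rpow <;> omega))
    refine h.trans ?_
    apply mul_le_mul_of_nonneg_left _ hB0
    rcases le_total k l with hkl | hkl
    · have c1 : (k:ℝ) ≤ i := by exact_mod_cast (by omega : k ≤ i)
      have c2 : (i:ℝ) ≤ l := by exact_mod_cast (by omega : i ≤ l)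
      rw [abs_of_nonpos (by linarith), abs_of_nonpos (by linarith)]; linarith
    · have c1 : (l:ℝ) ≤ i := by exact_mod_cast (by omega : l ≤ i)
      have c2 : (i:ℝ) ≤ k := by exact_mod_cast (by omega : i ≤ k)
      rw [abs_of_nonneg (by linarith), abs_of_nonneg (by linarith)]; linarith
  have h := disc_lip (f := fun i => f i - (f (l + 1) - f l) * (i : ℝ)) (k := k) (l := l)
    (B := B * |(k:ℝ) - l|) (fun i hi1 hi2 => by
      have := hd i hi1 hi2.le
      have e : f (i + 1) - (f (l + 1) - f l) * ((i + 1 : ℕ) : ℝ) - (f i - (f (l + 1) - f l) * (i:ℝ)) =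
        (f (i + 1) - f i) - (f (l + 1) - f l) := by push_cast; ring
      rw [e]; exact this)
  have e : f k - f l - (f (l + 1) - f l) * ((k : ℝ) - l) =
      (f k - (f (l + 1) - f l) * (k : ℝ)) - (f l - (f (l + 1) - f l) * (l : ℝ)) := by ring
  rw [e]
  refine h.trans ?_
  set u := |(k : ℝ) - n * p| / √n with hu
  have hu0 : 0 ≤ u := by positivity
  calc B * |(k:ℝ) - l| * |(k:ℝ) - l|
      ≤ C * (40 / p ^ 2 * (n : ℝ) ^ η * (1 + u) ^ 2) * (2 * √n * (1 + u)) * (2 * √n * (1 + u)) := by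
        rw [hB]; gcongr
    _ = C * (160 / p ^ 2) * ((n : ℝ) ^ η * (√n * √n)) * (1 + u) ^ 4 := by ring
    _ = _ := by
        rw [Real.mul_self_sqrt (by linarith)]
        congr 2
        rw [Real.rpow_add (by linarith), Real.rpow_one]

/-- expectation form: `E f(B_j)` against `f(l)`, `l ≈ n p_j` -/
theorem Eb_approx {M A : ℕ} {p : Fin A → ℝ} {ρ : ℝ} (P : Par M A p ρ) {η C : ℝ}
    (h1 : -1 ≤ η) (h2 : η ≤ 1) (hC : 0 ≤ C) {f : ℕ → ℝ}
    (hf : ∀ k : ℕ, |f (k + 1) - f k| ≤ C * ((k : ℝ) + 1) ^ η) :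
    ∃ C' > 0, ∀ n : ℕ, 1 ≤ n → ∀ j, ∀ l : ℕ, |(l : ℝ) - n * p j| ≤ 2 →
      Eb (p j) n (fun k => |f k - f l|) ≤ C' * (n : ℝ) ^ (η + 1/2) ∧
      |Eb (p j) n f - f l| ≤ C' * (n : ℝ) ^ (η + 1/2) := by
  obtain ⟨CU, hCU, hU⟩ := Ud_moment P.p0' P.p1' P.ps 3
  have ex : ∃ K > 0, ∀ j, C * (80 / p j ^ 2) ≤ K := by
    refine ⟨1 + ∑ j, C * (80 / p j ^ 2), ?_, ?_⟩
    · have : 0 ≤ ∑ j, C * (80 / p j ^ 2) := Finset.sum_nonneg fun j _ => by positivity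
      linarith
    · intro j
      have := Finset.single_le_sum (f := fun j => C * (80 / p j ^ 2)) (fun j _ => by positivity)
        (Finset.mem_univ j)
      linarith
  obtain ⟨K, hK, hKj⟩ := ex
  refine ⟨K * CU, by positivity, ?_⟩
  intro n hn j l hl
  have hn' : (1:ℝ) ≤ n := by exact_mod_cast hn
  have main : Eb (p j) n (fun k => |f k - f l|) ≤ K * CU * (n : ℝ) ^ (η + 1/2) := by
    rw [← EE_cnt P.ps j n (fun k => |f k - f l|)]
    calc EE p n (fun c => |f (cnt c j) - f l|)
        ≤ EE p n (fun c => (K * (n : ℝ) ^ (η + 1/2)) * Ud p n c ^ 3) := by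
          apply EE_mono P.p0'
          intro c
          refine (approx1 (P.p0 j) (P.p1' j) h1 h2 hC hf hn (cnt c j) l hl).trans ?_
          have := dev_le_Ud p n c j
          have := hKj j
          gcongr
      _ = (K * (n : ℝ) ^ (η + 1/2)) * EE p n (fun c => Ud p n c ^ 3) := EE_mul _ _ _
      _ ≤ (K * (n : ℝ) ^ (η + 1/2)) * CU := by have := hU n hn; gcongr
      _ = _ := by ring
  refine ⟨main, ?_⟩
  have : Eb (p j) n f - f l = Eb (p j) n (fun k => f k - f l) := by rw [Eb_sub, Eb_const]
  rw [this]
  exact (Eb_abs_le (P.p0' j) (P.p1' j) n _).trans main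
end Part3

section Part4
open Finset MeasureTheory Filter Topology

/-- bounded, measurable, asymptotically uniformly continuous functions -/
structure BA (h : ℝ → ℝ) : Prop where
  meas : Measurable h
  bdd : ∃ B, 0 ≤ B ∧ ∀ s, |h s| ≤ B
  auc : ∀ ε > 0, ∃ δ > 0, ∃ S, ∀ s r, S ≤ s → S ≤ r → |s - r| ≤ δ → |h s - h r| ≤ ε

namespace BA

theorem const (a : ℝ) : BA (fun _ => a) :=
  ⟨measurable_const, ⟨|a|, abs_nonneg a, fun _ => le_rfl⟩,
    fun ε hε => ⟨1, one_pos, 0, fun _ _ _ _ _ => by simp [hε.le]⟩⟩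

theorem add {f g : ℝ → ℝ} (hf : BA f) (hg : BA g) : BA (fun s => f s + g s) := by
  obtain ⟨B1, h10, h1⟩ := hf.bdd
  obtain ⟨B2, h20, h2⟩ := hg.bdd
  refine ⟨hf.meas.add hg.meas, ⟨B1 + B2, by linarith, fun s => ?_⟩, fun ε hε => ?_⟩
  · exact (abs_add_le _ _).trans (add_le_add (h1 s) (h2 s))
  · obtain ⟨δ1, d1, S1, e1⟩ := hf.auc (ε / 2) (by linarith)
    obtain ⟨δ2, d2, S2, e2⟩ := hg.auc (ε / 2) (by linarith)
    refine ⟨min δ1 δ2, lt_min d1 d2, max S1 S2, fun s r hs hr hsr => ?_⟩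
    have a1 := e1 s r ((le_max_left _ _).trans hs) ((le_max_left _ _).trans hr)
      (hsr.trans (min_le_left _ _))
    have a2 := e2 s r ((le_max_right _ _).trans hs) ((le_max_right _ _).trans hr)
      (hsr.trans (min_le_right _ _))
    have : f s + g s - (f r + g r) = (f s - f r) + (g s - g r) := by ring
    rw [this]
    have := abs_add_le (f s - f r) (g s - g r)
    linarith

theorem mul {f g : ℝ → ℝ} (hf : BA f) (hg : BA g) : BA (fun s => f s * g s) := by
  obtain ⟨B1, h10, h1⟩ := hf.bdd
  obtain ⟨B2, h20, h2⟩ := hg.bdd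
  refine ⟨hf.meas.mul hg.meas, ⟨B1 * B2, by positivity, fun s => ?_⟩, fun ε hε => ?_⟩
  · rw [abs_mul]; exact mul_le_mul (h1 s) (h2 s) (abs_nonneg _) h10
  · set K := B1 + B2 + 1
    have hK : 0 < K := by positivity
    obtain ⟨δ1, d1, S1, e1⟩ := hf.auc (ε / K) (by positivity)
    obtain ⟨δ2, d2, S2, e2⟩ := hg.auc (ε / K) (by positivity)
    refine ⟨min δ1 δ2, lt_min d1 d2, max S1 S2, fun s r hs hr hsr => ?_⟩
    have a1 := e1 s r ((le_max_left _ _).trans hs) ((le_max_left _ _).trans hr)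
      (hsr.trans (min_le_left _ _))
    have a2 := e2 s r ((le_max_right _ _).trans hs) ((le_max_right _ _).trans hr)
      (hsr.trans (min_le_right _ _))
    have : f s * g s - f r * g r = (f s - f r) * g s + f r * (g s - g r) := by ring
    rw [this]
    have h3 := abs_add_le ((f s - f r) * g s) (f r * (g s - g r))
    rw [abs_mul, abs_mul] at h3
    have h4 : |f s - f r| * |g s| ≤ ε / K * B2 := mul_le_mul a1 (h2 s) (abs_nonneg _) (by positivity)
    have h5 : |f r| * |g s - g r| ≤ B1 * (ε / K) := mul_le_mul (h1 r) a2 (abs_nonneg _) h10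
    have h6 : ε / K * K = ε := by field_simp
    have h7 : ε / K * K = ε / K * B2 + B1 * (ε/K) + ε / K := by simp only [K]; ring
    have : 0 < ε / K := by positivity
    linarith

theorem shift {f : ℝ → ℝ} (hf : BA f) (z : ℝ) : BA (fun s => f (s - z)) := by
  obtain ⟨B1, h10, h1⟩ := hf.bdd
  refine ⟨hf.meas.comp (measurable_id.sub_const z), ⟨B1, h10, fun s => h1 _⟩, fun ε hε => ?_⟩
  obtain ⟨δ1, d1, S1, e1⟩ := hf.auc ε hε
  refine ⟨δ1, d1, S1 + z, fun s r hs hr hsr => e1 _ _ (by linarith) (by linarith) ?_⟩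
  rw [sub_sub_sub_cancel_right]; exact hsr

theorem sum {ι : Type*} {f : ι → ℝ → ℝ} (s : Finset ι) (hf : ∀ i ∈ s, BA (f i)) :
    BA (fun x => ∑ i ∈ s, f i x) := by
  classical
  induction s using Finset.induction_on with
  | empty => simpa using const 0
  | insert a s ha ih =>
    simp only [Finset.sum_insert ha]
    exact (hf a (by simp)).add (ih fun i hi => hf i (by simp [hi]))

theorem neg {f : ℝ → ℝ} (hf : BA f) : BA (fun s => - f s) := by
  have := (const (-1)).mul hf; simpa using this

theorem sub {f g : ℝ → ℝ} (hf : BA f) (hg : BA g) : BA (fun s => f s - g s) := by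
  have := hf.add hg.neg; simpa [sub_eq_add_neg] using this

theorem ii {f : ℝ → ℝ} (hf : BA f) (a b : ℝ) : IntervalIntegrable f volume a b := by
  obtain ⟨B, h0, h1⟩ := hf.bdd
  refine (intervalIntegrable_const (c := B) (μ := volume) (a := a) (b := b)).mono_fun hf.meas.aestronglyMeasurable ?_
  refine Filter.Eventually.of_forall fun x => ?_
  simpa [abs_of_nonneg h0] using h1 x

/-- Barbalat-type lemma -/
theorem barbalat {v : ℝ → ℝ} (hv : BA v) (h0 : ∀ s, 0 ≤ v s) {s0 C : ℝ}
    (hC : ∀ T, s0 ≤ T → ∫ s in s0..T, v s ≤ C) : Tendsto v atTop (𝓝 0) := by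
  have hmono : Monotone (fun T => ∫ s in s0..(max s0 T), v s) := by
    intro a b hab
    simp only
    rw [← intervalIntegral.integral_add_adjacent_intervals (hv.ii s0 (max s0 a)) (hv.ii (max s0 a) (max s0 b))]
    have : 0 ≤ ∫ s in (max s0 a)..(max s0 b), v s :=
      intervalIntegral.integral_nonneg (max_le_max_left _ hab) (fun u _ => h0 u)
    linarith
  have hb : BddAbove (Set.range (fun T => ∫ s in s0..(max s0 T), v s)) :=
    ⟨C, by rintro _ ⟨T, rfl⟩; exact hC _ (le_max_left _ _)⟩
  have hlim := tendsto_atTop_ciSup hmono hb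
  rw [Metric.tendsto_atTop]
  intro ε hε
  obtain ⟨δ, hδ, S, hS⟩ := hv.auc (ε / 4) (by linarith)
  have hd : Tendsto (fun T => (∫ s in s0..(max s0 (T + δ)), v s) - ∫ s in s0..(max s0 T), v s) atTop (𝓝 0) := by
    have := (hlim.comp (tendsto_atTop_add_const_right _ δ tendsto_id)).sub hlim
    simpa using this
  have hev := (hd.eventually (gt_mem_nhds (show (0:ℝ) < δ * (ε / 4) by positivity)))
  rw [eventually_atTop] at hev
  obtain ⟨T0, hT0⟩ := hev
  refine ⟨max T0 (max s0 S), fun s hs => ?_⟩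
  have c1 : T0 ≤ s := (le_max_left _ _).trans hs
  have c2 : s0 ≤ s := ((le_max_left _ _).trans (le_max_right _ _)).trans hs
  have c3 : S ≤ s := ((le_max_right _ _).trans (le_max_right _ _)).trans hs
  have k1 := hT0 s c1
  rw [max_eq_right c2, max_eq_right (by linarith),
    ← intervalIntegral.integral_add_adjacent_intervals (hv.ii s0 s) (hv.ii s (s+δ))] at k1
  have k2 : ∫ r in s..(s+δ), (v s - ε / 4) ≤ ∫ r in s..(s+δ), v r := by
    apply intervalIntegral.integral_mono_on (by linarith) intervalIntegrable_const (hv.ii _ _)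
    intro r hr
    have := hS s r c3 (by linarith [hr.1]) (by rw [abs_le]; constructor <;> linarith [hr.1, hr.2])
    have := (abs_le.mp this).2
    linarith
  rw [intervalIntegral.integral_const] at k2
  simp only [add_sub_cancel_left, smul_eq_mul] at k2
  rw [Real.dist_eq, sub_zero, abs_of_nonneg (h0 s)]
  have : δ * (v s - ε/4) < δ * (ε / 4) := by linarith
  have := lt_of_mul_lt_mul_left this hδ.le
  linarith

end BA

theorem exp_int {h : ℝ → ℝ} {C c a b : ℝ} (hC : 0 ≤ C) (hc : 0 < c) (hab : a ≤ b)
    (hi : IntervalIntegrable h volume a b)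
    (hh : ∀ s, a ≤ s → |h s| ≤ C * Real.exp (-c * s)) :
    |∫ s in a..b, h s| ≤ C / c * Real.exp (-c * a) := by
  have hI : ∫ s in a..b, C * Real.exp (-c * s) = C / c * (Real.exp (-c * a) - Real.exp (-c * b)) := by
    rw [intervalIntegral.integral_const_mul]
    have : ∀ x ∈ Set.uIcc a b, HasDerivAt (fun x => - Real.exp (-c * x) / c) (Real.exp (-c * x)) x := by
      intro x _
      have h1 : HasDerivAt (fun x : ℝ => -c * x) (-c) x := by
        simpa using (hasDerivAt_id x).const_mul (-c)
      have h2 := (h1.exp).const_mul (-1 / c)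
      have e1 : (fun x => -1 / c * Real.exp (-c * x)) = (fun x => - Real.exp (-c * x) / c) := by
        funext x; ring
      have e2 : -1 / c * (Real.exp (-c * x) * -c) = Real.exp (-c * x) := by field_simp
      rw [e1, e2] at h2
      exact h2
    rw [intervalIntegral.integral_eq_sub_of_hasDerivAt this
      (Continuous.intervalIntegrable (by fun_prop) _ _)]
    field_simp; ring
  have h1 := intervalIntegral.norm_integral_le_of_norm_le (μ := volume) (a := a) (b := b) (f := h)
    (g := fun s => C * Real.exp (-c * s)) hab
    (Filter.Eventually.of_forall fun s hs => hh s hs.1.le)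
    (Continuous.intervalIntegrable (by fun_prop) _ _)
  rw [hI] at h1
  refine h1.trans ?_
  have := Real.exp_pos (-c * b)
  gcongr
  linarith

section renewal
variable {A : ℕ} {π y : Fin A → ℝ} {h : ℝ → ℝ}

theorem ren_step1 (hπ : ∀ j, 0 < π j) (hπ1 : ∑ j, π j = 1) (hh : BA h)
    {C c s0 : ℝ} (hC : 0 ≤ C) (hc : 0 < c)
    (he : ∀ s, s0 ≤ s → |h s - ∑ j, π j * h (s - y j)| ≤ C * Real.exp (-c * s)) (j : Fin A) :
    Tendsto (fun s => h s - h (s - y j)) atTop (𝓝 0) := by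
  obtain ⟨B, hB0, hB⟩ := hh.bdd
  set g : ℝ → ℝ := fun s => ∑ j, π j * h (s - y j) with hg
  have hgBA : BA g := BA.sum _ fun j _ => (BA.const (π j)).mul (hh.shift (y j))
  have hgb : ∀ s, |g s| ≤ B := by
    intro s
    calc |g s| ≤ ∑ j, |π j * h (s - y j)| := Finset.abs_sum_le_sum_abs _ _
      _ ≤ ∑ j, π j * B := by
          apply Finset.sum_le_sum; intro j _
          rw [abs_mul, abs_of_pos (hπ j)]
          exact mul_le_mul_of_nonneg_left (hB _) (hπ j).le
      _ = B := by rw [← Finset.sum_mul, hπ1, one_mul]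
  set v : ℝ → ℝ := fun s => (∑ j, π j * (h (s - y j) * h (s - y j))) - g s * g s with hv
  have hq : BA (fun s => ∑ j, π j * (h (s - y j) * h (s - y j))) :=
    BA.sum _ fun j _ => (BA.const (π j)).mul ((hh.shift (y j)).mul (hh.shift (y j)))
  have hvBA : BA v := hq.sub (hgBA.mul hgBA)
  have hvar : ∀ s, v s = ∑ j, π j * (h (s - y j) - g s) ^ 2 := by
    intro s
    have e : ∀ j, π j * (h (s - y j) - g s) ^ 2 =
      π j * (h (s - y j) * h (s - y j)) - 2 * g s * (π j * h (s - y j)) + g s ^ 2 * π j := fun j => by ring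
    simp only [e, Finset.sum_add_distrib, Finset.sum_sub_distrib, ← Finset.mul_sum, hπ1]
    simp only [hv, hg]; ring
  have hv0 : ∀ s, 0 ≤ v s := fun s => by
    rw [hvar]; exact Finset.sum_nonneg fun j _ => mul_nonneg (hπ j).le (sq_nonneg _)
  have hh2 : BA (fun s => h s * h s) := hh.mul hh
  have hhb2 : ∀ s, |h s * h s| ≤ B * B := fun s => by
    rw [abs_mul]; exact mul_le_mul (hB s) (hB s) (abs_nonneg _) hB0
  set r : ℝ → ℝ := fun s => h s * h s - g s * g s with hr
  have hrBA : BA r := hh2.sub (hgBA.mul hgBA)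
  have hrb : ∀ s, s0 ≤ s → |r s| ≤ (2 * B * C) * Real.exp (-c * s) := by
    intro s hs
    have e : r s = (h s - g s) * (h s + g s) := by simp only [hr]; ring
    rw [e, abs_mul]
    calc |h s - g s| * |h s + g s| ≤ (C * Real.exp (-c * s)) * (B + B) :=
          mul_le_mul (he s hs) ((abs_add_le _ _).trans (add_le_add (hB s) (hgb s))) (abs_nonneg _)
            (by positivity)
      _ = _ := by ring
  have hbd : ∀ T, s0 ≤ T → ∫ s in s0..T, v s ≤
      (∑ j, π j * (2 * (B * B * |y j|))) + (2 * B * C) / c * Real.exp (-c * s0) := by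
    intro T hT
    have e : ∀ s, v s = (∑ j, π j * (h (s - y j) * h (s - y j) - h s * h s)) + r s := by
      intro s
      simp only [mul_sub, Finset.sum_sub_distrib, ← Finset.sum_mul, hπ1, hv, hr]; ring
    have i1 : ∀ j, BA (fun s => π j * (h (s - y j) * h (s - y j) - h s * h s)) := fun j =>
      (BA.const (π j)).mul (((hh.shift (y j)).mul (hh.shift (y j))).sub hh2)
    simp_rw [e]
    rw [intervalIntegral.integral_add ((BA.sum univ fun j _ => i1 j).ii _ _) (hrBA.ii _ _),
      intervalIntegral.integral_finsetSum (fun j _ => (i1 j).ii _ _)]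
    have k1 := (abs_le.mp (exp_int (by positivity) hc hT (hrBA.ii _ _) (fun s hs => hrb s hs))).2
    refine add_le_add (Finset.sum_le_sum fun j _ => ?_) k1
    rw [intervalIntegral.integral_const_mul]
    refine mul_le_mul_of_nonneg_left ?_ (hπ j).le
    rw [intervalIntegral.integral_sub (((hh.shift (y j)).mul (hh.shift (y j))).ii _ _) (hh2.ii _ _),
      intervalIntegral.integral_comp_sub_right (fun s => h s * h s) (y j)]
    have k2 : (∫ s in (s0 - y j)..(T - y j), h s * h s) - ∫ s in s0..T, h s * h s =
        (∫ s in (s0 - y j)..s0, h s * h s) - ∫ s in (T - y j)..T, h s * h s := by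
      have a1 := intervalIntegral.integral_add_adjacent_intervals (hh2.ii (s0 - y j) s0) (hh2.ii s0 T)
      have a2 := intervalIntegral.integral_add_adjacent_intervals (hh2.ii (s0 - y j) (T - y j)) (hh2.ii (T - y j) T)
      linarith
    rw [k2]
    have k3 : ∀ a, |∫ s in (a - y j)..a, h s * h s| ≤ B * B * |y j| := by
      intro a
      have := intervalIntegral.norm_integral_le_of_norm_le_const (a := a - y j) (b := a)
        (f := fun s => h s * h s) (C := B * B) (fun s _ => hhb2 s)
      simpa using this
    have := (abs_le.mp (k3 s0)).2
    have := (abs_le.mp (k3 T)).1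
    linarith
  have hvt := BA.barbalat hvBA hv0 hbd
  -- conclude
  have hdev : Tendsto (fun s => h (s - y j) - g s) atTop (𝓝 0) := by
    have h1 : Tendsto (fun s => √(v s / π j)) atTop (𝓝 0) := by
      have := (hvt.div_const (π j)).sqrt
      simpa using this
    refine squeeze_zero_norm (fun s => ?_) h1
    rw [Real.norm_eq_abs]
    apply Real.le_sqrt_of_sq_le
    rw [sq_abs, le_div_iff₀ (hπ j), hvar, mul_comm]
    exact Finset.single_le_sum (f := fun j => π j * (h (s - y j) - g s) ^ 2)
      (fun j _ => mul_nonneg (hπ j).le (sq_nonneg _)) (Finset.mem_univ j)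
  have hexp : Tendsto (fun s => C * Real.exp (-c * s)) atTop (𝓝 0) := by
    have : Tendsto (fun s : ℝ => -c * s) atTop atBot :=
      Tendsto.const_mul_atTop_of_neg (by linarith) tendsto_id
    simpa using (Real.tendsto_exp_atBot.comp this).const_mul C
  have hg2 : Tendsto (fun s => h s - g s) atTop (𝓝 0) := by
    refine squeeze_zero_norm' ?_ hexp
    filter_upwards [eventually_ge_atTop s0] with s hs using he s hs
  have := hg2.sub hdev
  simpa using this

/-- the set of asymptotic periods -/
theorem ren_group (hh : BA h) : ∃ S : AddSubgroup ℝ, IsClosed (S : Set ℝ) ∧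
    ∀ z, z ∈ S ↔ Tendsto (fun s => h s - h (s - z)) atTop (𝓝 0) := by
  refine ⟨{ carrier := {z | Tendsto (fun s => h s - h (s - z)) atTop (𝓝 0)}
            add_mem' := ?_
            zero_mem' := ?_
            neg_mem' := ?_ }, ?_, fun z => Iff.rfl⟩
  · intro a b ha hb
    have h1 := hb.comp (tendsto_atTop_add_const_right atTop (-a) tendsto_id)
    have := ha.add h1
    simp only [Set.mem_ofPred_eq] at *
    convert this using 1
    · ext s
      simp only [Function.comp, id]
      have : s - (a + b) = s + -a - b := by ring
      rw [this, ← sub_eq_add_neg s a]; ring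
    · simp
  · simp
  · intro a ha
    have h1 := (ha.comp (tendsto_atTop_add_const_right atTop a tendsto_id)).neg
    simp only [Set.mem_ofPred_eq] at *
    convert h1 using 1
    · ext s
      simp only [Function.comp, id]
      rw [add_sub_cancel_right, sub_neg_eq_add]; ring
    · simp
  · apply isClosed_of_closure_subset
    intro z hz
    simp only [AddSubgroup.coe_set_mk, AddSubmonoid.coe_set_mk, AddSubsemigroup.coe_set_mk] at hz ⊢
    simp only [Set.mem_ofPred_eq]
    rw [Metric.tendsto_atTop]
    intro ε hε
    obtain ⟨δ, hδ, S, hS⟩ := hh.auc (ε / 4) (by linarith)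
    obtain ⟨w, hw, hwz⟩ := Metric.mem_closure_iff.mp hz δ hδ
    simp only [Set.mem_ofPred_eq] at hw
    obtain ⟨T, hT⟩ := (Metric.tendsto_atTop.mp hw) (ε / 4) (by linarith)
    refine ⟨max T (max (S + z) (S + w)), fun s hs => ?_⟩
    have c1 : T ≤ s := (le_max_left _ _).trans hs
    have c2 : S + z ≤ s := ((le_max_left _ _).trans (le_max_right _ _)).trans hs
    have c3 : S + w ≤ s := ((le_max_right _ _).trans (le_max_right _ _)).trans hs
    have k1 := hT s c1
    have k2 := hS (s - w) (s - z) (by linarith) (by linarith) (by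
      rw [sub_sub_sub_cancel_left, ← Real.dist_eq]; exact hwz.le)
    rw [Real.dist_eq, sub_zero] at k1 ⊢
    have : h s - h (s - z) = (h s - h (s - w)) + (h (s - w) - h (s - z)) := by ring
    rw [this]
    have := abs_add_le (h s - h (s - w)) (h (s - w) - h (s - z))
    linarith

theorem ren_dense (hπ : ∀ j, 0 < π j) (hπ1 : ∑ j, π j = 1) (hy : ∀ j, 0 < y j) (hh : BA h)
    {C c s0 : ℝ} (hC : 0 ≤ C) (hc : 0 < c)
    (he : ∀ s, s0 ≤ s → |h s - ∑ j, π j * h (s - y j)| ≤ C * Real.exp (-c * s))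
    (hall : ∀ z, Tendsto (fun s => h s - h (s - z)) atTop (𝓝 0)) :
    ∃ q, Tendsto h atTop (𝓝 q) := by
  obtain ⟨B, hB0, hB⟩ := hh.bdd
  set I : ℝ → ℝ := fun T => ∑ j, π j * ∫ s in (T - y j)..T, h s with hI
  have hgBA : BA (fun s => h s - ∑ j, π j * h (s - y j)) :=
    hh.sub (BA.sum _ fun j _ => (BA.const (π j)).mul (hh.shift (y j)))
  have hdiff : ∀ T T', I T' - I T = ∫ s in T..T', (h s - ∑ j, π j * h (s - y j)) := by
    intro T T'
    have i1 : ∀ j, BA (fun s => π j * (h s - h (s - y j))) := fun j =>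
      (BA.const (π j)).mul (hh.sub (hh.shift (y j)))
    have e : ∀ s, (h s - ∑ j, π j * h (s - y j)) = ∑ j, π j * (h s - h (s - y j)) := by
      intro s; simp only [mul_sub, Finset.sum_sub_distrib, ← Finset.sum_mul, hπ1, one_mul]
    simp_rw [e]
    rw [intervalIntegral.integral_finsetSum (fun j _ => (i1 j).ii _ _), ← Finset.sum_sub_distrib]
    refine Finset.sum_congr rfl fun j _ => ?_
    rw [intervalIntegral.integral_const_mul, ← mul_sub]
    congr 1
    rw [intervalIntegral.integral_sub (hh.ii _ _) ((hh.shift (y j)).ii _ _),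
      intervalIntegral.integral_comp_sub_right h (y j)]
    have a1 := intervalIntegral.integral_add_adjacent_intervals (hh.ii (T - y j) T) (hh.ii T T')
    have a2 := intervalIntegral.integral_add_adjacent_intervals (hh.ii (T - y j) (T' - y j)) (hh.ii (T' - y j) T')
    linarith
  have hexp : Tendsto (fun s => C / c * Real.exp (-c * s)) atTop (𝓝 0) := by
    have : Tendsto (fun s : ℝ => -c * s) atTop atBot :=
      Tendsto.const_mul_atTop_of_neg (by linarith) tendsto_id
    simpa using (Real.tendsto_exp_atBot.comp this).const_mul (C / c)
  have hcau : CauchySeq I := by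
    rw [Metric.cauchySeq_iff']
    intro ε hε
    obtain ⟨T0, hT0⟩ := eventually_atTop.mp (hexp.eventually (gt_mem_nhds hε))
    refine ⟨max T0 s0, fun T hT => ?_⟩
    have hT' : max T0 s0 ≤ T := hT
    rw [Real.dist_eq, hdiff]
    refine (exp_int hC hc hT' (hgBA.ii _ _) (fun s hs => he s ((le_max_right _ _).trans hs))).trans_lt ?_
    exact hT0 _ (le_max_left _ _)
  obtain ⟨q0, hq0⟩ := cauchySeq_tendsto_of_complete hcau
  set κ := ∑ j, π j * y j with hκ
  have hne : (univ : Finset (Fin A)).Nonempty := by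
    by_contra hcon
    rw [Finset.not_nonempty_iff_eq_empty] at hcon
    rw [hcon] at hπ1; simp at hπ1
  have hκ0 : 0 < κ := Finset.sum_pos (fun j _ => mul_pos (hπ j) (hy j)) hne
  have hd : Tendsto (fun T => κ * h T - I T) atTop (𝓝 0) := by
    have e : ∀ T, κ * h T - I T = ∑ j, π j * ∫ u in (0:ℝ)..(y j), (h T - h (T - u)) := by
      intro T
      rw [hκ, hI, Finset.sum_mul, ← Finset.sum_sub_distrib]
      refine Finset.sum_congr rfl fun j _ => ?_
      have hcm : BA h := hh
      rw [intervalIntegral.integral_sub intervalIntegrable_const]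
      · rw [intervalIntegral.integral_const, intervalIntegral.integral_comp_sub_left (fun u => h u) T]
        simp only [sub_zero, smul_eq_mul]; ring
      · have := (hh.ii (T - 0) (T - y j)).comp_sub_left T
        simpa using this
    simp_rw [e]
    suffices key : ∀ j, Tendsto (fun T => ∫ u in (0:ℝ)..(y j), (h T - h (T - u))) atTop
        (𝓝 (∫ u in (0:ℝ)..(y j), (0:ℝ))) by
      have := tendsto_finsetSum (f := fun j T => π j * ∫ u in (0:ℝ)..(y j), (h T - h (T - u))) (univ : Finset (Fin A)) fun j _ => (key j).const_mul (π j)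
      simpa using this
    intro j
    apply intervalIntegral.tendsto_integral_filter_of_dominated_convergence (fun _ => 2 * B)
    · refine Filter.Eventually.of_forall fun T => ?_
      exact (measurable_const.sub (hh.meas.comp (measurable_const.sub measurable_id))).aestronglyMeasurable
    · refine Filter.Eventually.of_forall fun T => Filter.Eventually.of_forall fun u _ => ?_
      have := abs_sub (h T) (h (T - u))
      have := hB T
      have := hB (T - u)
      rw [Real.norm_eq_abs]; linarith
    · exact intervalIntegrable_const
    · exact Filter.Eventually.of_forall fun u _ => hall u
  refine ⟨q0 / κ, ?_⟩
  have := (hd.add hq0).div_const κ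
  simp only [zero_add, sub_add_cancel] at this
  refine this.congr fun s => ?_
  field_simp

theorem ren_cyclic (hπ : ∀ j, 0 < π j) (hπ1 : ∑ j, π j = 1)
    {d : ℝ} (hd : 0 < d) {k : Fin A → ℕ} (hk : ∀ j, 1 ≤ k j) (hky : ∀ j, y j = k j * d) (hh : BA h)
    {C c s0 : ℝ} (hC : 0 ≤ C) (hc : 0 < c)
    (he : ∀ s, s0 ≤ s → |h s - ∑ j, π j * h (s - y j)| ≤ C * Real.exp (-c * s))
    (hper : ∀ i : ℕ, Tendsto (fun s => h s - h (s - i * d)) atTop (𝓝 0)) :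
    ∃ Q : ℝ → ℝ, (∀ s, Q (s + d) = Q s) ∧ Tendsto (fun s => h s - Q s) atTop (𝓝 0) := by
  set J : ℝ → ℝ := fun s => ∑ j, π j * ∑ i ∈ range (k j), h (s - i * d) with hJ
  have hJd : ∀ s, s0 ≤ s → |J s - J (s - d)| ≤ C * Real.exp (-c * s) := by
    intro s hs
    have e : J s - J (s - d) = h s - ∑ j, π j * h (s - y j) := by
      have e2 : h s = ∑ j, π j * h s := by rw [← Finset.sum_mul, hπ1, one_mul]
      rw [e2, hJ, ← Finset.sum_sub_distrib, ← Finset.sum_sub_distrib]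
      refine Finset.sum_congr rfl fun j _ => ?_
      rw [← mul_sub, ← mul_sub]
      congr 1
      have := Finset.sum_range_sub (fun i : ℕ => h (s - i * d)) (k j)
      rw [Finset.sum_sub_distrib] at this
      have e3 : ∑ i ∈ range (k j), h (s - d - i * d) = ∑ i ∈ range (k j), h (s - ((i + 1 : ℕ) : ℝ) * d) := by
        refine Finset.sum_congr rfl fun i _ => ?_
        congr 1; push_cast; ring
      rw [e3, hky]
      simp only [Nat.cast_zero, zero_mul, sub_zero] at this
      linarith
    rw [e]; exact he s hs
  set κ := ∑ j, π j * (k j : ℝ) with hκ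
  have hne : (univ : Finset (Fin A)).Nonempty := by
    by_contra hcon
    rw [Finset.not_nonempty_iff_eq_empty] at hcon
    rw [hcon] at hπ1; simp at hπ1
  have hκ0 : 0 < κ := Finset.sum_pos (fun j _ => mul_pos (hπ j) (by exact_mod_cast hk j)) hne
  set θ := Real.exp (-c * d) with hθ
  have hθ1 : θ < 1 := by rw [hθ, Real.exp_lt_one_iff]; nlinarith
  have hθ0 : 0 < θ := Real.exp_pos _
  have hstep : ∀ s, s0 ≤ s → ∀ n : ℕ, dist (J (s + n * d)) (J (s + (n + 1 : ℕ) * d)) ≤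
      (C * Real.exp (-c * s)) * θ ^ n := by
    intro s hs n
    have := hJd (s + (n + 1 : ℕ) * d) (by
      have : (0:ℝ) ≤ ((n + 1 : ℕ) : ℝ) * d := by positivity
      linarith)
    have e : s + ((n + 1 : ℕ) : ℝ) * d - d = s + n * d := by push_cast; ring
    rw [e] at this
    rw [dist_comm, Real.dist_eq]
    refine this.trans ?_
    have e2 : Real.exp (-c * (s + ((n + 1 : ℕ) : ℝ) * d)) = Real.exp (-c * s) * θ ^ (n + 1) := by
      rw [hθ, ← Real.exp_nat_mul, ← Real.exp_add]; congr 1; push_cast; ring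
    rw [e2, ← mul_assoc]
    apply mul_le_mul_of_nonneg_left _ (by positivity)
    exact pow_le_pow_of_le_one hθ0.le hθ1.le (by omega)
  have hex : ∀ s, ∃ q, Tendsto (fun n : ℕ => J (s + n * d)) atTop (𝓝 q) := by
    intro s
    obtain ⟨m, hm⟩ := exists_nat_ge ((s0 - s) / d)
    have hm' : s0 ≤ s + m * d := by rw [div_le_iff₀ hd] at hm; linarith
    have hcs := cauchySeq_of_le_geometric θ _ hθ1 (hstep (s + m * d) hm')
    obtain ⟨q, hq⟩ := cauchySeq_tendsto_of_complete hcs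
    refine ⟨q, ?_⟩
    rw [← tendsto_add_atTop_iff_nat m]
    refine hq.congr fun n => ?_
    congr 1; push_cast; ring
  choose q hq using hex
  refine ⟨fun s => q s / κ, fun s => ?_, ?_⟩
  · suffices hs : q (s + d) = q s by simp only [hs]
    have h1 := (tendsto_add_atTop_iff_nat 1).mpr (hq s)
    refine tendsto_nhds_unique (hq (s + d)) (h1.congr fun n => ?_)
    congr 1; push_cast; ring
  · have hb : ∀ s, s0 ≤ s → |J s - q s| ≤ C / (1 - θ) * Real.exp (-c * s) := by
      intro s hs
      have := dist_le_of_le_geometric_of_tendsto₀ θ _ hθ1 (hstep s hs) (hq s)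
      simp only [Nat.cast_zero, zero_mul, add_zero, Real.dist_eq] at this
      refine this.trans (le_of_eq ?_); ring
    have hexp : Tendsto (fun s => C / (1 - θ) * Real.exp (-c * s)) atTop (𝓝 0) := by
      have : Tendsto (fun s : ℝ => -c * s) atTop atBot :=
        Tendsto.const_mul_atTop_of_neg (by linarith) tendsto_id
      simpa using (Real.tendsto_exp_atBot.comp this).const_mul (C / (1 - θ))
    have t1 : Tendsto (fun s => J s - q s) atTop (𝓝 0) := by
      refine squeeze_zero_norm' ?_ hexp
      filter_upwards [eventually_ge_atTop s0] with s hs using hb s hs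
    have t2 : Tendsto (fun s => κ * h s - J s) atTop (𝓝 0) := by
      have e : ∀ s, κ * h s - J s = ∑ j, π j * ∑ i ∈ range (k j), (h s - h (s - i * d)) := by
        intro s
        rw [hκ, hJ, Finset.sum_mul, ← Finset.sum_sub_distrib]
        refine Finset.sum_congr rfl fun j _ => ?_
        rw [Finset.sum_sub_distrib, Finset.sum_const, card_range, nsmul_eq_mul]; ring
      simp_rw [e]
      have : (0:ℝ) = ∑ j : Fin A, π j * ∑ i ∈ range (k j), 0 := by simp
      rw [this]
      exact tendsto_finsetSum _ fun j _ => Tendsto.const_mul _ (tendsto_finsetSum _ fun i _ => hper i)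
    have := (t2.add t1).div_const κ
    simp only [add_zero, zero_div] at this
    refine this.congr fun s => ?_
    field_simp; ring

/-- a periodic function asymptotic to a BA function is continuous -/
theorem ren_cont (hh : BA h) {Q : ℝ → ℝ} {d : ℝ} (hd : 0 < d) (hQ : ∀ s, Q (s + d) = Q s)
    (ht : Tendsto (fun s => h s - Q s) atTop (𝓝 0)) : Continuous Q := by
  have hQn : ∀ s (n : ℕ), Q (s + n * d) = Q s := by
    intro s n
    induction n with
    | zero => simp
    | succ n ih => rw [← ih, ← hQ (s + n * d)]; congr 1; push_cast; ring
  rw [Metric.continuous_iff]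
  intro s ε hε
  obtain ⟨δ, hδ, S, hS⟩ := hh.auc (ε / 4) (by linarith)
  obtain ⟨T, hT⟩ := (Metric.tendsto_atTop.mp ht) (ε / 4) (by linarith)
  refine ⟨δ, hδ, fun r hr => ?_⟩
  obtain ⟨m, hm⟩ := exists_nat_ge ((max S T + δ - s) / d)
  have hm' : max S T + δ ≤ s + m * d := by rw [div_le_iff₀ hd] at hm; linarith
  have m1 := le_max_left S T
  have m2 := le_max_right S T
  rw [Real.dist_eq] at hr
  have hr2 := abs_lt.mp hr
  have k1 := hT (s + m * d) (by linarith)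
  have k2 := hT (r + m * d) (by linarith [hr2.1])
  have k3 := hS (r + m * d) (s + m * d) (by linarith [hr2.1]) (by linarith) (by
    rw [add_sub_add_right_eq_sub]; exact hr.le)
  rw [Real.dist_eq, sub_zero] at k1 k2
  rw [← hQn r m, ← hQn s m, Real.dist_eq]
  rw [abs_lt] at k1 k2 ⊢
  rw [abs_le] at k3
  constructor <;> linarith [k1.1, k1.2, k2.1, k2.2, k3.1, k3.2]

end renewal

theorem renewal {A : ℕ} {π y : Fin A → ℝ} (hπ : ∀ j, 0 < π j) (hπ1 : ∑ j, π j = 1)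
    (hy : ∀ j, 0 < y j) : ∃ d > 0, ∀ h : ℝ → ℝ, BA h → (∃ C c s0 : ℝ, 0 ≤ C ∧ 0 < c ∧
      ∀ s, s0 ≤ s → |h s - ∑ j, π j * h (s - y j)| ≤ C * Real.exp (-c * s)) →
    ∃ Q : ℝ → ℝ, Continuous Q ∧ (∀ s, Q (s + d) = Q s) ∧ (∀ j s, Q (s - y j) = Q s) ∧
      Tendsto (fun s => h s - Q s) atTop (𝓝 0) := by
  have hne : Nonempty (Fin A) := by
    by_contra hcon
    rw [not_nonempty_iff] at hcon
    simp at hπ1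
  set G := AddSubgroup.closure (Set.range y) with hG
  have hsub : ∀ (h : ℝ → ℝ), BA h → (∃ C c s0 : ℝ, 0 ≤ C ∧ 0 < c ∧
      ∀ s, s0 ≤ s → |h s - ∑ j, π j * h (s - y j)| ≤ C * Real.exp (-c * s)) →
      ∀ S : AddSubgroup ℝ, (∀ z, z ∈ S ↔ Tendsto (fun s => h s - h (s - z)) atTop (𝓝 0)) → G ≤ S := by
    intro h hh ⟨C, c, s0, hC, hc, he⟩ S hS
    rw [hG, AddSubgroup.closure_le]
    rintro _ ⟨j, rfl⟩
    exact (hS _).mpr (ren_step1 hπ hπ1 hh hC hc he j)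
  rcases AddSubgroup.dense_or_cyclic G with hdense | ⟨a, ha⟩
  · refine ⟨1, one_pos, fun h hh hrec => ?_⟩
    obtain ⟨S, hScl, hS⟩ := ren_group hh
    have hGS := hsub h hh hrec S hS
    have hall : ∀ z, z ∈ S := by
      intro z
      have h1 : Dense (S : Set ℝ) := hdense.mono hGS
      have h2 := hScl.closure_eq
      rw [h1.closure_eq] at h2
      have : z ∈ (S : Set ℝ) := by rw [← h2]; trivial
      exact this
    obtain ⟨C, c, s0, hC, hc, he⟩ := hrec
    obtain ⟨q, hq⟩ := ren_dense hπ hπ1 hy hh hC hc he (fun z => (hS z).mp (hall z))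
    refine ⟨fun _ => q, continuous_const, fun _ => rfl, fun _ _ => rfl, ?_⟩
    simpa using hq.sub_const q
  · have hya : ∀ j, ∃ z : ℤ, y j = z * a := by
      intro j
      have : y j ∈ G := AddSubgroup.subset_closure ⟨j, rfl⟩
      rw [ha, AddSubgroup.mem_closure_singleton] at this
      obtain ⟨z, hz⟩ := this
      exact ⟨z, by rw [← hz]; simp⟩
    have ha0 : a ≠ 0 := by
      rintro rfl
      obtain ⟨z, hz⟩ := hya hne.some
      have := hy hne.some
      rw [hz] at this; simp at this
    set d := |a| with hd
    have hd0 : 0 < d := abs_pos.mpr ha0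
    have hyd : ∀ j, ∃ k : ℕ, 1 ≤ k ∧ y j = k * d := by
      intro j
      obtain ⟨z, hz⟩ := hya j
      refine ⟨z.natAbs, ?_, ?_⟩
      · rw [Nat.one_le_iff_ne_zero, Int.natAbs_ne_zero]
        rintro rfl
        have := hy j
        rw [hz] at this; simp at this
      · rw [hd, Nat.cast_natAbs, Int.cast_abs, ← abs_mul, ← hz, abs_of_pos (hy j)]
    choose k hk1 hk using hyd
    refine ⟨d, hd0, fun h hh hrec => ?_⟩
    obtain ⟨S, hScl, hS⟩ := ren_group hh
    have hGS := hsub h hh hrec S hS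
    have hdS : d ∈ S := by
      have haG : a ∈ G := by rw [ha]; exact AddSubgroup.subset_closure rfl
      rcases abs_choice a with h1 | h1
      · rw [hd, h1]; exact hGS haG
      · rw [hd, h1]; exact hGS (G.neg_mem haG)
    obtain ⟨C, c, s0, hC, hc, he⟩ := hrec
    obtain ⟨Q, hQ1, hQ2⟩ := ren_cyclic hπ hπ1 hd0 hk1 hk hh hC hc he (fun i => by
      rw [← hS]
      have := S.nsmul_mem hdS i
      simpa using this)
    refine ⟨Q, ren_cont hh hd0 hQ1 hQ2, hQ1, fun j s => ?_, hQ2⟩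
    have hQn : ∀ s (n : ℕ), Q (s + n * d) = Q s := by
      intro s n
      induction n with
      | zero => simp
      | succ n ih => rw [← ih, ← hQ1 (s + n * d)]; congr 1; push_cast; ring
    rw [hk j, ← hQn (s - k j * d) (k j)]
    congr 1; ring
end Part4

section Part5
open Finset MeasureTheory Filter Topology

/-- `d` is a common period for the renewal lemma attached to the parameters -/
def RenProp (M : ℕ) {A : ℕ} (p : Fin A → ℝ) (ρ : ℝ) (d : ℝ) : Prop :=
  0 < d ∧ ∀ h : ℝ → ℝ, BA h → (∃ C c s0 : ℝ, 0 ≤ C ∧ 0 < c ∧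
      ∀ s, s0 ≤ s → |h s - ∑ j, ((M : ℝ) * p j ^ ρ) * h (s - (-Real.log (p j)))| ≤ C * Real.exp (-c * s)) →
    ∃ Q : ℝ → ℝ, Continuous Q ∧ (∀ s, Q (s + d) = Q s) ∧ (∀ j s, Q (s - (-Real.log (p j))) = Q s) ∧
      Tendsto (fun s => h s - Q s) atTop (𝓝 0)

theorem exists_ren {M A : ℕ} {p : Fin A → ℝ} {ρ : ℝ} (P : Par M A p ρ) : ∃ d, RenProp M p ρ d := by
  obtain ⟨d, hd, h⟩ := renewal (π := fun j => (M : ℝ) * p j ^ ρ) (y := fun j => -Real.log (p j))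
    (fun j => mul_pos P.Mpos (Real.rpow_pos_of_pos (P.p0 j) _)) P.pi_sum
    (fun j => by have := Real.log_neg (P.p0 j) (P.p1 j); linarith)
  exact ⟨d, hd, h⟩

/-- `f n ~ n^θ Q(log n)` -/
structure AsyQ {A : ℕ} (p : Fin A → ℝ) (d θ : ℝ) (f : ℕ → ℝ) (Q : ℝ → ℝ) : Prop where
  cont : Continuous Q
  per : ∀ s, Q (s + d) = Q s
  pery : ∀ j s, Q (s - (-Real.log (p j))) = Q s
  lim : Tendsto (fun n : ℕ => f n / (n : ℝ) ^ θ - Q (Real.log n)) atTop (𝓝 0)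

theorem rpow_near {x y η : ℝ} (hy : 0 < y) (h1 : y / 2 ≤ x) (h2 : x ≤ 2 * y) (h3 : -1 ≤ η)
    (h4 : η ≤ 1) : x ^ η ≤ 2 * y ^ η := by
  have hx : 0 < x := by linarith
  have hu : 1 / 2 ≤ x / y := by rw [le_div_iff₀ hy]; linarith
  have hu2 : x / y ≤ 2 := by rw [div_le_iff₀ hy]; linarith
  have e : x ^ η = (x / y) ^ η * y ^ η := by
    rw [← Real.mul_rpow (by positivity) hy.le, div_mul_cancel₀ _ hy.ne']
  rw [e]
  refine mul_le_mul_of_nonneg_right ?_ (by positivity)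
  rcases le_total 0 η with h | h
  · calc (x / y) ^ η ≤ 2 ^ η := Real.rpow_le_rpow (by positivity) hu2 h
      _ ≤ 2 ^ (1:ℝ) := Real.rpow_le_rpow_of_exponent_le (by norm_num) h4
      _ = 2 := by simp
  · calc (x / y) ^ η ≤ (1/2) ^ η := Real.rpow_le_rpow_of_nonpos (by positivity) hu h
      _ = 2 ^ (-η) := by rw [one_div, Real.inv_rpow (by norm_num), Real.rpow_neg (by norm_num)]
      _ ≤ 2 ^ (1:ℝ) := Real.rpow_le_rpow_of_exponent_le (by norm_num) (by linarith)
      _ = 2 := by simp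

/-- the continuous interpolation -/
noncomputable def hfun (θ : ℝ) (f : ℕ → ℝ) (s : ℝ) : ℝ :=
  if 0 ≤ s then Real.exp (-θ * s) * f ⌊Real.exp s⌋₊ else 0

theorem hfun_log {θ : ℝ} {f : ℕ → ℝ} {n : ℕ} (hn : 1 ≤ n) :
    hfun θ f (Real.log n) = f n / (n : ℝ) ^ θ := by
  have hn' : (1:ℝ) ≤ n := by exact_mod_cast hn
  have h0 : 0 ≤ Real.log n := Real.log_nonneg hn'
  rw [hfun, if_pos h0, Real.exp_log (by linarith), Nat.floor_natCast,
    Real.rpow_def_of_pos (by linarith), div_eq_mul_inv, ← Real.exp_neg]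
  rw [mul_comm]; congr 2; ring

theorem floor_bounds {s : ℝ} (hs : 0 ≤ s) : 1 ≤ ⌊Real.exp s⌋₊ ∧ (⌊Real.exp s⌋₊ : ℝ) ≤ Real.exp s ∧
    Real.exp s < (⌊Real.exp s⌋₊ : ℝ) + 1 := by
  refine ⟨?_, Nat.floor_le (Real.exp_pos s).le, Nat.lt_floor_add_one _⟩
  rw [Nat.one_le_floor_iff]; exact Real.one_le_exp hs

theorem exp_rpow (s η : ℝ) : (Real.exp s) ^ η = Real.exp (η * s) := by
  rw [← Real.exp_mul]; congr 1; ring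

theorem hfun_bdd {θ C : ℝ} (h0 : 0 ≤ θ) (h2 : θ ≤ 2) {f : ℕ → ℝ} (hC : 0 ≤ C)
    (hf : ∀ k : ℕ, |f k| ≤ C * ((k : ℝ) + 1) ^ θ) {s : ℝ} (hs : 0 ≤ s) :
    |f ⌊Real.exp s⌋₊| ≤ 4 * C * Real.exp (θ * s) := by
  obtain ⟨a1, a2, a3⟩ := floor_bounds hs
  refine (hf _).trans ?_
  have h1 : 1 ≤ Real.exp s := Real.one_le_exp hs
  have : ((⌊Real.exp s⌋₊ : ℝ) + 1) ^ θ ≤ 4 * Real.exp (θ * s) := by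
    calc ((⌊Real.exp s⌋₊ : ℝ) + 1) ^ θ ≤ (2 * Real.exp s) ^ θ :=
          Real.rpow_le_rpow (by positivity) (by linarith) h0
      _ = 2 ^ θ * Real.exp (θ * s) := by
          rw [Real.mul_rpow (by norm_num) (Real.exp_pos s).le, exp_rpow]
      _ ≤ 4 * Real.exp (θ * s) := by
          gcongr
          calc (2:ℝ) ^ θ ≤ 2 ^ (2:ℝ) := Real.rpow_le_rpow_of_exponent_le (by norm_num) h2
            _ = 4 := by norm_num
  calc C * ((⌊Real.exp s⌋₊ : ℝ) + 1) ^ θ ≤ C * (4 * Real.exp (θ * s)) := by gcongr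
    _ = _ := by ring

theorem hfun_lip {θ C : ℝ} (h0 : 0 ≤ θ) (h2 : θ ≤ 2) {f : ℕ → ℝ} (hC : 0 ≤ C)
    (hf : ∀ k : ℕ, |f k| ≤ C * ((k : ℝ) + 1) ^ θ)
    (hf1 : ∀ k : ℕ, |f (k + 1) - f k| ≤ C * ((k : ℝ) + 1) ^ (θ - 1)) {s r : ℝ} (hr : 0 ≤ r)
    (hrs : r ≤ s) (hrs1 : s ≤ r + 1) :
    |hfun θ f s - hfun θ f r| ≤ 32 * C * ((s - r) + Real.exp (-s)) := by
  have hs : 0 ≤ s := hr.trans hrs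
  obtain ⟨a1, a2, a3⟩ := floor_bounds hs
  obtain ⟨b1, b2, b3⟩ := floor_bounds hr
  have c1 := hfun_bdd h0 h2 hC hf hr
  rw [hfun, hfun, if_pos hs, if_pos hr]
  set n := ⌊Real.exp s⌋₊ with hn
  set k := ⌊Real.exp r⌋₊ with hk
  have hkn : k ≤ n := Nat.floor_mono (Real.exp_le_exp.mpr hrs)
  have E1 : 1 ≤ Real.exp s := Real.one_le_exp hs
  have E2 : 1 ≤ Real.exp r := Real.one_le_exp hr
  have hkn' : (k:ℝ) ≤ n := by exact_mod_cast hkn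
  have d1 : |f n - f k| ≤ C * (((n : ℝ) + 1) ^ (θ - 1) + ((k : ℝ) + 1) ^ (θ - 1)) * |(n:ℝ) - k| := by
    apply disc_lip
    intro i hi1 hi2
    refine (hf1 i).trans ?_
    apply mul_le_mul_of_nonneg_left (between_rpow hi1 hi2.le) hC
  have d2 : ((n : ℝ) + 1) ^ (θ - 1) ≤ 2 * Real.exp ((θ - 1) * s) := by
    rw [← exp_rpow]; apply rpow_near <;> linarith
  have d3 : ((k : ℝ) + 1) ^ (θ - 1) ≤ 6 * Real.exp ((θ - 1) * s) := by
    have : ((k : ℝ) + 1) ^ (θ - 1) ≤ 2 * Real.exp ((θ - 1) * r) := by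
      rw [← exp_rpow]; apply rpow_near <;> linarith
    refine this.trans ?_
    have h5 : Real.exp ((θ - 1) * r) ≤ Real.exp ((θ - 1) * s + 1) := by
      apply Real.exp_le_exp.mpr; nlinarith
    rw [Real.exp_add] at h5
    have := Real.exp_one_lt_d9
    have h6 := Real.exp_pos ((θ - 1) * s)
    nlinarith
  have d4 : |(n:ℝ) - k| ≤ Real.exp s * (s - r) + 1 := by
    rw [abs_of_nonneg (by linarith)]
    have : Real.exp s * (1 - (s - r)) ≤ Real.exp r := by
      have h5 := Real.add_one_le_exp (-(s - r))
      have : Real.exp r = Real.exp s * Real.exp (-(s - r)) := by rw [← Real.exp_add]; congr 1; ring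
      rw [this]; gcongr; linarith
    linarith
  have d5 : |Real.exp (-θ * s) * (f n - f k)| ≤ 8 * C * ((s - r) + Real.exp (-s)) := by
    rw [abs_mul, abs_of_pos (Real.exp_pos _)]
    calc Real.exp (-θ * s) * |f n - f k|
        ≤ Real.exp (-θ * s) * (C * (2 * Real.exp ((θ - 1) * s) + 6 * Real.exp ((θ - 1) * s)) *
          (Real.exp s * (s - r) + 1)) := by
          gcongr
          refine d1.trans ?_
          gcongr
      _ = 8 * C * (Real.exp (-θ * s) * Real.exp ((θ - 1) * s)) * (Real.exp s * (s - r) + 1) := by ring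
      _ = 8 * C * Real.exp (-s) * (Real.exp s * (s - r) + 1) := by
          rw [← Real.exp_add]; congr 3; ring
      _ = 8 * C * ((Real.exp (-s) * Real.exp s) * (s - r) + Real.exp (-s)) := by ring
      _ = _ := by rw [← Real.exp_add]; simp
  have d6 : |(Real.exp (-θ * s) - Real.exp (-θ * r)) * f k| ≤ 8 * C * (s - r) := by
    have e : Real.exp (-θ * s) - Real.exp (-θ * r) = -(Real.exp (-θ * r) * (1 - Real.exp (-θ * (s - r)))) := by
      rw [mul_sub, ← Real.exp_add]; ring_nf
    have h6 : Real.exp (-θ * (s - r)) ≤ 1 := by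
      rw [Real.exp_le_one_iff]; nlinarith
    have h7 := Real.add_one_le_exp (-θ * (s - r))
    rw [e, abs_mul, abs_neg, abs_mul, abs_of_pos (Real.exp_pos _), abs_of_nonneg (by linarith)]
    calc Real.exp (-θ * r) * (1 - Real.exp (-θ * (s - r))) * |f k|
        ≤ Real.exp (-θ * r) * (2 * (s - r)) * (4 * C * Real.exp (θ * r)) := by
          gcongr
          nlinarith
      _ = 8 * C * (s - r) * (Real.exp (-θ * r) * Real.exp (θ * r)) := by ring
      _ = _ := by rw [← Real.exp_add]; simp
  have e : Real.exp (-θ * s) * f n - Real.exp (-θ * r) * f k =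
      Real.exp (-θ * s) * (f n - f k) + (Real.exp (-θ * s) - Real.exp (-θ * r)) * f k := by ring
  rw [e]
  refine (abs_add_le _ _).trans ?_
  have := Real.exp_pos (-s)
  have h8 : 0 ≤ C * (s - r) := mul_nonneg hC (by linarith)
  have h9 : 0 ≤ C * Real.exp (-s) := by positivity
  nlinarith

theorem hfun_BA {θ C : ℝ} (h0 : 0 ≤ θ) (h2 : θ ≤ 2) {f : ℕ → ℝ} (hC : 0 ≤ C)
    (hf : ∀ k : ℕ, |f k| ≤ C * ((k : ℝ) + 1) ^ θ)
    (hf1 : ∀ k : ℕ, |f (k + 1) - f k| ≤ C * ((k : ℝ) + 1) ^ (θ - 1)) : BA (hfun θ f) := by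
  refine ⟨?_, ⟨4 * C, by positivity, ?_⟩, ?_⟩
  · refine Measurable.ite measurableSet_Ici ?_ measurable_const
    exact (Real.measurable_exp.comp (measurable_const.mul measurable_id)).mul
      (measurable_from_nat.comp (Nat.measurable_floor.comp Real.measurable_exp))
  · intro s
    rw [hfun]
    split_ifs with hs
    · rw [abs_mul, abs_of_pos (Real.exp_pos _)]
      calc Real.exp (-θ * s) * |f ⌊Real.exp s⌋₊| ≤ Real.exp (-θ * s) * (4 * C * Real.exp (θ * s)) := by
            gcongr; exact hfun_bdd h0 h2 hC hf hs
        _ = 4 * C * (Real.exp (-θ * s) * Real.exp (θ * s)) := by ring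
        _ = _ := by rw [← Real.exp_add]; simp
    · simp; positivity
  · intro ε hε
    have hexp : Tendsto (fun s : ℝ => Real.exp (-s)) atTop (𝓝 0) :=
      Real.tendsto_exp_neg_atTop_nhds_zero
    set K := 32 * C + 1
    have hK : 0 < K := by positivity
    obtain ⟨S, hS⟩ := eventually_atTop.mp (hexp.eventually (gt_mem_nhds (show (0:ℝ) < ε / (2 * K) by positivity)))
    refine ⟨min 1 (ε / (2 * K)), lt_min one_pos (by positivity), max 0 S, ?_⟩
    have key : ∀ s r, max 0 S ≤ s → max 0 S ≤ r → r ≤ s → s - r ≤ min 1 (ε / (2 * K)) →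
        |hfun θ f s - hfun θ f r| ≤ ε := by
      intro s r hs hr hrs hd
      have k0 : 0 ≤ r := (le_max_left _ _).trans hr
      have k1 := hfun_lip h0 h2 hC hf hf1 k0 hrs (by linarith [min_le_left 1 (ε / (2 * K))])
      have k2 := hS s ((le_max_right _ _).trans hs)
      have k3 := hd.trans (min_le_right _ _)
      refine k1.trans ?_
      have hpos := Real.exp_pos (-s)
      calc 32 * C * ((s - r) + Real.exp (-s)) ≤ K * (ε / (2 * K) + ε / (2 * K)) := by
            apply mul_le_mul _ (by linarith) (by linarith) hK.le
            simp only [K]; linarith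
        _ = ε := by field_simp; norm_num
    intro s r hs hr hd
    rcases le_total r s with h | h
    · exact key s r hs hr h (by rwa [abs_of_nonneg (by linarith)] at hd)
    · rw [abs_sub_comm]; exact key r s hr hs h (by rwa [abs_sub_comm, abs_of_nonneg (by linarith)] at hd)

theorem thmA {M A : ℕ} {p : Fin A → ℝ} {ρ d : ℝ} (P : Par M A p ρ) (hd : RenProp M p ρ d)
    {θ C ε : ℝ} {n0 : ℕ} {c : Fin A → ℝ} (h0 : 0 ≤ θ) (h2 : θ ≤ 2)
    (hc : ∀ j, c j * p j ^ θ = (M : ℝ) * p j ^ ρ) {f : ℕ → ℝ} (hC : 0 ≤ C) (hε : 0 < ε)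
    (hf : ∀ k : ℕ, |f k| ≤ C * ((k : ℝ) + 1) ^ θ)
    (hf1 : ∀ k : ℕ, |f (k + 1) - f k| ≤ C * ((k : ℝ) + 1) ^ (θ - 1))
    (hrec : ∀ n : ℕ, n0 ≤ n → |f n - ∑ j, c j * Eb (p j) n f| ≤ C * (n : ℝ) ^ (θ - ε)) :
    ∃ Q, AsyQ p d θ f Q := by
  have hBA := hfun_BA h0 h2 hC hf hf1
  have hcpos : ∀ j, 0 < c j := by
    intro j
    have h1 : 0 < p j ^ θ := Real.rpow_pos_of_pos (P.p0 j) _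
    have h3 : 0 < c j * p j ^ θ := by
      rw [hc]; exact mul_pos P.Mpos (Real.rpow_pos_of_pos (P.p0 j) _)
    exact pos_of_mul_pos_left h3 h1.le
  obtain ⟨C', hC', happ⟩ := Eb_approx P (η := θ - 1) (by linarith) (by linarith) hC hf1
  set δ := min ε (1/2) with hδ
  have hδ0 : 0 < δ := lt_min hε (by norm_num)
  have hδ1 : δ ≤ 1/2 := min_le_right _ _
  suffices hex : ∃ C c s0 : ℝ, 0 ≤ C ∧ 0 < c ∧
      ∀ s, s0 ≤ s → |hfun θ f s - ∑ j, ((M : ℝ) * p j ^ ρ) * hfun θ f (s - (-Real.log (p j)))| ≤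
        C * Real.exp (-c * s) by
    obtain ⟨Q, q1, q2, q3, q4⟩ := hd.2 (hfun θ f) hBA hex
    refine ⟨Q, q1, q2, q3, ?_⟩
    have hl : Tendsto (fun n : ℕ => Real.log (n:ℝ)) atTop atTop :=
      Real.tendsto_log_atTop.comp tendsto_natCast_atTop_atTop
    refine (q4.comp hl).congr' ?_
    filter_upwards [eventually_ge_atTop 1] with n hn
    simp only [Function.comp]
    rw [hfun_log hn]
  refine ⟨2 * (C + ∑ j, c j * C'), δ, max (n0 + 1) (∑ j, -Real.log (p j)), by
      have : 0 ≤ ∑ j, c j * C' := Finset.sum_nonneg fun j _ => mul_nonneg (hcpos j).le hC'.le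
      positivity, hδ0, ?_⟩
  · intro s hs
    have hs1 : (n0:ℝ) + 1 ≤ s := (le_max_left _ _).trans hs
    have hs2 : (∑ j, -Real.log (p j)) ≤ s := (le_max_right _ _).trans hs
    have hs0 : 0 ≤ s := by have : (0:ℝ) ≤ n0 := by positivity
                           linarith
    have hsy : ∀ j, 0 ≤ s - (-Real.log (p j)) := by
      intro j
      have := Finset.single_le_sum (f := fun j => -Real.log (p j))
        (fun j _ => by have := Real.log_neg (P.p0 j) (P.p1 j); show 0 ≤ -Real.log (p j); linarith) (Finset.mem_univ j)
      linarith
    obtain ⟨a1, a2, a3⟩ := floor_bounds hs0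
    have E1 : 1 ≤ Real.exp s := Real.one_le_exp hs0
    have hexpy : ∀ j, Real.exp (s - (-Real.log (p j))) = Real.exp s * p j := by
      intro j; rw [sub_neg_eq_add, Real.exp_add, Real.exp_log (P.p0 j)]
    set n := ⌊Real.exp s⌋₊ with hn
    have hnn0 : n0 ≤ n := by
      apply Nat.le_floor
      have := Real.add_one_le_exp s
      linarith
    have hn1 : (1:ℝ) ≤ n := by exact_mod_cast a1
    have hterm : ∀ j, ((M : ℝ) * p j ^ ρ) * hfun θ f (s - (-Real.log (p j))) =
        Real.exp (-θ * s) * (c j * f ⌊Real.exp s * p j⌋₊) := by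
      intro j
      rw [hfun, if_pos (hsy j), hexpy, ← hc j]
      have : Real.exp (-θ * (s - -Real.log (p j))) = Real.exp (-θ * s) * (p j ^ θ)⁻¹ := by
        rw [Real.rpow_def_of_pos (P.p0 j), ← Real.exp_neg, ← Real.exp_add]; congr 1; ring
      rw [this]
      have h1 : 0 < p j ^ θ := Real.rpow_pos_of_pos (P.p0 j) _
      field_simp
    simp_rw [hterm]
    rw [hfun, if_pos hs0, ← hn, ← Finset.mul_sum, ← mul_sub, abs_mul, abs_of_pos (Real.exp_pos _)]
    have hl : ∀ j, |(⌊Real.exp s * p j⌋₊ : ℝ) - n * p j| ≤ 2 := by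
      intro j
      have f1 := Nat.floor_le (mul_pos (Real.exp_pos s) (P.p0 j)).le
      have f2 := Nat.lt_floor_add_one (Real.exp s * p j)
      have := P.p0 j
      have := P.p1 j
      rw [abs_le]; constructor <;> nlinarith
    have hpow : ∀ x : ℝ, δ ≤ x → (n:ℝ) ^ (θ - x) ≤ 2 * Real.exp ((θ - δ) * s) := by
      intro x hx
      calc (n:ℝ) ^ (θ - x) ≤ (n:ℝ) ^ (θ - δ) := Real.rpow_le_rpow_of_exponent_le hn1 (by linarith)
        _ = (n:ℝ) ^ θ * (n:ℝ) ^ (-δ) := by rw [← Real.rpow_add (by linarith)]; rfl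
        _ ≤ (Real.exp s) ^ θ * (2 * (Real.exp s) ^ (-δ)) := by
            gcongr
            apply rpow_near <;> linarith
        _ = 2 * Real.exp ((θ - δ) * s) := by
            rw [exp_rpow, exp_rpow, mul_left_comm, ← Real.exp_add]; congr 2; ring
    have hmain : |f n - ∑ j, c j * f ⌊Real.exp s * p j⌋₊| ≤
        (C + ∑ j, c j * C') * (2 * Real.exp ((θ - δ) * s)) := by
      have e : f n - ∑ j, c j * f ⌊Real.exp s * p j⌋₊ = (f n - ∑ j, c j * Eb (p j) n f) +
          ∑ j, c j * (Eb (p j) n f - f ⌊Real.exp s * p j⌋₊) := by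
        simp only [mul_sub, Finset.sum_sub_distrib]; ring
      rw [e, add_mul]
      refine (abs_add_le _ _).trans (add_le_add ?_ ?_)
      · exact (hrec n hnn0).trans (mul_le_mul_of_nonneg_left (hpow ε (min_le_left _ _)) hC)
      · refine (Finset.abs_sum_le_sum_abs _ _).trans ?_
        rw [Finset.sum_mul]
        refine Finset.sum_le_sum fun j _ => ?_
        rw [abs_mul, abs_of_pos (hcpos j), mul_assoc]
        refine mul_le_mul_of_nonneg_left ?_ (hcpos j).le
        refine ((happ n a1 j _ (hl j)).2).trans (mul_le_mul_of_nonneg_left ?_ hC'.le)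
        have := hpow (1/2) hδ1
        rwa [show θ - 1 / 2 = θ - 1 + 1 / 2 by ring] at this
    calc Real.exp (-θ * s) * |f n - ∑ j, c j * f ⌊Real.exp s * p j⌋₊|
        ≤ Real.exp (-θ * s) * ((C + ∑ j, c j * C') * (2 * Real.exp ((θ - δ) * s))) := by gcongr
      _ = 2 * (C + ∑ j, c j * C') * (Real.exp (-θ * s) * Real.exp ((θ - δ) * s)) := by ring
      _ = _ := by rw [← Real.exp_add, show -θ * s + (θ - δ) * s = -δ * s by ring]
end Part5

section Part6
open Finset MeasureTheory Filter Topology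

theorem pot {p a : ℝ} (h0 : 0 ≤ p) (h1 : p ≤ 1) (ha : 0 ≤ a) (ha1 : a ≤ 1) (n : ℕ) :
    Eb p n (fun k => (k : ℝ) * ((k - 1 : ℕ) : ℝ) ^ a) ≤
      p ^ (1 + a) * ((n : ℝ) * ((n - 1 : ℕ) : ℝ) ^ a) := by
  cases n with
  | zero => simp [Eb_zero]
  | succ n =>
    rw [Eb_size]
    have h := Eb_rpow_le h0 h1 n ha ha1
    simp only [Nat.add_sub_cancel]
    have e : p ^ (1 + a) = p * p ^ a := by
      rw [Real.rpow_add_of_nonneg h0 zero_le_one ha, Real.rpow_one]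
    rw [e]
    have := mul_le_mul_of_nonneg_left h (show 0 ≤ ((n : ℝ) + 1) * p by positivity)
    push_cast
    nlinarith [this]

/-- `n (n-1)^a ≥ n^(1+a)/2`. -/
theorem pot_low {a : ℝ} (ha : 0 ≤ a) (ha1 : a ≤ 1) {n : ℕ} (hn : 2 ≤ n) :
    (n : ℝ) ^ (1 + a) ≤ 2 * ((n : ℝ) * ((n - 1 : ℕ) : ℝ) ^ a) := by
  have hn0 : (2 : ℝ) ≤ n := by exact_mod_cast hn
  have e : (n : ℝ) ^ (1 + a) = n * (n : ℝ) ^ a := by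
    rw [Real.rpow_add (by linarith), Real.rpow_one]
  have hc : ((n - 1 : ℕ) : ℝ) = n - 1 := by
    rw [Nat.cast_sub (by omega)]; simp
  rw [e, hc]
  have h1 : (n : ℝ) ^ a ≤ (2 * ((n : ℝ) - 1)) ^ a :=
    Real.rpow_le_rpow (by linarith) (by linarith) ha
  rw [Real.mul_rpow (by norm_num) (by linarith)] at h1
  have h2 : (2 : ℝ) ^ a ≤ 2 := by
    calc (2 : ℝ) ^ a ≤ 2 ^ (1 : ℝ) := Real.rpow_le_rpow_of_exponent_le (by norm_num) ha1
      _ = 2 := Real.rpow_one 2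
  have h3 : (0 : ℝ) ≤ ((n : ℝ) - 1) ^ a := Real.rpow_nonneg (by linarith) a
  have h4 : (n : ℝ) ^ a ≤ 2 * ((n : ℝ) - 1) ^ a := by nlinarith
  nlinarith

theorem pot_up {a : ℝ} (ha : 0 ≤ a) (n : ℕ) :
    (n : ℝ) * ((n - 1 : ℕ) : ℝ) ^ a ≤ (n : ℝ) ^ (1 + a) := by
  have e : (n : ℝ) ^ (1 + a) = n * (n : ℝ) ^ a := by
    rw [Real.rpow_add_of_nonneg (by positivity) zero_le_one ha, Real.rpow_one]
  rw [e]
  gcongr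
  exact Nat.sub_le n 1

theorem Eb_low {M A : ℕ} {p : Fin A → ℝ} {ρ : ℝ} (P : Par M A p ρ) (j : Fin A) {θ : ℝ} (h0 : 0 < θ)
    (h2 : θ ≤ 2) {n : ℕ} (hn : 1 ≤ n) {m : ℕ} (hm : (m : ℝ) ≤ n * p j / 2) :
    p j ^ θ * (n : ℝ) ^ θ - 4 * Real.exp 1 / p j * (n : ℝ) ^ (θ - 1/2) ≤
      Eb (p j) n (fun k => if m ≤ k then (k : ℝ) ^ θ else 0) := by
  have hp := P.p0 j
  have hn0 : (0 : ℝ) < n := by exact_mod_cast hn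
  have hx : 0 < n * p j := by positivity
  have h1 : Eb (p j) n (fun k => (n * p j) ^ θ - 2 * (n * p j) ^ θ / (n * p j) * √n *
      (|(k : ℝ) - n * p j| / √n)) ≤ Eb (p j) n (fun k => if m ≤ k then (k : ℝ) ^ θ else 0) := by
    apply Eb_mono hp.le (P.p1' j)
    intro k _
    have hs : 0 < √(n : ℝ) := Real.sqrt_pos.2 hn0
    have e1 : (n * p j) ^ θ - 2 * (n * p j) ^ θ / (n * p j) * √n *
      (|(k : ℝ) - n * p j| / √n) = (n * p j) ^ θ * (1 - 2 * |(k : ℝ) / (n * p j) - 1|) := by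
      have : |(k : ℝ) - n * p j| = n * p j * |(k : ℝ) / (n * p j) - 1| := by
        conv_rhs => rw [← abs_of_pos hx, ← abs_mul, abs_of_pos hx]
        congr 1; field_simp
      rw [this]; field_simp
    rw [e1]
    have hX : 0 < (n * p j) ^ θ := Real.rpow_pos_of_pos hx θ
    have hu0 : 0 ≤ (k : ℝ) / (n * p j) := by positivity
    have ek : (k : ℝ) ^ θ = (n * p j) ^ θ * ((k : ℝ) / (n * p j)) ^ θ := by
      rw [← Real.mul_rpow hx.le hu0, mul_div_cancel₀ _ hx.ne']
    set u := (k : ℝ) / (n * p j) with hu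
    rcases le_or_gt 1 u with h | h
    · have hmk : m ≤ k := by
        have : (m : ℝ) ≤ k := by
          have : n * p j ≤ k := by rwa [hu, le_div_iff₀ hx, one_mul] at h
          linarith
        exact_mod_cast this
      rw [if_pos hmk, ek]
      have : 1 ≤ u ^ θ := Real.one_le_rpow h h0.le
      have := abs_nonneg (u - 1)
      apply mul_le_mul_of_nonneg_left _ hX.le
      linarith
    · have hab : |u - 1| = 1 - u := by rw [abs_of_neg (by linarith)]; ring
      rw [hab]
      split_ifs with hmk
      · rw [ek]
        apply mul_le_mul_of_nonneg_left _ hX.le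
        have : u ^ (2 : ℝ) ≤ u ^ θ := by
          rcases eq_or_lt_of_le hu0 with h' | h'
          · rw [← h', Real.zero_rpow (by norm_num), Real.zero_rpow h0.ne']
          · exact Real.rpow_le_rpow_of_exponent_ge h' h.le h2
        rw [Real.rpow_two] at this
        nlinarith [sq_nonneg (u - 1)]
      · have : (k : ℝ) < m := by exact_mod_cast not_le.1 hmk
        have : u < 1 / 2 := by
          rw [hu, div_lt_iff₀ hx]; linarith
        nlinarith
  rw [Eb_sub, Eb_const, Eb_smul] at h1
  have h3 := dev_moment (fun j => P.p0' j) (fun j => P.p1' j) P.ps 1 j hn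
  simp only [pow_one, Nat.factorial_one, Nat.cast_one, one_mul] at h3
  rw [EE_cnt P.ps j n (fun k => |(k : ℝ) - n * p j| / √n)] at h3
  refine le_trans ?_ h1
  have e2 : (n * p j) ^ θ = p j ^ θ * (n : ℝ) ^ θ := by
    rw [Real.mul_rpow hn0.le hp.le, mul_comm]
  have e3 : (n : ℝ) ^ (θ - 1/2) * √n = (n : ℝ) ^ θ := by
    rw [Real.sqrt_eq_rpow, ← Real.rpow_add hn0]; congr 1; ring
  have e4 : √(n : ℝ) * √n = n := Real.mul_self_sqrt hn0.le
  have hp1 : p j ^ θ ≤ 1 := Real.rpow_le_one hp.le (P.p1' j) h0.le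
  have hs : 0 < √(n : ℝ) := Real.sqrt_pos.2 hn0
  have e5 : 2 * (n * p j) ^ θ / (n * p j) * √n = 2 * p j ^ θ / p j * (n : ℝ) ^ (θ - 1/2) := by
    rw [e2, ← e3]
    have : (n : ℝ) = √n * √n := e4.symm
    field_simp
    rw [Real.sq_sqrt hn0.le]
  rw [e5, e2]
  have hN : 0 < (n : ℝ) ^ (θ - 1/2) := Real.rpow_pos_of_pos hn0 _
  have : 2 * p j ^ θ / p j * (n : ℝ) ^ (θ - 1/2) * Eb (p j) n (fun k => |(k : ℝ) - n * p j| / √n)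
      ≤ 2 * 1 / p j * (n : ℝ) ^ (θ - 1/2) * (2 * Real.exp 1) := by
    gcongr
    exact Eb_nonneg hp.le (P.p1' j) n fun k _ => by positivity
  calc _ = p j ^ θ * (n : ℝ) ^ θ - 2 * 1 / p j * (n : ℝ) ^ (θ - 1/2) * (2 * Real.exp 1) := by ring
    _ ≤ _ := by linarith

/-- contraction lemma -/
theorem contraction {M A : ℕ} {p : Fin A → ℝ} {ρ : ℝ} (P : Par M A p ρ) {η : ℝ} (hη : ρ < η)
    {f a : ℕ → ℝ} (h0 : f 0 ≤ 0) (h1 : f 1 ≤ 0)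
    (hf : ∀ n ≥ 2, f n ≤ ∑ j, (M : ℝ) * Eb (p j) n f + a n)
    (ha : ∀ ε > 0, ∀ᶠ n : ℕ in atTop, a n ≤ ε * (n : ℝ) ^ η) :
    ∀ ε > 0, ∀ᶠ n : ℕ in atTop, f n ≤ ε * (n : ℝ) ^ η := by
  intro ε hε
  obtain ⟨x, hx1, hx2, hx3⟩ : ∃ x, ρ < x ∧ x ≤ η ∧ x ≤ 2 :=
    ⟨min η 2, lt_min hη P.r2, min_le_left _ _, min_le_right _ _⟩
  have r1 := P.r1
  set κ := ∑ j, (M : ℝ) * p j ^ x with hκ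
  have hκ1 : κ < 1 := P.rlt hx1
  set c : ℕ → ℝ := fun n => (n : ℝ) * ((n - 1 : ℕ) : ℝ) ^ (x - 1) * (n : ℝ) ^ (η - x) with hc
  set g : ℕ → ℝ := fun n => (n : ℝ) * ((n - 1 : ℕ) : ℝ) ^ (ρ - 1) with hg
  have hc0 : ∀ n, 0 ≤ c n := fun n => by simp only [hc]; positivity
  have hg0 : ∀ n, 0 ≤ g n := fun n => by simp only [hg]; positivity
  have hcE : ∀ n, ∑ j, (M : ℝ) * Eb (p j) n c ≤ κ * c n := by
    intro n
    rw [hκ, Finset.sum_mul]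
    apply Finset.sum_le_sum
    intro j _
    rw [mul_assoc]
    apply mul_le_mul_of_nonneg_left _ P.Mpos.le
    have := pot (P.p0' j) (P.p1' j) (show 0 ≤ x - 1 by linarith) (by linarith) n
    calc Eb (p j) n c ≤ Eb (p j) n (fun k => (n : ℝ) ^ (η - x) * ((k : ℝ) * ((k - 1 : ℕ) : ℝ) ^ (x-1))) := by
          apply Eb_mono (P.p0' j) (P.p1' j)
          intro k hk
          simp only [hc]
          rw [mul_comm]
          apply mul_le_mul_of_nonneg_right _ (by positivity)
          apply Real.rpow_le_rpow (by positivity) (by exact_mod_cast hk) (by linarith)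
      _ = (n : ℝ) ^ (η - x) * Eb (p j) n (fun k => ((k : ℝ) * ((k - 1 : ℕ) : ℝ) ^ (x-1))) := Eb_smul _ _ _ _
      _ ≤ (n : ℝ) ^ (η - x) * (p j ^ (1 + (x - 1)) * ((n : ℝ) * ((n - 1 : ℕ) : ℝ) ^ (x-1))) := by gcongr
      _ = _ := by rw [show 1 + (x - 1) = x by ring]; simp only [hc]; ring
  have hgE : ∀ n, ∑ j, (M : ℝ) * Eb (p j) n g ≤ g n := by
    intro n
    calc _ ≤ ∑ j, (M : ℝ) * p j ^ ρ * g n := by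
          apply Finset.sum_le_sum
          intro j _
          rw [mul_assoc]
          apply mul_le_mul_of_nonneg_left _ P.Mpos.le
          have := pot (P.p0' j) (P.p1' j) (show 0 ≤ ρ - 1 by linarith) (by linarith [P.r2]) n
          rwa [show 1 + (ρ - 1) = ρ by ring] at this
      _ = g n := by rw [← Finset.sum_mul, P.pi_sum, one_mul]
  have hcl : ∀ n : ℕ, 2 ≤ n → (n : ℝ) ^ η ≤ 2 * c n := by
    intro n hn
    have hn0 : (0 : ℝ) < n := by exact_mod_cast (by omega : 0 < n)
    have := pot_low (show 0 ≤ x - 1 by linarith) (by linarith) hn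
    rw [show 1 + (x - 1) = x by ring] at this
    calc (n : ℝ) ^ η = (n : ℝ) ^ x * (n : ℝ) ^ (η - x) := by rw [← Real.rpow_add hn0]; congr 1; ring
      _ ≤ 2 * ((n : ℝ) * ((n - 1 : ℕ) : ℝ) ^ (x - 1)) * (n : ℝ) ^ (η - x) := by gcongr
      _ = 2 * c n := by simp only [hc]; ring
  have hcu : ∀ n : ℕ, 2 ≤ n → c n ≤ (n : ℝ) ^ η := by
    intro n hn
    have hn0 : (0 : ℝ) < n := by exact_mod_cast (by omega : 0 < n)
    have := pot_up (show 0 ≤ x - 1 by linarith) n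
    rw [show 1 + (x - 1) = x by ring] at this
    calc c n ≤ (n : ℝ) ^ x * (n : ℝ) ^ (η - x) := by simp only [hc]; gcongr
      _ = (n : ℝ) ^ η := by rw [← Real.rpow_add hn0]; congr 1; ring
  -- choose N0
  have hε1 : 0 < ε * (1 - κ) / 4 := by have : 0 < 1 - κ := by linarith
                                       positivity
  obtain ⟨N0, hN0⟩ := eventually_atTop.1 (ha _ hε1)
  set N := max N0 2 with hN
  -- Λ bounding
  obtain ⟨Λ, hΛ0, hΛ⟩ : ∃ Λ : ℝ, 0 ≤ Λ ∧ ∀ n < N, f n ≤ Λ := by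
    refine ⟨∑ n ∈ range N, |f n|, Finset.sum_nonneg fun _ _ => abs_nonneg _, fun n hn => ?_⟩
    exact (le_abs_self _).trans (Finset.single_le_sum (f := fun n => |f n|) (fun _ _ => abs_nonneg _) (mem_range.2 hn))
  have key : ∀ n, f n ≤ ε / 2 * c n + Λ * g n := by
    apply comparison' (c := fun _ => (M : ℝ)) (a := a) (n0 := N) P.p0' P.p1' (fun _ => P.Mpos.le)
      (fun n hn => P.powlt (le_trans (le_max_right _ _) hn))
      (fun n hn => hf n (le_trans (le_max_right _ _) hn))
    · intro n hn
      have hn2 : 2 ≤ n := le_trans (le_max_right _ _) hn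
      have e1 : ∑ j, (M : ℝ) * Eb (p j) n (fun n => ε / 2 * c n + Λ * g n) =
          ε / 2 * ∑ j, (M : ℝ) * Eb (p j) n c + Λ * ∑ j, (M : ℝ) * Eb (p j) n g := by
        rw [Finset.mul_sum, Finset.mul_sum, ← Finset.sum_add_distrib]
        apply Finset.sum_congr rfl
        intro j _
        rw [Eb_add, Eb_smul, Eb_smul]; ring
      rw [e1]
      have h3 := hN0 n (le_trans (le_max_left _ _) hn)
      have h4 := mul_le_mul_of_nonneg_left (hcE n) (show 0 ≤ ε / 2 by positivity)
      have h5 := mul_le_mul_of_nonneg_left (hgE n) hΛ0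
      have h6 := mul_le_mul_of_nonneg_left (hcl n hn2) hε1.le
      nlinarith
    · intro n hn
      have hcg : 0 ≤ ε / 2 * c n + Λ * g n := by
        have := hc0 n; have := hg0 n; positivity
      rcases Nat.lt_or_ge n 2 with h | h
      · interval_cases n
        · linarith
        · linarith
      · have : 1 ≤ g n := by
          have h2 : (1 : ℝ) ≤ ((n - 1 : ℕ) : ℝ) := by exact_mod_cast (by omega : 1 ≤ n - 1)
          have h3 : (1 : ℝ) ≤ n := by exact_mod_cast (by omega : 1 ≤ n)
          have := Real.one_le_rpow h2 (show 0 ≤ ρ - 1 by linarith)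
          simp only [hg]; nlinarith
        have h5 := hΛ n hn
        have := mul_le_mul_of_nonneg_left this hΛ0
        have := hc0 n
        have : 0 ≤ ε / 2 * c n := by positivity
        linarith
  have hlim : Tendsto (fun n : ℕ => (n : ℝ) ^ (η - ρ)) atTop atTop :=
    (tendsto_rpow_atTop (by linarith)).comp tendsto_natCast_atTop_atTop
  filter_upwards [hlim.eventually_ge_atTop (2 * Λ / ε), eventually_ge_atTop 2] with n h3 hn
  have hn0 : (0 : ℝ) < n := by exact_mod_cast (by omega : 0 < n)
  have h4 := hcu n hn
  have h5 : g n ≤ (n : ℝ) ^ ρ := by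
    have := pot_up (show 0 ≤ ρ - 1 by linarith) n
    rwa [show 1 + (ρ - 1) = ρ by ring] at this
  have h6 : (n : ℝ) ^ η = (n : ℝ) ^ ρ * (n : ℝ) ^ (η - ρ) := by
    rw [← Real.rpow_add hn0]; congr 1; ring
  have h7 : Λ * (n : ℝ) ^ ρ ≤ ε / 2 * (n : ℝ) ^ η := by
    rw [h6]
    rw [div_le_iff₀ hε] at h3
    have : 0 < (n : ℝ) ^ ρ := by positivity
    nlinarith
  have := key n
  have := mul_le_mul_of_nonneg_left h4 (show 0 ≤ ε / 2 by positivity)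
  have := mul_le_mul_of_nonneg_left h5 hΛ0
  linarith
end Part6

section Part7
open Finset MeasureTheory Filter Topology

theorem lower {M A : ℕ} {p : Fin A → ℝ} {ρ : ℝ} (P : Par M A p ρ) {θ : ℝ} (h0 : 0 < θ) (h2 : θ < 2)
    {c : Fin A → ℝ} (hc : ∀ j, 0 ≤ c j) (hc1 : ∑ j, c j * p j ^ θ = 1)
    (hcs : ∀ n ≥ 2, ∑ j, c j * p j ^ n < 1) {f r : ℕ → ℝ} {n1 : ℕ}
    (hf0 : ∀ k < n1, 0 ≤ f k) (hpos : ∀ k ≥ n1, 0 < f k)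
    (hrec : ∀ n ≥ 2, n1 ≤ n → ∑ j, c j * Eb (p j) n f ≤ f n + r n)
    (hr : (∀ n, r n ≤ 0) ∨ (∃ δ > 0, (∀ k ≥ n1, δ ≤ f k) ∧
      ∀ ε > 0, ∀ᶠ n : ℕ in atTop, r n * (n : ℝ) ^ θ ≤ ε)) :
    ∃ c0 > 0, ∀ n ≥ n1, c0 * (n : ℝ) ^ θ ≤ f n := by
  set θ' := 3 / 4 * θ with hθ'
  have hθ'0 : 0 < θ' := by positivity
  have hθ'θ : θ' < θ := by rw [hθ']; linarith
  set S := ∑ j, c j * p j ^ θ' with hS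
  have hS1 : 1 < S := by
    rw [← hc1, hS]
    have hlt : ∀ j, p j ^ θ < p j ^ θ' := fun j =>
      Real.rpow_lt_rpow_of_exponent_gt (P.p0 j) (P.p1 j) hθ'θ
    apply Finset.sum_lt_sum
    · intro j _; exact mul_le_mul_of_nonneg_left (hlt j).le (hc j)
    · by_contra! hcon
      have : ∀ j, c j = 0 := by
        intro j
        have h := hcon j (mem_univ j)
        by_contra h'
        have : 0 < c j := lt_of_le_of_ne (hc j) (Ne.symm h')
        have := mul_lt_mul_of_pos_left (hlt j) this
        linarith
      simp [this] at hc1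
  set g := (S - 1) / 2 with hg
  have hg0 : 0 < g := by rw [hg]; linarith
  set C1 := ∑ j, c j * (4 * Real.exp 1 / p j) with hC1
  have hC10 : 0 ≤ C1 := Finset.sum_nonneg fun j _ => mul_nonneg (hc j) (by have := P.p0 j; positivity)
  -- key lower estimate
  have hE : ∀ t : ℝ, 0 < t → t ≤ 2 → ∀ n : ℕ, 1 ≤ n → (∀ j, (n1 : ℝ) ≤ n * p j / 2) →
      (∑ j, c j * p j ^ t) * (n : ℝ) ^ t - C1 * (n : ℝ) ^ (t - 1/2) ≤
      ∑ j, c j * Eb (p j) n (fun k => if n1 ≤ k then (k : ℝ) ^ t else 0) := by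
    intro t ht ht2 n hn hm
    rw [hC1, Finset.sum_mul, Finset.sum_mul, ← Finset.sum_sub_distrib]
    apply Finset.sum_le_sum
    intro j _
    have := mul_le_mul_of_nonneg_left (Eb_low P j ht ht2 hn (hm j)) (hc j)
    nlinarith
  have hlim : Tendsto (fun n : ℕ => (n : ℝ) ^ (-(1/2 - θ/4))) atTop (𝓝 0) :=
    (tendsto_rpow_neg_atTop (by linarith)).comp tendsto_natCast_atTop_atTop
  have ev1 : ∀ᶠ n : ℕ in atTop, 2 * C1 * (n : ℝ) ^ (-(1/2 - θ/4)) ≤ g := by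
    have h := hlim.const_mul (2 * C1)
    rw [mul_zero] at h
    exact h.eventually (ge_mem_nhds hg0) |>.mono fun n hn => hn
  have ev2 : ∀ᶠ n : ℕ in atTop, ∀ j, (n1 : ℝ) ≤ n * p j / 2 := by
    rw [Filter.eventually_all]
    intro j
    have : Tendsto (fun n : ℕ => (n : ℝ) * (p j / 2)) atTop atTop :=
      tendsto_natCast_atTop_atTop.atTop_mul_const (by have := P.p0 j; positivity)
    filter_upwards [this.eventually_ge_atTop (n1 : ℝ)] with n hn
    linarith
  have ev3 : ∀ᶠ N : ℕ in atTop, ∃ c0 > 0, (∀ k ≥ n1, k < N → c0 * 2 * (k : ℝ) ^ θ ≤ f k) ∧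
      ∀ n ≥ N, r n ≤ c0 * g * (n : ℝ) ^ θ' := by
    rcases hr with hr | ⟨δ, hδ, hδf, hr⟩
    · refine Eventually.of_forall fun N => ?_
      have : ∃ c0 > 0, (∀ k ≥ n1, k < N → c0 * 2 * (k : ℝ) ^ θ ≤ f k) := by
        induction N with
        | zero => exact ⟨1, one_pos, fun k _ h => by omega⟩
        | succ N ih =>
          obtain ⟨c0, hc0, ih⟩ := ih
          by_cases hN : n1 ≤ N
          · refine ⟨min c0 (f N / (2 * (N : ℝ) ^ θ + 1)), lt_min hc0 (div_pos (hpos N hN) (by positivity)), ?_⟩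
            intro k hk hkN
            rcases Nat.lt_succ_iff_lt_or_eq.1 hkN with h | h
            · refine le_trans ?_ (ih k hk h)
              gcongr
              exact min_le_left _ _
            · subst h
              calc _ ≤ f k / (2 * (k : ℝ) ^ θ + 1) * 2 * (k : ℝ) ^ θ := by gcongr; exact min_le_right _ _
                _ = f k * ((2 * (k : ℝ) ^ θ) / (2 * (k : ℝ) ^ θ + 1)) := by ring
                _ ≤ f k * 1 := by
                  have := hpos k hk
                  gcongr
                  rw [div_le_one (by positivity)]; linarith
                _ = f k := mul_one _
          · refine ⟨c0, hc0, fun k hk hkN => ih k hk (by omega)⟩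
      obtain ⟨c0, hc0, h⟩ := this
      exact ⟨c0, hc0, h, fun n _ => (hr n).trans (by positivity)⟩
    · obtain ⟨N0, hN0⟩ := eventually_atTop.1 (hr (δ * g / 2) (by positivity))
      filter_upwards [eventually_ge_atTop N0, eventually_ge_atTop 1] with N hN hN1
      have hNp : (0 : ℝ) < N := by exact_mod_cast hN1
      refine ⟨δ / (2 * (N : ℝ) ^ θ), by positivity, fun k hk hkN => ?_, fun n hn => ?_⟩
      · refine le_trans ?_ (hδf k hk)
        have : (k : ℝ) ^ θ ≤ (N : ℝ) ^ θ := by gcongr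
        calc _ = δ * ((k : ℝ) ^ θ / (N : ℝ) ^ θ) := by ring
          _ ≤ δ * 1 := by gcongr; rw [div_le_one (by positivity)]; exact this
          _ = δ := mul_one _
      · have h := hN0 n (hN.trans hn)
        have hnp : (0 : ℝ) < n := by exact_mod_cast (by omega : 0 < n)
        have hn1 : (1 : ℝ) ≤ n := by exact_mod_cast (by omega : 1 ≤ n)
        have h' : r n ≤ δ * g / 2 / (n : ℝ) ^ θ := by rw [le_div_iff₀ (by positivity)]; exact h
        refine h'.trans ?_
        have : (N : ℝ) ^ θ ≤ (n : ℝ) ^ θ := by gcongr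
        calc δ * g / 2 / (n : ℝ) ^ θ ≤ δ * g / 2 / (N : ℝ) ^ θ := by gcongr
          _ = δ / (2 * (N : ℝ) ^ θ) * g * 1 := by ring
          _ ≤ _ := by gcongr; exact Real.one_le_rpow hn1 hθ'0.le
  obtain ⟨N1, hN1⟩ := eventually_atTop.1 (ev1.and ev2)
  obtain ⟨N2, hN2⟩ := eventually_atTop.1 ev3
  set N := max (max N1 N2) (max 2 n1) with hN
  obtain ⟨c0, hc0, hca, hcb⟩ := hN2 N (by omega)
  set b : ℕ → ℝ := fun k => c0 * ((if n1 ≤ k then (k : ℝ) ^ θ else 0) + (if n1 ≤ k then (k : ℝ) ^ θ' else 0)) with hb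
  have key : ∀ n, -f n ≤ -b n := by
    apply comparison' (c := c) (a := r) (n0 := N) P.p0' P.p1' hc (fun n hn => hcs n (by omega))
    · intro n hn
      have := hrec n (by omega) (by omega)
      have e : ∑ j, c j * Eb (p j) n (fun k => - f k) = - ∑ j, c j * Eb (p j) n f := by
        rw [← Finset.sum_neg_distrib]; exact Finset.sum_congr rfl fun j _ => by rw [Eb_neg]; ring
      rw [e]; linarith
    · intro n hn
      have hn1 : 1 ≤ n := by omega
      have hnp : (0 : ℝ) < n := by exact_mod_cast hn1
      have hnr : (1 : ℝ) ≤ n := by exact_mod_cast hn1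
      have e : ∑ j, c j * Eb (p j) n (fun k => - b k) =
          - (c0 * (∑ j, c j * Eb (p j) n (fun k => if n1 ≤ k then (k : ℝ) ^ θ else 0) +
            ∑ j, c j * Eb (p j) n (fun k => if n1 ≤ k then (k : ℝ) ^ θ' else 0))) := by
        rw [← Finset.sum_add_distrib, Finset.mul_sum, ← Finset.sum_neg_distrib]
        exact Finset.sum_congr rfl fun j _ => by rw [Eb_neg, hb, Eb_smul, Eb_add]; ring
      rw [e]
      obtain ⟨hv1, hv2⟩ := hN1 n (by omega)
      have k1 := hE θ h0 h2.le n hn1 hv2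
      have k2 := hE θ' hθ'0 (by linarith) n hn1 hv2
      rw [hc1, one_mul] at k1
      rw [← hS] at k2
      have k3 : (n : ℝ) ^ (θ' - 1/2) ≤ (n : ℝ) ^ (θ - 1/2) :=
        Real.rpow_le_rpow_of_exponent_le hnr (by linarith)
      have k4 : (n : ℝ) ^ (θ - 1/2) = (n : ℝ) ^ (-(1/2 - θ/4)) * (n : ℝ) ^ θ' := by
        rw [← Real.rpow_add hnp]; congr 1; rw [hθ']; ring
      have k5 := hcb n hn
      have hq : 0 < (n : ℝ) ^ θ' := by positivity
      have k6 : 2 * C1 * (n : ℝ) ^ (θ - 1/2) ≤ g * (n : ℝ) ^ θ' := by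
        rw [k4, ← mul_assoc]; gcongr
      have k7 : C1 * (n : ℝ) ^ (θ' - 1/2) ≤ C1 * (n : ℝ) ^ (θ - 1/2) := by gcongr
      have hSg : S = 1 + 2 * g := by rw [hg]; ring
      rw [hSg] at k2
      simp only [hb, if_pos (show n1 ≤ n by omega)]
      have := mul_le_mul_of_nonneg_left (show (n : ℝ) ^ θ + (n : ℝ) ^ θ' + g * (n : ℝ) ^ θ' ≤
        (∑ j, c j * Eb (p j) n (fun k => if n1 ≤ k then (k : ℝ) ^ θ else 0) +
            ∑ j, c j * Eb (p j) n (fun k => if n1 ≤ k then (k : ℝ) ^ θ' else 0)) by linarith) hc0.le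
      linarith
    · intro n hn
      by_cases h : n1 ≤ n
      · have := hca n h hn
        simp only [hb, if_pos h]
        rcases Nat.eq_zero_or_pos n with h' | h'
        · subst h'
          have := (hpos 0 h).le
          simp only [Nat.cast_zero, Real.zero_rpow h0.ne', Real.zero_rpow hθ'0.ne']; linarith
        · have hnr : (1 : ℝ) ≤ n := by exact_mod_cast h'
          have k3 : (n : ℝ) ^ θ' ≤ (n : ℝ) ^ θ := Real.rpow_le_rpow_of_exponent_le hnr hθ'θ.le
          nlinarith
      · have := hf0 n (by omega)
        simp only [hb, if_neg h]; linarith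
  refine ⟨c0, hc0, fun n hn => ?_⟩
  have h := key n
  simp only [hb, if_pos hn] at h
  have : 0 ≤ c0 * (n : ℝ) ^ θ' := by positivity
  linarith

theorem AsyQ.eval {A : ℕ} {p : Fin A → ℝ} {d θ : ℝ} (hd : 0 < d) {f : ℕ → ℝ} {Q : ℝ → ℝ}
    (h : AsyQ p d θ f Q) (s : ℝ) :
    ∃ u : ℕ → ℕ, Tendsto u atTop atTop ∧ Tendsto (fun m => f (u m) / (u m : ℝ) ^ θ) atTop (𝓝 (Q s)) := by
  have hper : ∀ (m : ℕ) x, Q (x - m * d) = Q x := by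
    intro m
    induction m with
    | zero => intro x; simp
    | succ m ih => intro x; rw [← h.per]; rw [← ih x]; congr 1; push_cast; ring
  have hexp : Tendsto (fun m : ℕ => Real.exp (s + m * d)) atTop atTop :=
    Real.tendsto_exp_atTop.comp (tendsto_atTop_add_const_left _ _
      (tendsto_natCast_atTop_atTop.atTop_mul_const hd))
  have hu : Tendsto (fun m : ℕ => ⌊Real.exp (s + m * d)⌋₊) atTop atTop :=
    tendsto_nat_floor_atTop.comp hexp
  refine ⟨fun m => ⌊Real.exp (s + m * d)⌋₊, hu, ?_⟩
  have h1 := h.lim.comp hu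
  have h2 : Tendsto (fun m : ℕ => Real.log ((⌊Real.exp (s + m * d)⌋₊ : ℕ) : ℝ) - m * d) atTop (𝓝 s) := by
    have h3 : Tendsto (fun m : ℕ => ((⌊Real.exp (s + m * d)⌋₊ : ℕ) : ℝ) / Real.exp (s + m * d)) atTop (𝓝 1) :=
      tendsto_nat_floor_div_atTop.comp hexp
    have h4 := ((Real.continuousAt_log one_ne_zero).tendsto.comp h3).add_const s
    rw [Real.log_one, zero_add] at h4
    refine h4.congr' ?_
    filter_upwards [hu.eventually_ge_atTop 1] with m hm
    have : (0 : ℝ) < ((⌊Real.exp (s + m * d)⌋₊ : ℕ) : ℝ) := by exact_mod_cast hm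
    simp only [Function.comp]
    rw [Real.log_div this.ne' (Real.exp_pos _).ne', Real.log_exp]; ring
  have h3 : Tendsto (fun m : ℕ => Q (Real.log ((⌊Real.exp (s + m * d)⌋₊ : ℕ) : ℝ))) atTop (𝓝 (Q s)) := by
    refine ((h.cont.tendsto s).comp h2).congr fun m => ?_
    exact hper m _
  have := h1.add h3
  rw [zero_add] at this
  refine this.congr fun m => ?_
  simp

theorem AsyQ.pos {A : ℕ} {p : Fin A → ℝ} {d θ : ℝ} (hd : 0 < d) {f : ℕ → ℝ} {Q : ℝ → ℝ}
    (h : AsyQ p d θ f Q) {c0 : ℝ} (hc0 : 0 < c0) (hf : ∀ᶠ n : ℕ in atTop, c0 * (n : ℝ) ^ θ ≤ f n) (s : ℝ) :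
    0 < Q s := by
  obtain ⟨u, hu, hl⟩ := h.eval hd s
  refine lt_of_lt_of_le hc0 (ge_of_tendsto hl ?_)
  filter_upwards [hu.eventually hf, hu.eventually_ge_atTop 1] with m hm h1
  have : (0 : ℝ) < (u m : ℝ) := by exact_mod_cast h1
  rw [le_div_iff₀ (by positivity)]; exact hm

theorem AsyQ.bddQ {A : ℕ} {p : Fin A → ℝ} {d θ : ℝ} (hd : 0 < d) {f g : ℕ → ℝ} {Q R : ℝ → ℝ}
    (h : AsyQ p d θ f Q) (h' : AsyQ p d θ g R) {ε : ℝ}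
    (hf : ∀ᶠ n : ℕ in atTop, |f n - g n| ≤ ε * (n : ℝ) ^ θ) (s : ℝ) : |Q s - R s| ≤ ε := by
  have hsub : AsyQ p d θ (fun n => f n - g n) (fun s => Q s - R s) :=
    ⟨h.cont.sub h'.cont, fun s => by rw [h.per, h'.per], fun j s => by rw [h.pery, h'.pery], by
      have := h.lim.sub h'.lim
      rw [sub_zero] at this
      exact this.congr fun n => by ring⟩
  obtain ⟨u, hu, hl⟩ := hsub.eval hd s
  refine le_of_tendsto hl.abs ?_
  filter_upwards [hu.eventually hf, hu.eventually_ge_atTop 1] with m hm h1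
  have : (0 : ℝ) < (u m : ℝ) := by exact_mod_cast h1
  rw [abs_div, abs_of_pos (show (0 : ℝ) < (u m : ℝ) ^ θ by positivity), div_le_iff₀ (by positivity)]; exact hm

theorem AsyQ_limit {A : ℕ} {p : Fin A → ℝ} {d θ : ℝ} (hd : 0 < d) {f : ℕ → ℝ}
    (h : ∀ ε > 0, ∃ g R, AsyQ p d θ g R ∧ ∀ᶠ n : ℕ in atTop, |f n - g n| ≤ ε * (n : ℝ) ^ θ) :
    ∃ Q, AsyQ p d θ f Q := by
  have hk : ∀ k : ℕ, (0 : ℝ) < 1 / ((k : ℝ) + 1) := fun k => by positivity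
  choose g R hR hg using fun k : ℕ => h (1 / ((k : ℝ) + 1)) (hk k)
  have hcau : ∀ k l s, |R k s - R l s| ≤ 1 / ((k : ℝ) + 1) + 1 / ((l : ℝ) + 1) := by
    intro k l s
    refine (hR k).bddQ hd (hR l) ?_ s
    filter_upwards [hg k, hg l] with n h1 h2
    calc |g k n - g l n| = |(f n - g l n) - (f n - g k n)| := by congr 1; ring
      _ ≤ |f n - g l n| + |f n - g k n| := abs_sub _ _
      _ ≤ _ := by linarith
  have h0 : Tendsto (fun k : ℕ => 1 / ((k : ℝ) + 1)) atTop (𝓝 0) := tendsto_one_div_add_atTop_nhds_zero_nat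
  have hc : ∀ s, ∃ q, Tendsto (fun k => R k s) atTop (𝓝 q) := by
    intro s
    apply cauchySeq_tendsto_of_complete
    apply cauchySeq_of_le_tendsto_0 (fun k : ℕ => 2 * (1 / ((k : ℝ) + 1)))
    · intro n m N hn hm
      rw [Real.dist_eq]
      refine (hcau n m s).trans ?_
      have : 1 / ((n : ℝ) + 1) ≤ 1 / ((N : ℝ) + 1) := by gcongr
      have : 1 / ((m : ℝ) + 1) ≤ 1 / ((N : ℝ) + 1) := by gcongr
      linarith
    · simpa using h0.const_mul 2
  choose Q hQ using hc
  have hb : ∀ k s, |R k s - Q s| ≤ 1 / ((k : ℝ) + 1) := by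
    intro k s
    have h1 : Tendsto (fun l => |R k s - R l s|) atTop (𝓝 |R k s - Q s|) := ((hQ s).const_sub _).abs
    have h2 : Tendsto (fun l : ℕ => 1 / ((k : ℝ) + 1) + 1 / ((l : ℝ) + 1)) atTop (𝓝 (1 / ((k : ℝ) + 1) + 0)) :=
      h0.const_add _
    rw [add_zero] at h2
    exact le_of_tendsto_of_tendsto' h1 h2 fun l => hcau k l s
  refine ⟨Q, ?_, fun s => ?_, fun j s => ?_, ?_⟩
  · have : TendstoUniformly R Q atTop := by
      rw [Metric.tendstoUniformly_iff]
      intro ε hε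
      filter_upwards [h0.eventually (gt_mem_nhds hε)] with k hk s
      rw [dist_comm, Real.dist_eq]
      exact (hb k s).trans_lt hk
    exact this.continuous (Frequently.of_forall fun k => (hR k).cont)
  · exact tendsto_nhds_unique (hQ (s + d)) ((hQ s).congr fun k => ((hR k).per s).symm)
  · exact tendsto_nhds_unique (hQ _) ((hQ s).congr fun k => ((hR k).pery j s).symm)
  · rw [Metric.tendsto_atTop']
    intro ε hε
    obtain ⟨k, hk⟩ := (h0.eventually (gt_mem_nhds (show 0 < ε / 3 by positivity))).exists
    have h3 := (hR k).lim.eventually (Metric.ball_mem_nhds 0 (show 0 < ε / 3 by positivity))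
    obtain ⟨N, hN⟩ := eventually_atTop.1 (h3.and ((hg k).and (eventually_ge_atTop 1)))
    refine ⟨N, fun n hn => ?_⟩
    obtain ⟨a1, a2, a3⟩ := hN n hn.le
    rw [Real.dist_eq, sub_zero] at a1
    rw [Real.dist_eq, sub_zero]
    have a4 := hb k (Real.log n)
    have hnp : (0 : ℝ) < n := by exact_mod_cast a3
    have hp : (0 : ℝ) < (n : ℝ) ^ θ := by positivity
    have a5 : |f n / (n : ℝ) ^ θ - g k n / (n : ℝ) ^ θ| ≤ 1 / ((k : ℝ) + 1) := by
      rw [← sub_div, abs_div, abs_of_pos hp, div_le_iff₀ hp]; exact a2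
    calc |f n / (n : ℝ) ^ θ - Q (Real.log n)| = |(f n / (n : ℝ) ^ θ - g k n / (n : ℝ) ^ θ) +
          (g k n / (n : ℝ) ^ θ - R k (Real.log n)) + (R k (Real.log n) - Q (Real.log n))| := by congr 1; ring
      _ ≤ |f n / (n : ℝ) ^ θ - g k n / (n : ℝ) ^ θ| + |g k n / (n : ℝ) ^ θ - R k (Real.log n)|
          + |R k (Real.log n) - Q (Real.log n)| := abs_add_three _ _ _
      _ < ε := by linarith
end Part7

section Part8
open Finset MeasureTheory Filter Topology

theorem tailB {M A : ℕ} {p : Fin A → ℝ} {ρ : ℝ} (P : Par M A p ρ) {τ : ℕ → ℝ} {C ε : ℝ}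
    (hC : 0 ≤ C) (hε : 0 < ε) (hτ : ∀ n ≥ 2, |τ n| ≤ C * (n : ℝ) ^ (ρ - ε)) {ε' : ℝ} (hε' : 0 < ε') :
    ∃ K ≥ 2, ∀ g : ℕ → ℝ, (∀ n < K, g n = 0) → (∀ n ≥ K, g n = ∑ j, (M : ℝ) * Eb (p j) n g + τ n) →
      ∀ n, |g n| ≤ ε' * (n : ℝ) ^ ρ := by
  have r1 := P.r1
  have r2 := P.r2
  set δ := min ε (1/2) with hδ
  have hδ0 : 0 < δ := lt_min hε (by norm_num)
  have hδ1 : δ ≤ 1/2 := min_le_right _ _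
  have hδε : δ ≤ ε := min_le_left _ _
  set θ := ρ - δ with hθ
  set S := ∑ j, (M : ℝ) * p j ^ θ with hS
  have hS1 : 1 < S := P.rgt (by linarith)
  set g0 := (S - 1) / 2 with hg0
  have hg00 : 0 < g0 := by rw [hg0]; linarith
  have hSg : S = 1 + 2 * g0 := by rw [hg0]; ring
  set C1 := ∑ j, (M : ℝ) * (4 * Real.exp 1 / p j) with hC1
  set Λ := C / g0 with hΛ
  have hΛ0 : 0 ≤ Λ := by positivity
  set X : ℕ → ℝ := fun n => (n : ℝ) * ((n - 1 : ℕ) : ℝ) ^ (ρ - 1) with hX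
  have hX0 : ∀ n, 0 ≤ X n := fun n => by simp only [hX]; positivity
  have hXu : ∀ n, X n ≤ (n : ℝ) ^ ρ := by
    intro n
    have := pot_up (show 0 ≤ ρ - 1 by linarith) n
    rwa [show 1 + (ρ - 1) = ρ by ring] at this
  have hXl : ∀ n : ℕ, 2 ≤ n → (n : ℝ) ^ ρ ≤ 2 * X n := by
    intro n hn
    have := pot_low (show 0 ≤ ρ - 1 by linarith) (by linarith) hn
    rwa [show 1 + (ρ - 1) = ρ by ring] at this
  have hXE : ∀ n, ∑ j, (M : ℝ) * Eb (p j) n X ≤ X n := by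
    intro n
    calc _ ≤ ∑ j, (M : ℝ) * p j ^ ρ * X n := by
          apply Finset.sum_le_sum
          intro j _
          rw [mul_assoc]
          apply mul_le_mul_of_nonneg_left _ P.Mpos.le
          have := pot (P.p0' j) (P.p1' j) (show 0 ≤ ρ - 1 by linarith) (by linarith) n
          rwa [show 1 + (ρ - 1) = ρ by ring] at this
      _ = X n := by rw [← Finset.sum_mul, P.pi_sum, one_mul]
  -- choose m
  have hlim : Tendsto (fun n : ℕ => (n : ℝ) ^ (-δ)) atTop (𝓝 0) :=
    (tendsto_rpow_neg_atTop hδ0).comp tendsto_natCast_atTop_atTop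
  obtain ⟨m, hm2, hm⟩ : ∃ m : ℕ, 2 ≤ m ∧ 2 * Λ * (m : ℝ) ^ (-δ) ≤ ε' := by
    have h := hlim.const_mul (2 * Λ)
    rw [mul_zero] at h
    obtain ⟨m, h1, h2⟩ := ((h.eventually (ge_mem_nhds hε')).and (eventually_ge_atTop 2)).exists
    exact ⟨m, h2, h1⟩
  have hlim2 : Tendsto (fun n : ℕ => (n : ℝ) ^ (-(1/2 : ℝ))) atTop (𝓝 0) :=
    (tendsto_rpow_neg_atTop (by norm_num)).comp tendsto_natCast_atTop_atTop
  have ev1 : ∀ᶠ n : ℕ in atTop, C1 * (n : ℝ) ^ (-(1/2 : ℝ)) ≤ g0 := by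
    have h := hlim2.const_mul C1
    rw [mul_zero] at h
    exact h.eventually (ge_mem_nhds hg00)
  have ev2 : ∀ᶠ n : ℕ in atTop, ∀ j, (m : ℝ) ≤ n * p j / 2 := by
    rw [Filter.eventually_all]
    intro j
    have : Tendsto (fun n : ℕ => (n : ℝ) * (p j / 2)) atTop atTop :=
      tendsto_natCast_atTop_atTop.atTop_mul_const (by have := P.p0 j; positivity)
    filter_upwards [this.eventually_ge_atTop (m : ℝ)] with n hn
    linarith
  obtain ⟨K0, hK0⟩ := eventually_atTop.1 (ev1.and ev2)
  refine ⟨max K0 (max 2 m), by omega, fun g hgz hgr => ?_⟩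
  set K := max K0 (max 2 m) with hK
  set h : ℕ → ℝ := fun k => if m ≤ k then (k : ℝ) ^ θ else 0 with hh
  set b : ℕ → ℝ := fun n => Λ * (2 * (m : ℝ) ^ (-δ) * X n - h n) with hb
  have hmp : (0 : ℝ) < m := by exact_mod_cast (by omega : 0 < m)
  have hb0 : ∀ n, 0 ≤ b n := by
    intro n
    simp only [hb, hh]
    split_ifs with hmn
    · apply mul_nonneg hΛ0
      have hnp : (0 : ℝ) < n := by exact_mod_cast (by omega : 0 < n)
      have e : (n : ℝ) ^ θ = (n : ℝ) ^ (-δ) * (n : ℝ) ^ ρ := by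
        rw [← Real.rpow_add hnp]; congr 1; rw [hθ]; ring
      have h1 : (n : ℝ) ^ (-δ) ≤ (m : ℝ) ^ (-δ) :=
        Real.rpow_le_rpow_of_nonpos hmp (by exact_mod_cast hmn) (by linarith)
      have h2 := hXl n (by omega)
      have : (n : ℝ) ^ (-δ) * (n : ℝ) ^ ρ ≤ (m : ℝ) ^ (-δ) * (2 * X n) := by gcongr
      rw [e]; linarith
    · have := hX0 n
      rw [sub_zero]
      positivity
  have hbu : ∀ n, b n ≤ ε' * (n : ℝ) ^ ρ := by
    intro n
    have hhn : 0 ≤ h n := by simp only [hh]; split_ifs <;> positivity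
    have h1 : b n ≤ Λ * (2 * (m : ℝ) ^ (-δ) * X n) := by
      simp only [hb]; gcongr; linarith
    calc b n ≤ _ := h1
      _ = (2 * Λ * (m : ℝ) ^ (-δ)) * X n := by ring
      _ ≤ ε' * (n : ℝ) ^ ρ := by
        have := hX0 n; have := hXu n; gcongr
  have hsup : ∀ n ≥ K, ∑ j, (M : ℝ) * Eb (p j) n b + |τ n| ≤ b n := by
    intro n hn
    have hn1 : 1 ≤ n := by omega
    have hnp : (0 : ℝ) < n := by exact_mod_cast hn1
    have hnr : (1 : ℝ) ≤ n := by exact_mod_cast hn1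
    obtain ⟨hv1, hv2⟩ := hK0 n (by omega)
    have e1 : ∑ j, (M : ℝ) * Eb (p j) n b =
        Λ * (2 * (m : ℝ) ^ (-δ) * ∑ j, (M : ℝ) * Eb (p j) n X - ∑ j, (M : ℝ) * Eb (p j) n h) := by
      rw [Finset.mul_sum, ← Finset.sum_sub_distrib, Finset.mul_sum]
      apply Finset.sum_congr rfl
      intro j _
      rw [hb, Eb_smul, Eb_sub, Eb_smul]; ring
    have h1 : S * (n : ℝ) ^ θ - C1 * (n : ℝ) ^ (θ - 1/2) ≤ ∑ j, (M : ℝ) * Eb (p j) n h := by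
      rw [hS, hC1, Finset.sum_mul, Finset.sum_mul, ← Finset.sum_sub_distrib]
      apply Finset.sum_le_sum
      intro j _
      have := mul_le_mul_of_nonneg_left (Eb_low P j (show 0 < θ by linarith) (by linarith) hn1 (hv2 j)) P.Mpos.le
      nlinarith
    have h2 : C1 * (n : ℝ) ^ (θ - 1/2) ≤ g0 * (n : ℝ) ^ θ := by
      have : (n : ℝ) ^ (θ - 1/2) = (n : ℝ) ^ (-(1/2 : ℝ)) * (n : ℝ) ^ θ := by
        rw [← Real.rpow_add hnp]; congr 1; ring
      rw [this, ← mul_assoc]; gcongr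
    have h3 : |τ n| ≤ Λ * (g0 * (n : ℝ) ^ θ) := by
      have : Λ * (g0 * (n : ℝ) ^ θ) = C * (n : ℝ) ^ θ := by rw [hΛ]; field_simp
      rw [this]
      refine (hτ n (by omega)).trans ?_
      gcongr
      linarith
    have h4 := hXE n
    have hhn : h n = (n : ℝ) ^ θ := by simp only [hh]; rw [if_pos (by omega)]
    have h5 : Λ * (2 * (m : ℝ) ^ (-δ) * ∑ j, (M : ℝ) * Eb (p j) n X - ∑ j, (M : ℝ) * Eb (p j) n h) ≤
        Λ * (2 * (m : ℝ) ^ (-δ) * X n - ((n : ℝ) ^ θ + g0 * (n : ℝ) ^ θ)) := by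
      gcongr
      rw [hSg] at h1
      linarith
    rw [e1]
    simp only [hb, hhn]
    linarith
  have c1 : ∀ n, |g n| ≤ b n := by
    apply comparison' (c := fun _ => (M : ℝ)) (a := fun n => |τ n|) (n0 := K) P.p0' P.p1' (fun _ => P.Mpos.le)
      (fun n hn => P.powlt (by omega)) _ hsup
    · intro n hn; rw [hgz n hn, abs_zero]; exact hb0 n
    · intro n hn
      rw [hgr n hn]
      refine (abs_add_le _ _).trans ?_
      gcongr
      refine (Finset.abs_sum_le_sum_abs _ _).trans ?_
      apply Finset.sum_le_sum
      intro j _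
      rw [abs_mul, abs_of_pos P.Mpos]
      exact mul_le_mul_of_nonneg_left (Eb_abs_le (P.p0' j) (P.p1' j) n g) P.Mpos.le
  intro n
  exact (c1 n).trans (hbu n)

theorem thmA' {M A : ℕ} {p : Fin A → ℝ} {ρ d : ℝ} (P : Par M A p ρ) (hd : RenProp M p ρ d)
    {τ f : ℕ → ℝ} {C ε : ℝ} (hC : 0 ≤ C) (hε : 0 < ε) (f0 : f 0 = 0) (f1 : f 1 = 0)
    (hf : ∀ n ≥ 2, f n = ∑ j, (M : ℝ) * Eb (p j) n f + τ n)
    (hτ : ∀ n ≥ 2, |τ n| ≤ C * (n : ℝ) ^ (ρ - ε)) : ∃ Q, AsyQ p d ρ f Q := by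
  have r1 := P.r1
  have r2 := P.r2
  apply AsyQ_limit hd.1
  intro ε' hε'
  obtain ⟨K, hK2, hK⟩ := tailB P hC hε hτ hε'
  obtain ⟨g, hgz, hgr⟩ := exists_sol (p := p) (c := fun _ => (M : ℝ)) (n0 := K)
    (fun n hn => P.powlt (by omega)) τ
  have hg := hK g hgz hgr
  set F : ℕ → ℝ := fun n => f n - g n with hF
  have hFr : ∀ n ≥ K, F n = ∑ j, (M : ℝ) * Eb (p j) n F := by
    intro n hn
    simp only [hF]
    rw [hf n (by omega), hgr n hn]
    simp only [Eb_sub, mul_sub, Finset.sum_sub_distrib]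
    ring
  set D : ℕ → ℝ := fun n => F (n + 1) - F n with hD
  have hDr : ∀ n ≥ K, D n = ∑ j, (M : ℝ) * p j * Eb (p j) n D := by
    intro n hn
    simp only [hD]
    rw [hFr n hn, hFr (n + 1) (by omega), ← Finset.sum_sub_distrib]
    apply Finset.sum_congr rfl
    intro j _
    rw [← mul_sub, Eb_diff, mul_assoc]
  have hF0 : F 0 = 0 := by simp only [hF]; rw [f0, hgz 0 (by omega)]; ring
  have hF1 : F 1 = 0 := by simp only [hF]; rw [f1, hgz 1 (by omega)]; ring
  have hD0 : D 0 = 0 := by simp only [hD, zero_add, hF0, hF1]; ring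
  set C' := ∑ n ∈ range K, |D n| with hC'
  have hC'0 : 0 ≤ C' := Finset.sum_nonneg fun _ _ => abs_nonneg _
  have hDb : ∀ n, |D n| ≤ C' * (n : ℝ) ^ (ρ - 1) := by
    apply comparison' (c := fun j => (M : ℝ) * p j) (a := fun n => 0) (n0 := K)
      (f := fun n => |D n|) (b := fun n : ℕ => C' * (n : ℝ) ^ (ρ - 1)) P.p0' P.p1'
      (fun j => mul_nonneg P.Mpos.le (P.p0' j))
    · intro n hn
      have := P.powlt (n := n + 1) (by omega)
      refine lt_of_eq_of_lt (Finset.sum_congr rfl fun j _ => ?_) this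
      rw [pow_succ]; ring
    · intro n hn
      rw [add_zero, hDr n hn]
      refine (Finset.abs_sum_le_sum_abs _ _).trans ?_
      apply Finset.sum_le_sum
      intro j _
      have : 0 ≤ (M : ℝ) * p j := mul_nonneg P.Mpos.le (P.p0' j)
      rw [abs_mul, abs_of_nonneg this]
      exact mul_le_mul_of_nonneg_left (Eb_abs_le (P.p0' j) (P.p1' j) n D) this
    · intro n hn
      rw [add_zero]
      calc _ ≤ ∑ j, (M : ℝ) * p j ^ ρ * (C' * (n : ℝ) ^ (ρ - 1)) := by
            apply Finset.sum_le_sum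
            intro j _
            rw [Eb_smul]
            have h1 := Eb_rpow_le (P.p0' j) (P.p1' j) n (show 0 ≤ ρ - 1 by linarith) (by linarith)
            have e : p j ^ ρ = p j * p j ^ (ρ - 1) := by
              rw [← Real.rpow_one_add' (P.p0' j) (by linarith)]; congr 1; ring
            have := mul_le_mul_of_nonneg_left h1 (show 0 ≤ (M : ℝ) * p j * C' from
              mul_nonneg (mul_nonneg P.Mpos.le (P.p0' j)) hC'0)
            rw [e]
            linarith
        _ = _ := by rw [← Finset.sum_mul, P.pi_sum, one_mul]
    · intro n hn
      rcases Nat.eq_zero_or_pos n with h | h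
      · subst h; rw [hD0, abs_zero]; positivity
      · have hnr : (1 : ℝ) ≤ n := by exact_mod_cast h
        have h1 := Real.one_le_rpow hnr (show 0 ≤ ρ - 1 by linarith)
        have h2 : |D n| ≤ C' := Finset.single_le_sum (f := fun n => |D n|) (fun _ _ => abs_nonneg _) (mem_range.2 hn)
        nlinarith
  have hFb : ∀ n, |F n| ≤ C' * (n : ℝ) ^ ρ := by
    intro n
    have h1 : |F n - F 0| ≤ C' * (n : ℝ) ^ (ρ - 1) * |(n : ℝ) - (0 : ℕ)| := by
      apply disc_lip
      intro i _ hi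
      rw [Nat.max_zero] at hi
      refine (hDb i).trans ?_
      gcongr
    rw [hF0, sub_zero, Nat.cast_zero, sub_zero, abs_of_nonneg (show (0 : ℝ) ≤ n by positivity)] at h1
    have e : (n : ℝ) ^ ρ = (n : ℝ) ^ (ρ - 1) * n := by
      rw [← Real.rpow_add_one' (by positivity) (by linarith)]; congr 1; ring
    rw [e]; linarith
  have hmon : ∀ (k : ℕ) {η : ℝ}, 0 ≤ η → (k : ℝ) ^ η ≤ ((k : ℝ) + 1) ^ η := fun k η h =>
    Real.rpow_le_rpow (by positivity) (by linarith) h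
  obtain ⟨Q, hQ⟩ := thmA P hd (θ := ρ) (C := C') (ε := 1) (n0 := K) (c := fun _ => (M : ℝ)) (f := F)
    (by linarith) (by linarith) (fun j => rfl) hC'0 one_pos
    (fun k => (hFb k).trans (mul_le_mul_of_nonneg_left (hmon k (by linarith)) hC'0))
    (fun k => (hDb k).trans (mul_le_mul_of_nonneg_left (hmon k (by linarith)) hC'0))
    (fun n hn => by rw [← hFr n hn, sub_self, abs_zero]; positivity)
  refine ⟨F, Q, hQ, Eventually.of_forall fun n => ?_⟩
  have : f n - F n = g n := by simp only [hF]; ring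
  rw [this]; exact hg n
end Part8

section Part9
open Finset MeasureTheory Filter Topology

/-- centred first-generation sum -/
noncomputable def gt {A : ℕ} (p : Fin A → ℝ) (m : ℕ → ℝ) (n : ℕ) (c : Fin n → Fin A) : ℝ :=
  ∑ j, m (cnt c j) - EE p n (fun c => ∑ j, m (cnt c j))

theorem dlow_scalar {A x : ℝ} (hA : 2 ≤ A) {k : ℕ} (hk : (1 : ℝ) ≤ k) (hp : 0 < x) (hp1 : x < 1) :
    x - 1 / (2 * A) ≤ x * (1 + (1 - x) ^ k * ((2 * A - 1) * (k + 1) * x - 2 * (1 - x))) := by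
  have hq0 : 0 ≤ (1 - x) ^ k := pow_nonneg (by linarith) k
  have hq1 : (1 - x) ^ k ≤ 1 := pow_le_one₀ (by linarith) (by linarith)
  set y := (2 * (A : ℝ) - 1) * (k + 1) * x - 2 * (1 - x) with hy
  rcases le_or_gt 0 y with hy0 | hy0
  · have : 0 ≤ x * ((1 - x) ^ k * y) := by positivity
    have : 0 ≤ 1 / (2 * (A : ℝ)) := by positivity
    linarith
  · have t1 : y ≤ (1 - x) ^ k * y := by nlinarith
    have t2 : 4 * A * x - 2 ≤ y := by
      rw [hy]
      have : 0 ≤ (2 * (A : ℝ) - 1) * x * (k - 1) := by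
        apply mul_nonneg (mul_nonneg (by linarith) hp.le) (by linarith)
      linarith
    have t3 : x * (1 + (4 * A * x - 2)) ≤ x * (1 + (1 - x) ^ k * y) := by
      gcongr; linarith
    refine le_trans ?_ t3
    have : x * (1 + (4 * A * x - 2)) - (x - 1 / (2 * A)) = (8 * (A * x) ^ 2 - 4 * (A * x) + 1) / (2 * A) := by
      field_simp; ring
    have h8 : 0 ≤ (8 * (A * x) ^ 2 - 4 * (A * x) + 1) / (2 * A) := by
      apply div_nonneg _ (by positivity)
      nlinarith [sq_nonneg (4 * (A * x) - 1)]
    linarith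

structure Rec (M A : ℕ) (p : Fin A → ℝ) (ρ α β γ : ℝ) (m V : ℕ → ℝ) : Prop where
  P : Par M A p ρ
  ha : 0 ≤ α
  hb : 0 ≤ β
  hg : 0 ≤ γ
  hnz : ¬(α = 0 ∧ β = 0 ∧ γ = 0)
  hdeg : ¬(ρ = 1 ∧ α = 0 ∧ γ = 0)
  m0 : m 0 = α
  m1 : m 1 = β
  mr : ∀ n ≥ 2, m n = ∑ j, (M : ℝ) * Eb (p j) n m + γ
  V0 : V 0 = 0
  V1 : V 1 = 0
  Vr : ∀ n ≥ 2, V n = ∑ j, (M : ℝ) * Eb (p j) n V + M * EE p n (fun c => gt p m n c ^ 2)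

namespace Rec
variable {M A : ℕ} {p : Fin A → ℝ} {ρ α β γ : ℝ} {m V : ℕ → ℝ}

theorem M2 (R : Rec M A p ρ α β γ m V) : ρ = 1 ∧ M = 1 ∨ 1 < ρ ∧ 2 ≤ M := by
  have P := R.P
  rcases eq_or_lt_of_le P.r1 with h | h
  · left
    refine ⟨h.symm, ?_⟩
    have := P.hρ
    rw [← h] at this
    simp only [Real.rpow_one, P.ps, mul_one] at this
    exact_mod_cast this
  · right
    refine ⟨h, ?_⟩
    have := P.rgt h
    simp only [Real.rpow_one] at this
    rw [← Finset.mul_sum, P.ps, mul_one] at this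
    exact_mod_cast this

theorem dr (R : Rec M A p ρ α β γ m V) : ∀ n ≥ 2, (fun n => m (n+1) - m n) n =
    ∑ j, (M : ℝ) * p j * Eb (p j) n (fun n => m (n + 1) - m n) := by
  intro n hn
  simp only
  rw [R.mr n hn, R.mr (n+1) (by omega), add_sub_add_right_eq_sub, ← Finset.sum_sub_distrib]
  apply Finset.sum_congr rfl
  intro j _
  rw [← mul_sub, Eb_diff, mul_assoc]

theorem er (R : Rec M A p ρ α β γ m V) : ∀ n ≥ 2, (fun n => (m (n+2) - m (n+1)) - (m (n+1) - m n)) n =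
    ∑ j, (M : ℝ) * p j ^ 2 * Eb (p j) n (fun n => (m (n+2) - m (n+1)) - (m (n+1) - m n)) := by
  intro n hn
  simp only
  have h1 := R.dr n hn
  have h2 := R.dr (n+1) (by omega)
  simp only [add_assoc, Nat.reduceAdd] at h1 h2
  rw [h1, h2, ← Finset.sum_sub_distrib]
  apply Finset.sum_congr rfl
  intro j _
  rw [← mul_sub, Eb_diff]
  simp only [add_assoc, Nat.reduceAdd]
  ring

/-- bounds on m, d, e -/
theorem bounds (R : Rec M A p ρ α β γ m V) : ∃ C > 0, (∀ n : ℕ, |m n| ≤ C * ((n : ℝ) + 1) ^ ρ) ∧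
    (∀ n : ℕ, |m (n+1) - m n| ≤ C * ((n : ℝ) + 1) ^ (ρ - 1)) ∧
    (∀ n : ℕ, |(m (n+2) - m (n+1)) - (m (n+1) - m n)| ≤ C * ((n : ℝ) + 1) ^ (ρ - 2)) := by
  have P := R.P
  have r1 := P.r1
  have r2 := P.r2
  obtain ⟨C1, hC1, h1⟩ := bound_e P R.er
  obtain ⟨C2, hC2, h2⟩ := bound_d P R.dr (C := C1) (fun n => by simpa [add_assoc] using h1 n)
  refine ⟨C1 + C2 + |m 0|, by positivity, fun n => ?_, fun n => (h2 n).trans ?_, fun n => (h1 n).trans ?_⟩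
  · have h3 : |m n - m 0| ≤ C2 * ((n : ℝ) + 1) ^ (ρ - 1) * |(n : ℝ) - (0 : ℕ)| := by
      apply disc_lip
      intro i _ hi
      rw [Nat.max_zero] at hi
      refine (h2 i).trans ?_
      gcongr
    rw [Nat.cast_zero, sub_zero, abs_of_nonneg (show (0 : ℝ) ≤ n by positivity)] at h3
    have e : ((n : ℝ) + 1) ^ ρ = ((n : ℝ) + 1) ^ (ρ - 1) * (n + 1) := by
      rw [← Real.rpow_add_one (by positivity)]; congr 1; ring
    have h4 : 1 ≤ ((n : ℝ) + 1) ^ ρ := Real.one_le_rpow (by linarith [show (0 : ℝ) ≤ n by positivity]) (by linarith)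
    have h5 : |m n| ≤ |m n - m 0| + |m 0| := by
      calc |m n| = |(m n - m 0) + m 0| := by congr 1; ring
        _ ≤ _ := abs_add_le _ _
    have h6 : 0 ≤ ((n : ℝ) + 1) ^ (ρ - 1) := by positivity
    have h7 : |m 0| ≤ |m 0| * ((n : ℝ) + 1) ^ ρ := le_mul_of_one_le_right (abs_nonneg _) h4
    have h8 : C2 * ((n : ℝ) + 1) ^ (ρ - 1) * n ≤ C2 * ((n : ℝ) + 1) ^ ρ := by
      rw [e]; nlinarith [mul_nonneg hC2.le h6]
    have h9 : 0 ≤ C1 * ((n : ℝ) + 1) ^ ρ := by positivity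
    nlinarith
  · gcongr
    linarith [abs_nonneg (m 0)]
  · gcongr
    linarith [abs_nonneg (m 0)]

theorem asyM (R : Rec M A p ρ α β γ m V) {d : ℝ} (hd : RenProp M p ρ d) : ∃ Q, AsyQ p d ρ m Q := by
  have P := R.P
  have r1 := P.r1
  have r2 := P.r2
  obtain ⟨C, hC, h1, h2, h3⟩ := R.bounds
  refine thmA P hd (θ := ρ) (C := C + γ) (ε := ρ) (n0 := 2) (c := fun _ => (M : ℝ)) (by linarith) (by linarith)
    (fun j => rfl) (add_nonneg hC.le R.hg) (by linarith)
    (fun k => (h1 k).trans ?_) (fun k => (h2 k).trans ?_) (fun n hn => ?_)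
  · gcongr; linarith [R.hg]
  · gcongr; linarith [R.hg]
  · have h := R.mr n hn
    rw [show m n - ∑ j, (M : ℝ) * Eb (p j) n m = γ by linarith, abs_of_nonneg R.hg, sub_self, Real.rpow_zero]
    linarith

theorem asyD (R : Rec M A p ρ α β γ m V) {d : ℝ} (hd : RenProp M p ρ d) : ∃ Q, AsyQ p d (ρ - 1) (fun n => m (n+1) - m n) Q := by
  have P := R.P
  have r1 := P.r1
  have r2 := P.r2
  obtain ⟨C, hC, h1, h2, h3⟩ := R.bounds
  refine thmA P hd (θ := ρ - 1) (C := C) (ε := 1) (n0 := 2) (c := fun j => (M : ℝ) * p j) (by linarith) (by linarith)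
    (fun j => ?_) hC.le one_pos h2 (fun k => ?_) (fun n hn => ?_)
  · rw [mul_assoc, ← Real.rpow_one_add' (P.p0' j) (by linarith)]; congr 2; ring
  · have := h3 k
    rw [show ρ - 1 - 1 = ρ - 2 by ring]
    exact this
  · rw [← R.dr n hn, sub_self, abs_zero]; positivity

theorem mnn (R : Rec M A p ρ α β γ m V) : ∀ n, 0 ≤ m n := by
  have P := R.P
  have : ∀ n, - m n ≤ 0 := by
    apply comparison' (c := fun _ => (M : ℝ)) (a := fun _ => 0) (n0 := 2) (f := fun n => - m n) (b := fun _ => 0)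
      P.p0' P.p1' (fun _ => P.Mpos.le) (fun n hn => P.powlt hn)
    · intro n hn
      simp only [Eb_neg]
      have := R.mr n hn
      have := R.hg
      simp only [mul_neg, Finset.sum_neg_distrib]
      linarith
    · intro n hn; simp [Eb_const]
    · intro n hn
      have := R.ha; have := R.hb; have := R.m0; have := R.m1
      interval_cases n <;> linarith
  intro n; linarith [this n]

theorem mpos (R : Rec M A p ρ α β γ m V) : ∀ n ≥ 2, 0 < m n := by
  intro n hn
  have P := R.P
  have h0 : 0 ≤ ∑ j, (M : ℝ) * Eb (p j) n m := Finset.sum_nonneg fun j _ =>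
    mul_nonneg P.Mpos.le (Eb_nonneg (P.p0' j) (P.p1' j) n fun k _ => R.mnn k)
  have hmr := R.mr n hn
  rcases lt_or_eq_of_le R.hg with hγ | hγ
  · linarith
  have hab : 0 < α + β := by
    have := R.ha; have := R.hb
    by_contra! h
    exact R.hnz ⟨by linarith, by linarith, hγ.symm⟩
  obtain ⟨j⟩ := P.ne
  have hp := P.p0 j
  have hp1 := P.p1 j
  have h1 : 0 < Eb (p j) n m := by
    obtain ⟨k, rfl⟩ : ∃ k, n = k + 1 := ⟨n - 1, by omega⟩
    have h2 : Eb (p j) (k+1) (fun i => α * (if i = 0 then 1 else 0) + β * (if i = 1 then 1 else 0)) ≤ Eb (p j) (k+1) m := by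
      apply Eb_mono hp.le hp1.le
      intro i _
      by_cases hi : i = 0
      · subst hi; simp [R.m0]
      · by_cases hi1 : i = 1
        · subst hi1; simp [R.m1]
        · simp [hi, hi1, R.mnn]
    rw [Eb_add, Eb_smul, Eb_smul, Eb_ind_zero, Eb_ind_one] at h2
    refine lt_of_lt_of_le ?_ h2
    have hq : 0 < 1 - p j := by linarith
    have := R.ha; have := R.hb
    rcases lt_or_eq_of_le R.ha with h | h
    · have : 0 < α * (1 - p j) ^ (k+1) := by positivity
      have : 0 ≤ β * (((k : ℝ) + 1) * p j * (1 - p j) ^ k) := by positivity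
      linarith
    · have hβ : 0 < β := by linarith
      have : 0 ≤ α * (1 - p j) ^ (k+1) := by positivity
      have : 0 < β * (((k : ℝ) + 1) * p j * (1 - p j) ^ k) := by positivity
      linarith
  have h3 : (M : ℝ) * Eb (p j) n m ≤ ∑ j, (M : ℝ) * Eb (p j) n m :=
    Finset.single_le_sum (f := fun j => (M : ℝ) * Eb (p j) n m) (fun j _ =>
    mul_nonneg P.Mpos.le (Eb_nonneg (P.p0' j) (P.p1' j) n fun k _ => R.mnn k)) (mem_univ j)
  have := mul_pos P.Mpos h1
  linarith

theorem mlow (R : Rec M A p ρ α β γ m V) : ∃ c0 > 0, ∀ n : ℕ, 2 ≤ n → c0 * (n : ℝ) ^ ρ ≤ m n := by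
  have P := R.P
  refine lower P (by linarith [P.r1]) P.r2 (c := fun _ => (M : ℝ)) (r := fun _ => 0) (fun _ => P.Mpos.le) P.pi_sum
    (fun n hn => P.powlt hn) (fun k _ => R.mnn k) R.mpos (fun n hn _ => ?_) (Or.inl fun n => le_rfl)
  have := R.mr n hn
  have := R.hg
  linarith

/-- the value at 2 -/
theorem m2eq (R : Rec M A p ρ α β γ m V) : m 2 * (1 - M * ∑ j, p j ^ 2) = γ + 2 * M * (1 - ∑ j, p j ^ 2) * β +
    M * (A - 2 + ∑ j, p j ^ 2) * α := by
  have P := R.P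
  have h := R.mr 2 le_rfl
  have e : ∀ j, Eb (p j) 2 m = p j ^ 2 * m 2 + 2 * p j * (1 - p j) * β + (1 - p j) ^ 2 * α := by
    intro j
    simp only [Eb_succ, Eb_zero, R.m0, R.m1, zero_add, Nat.reduceAdd]
    ring
  simp only [e] at h
  have e2 : ∑ j, (M : ℝ) * (p j ^ 2 * m 2 + 2 * p j * (1 - p j) * β + (1 - p j) ^ 2 * α) =
      M * (∑ j, p j ^ 2) * m 2 + 2 * M * β * (∑ j, p j) - 2 * M * β * ∑ j, p j ^ 2 +
      (M * α * ∑ j : Fin A, 1 - 2 * M * α * ∑ j, p j + M * α * ∑ j, p j ^ 2) := by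
    simp only [Finset.mul_sum, Finset.sum_mul, ← Finset.sum_add_distrib, ← Finset.sum_sub_distrib]
    exact Finset.sum_congr rfl fun j _ => by ring
  rw [e2, P.ps] at h
  simp only [sum_const, card_univ, Fintype.card_fin, nsmul_eq_mul, mul_one] at h
  linarith

theorem m2gt (R : Rec M A p ρ α β γ m V) : 0 < m 2 + α - 2 * β := by
  have P := R.P
  have hs := P.hs
  have h := R.m2eq
  set s := ∑ j, p j ^ 2
  have ha := R.ha; have hb := R.hb; have hg := R.hg
  have hA : (2 : ℝ) ≤ A := by exact_mod_cast P.hA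
  have hM : (1 : ℝ) ≤ M := by exact_mod_cast P.hM
  have e : (m 2 + α - 2 * β) * (1 - M * s) = γ + 2 * (M - 1) * β + (M * (A - 2) + 1) * α := by
    have : (m 2 + α - 2 * β) * (1 - M * s) = m 2 * (1 - M * s) + (α - 2 * β) * (1 - M * s) := by ring
    rw [this, h]; ring
  have hpos : 0 < γ + 2 * (M - 1) * β + (M * (A - 2) + 1) * α := by
    have t1 : 0 ≤ 2 * ((M : ℝ) - 1) * β := mul_nonneg (by linarith) hb
    have t2 : α ≤ (M * ((A : ℝ) - 2) + 1) * α := by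
      have : 0 ≤ (M : ℝ) * ((A : ℝ) - 2) * α := mul_nonneg (mul_nonneg (by linarith) (by linarith)) ha
      linarith
    by_contra! hcon
    have a0 : α = 0 := by linarith
    have g0 : γ = 0 := by linarith
    rcases R.M2 with ⟨h1, h2⟩ | ⟨h1, h2⟩
    · exact R.hdeg ⟨h1, a0, g0⟩
    · have hM2 : (2 : ℝ) ≤ M := by exact_mod_cast h2
      have : β = 0 := by nlinarith
      exact R.hnz ⟨a0, this, g0⟩
  rw [← e] at hpos
  exact (pos_iff_pos_of_mul_pos hpos).2 (by linarith)

theorem dlow1 (R : Rec M A p ρ α β γ m V) (hM2 : 2 ≤ M) : ∃ δ > 0, -δ ≤ m 1 - m 0 ∧ ∀ n ≥ 1, δ ≤ m (n+1) - m n := by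
  have P := R.P
  have hs := P.hs
  have h := R.m2eq
  have ha := R.ha; have hb := R.hb; have hg := R.hg
  have hA : (2 : ℝ) ≤ A := by exact_mod_cast P.hA
  have hM : (2 : ℝ) ≤ M := by exact_mod_cast hM2
  have hsA : 1 ≤ A * ∑ j, p j ^ 2 := by
    have := Finset.sum_mul_sq_le_sq_mul_sq univ (fun _ : Fin A => (1 : ℝ)) p
    simp only [one_mul, P.ps, one_pow, sum_const, card_univ, Fintype.card_fin, nsmul_eq_mul, mul_one] at this
    exact this
  set s := ∑ j, p j ^ 2
  have hs0 : 0 ≤ s := Finset.sum_nonneg fun j _ => sq_nonneg _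
  obtain ⟨δ, hδ, hδ0, hδ1⟩ : ∃ δ > 0, -δ ≤ m 1 - m 0 ∧ 2 * A * δ ≤ m 2 - m 1 := by
    have e : (m 2 - m 1) * (1 - M * s) = γ + (2 * M - 1 - M * s) * β + M * (A - 2 + s) * α := by
      rw [R.m1, sub_mul, h]; ring
    have hd : 0 < 1 - M * s := by linarith
    have hMs : 0 ≤ M * s := by positivity
    have t1 : 0 ≤ (2 * (M : ℝ) - 2) * β := mul_nonneg (by linarith) hb
    rcases lt_or_eq_of_le ha with h1 | h1
    · refine ⟨α, h1, by rw [R.m0, R.m1]; linarith, ?_⟩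
      rw [← mul_le_mul_iff_left₀ hd, e]
      have t2 : (1 - M * s) * β ≥ 0 := by positivity
      have t3 : 2 * A * (1 - M * s) ≤ M * (A - 2 + s) := by
        have : (M : ℝ) * 1 ≤ M * (A * s) := by gcongr
        nlinarith
      nlinarith [mul_le_mul_of_nonneg_right t3 ha]
    · have hbg : 0 < β + γ := by
        by_contra! hcon
        exact R.hnz ⟨h1.symm, by linarith, by linarith⟩
      refine ⟨(β + γ) / (2 * A), by positivity, ?_, ?_⟩
      · rw [R.m0, R.m1, ← h1]
        have : 0 ≤ (β + γ) / (2 * A) := by positivity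
        linarith
      · have : 2 * A * ((β + γ) / (2 * A)) = β + γ := by field_simp
        rw [this, ← mul_le_mul_iff_left₀ hd, e, ← h1]
        nlinarith [mul_nonneg hMs hg]
  refine ⟨δ, hδ, hδ0, ?_⟩
  set b : ℕ → ℝ := fun k => δ + (-2 * δ) * (if k = 0 then 1 else 0) + ((2 * A - 1) * δ) * (if k = 1 then 1 else 0) with hb'
  have key : ∀ n, -(m (n+1) - m n) ≤ - b n := by
    apply comparison' (c := fun j => (M : ℝ) * p j) (a := fun _ => 0) (n0 := 2)
      (f := fun n => -(m (n+1) - m n)) (b := fun n => - b n) P.p0' P.p1'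
      (fun j => mul_nonneg P.Mpos.le (P.p0' j))
    · intro n hn
      have := P.powlt (n := n + 1) (by omega)
      refine lt_of_eq_of_lt (Finset.sum_congr rfl fun j _ => ?_) this
      rw [pow_succ]; ring
    · intro n hn
      have h := R.dr n hn
      simp only at h
      have : ∑ j, (M : ℝ) * p j * Eb (p j) n (fun n => -(m (n+1) - m n)) = -(m (n+1) - m n) := by
        rw [h, ← Finset.sum_neg_distrib]
        exact Finset.sum_congr rfl fun j _ => by rw [Eb_neg]; ring
      rw [this, add_zero]
    · intro n hn
      have hbn : b n = δ := by simp [hb', show n ≠ 0 by omega, show n ≠ 1 by omega]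
      rw [hbn, add_zero]
      have e1 : ∑ j, (M : ℝ) * p j * Eb (p j) n (fun n => - b n) = - (M * ∑ j, p j * Eb (p j) n b) := by
        rw [Finset.mul_sum, ← Finset.sum_neg_distrib]
        exact Finset.sum_congr rfl fun j _ => by rw [Eb_neg]; ring
      rw [e1]
      obtain ⟨k, rfl⟩ : ∃ k, n = k + 1 := ⟨n - 1, by omega⟩
      have hk : (1 : ℝ) ≤ k := by exact_mod_cast (by omega : 1 ≤ k)
      have e2 : ∀ j, δ * p j - δ / (2 * A) ≤ p j * Eb (p j) (k+1) b := by
        intro j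
        have hp := P.p0 j
        have hp1 := P.p1 j
        have eb : Eb (p j) (k+1) b = δ * (1 + (1 - p j) ^ k * ((2 * A - 1) * (k + 1) * p j - 2 * (1 - p j))) := by
          rw [hb', Eb_add, Eb_add, Eb_const, Eb_smul, Eb_smul, Eb_ind_zero, Eb_ind_one]
          ring
        rw [eb]
        have hfin := dlow_scalar hA hk hp hp1
        have h9 := mul_le_mul_of_nonneg_left hfin hδ.le
        have e9 : δ * (1 / (2 * A)) = δ / (2 * A) := by ring
        rw [← e9]
        linarith
      have e3 : δ / 2 ≤ ∑ j, p j * Eb (p j) (k+1) b := by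
        have := Finset.sum_le_sum fun j (_ : j ∈ univ) => e2 j
        rw [Finset.sum_sub_distrib, ← Finset.mul_sum, P.ps, sum_const, card_univ, Fintype.card_fin, nsmul_eq_mul] at this
        have e5 : (A : ℝ) * (δ / (2 * A)) = δ / 2 := by field_simp
        linarith
      have := mul_le_mul hM e3 (by positivity) (by linarith)
      linarith
    · intro n hn
      interval_cases n
      · simp only [hb']; norm_num; linarith [hδ0]
      · simp only [hb']; norm_num; linarith [hδ1]
  intro n hn
  have h := key n
  have : δ ≤ b n := by
    simp only [hb', show n ≠ 0 by omega, if_false]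
    split_ifs
    · nlinarith
    · simp
  linarith

theorem dlow (R : Rec M A p ρ α β γ m V) (hM2 : 2 ≤ M) : ∃ c0 > 0, ∀ n : ℕ, 1 ≤ n → c0 * (n : ℝ) ^ (ρ - 1) ≤ m (n+1) - m n := by
  have P := R.P
  obtain ⟨δ, hδ, h0, h1⟩ := R.dlow1 hM2
  have hρ : 1 < ρ := by
    rcases R.M2 with ⟨_, h⟩ | ⟨h, _⟩
    · omega
    · exact h
  set f : ℕ → ℝ := fun n => if n = 0 then 0 else m (n+1) - m n with hf
  have hf1 : ∀ n ≥ 1, f n = m (n+1) - m n := fun n hn => by simp [hf, show n ≠ 0 by omega]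
  have key := lower P (θ := ρ - 1) (by linarith) (by linarith [P.r2]) (c := fun j => (M : ℝ) * p j)
    (r := fun n => δ * ∑ j, (M : ℝ) * p j * (1 - p j) ^ n) (f := f) (n1 := 1)
    (fun j => mul_nonneg P.Mpos.le (P.p0' j)) (by
      refine Eq.trans ?_ P.pi_sum
      apply Finset.sum_congr rfl
      intro j _
      have hne : 1 + (ρ - 1) ≠ 0 := by rw [add_sub_cancel]; exact (by linarith : (0:ℝ) < ρ).ne'
      rw [mul_assoc, ← Real.rpow_one_add' (P.p0' j) hne]; congr 2; ring)
    (fun n hn => by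
      have := P.powlt (n := n + 1) (by omega)
      refine lt_of_eq_of_lt (Finset.sum_congr rfl fun j _ => ?_) this
      rw [pow_succ]; ring)
    (fun k hk => by simp [hf, show k = 0 by omega])
    (fun k hk => by rw [hf1 k hk]; linarith [h1 k hk])
    (fun n hn _ => by
      rw [hf1 n (by omega)]
      have h := R.dr n hn
      simp only at h
      rw [h, Finset.mul_sum, ← Finset.sum_add_distrib]
      apply Finset.sum_le_sum
      intro j _
      have : Eb (p j) n f ≤ Eb (p j) n (fun k => (m (k+1) - m k) + δ * (if k = 0 then 1 else 0)) := by
        apply Eb_mono (P.p0' j) (P.p1' j)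
        intro k _
        by_cases hk : k = 0
        · subst hk; simp [hf]; linarith
        · simp [hf, hk]
      rw [Eb_add, Eb_smul, Eb_ind_zero] at this
      have := mul_le_mul_of_nonneg_left this (mul_nonneg P.Mpos.le (P.p0' j))
      linarith)
    (Or.inr ⟨δ, hδ, fun k hk => by rw [hf1 k hk]; exact h1 k hk, fun ε hε => by
      have : Tendsto (fun n : ℕ => δ * (∑ j, (M : ℝ) * p j * (1 - p j) ^ n) * (n : ℝ) ^ (ρ - 1)) atTop (𝓝 0) := by
        have h2 : ∀ j, Tendsto (fun n : ℕ => δ * M * p j * ((n : ℝ) ^ 1 * (1 - p j) ^ n)) atTop (𝓝 (δ * M * p j * 0)) := fun j =>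
          (tendsto_pow_const_mul_const_pow_of_lt_one 1 (by linarith [P.p1 j]) (by linarith [P.p0 j])).const_mul _
        have h3 := tendsto_finsetSum univ fun j _ => h2 j
        simp only [mul_zero, Finset.sum_const_zero] at h3
        refine squeeze_zero' ?_ ?_ h3
        · filter_upwards with n
          have : 0 ≤ ∑ j, (M : ℝ) * p j * (1 - p j) ^ n := Finset.sum_nonneg fun j _ =>
            mul_nonneg (mul_nonneg P.Mpos.le (P.p0' j)) (pow_nonneg (by linarith [P.p1 j]) n)
          positivity
        · filter_upwards [eventually_ge_atTop 1] with n hn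
          have hn1 : (1 : ℝ) ≤ n := by exact_mod_cast hn
          have h4 : (n : ℝ) ^ (ρ - 1) ≤ n := by
            calc (n : ℝ) ^ (ρ - 1) ≤ (n : ℝ) ^ (1 : ℝ) := Real.rpow_le_rpow_of_exponent_le hn1 (by linarith [P.r2])
              _ = n := Real.rpow_one _
          rw [Finset.mul_sum, Finset.sum_mul]
          apply Finset.sum_le_sum
          intro j _
          have : 0 ≤ δ * (M * p j * (1 - p j) ^ n) :=
            mul_nonneg hδ.le (mul_nonneg (mul_nonneg P.Mpos.le (P.p0' j)) (pow_nonneg (by linarith [P.p1 j]) n))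
          have := mul_le_mul_of_nonneg_left h4 this
          rw [pow_one]; linarith
      exact this.eventually (ge_mem_nhds hε)⟩)
  obtain ⟨c0, hc0, h⟩ := key
  exact ⟨c0, hc0, fun n hn => by rw [← hf1 n hn]; exact h n hn⟩

end Rec
end Part9

section Part10
open Finset MeasureTheory Filter Topology

theorem per_unif {Q : ℝ → ℝ} {d : ℝ} (hd : 0 < d) (hc : Continuous Q) (hp : ∀ s, Q (s + d) = Q s) :
    (∃ B > 0, ∀ s, |Q s| ≤ B) ∧ ∀ ε > 0, ∃ δ > 0, ∀ s t, |s - t| < δ → |Q s - Q t| < ε := by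
  have hper : Function.Periodic Q d := hp
  have hsh : ∀ s t, Q (t - ⌊s / d⌋ * d) = Q t := fun s t => by
    have := hper.sub_zsmul_eq ⌊s / d⌋ (x := t)
    simpa using this
  have hr : ∀ s : ℝ, 0 ≤ s - ⌊s / d⌋ * d ∧ s - ⌊s / d⌋ * d ≤ d := by
    intro s
    have h1 := Int.floor_le (s / d)
    have h2 := (Int.lt_floor_add_one (s / d)).le
    rw [le_div_iff₀ hd] at h1
    rw [div_le_iff₀ hd] at h2
    constructor <;> linarith
  have hK : IsCompact (Set.Icc (-1) (d + 1)) := isCompact_Icc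
  constructor
  · obtain ⟨B, hB⟩ := hK.exists_bound_of_continuousOn hc.continuousOn
    refine ⟨|B| + 1, by positivity, fun s => ?_⟩
    rw [← hsh s s]
    have := hB (s - ⌊s / d⌋ * d) ⟨by linarith [(hr s).1], by linarith [(hr s).2]⟩
    rw [Real.norm_eq_abs] at this
    linarith [le_abs_self B]
  · intro ε hε
    have hu := hK.uniformContinuousOn_of_continuous hc.continuousOn
    rw [Metric.uniformContinuousOn_iff] at hu
    obtain ⟨δ, hδ, h⟩ := hu ε hε
    refine ⟨min δ 1, lt_min hδ one_pos, fun s t hst => ?_⟩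
    have h1 := lt_of_lt_of_le hst (min_le_left _ _)
    have h2 := abs_lt.1 (lt_of_lt_of_le hst (min_le_right _ _))
    rw [← hsh s s, ← hsh s t]
    have h3 := hr s
    refine h _ ⟨by linarith, by linarith⟩ _ ⟨by linarith, by linarith⟩ ?_
    rw [Real.dist_eq]
    rw [show s - ⌊s / d⌋ * d - (t - ⌊s / d⌋ * d) = s - t by ring]
    exact h1

section
variable {A : ℕ} {p : Fin A → ℝ} {d θ : ℝ} {f : ℕ → ℝ} {Q : ℝ → ℝ}

theorem AsyQ.qlim (hd : 0 < d) (h : AsyQ p d θ f Q) {x y : ℕ → ℝ}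
    (hxy : Tendsto (fun n => x n - y n) atTop (𝓝 0)) : Tendsto (fun n => Q (x n) - Q (y n)) atTop (𝓝 0) := by
  rw [Metric.tendsto_atTop] at hxy ⊢
  intro ε hε
  obtain ⟨δ, hδ, hu⟩ := (per_unif hd h.cont h.per).2 ε hε
  obtain ⟨N, hN⟩ := hxy δ hδ
  refine ⟨N, fun n hn => ?_⟩
  have := hN n hn
  rw [Real.dist_eq, sub_zero] at this ⊢
  exact hu _ _ this

theorem AsyQ.bdd (hd : 0 < d) (hθ : 0 ≤ θ) (h : AsyQ p d θ f Q) :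
    ∃ C > 0, ∀ n : ℕ, |f n| ≤ C * ((n : ℝ) + 1) ^ θ := by
  obtain ⟨⟨B, hB, hQ⟩, -⟩ := per_unif hd h.cont h.per
  obtain ⟨N, hN⟩ := Metric.tendsto_atTop.1 h.lim 1 one_pos
  refine ⟨B + 1 + ∑ i ∈ range (N + 1), |f i|, by positivity, fun n => ?_⟩
  have h1 : 1 ≤ ((n : ℝ) + 1) ^ θ := Real.one_le_rpow (by linarith [(Nat.cast_nonneg n : (0:ℝ) ≤ n)]) hθ
  by_cases hn : n < N + 1
  · have : |f n| ≤ ∑ i ∈ range (N + 1), |f i| :=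
      Finset.single_le_sum (f := fun i => |f i|) (fun i _ => abs_nonneg _) (mem_range.2 hn)
    have h2 : 0 ≤ |f n| := abs_nonneg _
    nlinarith
  · have h0 : (0 : ℝ) < n := by exact_mod_cast (by omega : 0 < n)
    have h2 := hN n (by omega)
    rw [Real.dist_eq, sub_zero] at h2
    have h3 : |f n / (n : ℝ) ^ θ| ≤ B + 1 := by
      have := abs_add_le (f n / (n : ℝ) ^ θ - Q (Real.log n)) (Q (Real.log n))
      rw [sub_add_cancel] at this
      linarith [hQ (Real.log n)]
    have hp : 0 < (n : ℝ) ^ θ := by positivity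
    rw [abs_div, abs_of_pos hp, div_le_iff₀ hp] at h3
    have h4 : (n : ℝ) ^ θ ≤ ((n : ℝ) + 1) ^ θ := by gcongr; linarith
    have h5 : 0 ≤ ∑ i ∈ range (N + 1), |f i| := by positivity
    calc |f n| ≤ (B + 1) * (n : ℝ) ^ θ := h3
      _ ≤ (B + 1) * ((n : ℝ) + 1) ^ θ := by gcongr
      _ ≤ _ := mul_le_mul_of_nonneg_right (by linarith) (by positivity)

/-- slow variation -/
theorem AsyQ.slow (hd : 0 < d) (h : AsyQ p d θ f Q) {ε : ℝ} (hε : 0 < ε) :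
    ∃ η > 0, ∃ N : ℕ, ∀ n : ℕ, N ≤ n → ∀ k : ℕ, |(k : ℝ) - n| ≤ η * n → |f k - f n| ≤ ε * (n : ℝ) ^ θ := by
  obtain ⟨⟨B, hB, hQ⟩, hU⟩ := per_unif hd h.cont h.per
  obtain ⟨δ, hδ, hu⟩ := hU (ε / 8) (by positivity)
  -- continuity at 1
  have c1 : ContinuousAt (fun x : ℝ => x ^ θ) 1 := Real.continuousAt_rpow_const 1 θ (Or.inl one_ne_zero)
  have c2 : ContinuousAt Real.log 1 := Real.continuousAt_log one_ne_zero
  obtain ⟨η1, hη1, H1⟩ := Metric.continuousAt_iff.1 c1 (min 1 (ε / (8 * B))) (by positivity)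
  obtain ⟨η2, hη2, H2⟩ := Metric.continuousAt_iff.1 c2 δ hδ
  obtain ⟨N, hN⟩ := Metric.tendsto_atTop.1 h.lim (ε / 8) (by positivity)
  refine ⟨min (min η1 η2) 1 / 2, by positivity, 2 * N + 1, fun n hn k hk => ?_⟩
  set η := min (min η1 η2) 1
  have e1 : η ≤ η1 := (min_le_left _ _).trans (min_le_left _ _)
  have e2 : η ≤ η2 := (min_le_left _ _).trans (min_le_right _ _)
  have e3 : η ≤ 1 := min_le_right _ _
  have e0 : 0 < η := by positivity
  have hn0 : (0 : ℝ) < n := by exact_mod_cast (by omega : 0 < n)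
  set x : ℝ := k / n with hx
  have hxk : (k : ℝ) = n * x := by rw [hx]; field_simp
  have hx1 : |x - 1| ≤ η / 2 := by
    rw [hxk, show (n : ℝ) * x - n = n * (x - 1) by ring, abs_mul, abs_of_pos hn0, mul_comm] at hk
    exact le_of_mul_le_mul_right hk hn0
  have hx1' := abs_le.1 hx1
  have hx0 : 0 < x := by linarith
  have hkN : N ≤ k := by
    have : (N : ℝ) ≤ k := by
      rw [hxk]
      have : (2 * N + 1 : ℝ) ≤ n := by exact_mod_cast hn
      nlinarith
    exact_mod_cast this
  have a1 : |x ^ θ - 1| < min 1 (ε / (8 * B)) := by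
    have := H1 (x := x) (by rw [Real.dist_eq]; linarith)
    rwa [Real.dist_eq, Real.one_rpow] at this
  have a1' := (abs_lt.1 (lt_of_lt_of_le a1 (min_le_left _ _))).2
  have a1'' := lt_of_lt_of_le a1 (min_le_right _ _)
  have a2 : |Q (Real.log k) - Q (Real.log n)| < ε / 8 := by
    apply hu
    have := H2 (x := x) (by rw [Real.dist_eq]; linarith)
    rw [Real.dist_eq, Real.log_one, sub_zero] at this
    rwa [hxk, Real.log_mul hn0.ne' hx0.ne', add_sub_cancel_left]
  have a3 := hN k hkN
  have a4 := hN n (by omega)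
  rw [Real.dist_eq, sub_zero] at a3 a4
  have hk0 : (0 : ℝ) < k := by rw [hxk]; positivity
  set u := f k / (k : ℝ) ^ θ - Q (Real.log k)
  set v := f n / (n : ℝ) ^ θ - Q (Real.log n)
  have f1 : f k = (n : ℝ) ^ θ * (x ^ θ * (Q (Real.log k) + u)) := by
    have : (k : ℝ) ^ θ ≠ 0 := by positivity
    rw [← mul_assoc, ← Real.mul_rpow hn0.le hx0.le, ← hxk]
    simp only [u]; field_simp; ring
  have f2 : f n = (n : ℝ) ^ θ * (Q (Real.log n) + v) := by
    have : (n : ℝ) ^ θ ≠ 0 := by positivity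
    simp only [v]; field_simp; ring
  rw [f1, f2, ← mul_sub, abs_mul, abs_of_pos (by positivity : 0 < (n : ℝ) ^ θ), mul_comm]
  gcongr
  have hq := hQ (Real.log k)
  set y := Q (Real.log k)
  set z := Q (Real.log n)
  have e : x ^ θ * (y + u) - (z + v) = (x ^ θ - 1) * y + (y - z) + (x ^ θ * u - v) := by ring
  rw [e]
  have b1 : |(x ^ θ - 1) * y| ≤ ε / 8 := by
    rw [abs_mul]
    calc |x ^ θ - 1| * |y| ≤ (ε / (8 * B)) * B := by gcongr
      _ = ε / 8 := by field_simp
  have b2 : |x ^ θ * u| ≤ 2 * (ε / 8) := by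
    rw [abs_mul, abs_of_pos (by positivity : 0 < x ^ θ)]
    gcongr
    linarith
  have := abs_le.1 b1
  have := abs_le.1 b2
  have := abs_lt.1 a2
  have := abs_lt.1 a4
  rw [abs_le]
  constructor <;> linarith

theorem floor_lim {x : ℝ} (hx : 0 < x) : Tendsto (fun n : ℕ => ((⌊(n : ℝ) * x⌋₊ : ℕ) : ℝ) / n) atTop (𝓝 x) := by
  have := (tendsto_nat_floor_mul_div_atTop (R := ℝ) hx.le).comp tendsto_natCast_atTop_atTop
  refine this.congr fun n => ?_
  simp [mul_comm]

theorem AsyQ.floor (hd : 0 < d) (h : AsyQ p d θ f Q) {j : Fin A} (hp : 0 < p j) :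
    Tendsto (fun n : ℕ => f ⌊(n : ℝ) * p j⌋₊ / (n : ℝ) ^ θ - p j ^ θ * Q (Real.log n)) atTop (𝓝 0) := by
  obtain ⟨⟨B, hB, hQ⟩, hU⟩ := per_unif hd h.cont h.per
  set l : ℕ → ℕ := fun n => ⌊(n : ℝ) * p j⌋₊ with hl
  have hlt : Tendsto l atTop atTop :=
    tendsto_nat_floor_atTop.comp (tendsto_natCast_atTop_atTop.atTop_mul_const hp)
  have h1 := floor_lim hp
  have h2 : Tendsto (fun n : ℕ => ((l n : ℝ) / n) ^ θ) atTop (𝓝 (p j ^ θ)) :=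
    h1.rpow_const (Or.inl hp.ne')
  have h3 : Tendsto (fun n : ℕ => Q (Real.log (l n)) - Q (Real.log n)) atTop (𝓝 0) := by
    have e : ∀ n : ℕ, Q (Real.log n) = Q (Real.log n + Real.log (p j)) := fun n => by
      rw [← h.pery j (Real.log n)]; congr 1; ring
    have : Tendsto (fun n : ℕ => Q (Real.log (l n)) - Q (Real.log n + Real.log (p j))) atTop (𝓝 0) := by
      apply h.qlim hd
      have h4 := (h1.log hp.ne').sub_const (Real.log (p j))
      rw [sub_self] at h4
      refine h4.congr' ?_
      filter_upwards [hlt.eventually_ge_atTop 1, eventually_ge_atTop 1] with n hn1 hn2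
      have a : ((l n : ℕ) : ℝ) ≠ 0 := by exact_mod_cast (by omega : l n ≠ 0)
      have b : (n : ℝ) ≠ 0 := by exact_mod_cast (by omega : n ≠ 0)
      rw [Real.log_div a b]; ring
    exact this.congr fun n => by rw [← e]
  have h5 := h.lim.comp hlt
  have t1 := h2.mul h5
  have t2 : Tendsto (fun n : ℕ => (((l n : ℝ) / n) ^ θ - p j ^ θ) * Q (Real.log (l n))) atTop (𝓝 0) := by
    have h6 := h2.sub_const (p j ^ θ)
    rw [sub_self] at h6
    refine h6.zero_mul_isBoundedUnder_le ⟨B, ?_⟩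
    rw [eventually_map]
    exact Eventually.of_forall fun n => hQ _
  have t3 := h3.const_mul (p j ^ θ)
  have t := (t1.add t2).add t3
  simp only [mul_zero, add_zero] at t
  refine t.congr' ?_
  filter_upwards [hlt.eventually_ge_atTop 1, eventually_ge_atTop 1] with n hn1 hn2
  have a : (0 : ℝ) < (l n : ℕ) := by exact_mod_cast (by omega : 0 < l n)
  have b : (0 : ℝ) < (n : ℝ) := by exact_mod_cast (by omega : 0 < n)
  simp only [Function.comp]
  rw [Real.div_rpow a.le b.le]
  have : (l n : ℝ) ^ θ ≠ 0 := by positivity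
  have : (n : ℝ) ^ θ ≠ 0 := by positivity
  change _ = f (l n) / (n : ℝ) ^ θ - _
  field_simp
  ring
end

theorem Eb_sq_dev {M A : ℕ} {p : Fin A → ℝ} {ρ : ℝ} (P : Par M A p ρ) (j : Fin A) {n : ℕ} (hn : 1 ≤ n) :
    Eb (p j) n (fun k => (|(k : ℝ) - n * p j| / √n) ^ 2) ≤ 4 * Real.exp 1 := by
  have := dev_moment P.p0' P.p1' P.ps 2 j hn
  rw [EE_cnt P.ps j n (fun k => (|(k : ℝ) - n * p j| / √n) ^ 2)] at this
  refine this.trans (le_of_eq ?_)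
  simp [Nat.factorial]; ring

theorem conc {M A : ℕ} {p : Fin A → ℝ} {ρ d θ : ℝ} (P : Par M A p ρ) (hd : 0 < d) (hθ : 0 ≤ θ) {f : ℕ → ℝ} {Q : ℝ → ℝ}
    (h : AsyQ p d θ f Q) (j : Fin A) {ε : ℝ} (hε : 0 < ε) :
    ∀ᶠ n : ℕ in atTop, Eb (p j) n (fun k => (f k - f ⌊(n : ℝ) * p j⌋₊) ^ 2) ≤ ε * ((n : ℝ) ^ θ) ^ 2 := by
  obtain ⟨C, hC, hb⟩ := h.bdd hd hθ
  obtain ⟨η, hη, N, hs⟩ := h.slow hd (ε := √(ε / 2)) (by positivity)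
  have hp := P.p0 j
  have hp1 := P.p1 j
  set η' := η * p j / 2 with hη'
  have hη'0 : 0 < η' := by positivity
  have hlt : Tendsto (fun n : ℕ => ⌊(n : ℝ) * p j⌋₊) atTop atTop :=
    tendsto_nat_floor_atTop.comp (tendsto_natCast_atTop_atTop.atTop_mul_const hp)
  set K := (2 * (C * 2 ^ θ)) ^ 2 / η' ^ 2 with hK
  have hK0 : 0 ≤ K := by positivity
  have hev : ∀ᶠ n : ℕ in atTop, K * (4 * Real.exp 1) / n ≤ ε / 2 :=
    (tendsto_const_div_atTop_nhds_zero_nat _).eventually (ge_mem_nhds (by positivity))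
  have hev2 : ∀ᶠ n : ℕ in atTop, (1 + η) / n ≤ η' :=
    (tendsto_const_div_atTop_nhds_zero_nat _).eventually (ge_mem_nhds hη'0)
  filter_upwards [hev, hev2, hlt.eventually_ge_atTop N, eventually_ge_atTop 1] with n h1 h2 h3 hn
  have hn1 : (1 : ℝ) ≤ n := by exact_mod_cast hn
  have hn0 : (0 : ℝ) < n := by linarith
  set l := ⌊(n : ℝ) * p j⌋₊ with hl
  have hl1 : (l : ℝ) ≤ n * p j := Nat.floor_le (by positivity)
  have hl2 : n * p j < (l : ℝ) + 1 := Nat.lt_floor_add_one _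
  have hln : (l : ℝ) ≤ n := by nlinarith
  rw [div_le_iff₀ hn0] at h2
  have hX : 0 < (n : ℝ) ^ θ := by positivity
  have hbig : ∀ k : ℕ, (k : ℝ) ≤ n → |f k| ≤ C * 2 ^ θ * (n : ℝ) ^ θ := by
    intro k hk
    refine (hb k).trans ?_
    rw [mul_assoc, ← Real.mul_rpow (by norm_num) hn0.le]
    gcongr
    linarith
  have hpt : ∀ k ≤ n, (f k - f l) ^ 2 ≤ ε / 2 * ((n : ℝ) ^ θ) ^ 2 +
      K / n * ((n : ℝ) ^ θ) ^ 2 * (|(k : ℝ) - n * p j| / √n) ^ 2 := by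
    intro k hk
    have hkn : (k : ℝ) ≤ n := by exact_mod_cast hk
    rcases le_or_gt |(k : ℝ) - n * p j| (η' * n) with hc | hc
    · have hkl : |(k : ℝ) - l| ≤ η * l := by
        have h5 := abs_le.1 hc
        have h6 : η' * n + 1 ≤ η * l := by
          have : η' * n = η * (n * p j) / 2 := by rw [hη']; ring
          nlinarith
        rw [abs_le]
        constructor <;> linarith
      have h6 := hs l h3 k hkl
      have h7 : |f k - f l| ≤ √(ε / 2) * (n : ℝ) ^ θ := by
        refine h6.trans ?_
        gcongr
      have h8 : (f k - f l) ^ 2 ≤ (√(ε / 2) * (n : ℝ) ^ θ) ^ 2 := sq_le_sq' (by linarith [(abs_le.1 h7).1]) (abs_le.1 h7).2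
      rw [mul_pow, Real.sq_sqrt (by positivity)] at h8
      have : 0 ≤ K / n * ((n : ℝ) ^ θ) ^ 2 * (|(k : ℝ) - n * p j| / √n) ^ 2 := by positivity
      linarith
    · have h5 : |f k - f l| ≤ 2 * (C * 2 ^ θ) * (n : ℝ) ^ θ := by
        have := abs_sub (f k) (f l)
        have := hbig k hkn
        have := hbig l hln
        linarith
      have h8 : (f k - f l) ^ 2 ≤ (2 * (C * 2 ^ θ) * (n : ℝ) ^ θ) ^ 2 := sq_le_sq' (by linarith [(abs_le.1 h5).1]) (abs_le.1 h5).2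
      have h9 : η' ^ 2 * n ≤ (|(k : ℝ) - n * p j| / √n) ^ 2 := by
        rw [div_pow (|(k : ℝ) - n * p j|), Real.sq_sqrt hn0.le, le_div_iff₀ hn0]
        have := pow_le_pow_left₀ (by positivity) hc.le 2
        rw [mul_pow] at this
        linarith
      have h10 : (2 * (C * 2 ^ θ) * (n : ℝ) ^ θ) ^ 2 = K / n * ((n : ℝ) ^ θ) ^ 2 * (η' ^ 2 * n) := by
        rw [hK]; field_simp
      have h11 : K / n * ((n : ℝ) ^ θ) ^ 2 * (η' ^ 2 * n) ≤ K / n * ((n : ℝ) ^ θ) ^ 2 * (|(k : ℝ) - n * p j| / √n) ^ 2 := by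
        gcongr
      have : 0 ≤ ε / 2 * ((n : ℝ) ^ θ) ^ 2 := by positivity
      linarith
  have h12 := Eb_mono hp.le hp1.le n hpt
  rw [Eb_add, Eb_const, Eb_smul] at h12
  have h13 := Eb_sq_dev P j hn
  have h14 : K / n * ((n : ℝ) ^ θ) ^ 2 * Eb (p j) n (fun k => (|(k : ℝ) - n * p j| / √n) ^ 2) ≤
      K / n * ((n : ℝ) ^ θ) ^ 2 * (4 * Real.exp 1) := by gcongr
  have h15 : K / n * ((n : ℝ) ^ θ) ^ 2 * (4 * Real.exp 1) = K * (4 * Real.exp 1) / n * ((n : ℝ) ^ θ) ^ 2 := by ring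
  have h16 : K * (4 * Real.exp 1) / n * ((n : ℝ) ^ θ) ^ 2 ≤ ε / 2 * ((n : ℝ) ^ θ) ^ 2 := by gcongr
  linarith

theorem Eb_sq_le {p : ℝ} (h0 : 0 ≤ p) (h1 : p ≤ 1) (n : ℕ) (g : ℕ → ℝ) :
    (Eb p n g) ^ 2 ≤ Eb p n (fun k => g k ^ 2) :=
  Eb_jensen_convex h0 h1 n (φ := fun x => x ^ 2) (s := Set.univ) (Even.convexOn_pow even_two) g (fun _ => trivial)

theorem Eb_asy {M A : ℕ} {p : Fin A → ℝ} {ρ d θ : ℝ} (P : Par M A p ρ) (hd : 0 < d) (hθ : 0 ≤ θ) {f : ℕ → ℝ} {Q : ℝ → ℝ}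
    (h : AsyQ p d θ f Q) (j : Fin A) :
    Tendsto (fun n : ℕ => Eb (p j) n f / (n : ℝ) ^ θ - p j ^ θ * Q (Real.log n)) atTop (𝓝 0) := by
  have h1 := h.floor hd (P.p0 j)
  have h2 : Tendsto (fun n : ℕ => (Eb (p j) n f - f ⌊(n : ℝ) * p j⌋₊) / (n : ℝ) ^ θ) atTop (𝓝 0) := by
    rw [Metric.tendsto_atTop']
    intro ε hε
    have h3 := (conc P hd hθ h j (ε := (ε / 2) ^ 2) (by positivity)).and (eventually_ge_atTop 1)
    obtain ⟨N, hN⟩ := eventually_atTop.1 h3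
    refine ⟨N, fun n hn => ?_⟩
    obtain ⟨h4, h5⟩ := hN n hn.le
    have hn0 : (0 : ℝ) < n := by exact_mod_cast h5
    have hX : 0 < (n : ℝ) ^ θ := by positivity
    rw [Real.dist_eq, sub_zero, abs_div, abs_of_pos hX, div_lt_iff₀ hX]
    have h6 := (Eb_sq_le (P.p0' j) (P.p1' j) n (fun k => f k - f ⌊(n : ℝ) * p j⌋₊)).trans h4
    rw [Eb_sub, Eb_const, ← mul_pow] at h6
    have h7 := abs_le_of_sq_le_sq h6 (by positivity)
    have : |Eb (p j) n f - f ⌊(n : ℝ) * p j⌋₊| ≤ ε / 2 * (n : ℝ) ^ θ := h7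
    nlinarith
  have h3 := h1.add h2
  rw [add_zero] at h3
  refine h3.congr fun n => ?_
  ring
end Part10

section Part11
open Finset MeasureTheory Filter Topology

noncomputable def dD {A : ℕ} (p : Fin A → ℝ) (m : ℕ → ℝ) (n : ℕ) (j : Fin A) : ℝ :=
  m (⌊(n : ℝ) * p j⌋₊ + 1) - m ⌊(n : ℝ) * p j⌋₊

noncomputable def xx {A : ℕ} (p : Fin A → ℝ) (m : ℕ → ℝ) (n : ℕ) (j : Fin A) : ℝ :=
  dD p m n j - ∑ i, p i * dD p m n i

theorem xx_mean {A : ℕ} {p : Fin A → ℝ} (hps : ∑ j, p j = 1) (m : ℕ → ℝ) (n : ℕ) :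
    ∑ j, p j * xx p m n j = 0 := by
  simp only [xx, mul_sub, Finset.sum_sub_distrib, ← Finset.sum_mul, hps, one_mul, sub_self]

theorem xx_sq {A : ℕ} {p : Fin A → ℝ} (hps : ∑ j, p j = 1) (m : ℕ → ℝ) (n : ℕ) :
    ∑ j, p j * xx p m n j ^ 2 = ∑ j, p j * dD p m n j ^ 2 - (∑ i, p i * dD p m n i) ^ 2 := by
  set a := ∑ i, p i * dD p m n i with ha
  have : ∀ j, p j * xx p m n j ^ 2 = p j * dD p m n j ^ 2 - 2 * a * (p j * dD p m n j) + a ^ 2 * p j := by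
    intro j; rw [xx, ← ha]; ring
  simp only [this, Finset.sum_add_distrib, Finset.sum_sub_distrib, ← Finset.mul_sum, hps, ← ha]
  ring

theorem xx_unif {A : ℕ} {p : Fin A → ℝ} (hps : ∑ j, p j = 1) (m : ℕ → ℝ) (n : ℕ)
    (hu : ∀ j, p j = 1 / (A : ℝ)) (j : Fin A) : xx p m n j = 0 := by
  have : ∀ i, dD p m n i = dD p m n j := fun i => by simp only [dD, hu]
  simp only [xx, this, ← Finset.sum_mul, hps, one_mul, sub_self]

theorem lin_eq {A : ℕ} {p : Fin A → ℝ} (hps : ∑ j, p j = 1) (m : ℕ → ℝ) (n : ℕ) (c : Fin n → Fin A) :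
    ∑ k, xx p m n (c k) = ∑ j, xx p m n j * ((cnt c j : ℝ) - n * p j) := by
  rw [sum_color c (xx p m n)]
  simp only [mul_sub, Finset.sum_sub_distrib]
  have : ∑ j, xx p m n j * ((n : ℝ) * p j) = n * ∑ j, p j * xx p m n j := by
    rw [Finset.mul_sum]; exact Finset.sum_congr rfl fun j _ => by ring
  rw [this, xx_mean hps, mul_zero, sub_zero]

namespace Rec
variable {M A : ℕ} {p : Fin A → ℝ} {ρ α β γ : ℝ} {m V : ℕ → ℝ}

theorem dD_bound (R : Rec M A p ρ α β γ m V) : ∃ C > 0, ∀ n : ℕ, 1 ≤ n → (∀ j, |dD p m n j| ≤ C * (n : ℝ) ^ (ρ - 1)) ∧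
    (∀ j, |xx p m n j| ≤ C * (n : ℝ) ^ (ρ - 1)) := by
  have P := R.P
  have r1 := P.r1
  have r2 := P.r2
  obtain ⟨C, hC, -, h2, -⟩ := R.bounds
  refine ⟨4 * C, by positivity, fun n hn => ?_⟩
  have hn1 : (1 : ℝ) ≤ n := by exact_mod_cast hn
  have h : ∀ j, |dD p m n j| ≤ 2 * C * (n : ℝ) ^ (ρ - 1) := by
    intro j
    refine (h2 _).trans ?_
    have hl : ((⌊(n : ℝ) * p j⌋₊ : ℕ) : ℝ) ≤ n :=
      (Nat.floor_le (mul_nonneg (by positivity) (P.p0' j))).trans (by nlinarith [P.p1' j])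
    calc C * (((⌊(n : ℝ) * p j⌋₊ : ℕ) : ℝ) + 1) ^ (ρ - 1) ≤ C * (2 * (n : ℝ)) ^ (ρ - 1) := by
          gcongr <;> linarith
      _ = C * 2 ^ (ρ - 1) * (n : ℝ) ^ (ρ - 1) := by rw [Real.mul_rpow (by norm_num) (by positivity)]; ring
      _ ≤ 2 * C * (n : ℝ) ^ (ρ - 1) := by
          have : (2 : ℝ) ^ (ρ - 1) ≤ 2 ^ (1 : ℝ) := Real.rpow_le_rpow_of_exponent_le (by norm_num) (by linarith)
          rw [Real.rpow_one] at this
          gcongr ?_ * _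
          nlinarith
  have hX : 0 < (n : ℝ) ^ (ρ - 1) := by positivity
  have hm : |∑ i, p i * dD p m n i| ≤ 2 * C * (n : ℝ) ^ (ρ - 1) := by
    refine (Finset.abs_sum_le_sum_abs _ _).trans ?_
    calc ∑ i, |p i * dD p m n i| ≤ ∑ i, p i * (2 * C * (n : ℝ) ^ (ρ - 1)) := by
          apply Finset.sum_le_sum; intro i _
          rw [abs_mul, abs_of_pos (P.p0 i)]
          exact mul_le_mul_of_nonneg_left (h i) (P.p0' i)
      _ = _ := by rw [← Finset.sum_mul, P.ps, one_mul]
  refine ⟨fun j => (h j).trans ?_, fun j => ?_⟩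
  · nlinarith [mul_pos hC hX]
  · have := abs_sub (dD p m n j) (∑ i, p i * dD p m n i)
    rw [xx]
    linarith [h j]

theorem lin_bound (R : Rec M A p ρ α β γ m V) {C : ℝ} (hC : 0 < C) {n : ℕ} (hn : 1 ≤ n) (h : ∀ j, |xx p m n j| ≤ C * (n : ℝ) ^ (ρ - 1))
    (c : Fin n → Fin A) : |∑ k, xx p m n (c k)| ≤ C * (n : ℝ) ^ (ρ - 1/2) * Ud p n c := by
  have P := R.P
  have hn1 : (1 : ℝ) ≤ n := by exact_mod_cast hn
  rw [lin_eq P.ps]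
  refine (Finset.abs_sum_le_sum_abs _ _).trans ?_
  have hs : 0 < √(n : ℝ) := by positivity
  have e : (n : ℝ) ^ (ρ - 1/2) = (n : ℝ) ^ (ρ - 1) * √n := by
    rw [Real.sqrt_eq_rpow, ← Real.rpow_add (by linarith)]; congr 1; ring
  calc ∑ j, |xx p m n j * ((cnt c j : ℝ) - n * p j)|
      ≤ ∑ j, C * (n : ℝ) ^ (ρ - 1/2) * (|(cnt c j : ℝ) - n * p j| / √n) := by
        apply Finset.sum_le_sum; intro j _
        rw [abs_mul, e]
        calc |xx p m n j| * |(cnt c j : ℝ) - n * p j| ≤ C * (n : ℝ) ^ (ρ - 1) * |(cnt c j : ℝ) - n * p j| := by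
              gcongr; exact h j
          _ = _ := by field_simp
    _ = C * (n : ℝ) ^ (ρ - 1/2) * ∑ j, (|(cnt c j : ℝ) - n * p j| / √n) := by rw [Finset.mul_sum]
    _ ≤ _ := by
        gcongr
        unfold Ud
        linarith

theorem decomp (R : Rec M A p ρ α β γ m V) : ∃ C > 0, ∀ n : ℕ, 1 ≤ n → (∀ j, |xx p m n j| ≤ C * (n : ℝ) ^ (ρ - 1)) ∧
    (∀ c : Fin n → Fin A, |∑ k, xx p m n (c k)| ≤ C * (n : ℝ) ^ (ρ - 1/2) * Ud p n c) ∧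
    (∀ c : Fin n → Fin A, |gt p m n c - ∑ k, xx p m n (c k)| ≤ C * (n : ℝ) ^ (ρ - 1) * Ud p n c ^ 4) := by
  have P := R.P
  have r1 := P.r1
  have r2 := P.r2
  obtain ⟨C1, hC1, h1⟩ := R.dD_bound
  obtain ⟨C2, hC2, -, -, h3⟩ := R.bounds
  obtain ⟨CU, hCU, hU⟩ := Ud_moment P.p0' P.p1' P.ps 4
  set K := ∑ j, C2 * (160 / p j ^ 2) with hK
  have hK0 : 0 ≤ K := Finset.sum_nonneg fun j _ => by have := P.p0 j; positivity
  refine ⟨C1 + K * (1 + CU), by positivity, fun n hn => ?_⟩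
  obtain ⟨-, h1x⟩ := h1 n hn
  have hn1 : (1 : ℝ) ≤ n := by exact_mod_cast hn
  have hX : 0 < (n : ℝ) ^ (ρ - 1) := by positivity
  have hKC : 0 ≤ K * (1 + CU) := by positivity
  refine ⟨fun j => (h1x j).trans (by gcongr; linarith), fun c => (R.lin_bound hC1 hn h1x c).trans ?_, fun c => ?_⟩
  · have : 1 ≤ Ud p n c := Ud_one_le p n c
    gcongr
    linarith
  set l : Fin A → ℕ := fun j => ⌊(n : ℝ) * p j⌋₊ with hl
  set X : (Fin n → Fin A) → ℝ := fun c => ∑ j, (m (cnt c j) - m (l j) - (m (l j + 1) - m (l j)) * ((cnt c j : ℝ) - l j)) with hX'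
  have hXb : ∀ c, |X c| ≤ K * (n : ℝ) ^ (ρ - 1) * Ud p n c ^ 4 := by
    intro c
    refine (Finset.abs_sum_le_sum_abs _ _).trans ?_
    rw [hK, Finset.sum_mul, Finset.sum_mul]
    apply Finset.sum_le_sum
    intro j _
    have hp := P.p0 j
    have hl1 : ((l j : ℕ) : ℝ) ≤ n * p j := Nat.floor_le (by positivity)
    have hl2 : n * p j < ((l j : ℕ) : ℝ) + 1 := Nat.lt_floor_add_one _
    have := approx2 (P.p0 j) (P.p1' j) (η := ρ - 2) (by linarith) (by linarith) hC2.le h3 hn (cnt c j) (l j)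
      (by rw [abs_le]; constructor <;> linarith)
    refine this.trans ?_
    rw [show ρ - 2 + 1 = ρ - 1 by ring]
    gcongr
    exact dev_le_Ud p n c j
  have hEX : |EE p n X| ≤ K * (n : ℝ) ^ (ρ - 1) * CU := by
    have h5 := EE_norm_le (E := ℝ) P.p0' n X
    rw [Real.norm_eq_abs] at h5
    refine h5.trans ((EE_mono P.p0' n hXb).trans ?_)
    rw [EE_mul]
    gcongr
    exact hU n hn
  set k0 := ∑ j, (m (l j) - dD p m n j * l j) + n * ∑ i, p i * dD p m n i with hk0
  have e1 : ∀ c : Fin n → Fin A, ∑ j, m (cnt c j) = (X c + k0) + ∑ k, xx p m n (c k) := by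
    intro c
    have e2 : ∑ k, xx p m n (c k) = ∑ j, dD p m n j * cnt c j - n * ∑ i, p i * dD p m n i := by
      rw [sum_color c (xx p m n)]
      simp only [xx, sub_mul, Finset.sum_sub_distrib, ← Finset.mul_sum]
      rw [sum_cnt c]; ring
    rw [e2, hk0, hX', show ∀ a b c d : ℝ, a + (b + c) + (d - c) = a + b + d by intros; ring,
      ← Finset.sum_add_distrib, ← Finset.sum_add_distrib]
    apply Finset.sum_congr rfl
    intro j _
    simp only [dD, ← hl]
    change _ = m (cnt c j) - m (l j) - (m (l j + 1) - m (l j)) * (↑(cnt c j) - ↑(l j)) +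
      (m (l j) - (m (l j + 1) - m (l j)) * (l j)) + (m (l j + 1) - m (l j)) * (cnt c j)
    ring
  have e3 : gt p m n c - ∑ k, xx p m n (c k) = X c - EE p n X := by
    unfold gt
    simp only [e1]
    rw [EE_add, EE_add, EE_const P.ps, (EE_lin_sq P.ps (xx p m n) (xx_mean P.ps m n) n).1]
    ring
  rw [e3]
  have h6 := abs_sub (X c) (EE p n X)
  have h7 := hXb c
  have hU1 := one_le_pow₀ (n := 4) (Ud_one_le p n c)
  have h8 : K * (n : ℝ) ^ (ρ - 1) * CU ≤ K * CU * (n : ℝ) ^ (ρ - 1) * Ud p n c ^ 4 := by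
    rw [show K * (n : ℝ) ^ (ρ - 1) * CU = K * CU * (n : ℝ) ^ (ρ - 1) by ring]
    exact le_mul_of_one_le_right (by positivity) hU1
  have h9 : 0 ≤ C1 * (n : ℝ) ^ (ρ - 1) * Ud p n c ^ 4 := by positivity
  have : (C1 + K * (1 + CU)) * (n : ℝ) ^ (ρ - 1) * Ud p n c ^ 4 =
    C1 * (n : ℝ) ^ (ρ - 1) * Ud p n c ^ 4 + K * (n : ℝ) ^ (ρ - 1) * Ud p n c ^ 4 +
     K * CU * (n : ℝ) ^ (ρ - 1) * Ud p n c ^ 4 := by ring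
  linarith

theorem second (R : Rec M A p ρ α β γ m V) : ∃ C > 0, ∀ n : ℕ, 1 ≤ n →
    |EE p n (fun c => gt p m n c ^ 2) - n * ∑ j, p j * xx p m n j ^ 2| ≤ C * (n : ℝ) ^ (2 * ρ - 3/2) ∧
    ((∀ j, p j = 1 / (A : ℝ)) → EE p n (fun c => gt p m n c ^ 2) ≤ C * (n : ℝ) ^ (2 * ρ - 2)) := by
  have P := R.P
  obtain ⟨C, hC, h⟩ := R.decomp
  obtain ⟨CU, hCU, hU⟩ := Ud_moment P.p0' P.p1' P.ps 8
  refine ⟨3 * C ^ 2 * CU, by positivity, fun n hn => ?_⟩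
  obtain ⟨-, hL, hR⟩ := h n hn
  have hn1 : (1 : ℝ) ≤ n := by exact_mod_cast hn
  have hn0 : (0 : ℝ) < n := by linarith
  have x1 : (n : ℝ) ^ (ρ - 1) * (n : ℝ) ^ (ρ - 1/2) = (n : ℝ) ^ (2 * ρ - 3/2) := by
    rw [← Real.rpow_add hn0]; congr 1; ring
  have x2 : (n : ℝ) ^ (ρ - 1) * (n : ℝ) ^ (ρ - 1) = (n : ℝ) ^ (2 * ρ - 2) := by
    rw [← Real.rpow_add hn0]; congr 1; ring
  have x3 : (n : ℝ) ^ (ρ - 1) ≤ (n : ℝ) ^ (ρ - 1/2) := Real.rpow_le_rpow_of_exponent_le hn1 (by linarith)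
  set a := (n : ℝ) ^ (ρ - 1)
  set b := (n : ℝ) ^ (ρ - 1/2)
  have ha : 0 < a := by positivity
  have hb : 0 < b := by positivity
  constructor
  · rw [← (EE_lin_sq P.ps (xx p m n) (xx_mean P.ps m n) n).2, ← EE_sub, ← x1]
    have h5 := EE_norm_le (E := ℝ) P.p0' n (fun c => gt p m n c ^ 2 - (∑ k, xx p m n (c k)) ^ 2)
    rw [Real.norm_eq_abs] at h5
    refine h5.trans ?_
    have : ∀ c : Fin n → Fin A, ‖gt p m n c ^ 2 - (∑ k, xx p m n (c k)) ^ 2‖ ≤ 3 * C ^ 2 * (a * b) * Ud p n c ^ 8 := by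
      intro c
      rw [Real.norm_eq_abs]
      have h1 := hL c
      have h2 := hR c
      have hU1 := Ud_one_le p n c
      set u := Ud p n c
      set L := ∑ k, xx p m n (c k)
      have e : gt p m n c ^ 2 - L ^ 2 = (gt p m n c - L) * ((gt p m n c - L) + 2 * L) := by ring
      rw [e, abs_mul]
      have h3 : |(gt p m n c - L) + 2 * L| ≤ 3 * C * b * u ^ 4 := by
        refine (abs_add_le _ _).trans ?_
        rw [abs_mul, abs_of_pos (by norm_num : (0 : ℝ) < 2)]
        have : u ≤ u ^ 4 := le_self_pow₀ hU1 (by norm_num)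
        have : C * b * u ≤ C * b * u ^ 4 := by gcongr
        have : C * a * u ^ 4 ≤ C * b * u ^ 4 := by gcongr
        linarith
      calc |gt p m n c - L| * |(gt p m n c - L) + 2 * L| ≤ (C * a * u ^ 4) * (3 * C * b * u ^ 4) := by gcongr
        _ = _ := by ring
    refine (EE_mono P.p0' n this).trans ?_
    rw [EE_mul]
    calc _ ≤ 3 * C ^ 2 * (a * b) * CU := by gcongr; exact hU n hn
      _ = _ := by ring
  · intro hu
    rw [← x2]
    have : ∀ c : Fin n → Fin A, gt p m n c ^ 2 ≤ C ^ 2 * (a * a) * Ud p n c ^ 8 := by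
      intro c
      have h2 := hR c
      simp only [xx_unif P.ps m n hu, Finset.sum_const_zero, sub_zero] at h2
      have := pow_le_pow_left₀ (abs_nonneg _) h2 2
      rw [sq_abs] at this
      refine this.trans (le_of_eq (by ring))
    refine (EE_mono P.p0' n this).trans ?_
    rw [EE_mul]
    calc _ ≤ C ^ 2 * (a * a) * CU := by gcongr; exact hU n hn
      _ ≤ _ := by nlinarith [mul_pos (mul_pos (pow_pos hC 2) (mul_pos ha ha)) hCU]

theorem toll_nn (R : Rec M A p ρ α β γ m V) (n : ℕ) : 0 ≤ (M : ℝ) * EE p n (fun c => gt p m n c ^ 2) :=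
  mul_nonneg R.P.Mpos.le (EE_nonneg R.P.p0' n fun c => sq_nonneg _)

theorem Vnn (R : Rec M A p ρ α β γ m V) : ∀ n, 0 ≤ V n := by
  have P := R.P
  have : ∀ n, - V n ≤ 0 := by
    apply comparison' (c := fun _ => (M : ℝ)) (a := fun _ => 0) (n0 := 2) (f := fun n => - V n) (b := fun _ => 0)
      P.p0' P.p1' (fun _ => P.Mpos.le) (fun n hn => P.powlt hn)
    · intro n hn
      simp only [Eb_neg]
      have := R.Vr n hn
      have := R.toll_nn n
      simp only [mul_neg, Finset.sum_neg_distrib]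
      linarith
    · intro n hn; simp [Eb_const]
    · intro n hn
      have := R.V0; have := R.V1
      interval_cases n <;> linarith
  intro n; linarith [this n]

theorem Vpos (R : Rec M A p ρ α β γ m V) : ∀ n ≥ 2, 0 < V n := by
  have P := R.P
  have hA := P.hA
  have hsum : ∀ n, 0 ≤ ∑ j, (M : ℝ) * Eb (p j) n V := fun n => Finset.sum_nonneg fun j _ =>
    mul_nonneg P.Mpos.le (Eb_nonneg (P.p0' j) (P.p1' j) n fun k _ => R.Vnn k)
  have h2 : 0 < V 2 := by
    rw [R.Vr 2 le_rfl]
    have : 0 < EE p 2 (fun c => gt p m 2 c ^ 2) := by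
      by_contra! hcon
      have h0 : ∀ c : Fin 2 → Fin A, gt p m 2 c = 0 := by
        intro c
        have hw : 0 < ∏ k, p (c k) := Finset.prod_pos fun k _ => P.p0 _
        have : (∏ k, p (c k)) • gt p m 2 c ^ 2 ≤ EE p 2 (fun c => gt p m 2 c ^ 2) :=
          Finset.single_le_sum (f := fun c : Fin 2 → Fin A => (∏ k, p (c k)) • gt p m 2 c ^ 2)
            (fun c _ => mul_nonneg (Finset.prod_nonneg fun k _ => P.p0' _) (sq_nonneg _)) (mem_univ c)
        rw [smul_eq_mul] at this
        have h5 : gt p m 2 c ^ 2 ≤ 0 := by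
          by_contra! h6
          have := mul_pos hw h6
          linarith
        exact pow_eq_zero_iff (two_ne_zero) |>.1 (le_antisymm h5 (sq_nonneg _))
      set i0 : Fin A := ⟨0, by omega⟩
      set i1 : Fin A := ⟨1, by omega⟩
      have hne : i0 ≠ i1 := by simp [i0, i1]
      have e0 := h0 ![i0, i0]
      have e1 := h0 ![i0, i1]
      unfold gt at e0 e1
      have e2 : ∑ j, m (cnt ![i0, i0] j) - ∑ j, m (cnt ![i0, i1] j) = 0 := by linarith
      have c0 : ∀ j, cnt ![i0, i0] j = (if i0 = j then 1 else 0) + (if i0 = j then 1 else 0) := by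
        intro j
        simp only [cnt, Finset.card_filter, Fin.sum_univ_two, Matrix.cons_val_zero, Matrix.cons_val_one]
        congr
      have c1 : ∀ j, cnt ![i0, i1] j = (if i0 = j then 1 else 0) + (if i1 = j then 1 else 0) := by
        intro j
        simp only [cnt, Finset.card_filter, Fin.sum_univ_two, Matrix.cons_val_zero, Matrix.cons_val_one]
        congr
      rw [← Finset.sum_sub_distrib] at e2
      have e3 : ∀ j, m (cnt ![i0, i0] j) - m (cnt ![i0, i1] j) =
          (if i0 = j then m 2 - m 1 else 0) + (if i1 = j then m 0 - m 1 else 0) := by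
        intro j
        rw [c0, c1]
        by_cases h1 : i0 = j
        · have : i1 ≠ j := by rw [← h1]; exact hne.symm
          simp [h1, this]
        · by_cases h2 : i1 = j
          · simp [h1, h2]
          · simp [h1, h2]
      rw [Finset.sum_congr rfl fun j _ => e3 j, Finset.sum_add_distrib, Finset.sum_ite_eq, Finset.sum_ite_eq] at e2
      simp only [mem_univ, if_true, R.m0, R.m1] at e2
      linarith [R.m2gt]
    have := mul_pos P.Mpos this
    linarith [hsum 2]
  intro n hn
  rcases eq_or_lt_of_le hn with h | h
  · rw [← h]; exact h2
  rw [R.Vr n hn]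
  obtain ⟨j⟩ := P.ne
  have hp := P.p0 j
  have hp1 := P.p1 j
  have h3 : 0 < Eb (p j) n V := by
    obtain ⟨k, rfl⟩ : ∃ k, n = k + 1 + 1 := ⟨n - 2, by omega⟩
    have h4 : Eb (p j) (k+1+1) (fun i => V 2 * (if i = 2 then 1 else 0)) ≤ Eb (p j) (k+1+1) V := by
      apply Eb_mono hp.le hp1.le
      intro i _
      by_cases hi : i = 2
      · subst hi; simp
      · simp [hi, R.Vnn]
    refine lt_of_lt_of_le ?_ h4
    rw [Eb_smul]
    apply mul_pos h2
    rw [Eb_succ]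
    have e : (fun k : ℕ => if k + 1 = 2 then (1 : ℝ) else 0) = fun k => if k = 1 then 1 else 0 := by
      funext k; simp
    rw [e, Eb_ind_one]
    have h5 : 0 ≤ Eb (p j) (k+1) (fun i => if i = 2 then 1 else 0) :=
      Eb_nonneg hp.le hp1.le _ fun i _ => by split_ifs <;> norm_num
    have hq : 0 < 1 - p j := by linarith
    positivity
  have h4 : (M : ℝ) * Eb (p j) n V ≤ ∑ j, (M : ℝ) * Eb (p j) n V :=
    Finset.single_le_sum (f := fun j => (M : ℝ) * Eb (p j) n V) (fun j _ =>
    mul_nonneg P.Mpos.le (Eb_nonneg (P.p0' j) (P.p1' j) n fun k _ => R.Vnn k)) (mem_univ j)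
  have := mul_pos P.Mpos h3
  linarith [R.toll_nn n]

theorem Vlow (R : Rec M A p ρ α β γ m V) : ∃ c0 > 0, ∀ n : ℕ, 2 ≤ n → c0 * (n : ℝ) ^ ρ ≤ V n := by
  have P := R.P
  refine lower P (by linarith [P.r1]) P.r2 (c := fun _ => (M : ℝ)) (r := fun _ => 0) (fun _ => P.Mpos.le) P.pi_sum
    (fun n hn => P.powlt hn) (fun k _ => R.Vnn k) R.Vpos (fun n hn _ => ?_) (Or.inl fun n => le_rfl)
  have := R.Vr n hn
  have := R.toll_nn n
  linarith

end Rec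
end Part11

section Part12
open Finset MeasureTheory Filter Topology

section
variable {A : ℕ} {p : Fin A → ℝ} {d θ : ℝ} {f g : ℕ → ℝ} {Q Q' : ℝ → ℝ}

theorem AsyQ.sub' (h : AsyQ p d θ f Q) (h' : AsyQ p d θ g Q') :
    AsyQ p d θ (fun n => f n - g n) (fun s => Q s - Q' s) :=
  ⟨h.cont.sub h'.cont, fun s => by rw [h.per, h'.per], fun j s => by rw [h.pery, h'.pery], by
    have := h.lim.sub h'.lim
    rw [sub_zero] at this
    refine this.congr fun n => ?_
    rw [sub_div]; ring⟩

theorem AsyQ.const_lin (c : ℝ) : AsyQ p d 1 (fun n => c * (n : ℝ)) (fun _ => c) :=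
  ⟨continuous_const, fun _ => rfl, fun _ _ => rfl, by
    refine tendsto_const_nhds.congr' ?_
    filter_upwards [eventually_ge_atTop 1] with n hn
    have : (0 : ℝ) < n := by exact_mod_cast hn
    rw [Real.rpow_one, mul_div_cancel_right₀ _ this.ne', sub_self]⟩

theorem sq_lim {x q : ℕ → ℝ} {B : ℝ} (hq : ∀ n, |q n| ≤ B) (h : Tendsto (fun n => x n - q n) atTop (𝓝 0)) :
    Tendsto (fun n => x n ^ 2 - q n ^ 2) atTop (𝓝 0) := by
  have h1 : Tendsto (fun n => (x n - q n) * q n) atTop (𝓝 0) := by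
    refine squeeze_zero_norm (a := fun n => |x n - q n| * B) (fun n => ?_) ?_
    · rw [Real.norm_eq_abs, abs_mul]; exact mul_le_mul_of_nonneg_left (hq n) (abs_nonneg _)
    · simpa using h.abs.mul_const B
  have := (h.mul h).add (h1.const_mul 2)
  simp only [mul_zero, add_zero] at this
  refine this.congr fun n => by ring

theorem AsyQ.sq_mul (hd : 0 < d) (h : AsyQ p d θ f Q) :
    AsyQ p d (2 * θ + 1) (fun n => (n : ℝ) * f n ^ 2) (fun s => Q s ^ 2) := by
  obtain ⟨⟨B, hB, hQ⟩, -⟩ := per_unif hd h.cont h.per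
  refine ⟨h.cont.pow 2, fun s => by rw [h.per], fun j s => by rw [h.pery], ?_⟩
  have := sq_lim (q := fun n : ℕ => Q (Real.log n)) (fun n => hQ _) h.lim
  refine this.congr' ?_
  filter_upwards [eventually_ge_atTop 1] with n hn
  have hn : (0 : ℝ) < n := by exact_mod_cast hn
  congr 1
  rw [Real.rpow_add hn, Real.rpow_one, mul_comm (2 : ℝ), Real.rpow_mul hn.le, div_pow]
  have : (0:ℝ) < (n : ℝ) ^ θ := by positivity
  rw [Real.rpow_two]
  field_simp

theorem AsyQ.sub_small (h : AsyQ p d θ f Q) (hθ : 1 < θ) (c : ℝ) :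
    AsyQ p d θ (fun n => f n - c * (n : ℝ)) Q := by
  refine ⟨h.cont, h.per, h.pery, ?_⟩
  have h2 : Tendsto (fun n : ℕ => c * (n : ℝ) ^ (-(θ - 1))) atTop (𝓝 (c * 0)) :=
    ((tendsto_rpow_neg_atTop (by linarith)).comp tendsto_natCast_atTop_atTop).const_mul c
  have := h.lim.sub h2
  rw [mul_zero, sub_zero] at this
  refine this.congr' ?_
  filter_upwards [eventually_ge_atTop 1] with n hn
  have hn : (0 : ℝ) < n := by exact_mod_cast hn
  rw [neg_sub, Real.rpow_sub hn, Real.rpow_one, sub_div]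
  ring
end

namespace Rec
variable {M A : ℕ} {p : Fin A → ℝ} {ρ α β γ : ℝ} {m V : ℕ → ℝ}

theorem var1_toll (R : Rec M A p ρ α β γ m V) (hρ : ρ = 1) (hM : M = 1) : ∃ C > 0, ∀ n : ℕ, 2 ≤ n →
    |EE p n (fun c => gt p m n c ^ 2) + n * (m (n+1) - m n) ^ 2 -
      ∑ j, Eb (p j) n (fun k => (k : ℝ) * (m (k+1) - m k) ^ 2)| ≤ C * (n : ℝ) ^ ((1:ℝ)/2) := by
  have P := R.P
  subst hρ hM
  obtain ⟨C, hC, -, hb1, hb2⟩ := R.bounds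
  simp only [sub_self, Real.rpow_zero, mul_one] at hb1
  obtain ⟨C2, hC2, h2⟩ := R.second
  have hdiff : ∀ k : ℕ, |(fun k : ℕ => m (k+1) - m k) (k+1) - (fun k : ℕ => m (k+1) - m k) k| ≤ C * ((k : ℝ) + 1) ^ (-1 : ℝ) := by
    intro k
    have := hb2 k
    norm_num at this ⊢
    exact this
  obtain ⟨C3, hC3, h3⟩ := Eb_approx P (η := -1) (by norm_num) (by norm_num) hC.le (f := fun k : ℕ => m (k+1) - m k) hdiff
  have hdw : ∀ k : ℕ, |(fun k : ℕ => (k : ℝ) * (m (k+1) - m k)^2) (k+1) - (fun k : ℕ => (k : ℝ) * (m (k+1) - m k)^2) k|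
      ≤ 3 * C ^ 2 * ((k : ℝ) + 1) ^ (0 : ℝ) := by
    intro k
    rw [Real.rpow_zero, mul_one]
    have e1 := hdiff k
    simp only at e1 ⊢
    set x := m (k+1) - m k with hx
    set y := m (k+1+1) - m (k+1) with hy
    have hx1 : |x| ≤ C := hb1 k
    have hy1 : |y| ≤ C := hb1 (k+1)
    have e2 : (k : ℝ) * |y - x| ≤ C := by
      rw [Real.rpow_neg_one] at e1
      calc (k : ℝ) * |y - x| ≤ ((k : ℝ) + 1) * (C * ((k : ℝ) + 1)⁻¹) := by gcongr; linarith
        _ = C := by field_simp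
    have : ((k + 1 : ℕ) : ℝ) * y ^ 2 - k * x ^ 2 = y ^ 2 + (k * (y - x)) * (y + x) := by push_cast; ring
    rw [this]
    refine (abs_add_le _ _).trans ?_
    rw [abs_mul, abs_mul, abs_of_nonneg (Nat.cast_nonneg k : (0:ℝ) ≤ k), abs_of_nonneg (sq_nonneg y)]
    have h5 : y ^ 2 ≤ C ^ 2 := by rw [← sq_abs]; gcongr
    have h6 : |y + x| ≤ 2 * C := (abs_add_le _ _).trans (by linarith)
    have h7 : (k : ℝ) * |y - x| * |y + x| ≤ C * (2 * C) := by gcongr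
    linarith
  obtain ⟨C4, hC4, h4⟩ := Eb_approx P (η := 0) (by norm_num) (by norm_num) (by positivity) (f := fun k : ℕ => (k : ℝ) * (m (k+1) - m k)^2) hdw
  refine ⟨C2 + 2 * C * C3 + A * (C4 + C ^ 2), by positivity, fun n hn => ?_⟩
  have hn1 : 1 ≤ n := by omega
  have hnR : (1 : ℝ) ≤ n := by exact_mod_cast hn1
  set s := (n : ℝ) ^ ((1:ℝ)/2) with hs
  have hs1 : 1 ≤ s := Real.one_le_rpow hnR (by norm_num)
  have hl : ∀ j, |((⌊(n : ℝ) * p j⌋₊ : ℕ) : ℝ) - n * p j| ≤ 1 := by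
    intro j
    have h1 : 0 ≤ (n : ℝ) * p j := mul_nonneg (by linarith) (P.p0' j)
    have := Nat.floor_le h1
    have := Nat.lt_floor_add_one ((n : ℝ) * p j)
    rw [abs_le]; constructor <;> linarith
  have k1 := (h2 n hn1).1
  rw [show 2 * (1:ℝ) - 3/2 = 1/2 by norm_num, ← hs] at k1
  rw [xx_sq P.ps] at k1
  set D := fun j => dD p m n j with hD
  set a := ∑ i, p i * dD p m n i with ha
  set dn := m (n+1) - m n with hdn
  have k2 : |dn - a| ≤ C3 * (n : ℝ) ^ (-(1:ℝ)/2) := by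
    have := R.dr n hn
    simp only [Nat.cast_one, one_mul] at this
    rw [hdn, this, ha, ← Finset.sum_sub_distrib]
    refine (Finset.abs_sum_le_sum_abs _ _).trans ?_
    calc _ ≤ ∑ j, p j * (C3 * (n : ℝ) ^ (-(1:ℝ)/2)) := by
          apply Finset.sum_le_sum; intro j _
          rw [← mul_sub, abs_mul, abs_of_pos (P.p0 j)]
          apply mul_le_mul_of_nonneg_left _ (P.p0' j)
          have := (h3 n hn1 j ⌊(n : ℝ) * p j⌋₊ ((hl j).trans (by norm_num))).2
          rw [show (-1 : ℝ) + 1/2 = -(1:ℝ)/2 by norm_num] at this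
          exact this
      _ = _ := by rw [← Finset.sum_mul, P.ps, one_mul]
  have hDb : ∀ j, |dD p m n j| ≤ C := fun j => hb1 _
  have hab : |a| ≤ C := by
    refine (Finset.abs_sum_le_sum_abs _ _).trans ?_
    calc _ ≤ ∑ j, p j * C := by
          apply Finset.sum_le_sum; intro j _
          rw [abs_mul, abs_of_pos (P.p0 j)]
          exact mul_le_mul_of_nonneg_left (hDb j) (P.p0' j)
      _ = _ := by rw [← Finset.sum_mul, P.ps, one_mul]
  have k3 : |(n : ℝ) * dn ^ 2 - n * a ^ 2| ≤ 2 * C * C3 * s := by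
    have : (n : ℝ) * dn ^ 2 - n * a ^ 2 = n * ((dn - a) * (dn + a)) := by ring
    rw [this, abs_mul, abs_mul, abs_of_nonneg (by linarith)]
    have h6 : |dn + a| ≤ 2 * C := (abs_add_le _ _).trans (by linarith [hb1 n])
    calc (n : ℝ) * (|dn - a| * |dn + a|) ≤ n * ((C3 * (n : ℝ) ^ (-(1:ℝ)/2)) * (2 * C)) := by gcongr
      _ = 2 * C * C3 * (n * (n : ℝ) ^ (-(1:ℝ)/2)) := by ring
      _ = 2 * C * C3 * s := by
        rw [hs]; congr 1
        nth_rewrite 1 [← Real.rpow_one (n : ℝ)]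
        rw [← Real.rpow_add (by linarith)]; norm_num
  have k4 : |∑ j, Eb (p j) n (fun k => (k : ℝ) * (m (k+1) - m k) ^ 2) - n * ∑ j, p j * dD p m n j ^ 2| ≤
      A * (C4 + C ^ 2) * s := by
    rw [Finset.mul_sum, ← Finset.sum_sub_distrib]
    refine (Finset.abs_sum_le_sum_abs _ _).trans ?_
    calc _ ≤ ∑ j : Fin A, (C4 + C ^ 2) * s := by
          apply Finset.sum_le_sum; intro j _
          have e1 := (h4 n hn1 j ⌊(n : ℝ) * p j⌋₊ ((hl j).trans (by norm_num))).2
          rw [zero_add, ← hs] at e1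
          have e2 : |((⌊(n : ℝ) * p j⌋₊ : ℕ) : ℝ) * dD p m n j ^ 2 - n * (p j * dD p m n j ^ 2)| ≤ C ^ 2 * s := by
            rw [← mul_assoc, ← sub_mul, abs_mul, abs_of_nonneg (sq_nonneg (dD p m n j))]
            have : dD p m n j ^ 2 ≤ C ^ 2 := by rw [← sq_abs]; gcongr; exact hDb j
            calc _ ≤ 1 * C ^ 2 := by gcongr; exact hl j
              _ ≤ _ := by nlinarith [sq_nonneg C]
          have e3 := abs_sub_le (Eb (p j) n (fun k => (k : ℝ) * (m (k+1) - m k) ^ 2))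
            (((⌊(n : ℝ) * p j⌋₊ : ℕ) : ℝ) * dD p m n j ^ 2) (n * (p j * dD p m n j ^ 2))
          refine e3.trans ?_
          have e1' : |Eb (p j) n (fun k => (k : ℝ) * (m (k+1) - m k) ^ 2) - ((⌊(n : ℝ) * p j⌋₊ : ℕ) : ℝ) * dD p m n j ^ 2| ≤ C4 * s := e1
          linarith
      _ = _ := by rw [Finset.sum_const, Finset.card_univ, Fintype.card_fin, nsmul_eq_mul]; ring
  rw [abs_le] at k1 k3 k4 ⊢
  constructor <;> nlinarith

theorem var1 (R : Rec M A p ρ α β γ m V) {d : ℝ} (hd : RenProp M p ρ d) (hρ : ρ = 1) (hM : M = 1) :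
    ∃ Q, AsyQ p d ρ V Q := by
  obtain ⟨C, hC, hT⟩ := R.var1_toll hρ hM
  have P := R.P
  obtain ⟨q, hq⟩ := R.asyD hd
  subst hρ hM
  have hw := hq.sq_mul hd.1
  simp only [sub_self, mul_zero, zero_add] at hw
  set w := fun n : ℕ => (n : ℝ) * (m (n+1) - m n) ^ 2 with hwd
  set c1 := (m 2 - m 1) ^ 2 with hc1
  obtain ⟨QZ, hZ⟩ := thmA' P hd (f := fun n => V n + w n - c1 * n) (C := C) (ε := 1/2)
    (τ := fun n => EE p n (fun c => gt p m n c ^ 2) + w n - ∑ j, Eb (p j) n w) hC.le (by norm_num)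
    (by simp [R.V0, hwd]) (by simp [R.V1, hwd, hc1]) (by
      intro n hn
      have := R.Vr n hn
      simp only [Nat.cast_one, one_mul] at this ⊢
      simp only [Eb_sub, Eb_add, Eb_smul, Eb_id, Finset.sum_add_distrib, Finset.sum_sub_distrib]
      rw [← Finset.mul_sum, ← Finset.mul_sum, P.ps]
      linarith) (by
      intro n hn
      have := hT n hn
      norm_num at this ⊢
      exact this)
  have h9 := (hZ.sub' hw).sub' (AsyQ.const_lin (-c1))
  have e : (fun n : ℕ => V n + w n - c1 * n - w n - -c1 * n) = V := by
    funext n; ring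
  rw [e] at h9
  exact ⟨_, h9⟩

theorem varu (R : Rec M A p ρ α β γ m V) {d : ℝ} (hd : RenProp M p ρ d) (hu : ∀ j, p j = 1 / (A : ℝ)) :
    ∃ Q, AsyQ p d ρ V Q := by
  have P := R.P
  obtain ⟨C, hC, h⟩ := R.second
  have hM := P.Mpos
  refine thmA' P hd (C := M * C) (ε := 2 - ρ) (by positivity) (by linarith [P.r2]) R.V0 R.V1 R.Vr ?_
  intro n hn
  rw [abs_of_nonneg (R.toll_nn n), mul_assoc]
  apply mul_le_mul_of_nonneg_left _ hM.le
  have := (h n (by omega)).2 hu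
  rwa [show ρ - (2 - ρ) = 2 * ρ - 2 by ring]

theorem varn (R : Rec M A p ρ α β γ m V) {d : ℝ} (hd : RenProp M p ρ d) (hρ : 1 < ρ) (hM2 : 2 ≤ M) (hu : ¬ ∀ j, p j = 1 / (A : ℝ)) :
    ∃ Q, AsyQ p d (2 * ρ - 1) V Q ∧ ∀ s, 0 < Q s := by
  have P := R.P
  have hM := P.Mpos
  have hne := P.ne
  obtain ⟨q, hq⟩ := R.asyD hd
  obtain ⟨c0, hc0, hlow⟩ := R.dlow hM2
  have hqpos : ∀ s, 0 < q s := fun s => hq.pos hd.1 hc0 (eventually_atTop.2 ⟨1, fun n hn => hlow n hn⟩) s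
  obtain ⟨⟨B, hB, hqB⟩, -⟩ := per_unif hd.1 hq.cont hq.per
  set y := fun j => p j ^ (ρ - 1) with hy
  set yb := ∑ j, p j * y j with hyb
  set v := ∑ j, p j * (y j - yb) ^ 2 with hv
  have hvnn : ∀ j ∈ (univ : Finset (Fin A)), 0 ≤ p j * (y j - yb) ^ 2 := fun j _ => mul_nonneg (P.p0' j) (sq_nonneg _)
  have hvpos : 0 < v := by
    rcases (Finset.sum_nonneg hvnn).lt_or_eq with h | h
    · exact h
    exfalso
    apply hu
    have h1 := (Finset.sum_eq_zero_iff_of_nonneg hvnn).1 h.symm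
    have h2 : ∀ j, y j = yb := by
      intro j
      rcases mul_eq_zero.1 (h1 j (mem_univ j)) with h | h
      · exact absurd h (P.p0 j).ne'
      · have := pow_eq_zero_iff (two_ne_zero) |>.1 h
        linarith
    intro j
    have h3 : ∀ i, p i = p j := fun i =>
      (Real.rpow_left_inj (P.p0' i) (P.p0' j) (by linarith : ρ - 1 ≠ 0)).1 ((h2 i).trans (h2 j).symm)
    have := P.ps
    simp only [h3, Finset.sum_const, Finset.card_univ, Fintype.card_fin, nsmul_eq_mul] at this
    have hA : (A : ℝ) ≠ 0 := by have := P.hA; positivity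
    field_simp; linarith
  set S := ∑ j, (M : ℝ) * p j ^ (2 * ρ - 1) with hS
  have hS1 : S < 1 := P.rlt (by linarith)
  set κ := M * v / (1 - S) with hκ
  have h1S : 0 < 1 - S := by linarith
  have hκ0 : 0 < κ := by positivity
  set c1 := (m 2 - m 1) ^ 2 with hc1
  set w := fun n : ℕ => (n : ℝ) * (m (n+1) - m n) ^ 2 - c1 * n with hwd
  have hw : AsyQ p d (2 * ρ - 1) w (fun s => q s ^ 2) := by
    have := hq.sq_mul hd.1
    rw [show 2 * (ρ - 1) + 1 = 2 * ρ - 1 by ring] at this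
    exact this.sub_small (by linarith) c1
  set τ := fun n => (M : ℝ) * EE p n (fun c => gt p m n c ^ 2) with hτ
  set a := fun n => τ n - κ * (w n - ∑ j, (M : ℝ) * Eb (p j) n w) with ha
  -- limit of the toll
  have hxx : ∀ j, Tendsto (fun n : ℕ => (xx p m n j / (n : ℝ) ^ (ρ - 1)) ^ 2 - ((y j - yb) * q (Real.log n)) ^ 2) atTop (𝓝 0) := by
    intro j
    apply sq_lim (B := |y j - yb| * B)
    · intro n; rw [abs_mul]; exact mul_le_mul_of_nonneg_left (hqB _) (abs_nonneg _)
    have h1 : ∀ i, Tendsto (fun n : ℕ => dD p m n i / (n : ℝ) ^ (ρ - 1) - y i * q (Real.log n)) atTop (𝓝 0) :=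
      fun i => hq.floor hd.1 (P.p0 i)
    have h2 : Tendsto (fun n : ℕ => ∑ i, p i * (dD p m n i / (n : ℝ) ^ (ρ - 1) - y i * q (Real.log n))) atTop (𝓝 (∑ i, p i * 0)) :=
      tendsto_finsetSum _ fun i _ => (h1 i).const_mul _
    simp only [mul_zero, Finset.sum_const_zero] at h2
    have := (h1 j).sub h2
    rw [sub_zero] at this
    refine this.congr fun n => ?_
    simp only [mul_sub, Finset.sum_sub_distrib]
    rw [xx, sub_div, Finset.sum_div, hyb, sub_mul, Finset.sum_mul]
    simp only [mul_div_assoc, mul_assoc]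
    ring
  obtain ⟨C2, hC2, h2⟩ := R.second
  have hgt : Tendsto (fun n : ℕ => EE p n (fun c => gt p m n c ^ 2) / (n : ℝ) ^ (2 * ρ - 1) - v * q (Real.log n) ^ 2) atTop (𝓝 0) := by
    have h3 : Tendsto (fun n : ℕ => ∑ j, p j * ((xx p m n j / (n : ℝ) ^ (ρ - 1)) ^ 2 - ((y j - yb) * q (Real.log n)) ^ 2)) atTop (𝓝 (∑ j, p j * 0)) :=
      tendsto_finsetSum _ fun i _ => (hxx i).const_mul _
    simp only [mul_zero, Finset.sum_const_zero] at h3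
    have h4 : Tendsto (fun n : ℕ => (EE p n (fun c => gt p m n c ^ 2) - n * ∑ j, p j * xx p m n j ^ 2) / (n : ℝ) ^ (2 * ρ - 1)) atTop (𝓝 0) := by
      have h5 : Tendsto (fun n : ℕ => C2 * (n : ℝ) ^ (-((1:ℝ)/2))) atTop (𝓝 (C2 * 0)) :=
        ((tendsto_rpow_neg_atTop (by norm_num)).comp tendsto_natCast_atTop_atTop).const_mul C2
      rw [mul_zero] at h5
      refine squeeze_zero_norm' ?_ h5
      filter_upwards [eventually_ge_atTop 1] with n hn
      have hn0 : (0 : ℝ) < n := by exact_mod_cast hn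
      rw [Real.norm_eq_abs, abs_div, abs_of_pos (by positivity : 0 < (n : ℝ) ^ (2 * ρ - 1)), div_le_iff₀ (by positivity), mul_assoc,
        ← Real.rpow_add hn0]
      have e9 := (h2 n hn).1
      rwa [show -((1:ℝ)/2) + (2 * ρ - 1) = 2 * ρ - 3/2 by ring]
    have := h3.add h4
    rw [add_zero] at this
    refine this.congr' ?_
    filter_upwards [eventually_ge_atTop 1] with n hn
    have hn0 : (0 : ℝ) < n := by exact_mod_cast hn
    have e1 : (n : ℝ) ^ (2 * ρ - 1) = n * ((n : ℝ) ^ (ρ - 1)) ^ 2 := by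
      rw [show 2 * ρ - 1 = 1 + ((ρ - 1) + (ρ - 1)) by ring, Real.rpow_add hn0, Real.rpow_add hn0, Real.rpow_one]; ring
    rw [e1]
    have hpos : 0 < (n : ℝ) ^ (ρ - 1) := by positivity
    simp only [mul_sub, Finset.sum_sub_distrib, mul_pow, div_pow]
    rw [sub_div, hv, Finset.sum_mul, mul_div_mul_left _ _ hn0.ne', Finset.sum_div]
    simp only [mul_div_assoc, mul_assoc]
    ring
  have hlim : Tendsto (fun n : ℕ => a n / (n : ℝ) ^ (2 * ρ - 1)) atTop (𝓝 0) := by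
    have h3 : Tendsto (fun n : ℕ => ∑ j, (M : ℝ) * (Eb (p j) n w / (n : ℝ) ^ (2 * ρ - 1) - p j ^ (2 * ρ - 1) * q (Real.log n) ^ 2)) atTop (𝓝 (∑ j : Fin A, (M : ℝ) * 0)) :=
      tendsto_finsetSum _ fun i _ => (Eb_asy P hd.1 (by linarith) hw i).const_mul _
    simp only [mul_zero, Finset.sum_const_zero] at h3
    have := (hgt.const_mul (M : ℝ)).sub ((hw.lim.sub h3).const_mul κ)
    simp only [mul_zero, sub_zero] at this
    refine this.congr fun n => ?_
    have e : κ * (1 - S) = M * v := by rw [hκ]; field_simp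
    simp only [ha, hτ, mul_sub, Finset.sum_sub_distrib]
    simp only [sub_div, mul_div_assoc, Finset.sum_div, mul_sub, ← mul_assoc, ← Finset.sum_mul]
    have e' : κ * S = κ - M * v := by linarith
    rw [show (∑ j, (M : ℝ) * p j ^ (2 * ρ - 1)) = S from rfl]
    have : κ * (S * q (Real.log n) ^ 2) = (κ - M * v) * q (Real.log n) ^ 2 := by rw [← mul_assoc, e']
    linarith
  have habs : ∀ ε > 0, ∀ᶠ n : ℕ in atTop, |a n| ≤ ε * (n : ℝ) ^ (2 * ρ - 1) := by
    intro ε hε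
    filter_upwards [(Metric.tendsto_nhds.1 hlim) ε hε, eventually_ge_atTop 1] with n h1 hn
    have hn0 : (0 : ℝ) < n := by exact_mod_cast hn
    rw [Real.dist_eq, sub_zero, abs_div, abs_of_pos (by positivity : 0 < (n : ℝ) ^ (2 * ρ - 1)), div_lt_iff₀ (by positivity)] at h1
    exact h1.le
  have w0 : w 0 = 0 := by simp [hwd]
  have w1 : w 1 = 0 := by simp [hwd, hc1]
  have up := contraction P (η := 2 * ρ - 1) (by linarith) (f := fun n => V n - κ * w n) (a := a)
    (by simp [w0, R.V0]) (by simp [w1, R.V1]) (by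
      intro n hn
      simp only [Eb_sub, Eb_smul, mul_sub, Finset.sum_sub_distrib, ha]
      rw [R.Vr n hn]
      have : ∑ j, (M : ℝ) * (κ * Eb (p j) n w) = κ * ∑ j, (M : ℝ) * Eb (p j) n w := by
        rw [Finset.mul_sum]; exact Finset.sum_congr rfl fun j _ => by ring
      rw [this]; simp only [hτ]; linarith)
    (fun ε hε => (habs ε hε).mono fun n h => (le_abs_self _).trans h)
  have dn := contraction P (η := 2 * ρ - 1) (by linarith) (f := fun n => κ * w n - V n) (a := fun n => - a n)
    (by simp [w0, R.V0]) (by simp [w1, R.V1]) (by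
      intro n hn
      simp only [Eb_sub, Eb_smul, mul_sub, Finset.sum_sub_distrib, ha]
      rw [R.Vr n hn]
      have : ∑ j, (M : ℝ) * (κ * Eb (p j) n w) = κ * ∑ j, (M : ℝ) * Eb (p j) n w := by
        rw [Finset.mul_sum]; exact Finset.sum_congr rfl fun j _ => by ring
      rw [this]; simp only [hτ]; linarith)
    (fun ε hε => (habs ε hε).mono fun n h => (neg_le_abs _).trans h)
  refine ⟨fun s => κ * q s ^ 2, ⟨?_, ?_, ?_, ?_⟩, ?_⟩
  · exact continuous_const.mul (hq.cont.pow 2)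
  · intro s; simp only [hq.per]
  · intro j s; simp only [hq.pery]
  · have h1 : Tendsto (fun n : ℕ => (V n - κ * w n) / (n : ℝ) ^ (2 * ρ - 1)) atTop (𝓝 0) := by
      rw [Metric.tendsto_nhds]
      intro ε hε
      filter_upwards [up (ε/2) (by positivity), dn (ε/2) (by positivity), eventually_ge_atTop 1] with n h1 h2 hn
      have hn0 : (0 : ℝ) < n := by exact_mod_cast hn
      have hX : 0 < (n : ℝ) ^ (2 * ρ - 1) := by positivity
      rw [Real.dist_eq, sub_zero, abs_div, abs_of_pos hX, div_lt_iff₀ hX, abs_lt]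
      constructor <;> nlinarith
    have := h1.add (hw.lim.const_mul κ)
    rw [mul_zero, add_zero] at this
    refine this.congr fun n => ?_
    simp only [sub_div]; ring
  · intro s; have := hqpos s; positivity

theorem varQ (R : Rec M A p ρ α β γ m V) {d : ℝ} (hd : RenProp M p ρ d) : ∃ η Q, AsyQ p d η V Q ∧ (∀ s, 0 < Q s) ∧
    ((∀ j, p j = 1 / (A : ℝ)) → η = ρ) ∧ ((¬ ∀ j, p j = 1 / (A : ℝ)) → η = 2 * ρ - 1) := by
  obtain ⟨c0, hc0, hlow⟩ := R.Vlow
  have hpos : ∀ Q, AsyQ p d ρ V Q → ∀ s, 0 < Q s := fun Q h s =>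
    h.pos hd.1 hc0 (eventually_atTop.2 ⟨2, fun n hn => hlow n hn⟩) s
  rcases R.M2 with ⟨h1, h2⟩ | ⟨h1, h2⟩
  · obtain ⟨Q, hQ⟩ := R.var1 hd h1 h2
    exact ⟨ρ, Q, hQ, hpos Q hQ, fun _ => rfl, fun _ => by rw [h1]; norm_num⟩
  by_cases hu : ∀ j, p j = 1 / (A : ℝ)
  · obtain ⟨Q, hQ⟩ := R.varu hd hu
    exact ⟨ρ, Q, hQ, hpos Q hQ, fun _ => rfl, fun h => absurd hu h⟩
  · obtain ⟨Q, hQ, hp⟩ := R.varn hd h1 h2 hu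
    exact ⟨_, Q, hQ, hp, fun h => absurd h hu, fun _ => rfl⟩

end Rec
end Part12

section Part13
open Finset MeasureTheory Filter Topology

/-- third order remainder of the exponential -/
noncomputable def R3 (x : ℝ) : ℂ := Complex.exp (Complex.I * x) - 1 - Complex.I * x + (x : ℂ) ^ 2 / 2

theorem exp_I_two (x : ℝ) : ‖Complex.exp (Complex.I * x) - 1 - Complex.I * x‖ ≤ 2 * x ^ 2 := by
  rcases le_or_gt |x| 1 with h | h
  · have h1 : ‖Complex.I * (x : ℂ)‖ ≤ 1 := by simpa using h
    have := Complex.norm_exp_sub_one_sub_id_le h1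
    simp only [norm_mul, Complex.norm_I, one_mul, Complex.norm_real, Real.norm_eq_abs, sq_abs] at this
    nlinarith [sq_nonneg x]
  · have h1 := Real.norm_exp_I_mul_ofReal_sub_one_le (x := x)
    have h2 : ‖Complex.I * (x : ℂ)‖ = |x| := by simp
    refine (norm_sub_le _ _).trans ?_
    rw [h2]
    rw [Real.norm_eq_abs] at h1
    nlinarith [sq_abs x]

theorem R3_lip (x y : ℝ) : ‖R3 x - R3 y‖ ≤ 2 * |x - y| * (x ^ 2 + y ^ 2) := by
  have hd : ∀ z : ℝ, HasDerivAt R3 (Complex.I * (Complex.exp (Complex.I * z) - 1 - Complex.I * z)) z := by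
    intro z
    have h0 : HasDerivAt (fun z : ℝ => (z : ℂ)) 1 z := Complex.ofRealCLM.hasDerivAt
    have h1 : HasDerivAt (fun z : ℝ => Complex.I * (z : ℂ)) (Complex.I * 1) z := h0.const_mul _
    have h2 := (((h1.cexp).sub_const 1).sub h1).add ((h0.pow 2).div_const 2)
    refine HasDerivAt.congr_deriv (h2.congr_of_eventuallyEq (Eventually.of_forall fun z => ?_)) ?_
    · simp [R3]
    · have := Complex.I_sq
      push_cast
      linear_combination (z : ℂ) * this
  have := Convex.norm_image_sub_le_of_norm_hasDerivWithin_le (f := R3) (s := Set.uIcc y x)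
    (C := 2 * (x ^ 2 + y ^ 2)) (fun z _ => (hd z).hasDerivWithinAt) (fun z hz => ?_) (convex_uIcc y x)
    Set.left_mem_uIcc Set.right_mem_uIcc
  · rw [Real.norm_eq_abs] at this
    linarith
  · rw [norm_mul, Complex.norm_I, one_mul]
    refine (exp_I_two z).trans ?_
    have hz2 : z ^ 2 ≤ x ^ 2 + y ^ 2 := by
      rcases Set.mem_uIcc.1 hz with ⟨h1, h2⟩ | ⟨h1, h2⟩
      · rcases le_total 0 z with h | h <;> nlinarith [sq_nonneg x, sq_nonneg y]
      · rcases le_total 0 z with h | h <;> nlinarith [sq_nonneg x, sq_nonneg y]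
    linarith

theorem R3_bound (x : ℝ) : ‖R3 x‖ ≤ 2 * |x| ^ 3 := by
  have := R3_lip x 0
  have h0 : R3 0 = 0 := by simp [R3]
  rw [h0, sub_zero, sub_zero] at this
  refine this.trans (le_of_eq ?_)
  rw [show |x| ^ 3 = |x| ^ 2 * |x| by ring, sq_abs]; ring

theorem min_sqrt {u a : ℝ} (h0 : 0 ≤ u) (h1 : u ≤ 1) (h2 : u ≤ a) : u ≤ √a := by
  apply Real.le_sqrt_of_sq_le; nlinarith

/-- second order remainder of exp(-x) at y -/
theorem exp_taylor {x y : ℝ} (hx : 0 ≤ x) (hy : 0 ≤ y) :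
    |Real.exp (-x) - Real.exp (-y) + Real.exp (-y) * (x - y)| ≤ |x - y| * √|x - y| := by
  have hd : ∀ z : ℝ, HasDerivAt (fun z => Real.exp (-z) + Real.exp (-y) * z) (Real.exp (-y) - Real.exp (-z)) z := by
    intro z
    have h1 := (hasDerivAt_id z).neg.exp.add ((hasDerivAt_id z).const_mul (Real.exp (-y)))
    refine HasDerivAt.congr_deriv h1 ?_
    simp; ring
  have := Convex.norm_image_sub_le_of_norm_hasDerivWithin_le (f := fun z => Real.exp (-z) + Real.exp (-y) * z) (s := Set.uIcc y x)
    (C := √|x - y|) (fun z _ => (hd z).hasDerivWithinAt) (fun z hz => ?_) (convex_uIcc y x)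
    Set.left_mem_uIcc Set.right_mem_uIcc
  · simp only [Real.norm_eq_abs] at this
    refine le_trans (le_of_eq ?_) (this.trans (le_of_eq (mul_comm _ _)))
    congr 1; ring
  · rw [Real.norm_eq_abs]
    have hz0 : 0 ≤ z := (le_min hy hx).trans hz.1
    have hzy : |z - y| ≤ |x - y| := Set.abs_sub_left_of_mem_uIcc hz
    have e1 : ∀ u : ℝ, 0 ≤ u → Real.exp (-u) ≤ 1 := fun u hu => Real.exp_le_one_iff.2 (by linarith)
    have e2 : ∀ u v : ℝ, 0 ≤ u → Real.exp (-u) - Real.exp (-v) ≤ |v - u| := by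
      intro u v hu
      have h3 : Real.exp (-v) = Real.exp (-u) * Real.exp (-(v - u)) := by rw [← Real.exp_add]; congr 1; ring
      have h4 := Real.add_one_le_exp (-(v - u))
      have h5 := e1 u hu
      have h6 := Real.exp_pos (-u)
      have h7 := le_abs_self (v - u)
      rw [h3]
      nlinarith [abs_nonneg (v - u)]
    apply min_sqrt (abs_nonneg _)
    · rw [abs_le]
      constructor <;> linarith [e1 z hz0, e1 y hy, Real.exp_pos (-z), Real.exp_pos (-y)]
    · refine le_trans ?_ hzy
      rw [abs_le]
      have := e2 y z hy
      have := e2 z y hz0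
      rw [abs_sub_comm] at this
      constructor <;> linarith

noncomputable def r2 (x : ℝ) : ℝ := Real.exp (-x) - 1 + x

theorem r2_lip {x y : ℝ} (hx : 0 ≤ x) (hy : 0 ≤ y) : |r2 x - r2 y| ≤ |x - y| * √(x + y) := by
  have hd : ∀ z : ℝ, HasDerivAt r2 (1 - Real.exp (-z)) z := by
    intro z
    have h1 := ((hasDerivAt_id z).neg.exp.sub_const 1).add (hasDerivAt_id z)
    refine HasDerivAt.congr_deriv h1 ?_
    simp; ring
  have := Convex.norm_image_sub_le_of_norm_hasDerivWithin_le (f := r2) (s := Set.uIcc y x)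
    (C := √(x+y)) (fun z _ => (hd z).hasDerivWithinAt) (fun z hz => ?_) (convex_uIcc y x)
    Set.left_mem_uIcc Set.right_mem_uIcc
  · simp only [Real.norm_eq_abs] at this
    rw [mul_comm]; exact this
  · have hz0 : 0 ≤ z := (le_min hy hx).trans hz.1
    have hz1 : z ≤ x + y := hz.2.trans (max_le (by linarith) (by linarith))
    have h1 : Real.exp (-z) ≤ 1 := Real.exp_le_one_iff.2 (by linarith)
    have h2 := Real.add_one_le_exp (-z)
    rw [Real.norm_eq_abs, abs_of_nonneg (by linarith)]
    apply min_sqrt (by linarith) (by linarith [Real.exp_pos (-z)]) (by linarith)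

theorem sqrt_half_sq (t : ℝ) : √(t ^ 2 / 2) ≤ |t| := by
  rw [← Real.sqrt_sq_eq_abs]; apply Real.sqrt_le_sqrt; nlinarith [sq_nonneg t]

theorem iid_char {A : ℕ} {p : Fin A → ℝ} (hp : ∀ j, 0 ≤ p j) (hps : ∑ j, p j = 1) (x : Fin A → ℝ) (hx : ∑ j, p j * x j = 0)
    {X : ℝ} (hX : ∀ j, |x j| ≤ X) (hX0 : 0 ≤ X) (n : ℕ) (t : ℝ) :
    ‖EE p n (fun c => Complex.exp (Complex.I * ((t * ∑ k, x (c k) : ℝ) : ℂ))) -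
      ((Real.exp (-((n * ∑ j, p j * x j ^ 2) * (t ^ 2 / 2))) : ℝ) : ℂ)‖ ≤ 3 * n * X ^ 3 * |t| ^ 3 := by
  set σ := ∑ j, p j * x j ^ 2 with hσ
  have hσ0 : 0 ≤ σ := Finset.sum_nonneg fun j _ => mul_nonneg (hp j) (sq_nonneg _)
  have hσX : σ ≤ X ^ 2 := by
    calc σ ≤ ∑ j, p j * X ^ 2 := Finset.sum_le_sum fun j _ => by
          apply mul_le_mul_of_nonneg_left _ (hp j)
          rw [← sq_abs]; exact pow_le_pow_left₀ (abs_nonneg _) (hX j) 2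
      _ = X ^ 2 := by rw [← Finset.sum_mul, hps, one_mul]
  have e1 : (fun c : Fin n → Fin A => Complex.exp (Complex.I * ((t * ∑ k, x (c k) : ℝ) : ℂ))) =
      fun c => ∏ k, (fun j => Complex.exp (Complex.I * ((t * x j : ℝ) : ℂ))) (c k) := by
    funext c
    rw [← Complex.exp_sum, Finset.mul_sum]
    push_cast
    rw [Finset.mul_sum]
  rw [e1, EE_prod_pi n (fun j => Complex.exp (Complex.I * ((t * x j : ℝ) : ℂ)))]
  have e2 : ((Real.exp (-((n * σ) * (t ^ 2 / 2))) : ℝ) : ℂ) = ((Real.exp (-(σ * (t ^ 2 / 2))) : ℝ) : ℂ) ^ n := by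
    rw [← Complex.ofReal_pow, ← Real.exp_nat_mul]; congr 2; ring
  rw [e2]
  set z := ∑ j, (p j : ℂ) * Complex.exp (Complex.I * ((t * x j : ℝ) : ℂ)) with hz
  set w := ((Real.exp (-(σ * (t ^ 2 / 2))) : ℝ) : ℂ) with hw
  have hz1 : ‖z‖ ≤ 1 := by
    refine (norm_sum_le _ _).trans (le_of_eq ?_)
    rw [← hps]
    refine Finset.sum_congr rfl fun j _ => ?_
    rw [norm_mul, mul_comm Complex.I, Complex.norm_exp_ofReal_mul_I, mul_one, Complex.norm_real, Real.norm_of_nonneg (hp j)]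
  have hs : 0 ≤ σ * (t ^ 2 / 2) := by positivity
  have hw1 : ‖w‖ ≤ 1 := by
    rw [hw, Complex.norm_real, Real.norm_of_nonneg (Real.exp_pos _).le]
    exact Real.exp_le_one_iff.2 (by linarith)
  have hpow : ∀ k : ℕ, ‖z ^ k - w ^ k‖ ≤ k * ‖z - w‖ := by
    intro k
    induction k with
    | zero => simp
    | succ k ih =>
      have : z ^ (k+1) - w ^ (k+1) = z * (z ^ k - w ^ k) + (z - w) * w ^ k := by ring
      rw [this]
      refine (norm_add_le _ _).trans ?_
      rw [norm_mul, norm_mul, norm_pow]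
      have h1 : ‖w‖ ^ k ≤ 1 := pow_le_one₀ (norm_nonneg _) hw1
      have h2 : ‖z‖ * ‖z ^ k - w ^ k‖ ≤ 1 * (k * ‖z - w‖) := by gcongr
      have h3 : ‖z - w‖ * ‖w‖ ^ k ≤ ‖z - w‖ * 1 := by gcongr
      push_cast; linarith
  refine (hpow n).trans ?_
  have key : ‖z - w‖ ≤ 3 * X ^ 3 * |t| ^ 3 := by
    have e3 : z - w = ∑ j, (p j : ℂ) * R3 (t * x j) - ((r2 (σ * (t ^ 2 / 2)) : ℝ) : ℂ) := by
      have hxC : ∑ j, (p j : ℂ) * (x j : ℂ) = 0 := by exact_mod_cast congrArg (fun r : ℝ => (r : ℂ)) hx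
      have hpC : ∑ j, (p j : ℂ) = 1 := by exact_mod_cast congrArg (fun r : ℝ => (r : ℂ)) hps
      have hsC : (σ : ℂ) = ∑ j, (p j : ℂ) * (x j : ℂ) ^ 2 := by rw [hσ]; push_cast; rfl
      have e4 : ∀ j, (p j : ℂ) * R3 (t * x j) = (p j : ℂ) * Complex.exp (Complex.I * ((t * x j : ℝ) : ℂ)) - p j
          - Complex.I * t * ((p j : ℂ) * x j) + (t : ℂ) ^ 2 / 2 * ((p j : ℂ) * (x j : ℂ) ^ 2) := by
        intro j; rw [R3]; push_cast; ring
      simp only [e4, Finset.sum_add_distrib, Finset.sum_sub_distrib, ← Finset.mul_sum, hxC, hpC, ← hsC, ← hz]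
      rw [hw, r2]; push_cast; ring
    rw [e3]
    refine (norm_sub_le _ _).trans ?_
    have b1 : ‖∑ j, (p j : ℂ) * R3 (t * x j)‖ ≤ 2 * X ^ 3 * |t| ^ 3 := by
      refine (norm_sum_le _ _).trans ?_
      calc _ ≤ ∑ j, p j * (2 * X ^ 3 * |t| ^ 3) := Finset.sum_le_sum fun j _ => by
            rw [norm_mul, Complex.norm_real, Real.norm_of_nonneg (hp j)]
            apply mul_le_mul_of_nonneg_left _ (hp j)
            refine (R3_bound _).trans ?_
            rw [abs_mul, mul_pow]
            have := pow_le_pow_left₀ (abs_nonneg _) (hX j) 3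
            nlinarith [pow_nonneg (abs_nonneg t) 3]
        _ = _ := by rw [← Finset.sum_mul, hps, one_mul]
    have b2 : ‖((r2 (σ * (t ^ 2 / 2)) : ℝ) : ℂ)‖ ≤ X ^ 3 * |t| ^ 3 := by
      rw [Complex.norm_real, Real.norm_eq_abs]
      have := r2_lip hs le_rfl
      have h0 : r2 0 = 0 := by simp [r2]
      rw [h0, sub_zero, sub_zero, add_zero, abs_of_nonneg hs] at this
      refine this.trans ?_
      have h3 : √(σ * (t ^ 2 / 2)) ≤ X * |t| := by
        rw [Real.sqrt_mul hσ0]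
        apply mul_le_mul _ (sqrt_half_sq t) (Real.sqrt_nonneg _) hX0
        rw [← Real.sqrt_sq hX0]; exact Real.sqrt_le_sqrt hσX
      have h4 : σ * (t ^ 2 / 2) ≤ X ^ 2 * |t| ^ 2 := by
        rw [sq_abs]; apply mul_le_mul hσX _ (by positivity) (by positivity)
        nlinarith [sq_nonneg t]
      calc _ ≤ (X ^ 2 * |t| ^ 2) * (X * |t|) := by gcongr
        _ = _ := by ring
    linarith
  calc (n : ℝ) * ‖z - w‖ ≤ n * (3 * X ^ 3 * |t| ^ 3) := by gcongr
    _ = _ := by ring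

theorem clt_step {A n : ℕ} {p : Fin A → ℝ} (hp : ∀ j, 0 ≤ p j) (hps : ∑ j, p j = 1)
    (g L W : (Fin n → Fin A) → ℝ) {ν νL w Λ K : ℝ} (hΛ : 0 < Λ) (hW : ∀ c, 0 ≤ W c) (hw0 : 0 ≤ w)
    (hg : EE p n g = 0) (hν : EE p n (fun c => g c ^ 2) = ν) (hL : EE p n L = 0)
    (hνL : EE p n (fun c => L c ^ 2) = νL) (hw : EE p n W = w) (hvar : EE p n (fun c => (W c - w) ^ 2) ≤ Λ ^ 2)
    (hchar : ∀ t : ℝ, ‖EE p n (fun c => Complex.exp (Complex.I * ((t * L c : ℝ) : ℂ))) -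
      ((Real.exp (-(νL * (t ^ 2 / 2))) : ℝ) : ℂ)‖ ≤ K * |t| ^ 3)
    (hrem : EE p n (fun c => |g c - L c| * (g c ^ 2 + L c ^ 2)) ≤ K)
    (hνν : |ν - νL| * √(ν + νL) ≤ K) (t : ℝ) :
    ‖EE p n (fun c => ((Real.exp (-(W c * (t ^ 2 / 2))) : ℝ) : ℂ) * Complex.exp (Complex.I * ((t * g c : ℝ) : ℂ))) -
      ((Real.exp (-((w + ν) * (t ^ 2 / 2))) : ℝ) : ℂ)‖ ≤ (Λ * √ν + 2 * (Λ * √Λ) + 4 * K) * |t| ^ 3 := by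
  set s := t ^ 2 / 2 with hs
  have hs0 : 0 ≤ s := by positivity
  have hst : s ≤ |t| ^ 2 := by rw [sq_abs]; nlinarith [sq_nonneg t]
  have ht3 : 0 ≤ |t| ^ 3 := by positivity
  have hν0 : 0 ≤ ν := hν ▸ EE_nonneg hp n fun c => sq_nonneg _
  have hνL0 : 0 ≤ νL := hνL ▸ EE_nonneg hp n fun c => sq_nonneg _
  set ew := Real.exp (-(w * s)) with hew
  have hew1 : ew ≤ 1 := Real.exp_le_one_iff.2 (by have := mul_nonneg hw0 hs0; linarith)
  have hew0 : 0 < ew := Real.exp_pos _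
  set eg := fun c => Complex.exp (Complex.I * ((t * g c : ℝ) : ℂ)) with heg
  have dec : EE p n (fun c => ((Real.exp (-(W c * s)) : ℝ) : ℂ) * eg c) - ((Real.exp (-((w + ν) * s)) : ℝ) : ℂ)
    = EE p n (fun c => ((Real.exp (-(W c * s)) - ew : ℝ) : ℂ) * (eg c - 1)) +
      (((EE p n (fun c => Real.exp (-(W c * s)) - ew + ew * (W c * s - w * s)) : ℝ) : ℂ) +
      (ew : ℂ) * (EE p n eg - ((Real.exp (-(ν * s)) : ℝ) : ℂ))) := by
    have h1 : EE p n (fun c => Real.exp (-(W c * s)) - ew + ew * (W c * s - w * s)) =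
        EE p n (fun c => Real.exp (-(W c * s))) - ew := by
      have : (fun c => Real.exp (-(W c * s)) - ew + ew * (W c * s - w * s)) =
        fun c => (Real.exp (-(W c * s)) - ew) + (ew * s) * (W c - w) := by funext c; ring
      rw [this, EE_add, EE_sub, EE_mul, EE_sub, hw, EE_const hps, EE_const hps, sub_self, mul_zero, add_zero]
    rw [h1]
    have h2 : (fun c => ((Real.exp (-(W c * s)) - ew : ℝ) : ℂ) * (eg c - 1)) =
      fun c => (((Real.exp (-(W c * s)) : ℝ) : ℂ) * eg c - (ew : ℂ) * eg c) - (((Real.exp (-(W c * s)) : ℝ) : ℂ) - (ew : ℂ)) := by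
      funext c; push_cast; ring
    rw [h2, EE_sub, EE_sub, EE_sub, EE_mulC, EE_ofReal, EE_const hps]
    have h3 : Real.exp (-((w + ν) * s)) = ew * Real.exp (-(ν * s)) := by rw [hew, ← Real.exp_add]; congr 1; ring
    rw [h3]; push_cast; ring
  rw [dec]
  -- part one
  have p1 : ‖EE p n (fun c => ((Real.exp (-(W c * s)) - ew : ℝ) : ℂ) * (eg c - 1))‖ ≤ Λ * √ν * |t| ^ 3 := by
    refine (EE_norm_le hp n _).trans ?_
    have hpt : ∀ c, ‖((Real.exp (-(W c * s)) - ew : ℝ) : ℂ) * (eg c - 1)‖ ≤ |t| ^ 3 * (|W c - w| * |g c|) := by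
      intro c
      rw [norm_mul, Complex.norm_real, Real.norm_eq_abs]
      have e2 : ∀ u v : ℝ, 0 ≤ u → Real.exp (-u) - Real.exp (-v) ≤ |v - u| := by
        intro u v hu
        have h3 : Real.exp (-v) = Real.exp (-u) * Real.exp (-(v - u)) := by rw [← Real.exp_add]; congr 1; ring
        have h4 := Real.add_one_le_exp (-(v - u))
        have h5 : Real.exp (-u) ≤ 1 := Real.exp_le_one_iff.2 (by linarith)
        have h6 := Real.exp_pos (-u)
        have h7 := le_abs_self (v - u)
        rw [h3]
        nlinarith [abs_nonneg (v - u)]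
      have h1 : |Real.exp (-(W c * s)) - ew| ≤ |t| ^ 2 * |W c - w| := by
        have hh : |W c * s - w * s| ≤ |t| ^ 2 * |W c - w| := by
          rw [← sub_mul, abs_mul, abs_of_nonneg hs0, mul_comm]
          gcongr
        refine le_trans ?_ hh
        rw [abs_le]
        have a1 := e2 (W c * s) (w * s) (mul_nonneg (hW c) hs0)
        have a2 := e2 (w * s) (W c * s) (mul_nonneg hw0 hs0)
        rw [abs_sub_comm] at a1
        constructor <;> linarith
      have h2 : ‖eg c - 1‖ ≤ |t| * |g c| := by
        have := Real.norm_exp_I_mul_ofReal_sub_one_le (x := t * g c)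
        rw [Real.norm_eq_abs, abs_mul] at this
        exact this
      calc _ ≤ (|t| ^ 2 * |W c - w|) * (|t| * |g c|) := by gcongr
        _ = _ := by ring
    refine (EE_mono hp n hpt).trans ?_
    rw [EE_mul, mul_comm]
    apply mul_le_mul_of_nonneg_right _ ht3
    have hc := EE_cauchy hp n (fun c => |W c - w|) (fun c => |g c|)
    simp only [sq_abs] at hc
    rw [hν] at hc
    apply le_of_sq_le_sq _ (by positivity)
    rw [mul_pow, Real.sq_sqrt hν0]
    exact hc.trans (mul_le_mul_of_nonneg_right hvar hν0)
  have p2 : ‖((EE p n (fun c => Real.exp (-(W c * s)) - ew + ew * (W c * s - w * s)) : ℝ) : ℂ)‖ ≤ 2 * (Λ * √Λ) * |t| ^ 3 := by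
    rw [Complex.norm_real]
    refine (EE_norm_le hp n _).trans ?_
    have hsΛ : 0 < √Λ := Real.sqrt_pos.2 hΛ
    have hpt : ∀ c, ‖Real.exp (-(W c * s)) - ew + ew * (W c * s - w * s)‖ ≤ |t| ^ 3 * (1 / √Λ * (W c - w) ^ 2 + Λ * √Λ) := by
      intro c
      refine (exp_taylor (mul_nonneg (hW c) hs0) (mul_nonneg hw0 hs0)).trans ?_
      rw [← sub_mul, abs_mul, abs_of_nonneg hs0]
      set a := |W c - w| with ha
      have ha0 : 0 ≤ a := abs_nonneg _
      rw [Real.sqrt_mul ha0, ← sq_abs (W c - w), ← ha]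
      have h1 : √s ≤ |t| := sqrt_half_sq t
      have h2 : a * √a ≤ 1 / √Λ * a ^ 2 + Λ * √Λ := by
        rcases le_total a Λ with h | h
        · have : √a ≤ √Λ := Real.sqrt_le_sqrt h
          have h3 : 0 ≤ 1 / √Λ * a ^ 2 := by positivity
          have : a * √a ≤ Λ * √Λ := by gcongr
          linarith
        · have h4 : √Λ ≤ √a := Real.sqrt_le_sqrt h
          have h3 : 0 ≤ Λ * √Λ := by positivity
          have h5 : a * √a ≤ 1 / √Λ * a ^ 2 := by
            rw [one_div, ← div_eq_inv_mul, le_div_iff₀ hsΛ, sq, mul_assoc]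
            apply mul_le_mul_of_nonneg_left _ ha0
            calc √a * √Λ ≤ √a * √a := by gcongr
              _ = a := Real.mul_self_sqrt ha0
          linarith
      calc a * s * (√a * √s) = (s * √s) * (a * √a) := by ring
        _ ≤ (|t| ^ 2 * |t|) * (1 / √Λ * a ^ 2 + Λ * √Λ) := by gcongr
        _ = _ := by ring
    refine (EE_mono hp n hpt).trans ?_
    rw [EE_mul, EE_add, EE_mul, EE_const hps, mul_comm]
    apply mul_le_mul_of_nonneg_right _ ht3
    have : 1 / √Λ * EE p n (fun c => (W c - w) ^ 2) ≤ 1 / √Λ * Λ ^ 2 := by gcongr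
    have h6 : 1 / √Λ * Λ ^ 2 = Λ * √Λ := by
      rw [one_div, ← div_eq_inv_mul, div_eq_iff hsΛ.ne', mul_assoc, Real.mul_self_sqrt hΛ.le, sq]
    linarith
  have taylor : ∀ (h : (Fin n → Fin A) → ℝ) (v : ℝ), EE p n h = 0 → EE p n (fun c => h c ^ 2) = v →
      EE p n (fun c => Complex.exp (Complex.I * ((t * h c : ℝ) : ℂ))) - ((Real.exp (-(v * s)) : ℝ) : ℂ) =
      EE p n (fun c => R3 (t * h c)) - ((r2 (v * s) : ℝ) : ℂ) := by
    intro h v h0 h2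
    have e : (fun c => Complex.exp (Complex.I * ((t * h c : ℝ) : ℂ))) =
      fun c => R3 (t * h c) + (1 + ((Complex.I * t) * ((h c : ℝ) : ℂ) + (- (s : ℂ)) * ((h c ^ 2 : ℝ) : ℂ))) := by
      funext c; rw [R3, hs]; push_cast; ring
    rw [e, EE_add, EE_add, EE_add, EE_mulC, EE_mulC, EE_ofReal, EE_ofReal, h0, h2, EE_const hps, r2]
    push_cast; ring
  have p3 : ‖EE p n eg - ((Real.exp (-(ν * s)) : ℝ) : ℂ)‖ ≤ 4 * K * |t| ^ 3 := by
    have t1 := taylor g ν hg hν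
    have t2 := taylor L νL hL hνL
    have hc := hchar t
    rw [← hs, t2] at hc
    rw [show EE p n eg - _ = _ from t1]
    have e : EE p n (fun c => R3 (t * g c)) - ((r2 (ν * s) : ℝ) : ℂ) =
      (EE p n (fun c => R3 (t * L c)) - ((r2 (νL * s) : ℝ) : ℂ)) + (EE p n (fun c => R3 (t * g c) - R3 (t * L c)) -
        ((r2 (ν * s) - r2 (νL * s) : ℝ) : ℂ)) := by
      rw [EE_sub]; push_cast; ring
    rw [e]
    refine (norm_add_le _ _).trans ?_
    have b1 : ‖EE p n (fun c => R3 (t * g c) - R3 (t * L c))‖ ≤ 2 * K * |t| ^ 3 := by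
      refine (EE_norm_le hp n _).trans ?_
      have hpt : ∀ c, ‖R3 (t * g c) - R3 (t * L c)‖ ≤ 2 * |t| ^ 3 * (|g c - L c| * (g c ^ 2 + L c ^ 2)) := by
        intro c
        refine (R3_lip _ _).trans (le_of_eq ?_)
        rw [← mul_sub, abs_mul, show |t| ^ 3 = |t| ^ 2 * |t| by ring, sq_abs]; ring
      refine (EE_mono hp n hpt).trans ?_
      rw [EE_mul]
      nlinarith
    have b2 : ‖((r2 (ν * s) - r2 (νL * s) : ℝ) : ℂ)‖ ≤ K * |t| ^ 3 := by
      rw [Complex.norm_real, Real.norm_eq_abs]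
      refine (r2_lip (mul_nonneg hν0 hs0) (mul_nonneg hνL0 hs0)).trans ?_
      rw [← sub_mul, ← add_mul, abs_mul, abs_of_nonneg hs0, Real.sqrt_mul (by positivity)]
      have h1 : √s ≤ |t| := sqrt_half_sq t
      calc |ν - νL| * s * (√(ν + νL) * √s) = (|ν - νL| * √(ν + νL)) * (s * √s) := by ring
        _ ≤ (|ν - νL| * √(ν + νL)) * (|t| ^ 2 * |t|) := by gcongr
        _ ≤ K * (|t| ^ 2 * |t|) := by gcongr
        _ = _ := by ring
    have := norm_sub_le (EE p n (fun c => R3 (t * g c) - R3 (t * L c))) ((r2 (ν * s) - r2 (νL * s) : ℝ) : ℂ)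
    linarith
  refine (norm_add_le _ _).trans ?_
  have h4 : ‖(ew : ℂ) * (EE p n eg - ((Real.exp (-(ν * s)) : ℝ) : ℂ))‖ ≤ 4 * K * |t| ^ 3 := by
    rw [norm_mul, Complex.norm_real, Real.norm_of_nonneg hew0.le]
    refine le_trans ?_ p3
    exact mul_le_of_le_one_left (norm_nonneg _) hew1
  have := norm_add_le ((EE p n (fun c => Real.exp (-(W c * s)) - ew + ew * (W c * s - w * s)) : ℝ) : ℂ)
    ((ew : ℂ) * (EE p n eg - ((Real.exp (-(ν * s)) : ℝ) : ℂ)))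
  linarith
end Part13

section Part14
open Finset MeasureTheory Filter Topology

theorem pow_sub_le {z w : ℂ} (hz1 : ‖z‖ ≤ 1) (hw1 : ‖w‖ ≤ 1) (k : ℕ) : ‖z ^ k - w ^ k‖ ≤ k * ‖z - w‖ := by
  induction k with
  | zero => simp
  | succ k ih =>
    have : z ^ (k+1) - w ^ (k+1) = z * (z ^ k - w ^ k) + (z - w) * w ^ k := by ring
    rw [this]
    refine (norm_add_le _ _).trans ?_
    rw [norm_mul, norm_mul, norm_pow]
    have h1 : ‖w‖ ^ k ≤ 1 := pow_le_one₀ (norm_nonneg _) hw1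
    have h2 : ‖z‖ * ‖z ^ k - w ^ k‖ ≤ 1 * (k * ‖z - w‖) := by gcongr
    have h3 : ‖z - w‖ * ‖w‖ ^ k ≤ ‖z - w‖ * 1 := by gcongr
    push_cast; linarith

theorem prod_sub_le {ι : Type*} (s : Finset ι) (x y : ι → ℂ) (hx : ∀ i, ‖x i‖ ≤ 1) (hy : ∀ i, ‖y i‖ ≤ 1) :
    ‖∏ i ∈ s, x i - ∏ i ∈ s, y i‖ ≤ ∑ i ∈ s, ‖x i - y i‖ := by
  classical
  induction s using Finset.induction_on with
  | empty => simp
  | insert i s hi ih =>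
    rw [Finset.prod_insert hi, Finset.prod_insert hi, Finset.sum_insert hi]
    have e : x i * ∏ i ∈ s, x i - y i * ∏ i ∈ s, y i = x i * (∏ i ∈ s, x i - ∏ i ∈ s, y i) + (x i - y i) * ∏ i ∈ s, y i := by ring
    rw [e]
    refine (norm_add_le _ _).trans ?_
    rw [norm_mul, norm_mul]
    have h1 : ‖∏ i ∈ s, y i‖ ≤ 1 := by
      rw [norm_prod]; exact Finset.prod_le_one (fun _ _ => norm_nonneg _) fun i _ => hy i
    have h2 : ‖x i‖ * ‖∏ i ∈ s, x i - ∏ i ∈ s, y i‖ ≤ 1 * ∑ i ∈ s, ‖x i - y i‖ := by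
      gcongr; exact hx i
    have h3 : ‖x i - y i‖ * ‖∏ i ∈ s, y i‖ ≤ ‖x i - y i‖ * 1 := by gcongr
    linarith

namespace Rec
variable {M A : ℕ} {p : Fin A → ℝ} {ρ α β γ : ℝ} {m V : ℕ → ℝ}

theorem tollK_aux (R : Rec M A p ρ α β γ m V) {C CU N l : ℝ} (hC : 0 < C) {n : ℕ} (hn : 1 ≤ n) (hl : ρ - 1 ≤ l)
    (hU : EE p n (fun c => Ud p n c ^ 12) ≤ CU)
    (hL : ∀ c : Fin n → Fin A, |∑ k, xx p m n (c k)| ≤ C * (n : ℝ) ^ l * Ud p n c)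
    (hR : ∀ c : Fin n → Fin A, |gt p m n c - ∑ k, xx p m n (c k)| ≤ C * (n : ℝ) ^ (ρ - 1) * Ud p n c ^ 4)
    (hN : n * ∑ j, p j * xx p m n j ^ 2 = N)
    (hNN : |EE p n (fun c => gt p m n c ^ 2) - N| ≤ C * (n : ℝ) ^ (ρ - 1 + l)) (hNl : N ≤ C * (n : ℝ) ^ (2 * l)) :
    EE p n (fun c => |gt p m n c - ∑ k, xx p m n (c k)| * (gt p m n c ^ 2 + (∑ k, xx p m n (c k)) ^ 2)) ≤
      5 * C ^ 3 * CU * (n : ℝ) ^ (ρ - 1 + 2 * l) ∧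
    |EE p n (fun c => gt p m n c ^ 2) - N| * √(EE p n (fun c => gt p m n c ^ 2) + N) ≤
      C * √(3 * C) * (n : ℝ) ^ (ρ - 1 + 2 * l) ∧
    EE p n (fun c => gt p m n c ^ 2) ≤ 2 * C * (n : ℝ) ^ (2 * l) := by
  have P := R.P
  have hn1 : (1 : ℝ) ≤ n := by exact_mod_cast hn
  have hn0 : (0 : ℝ) < n := by linarith
  set a := (n : ℝ) ^ (ρ - 1) with ha
  set b := (n : ℝ) ^ l with hb
  have ha0 : 0 < a := by positivity
  have hb0 : 0 < b := by positivity
  have hab : a ≤ b := Real.rpow_le_rpow_of_exponent_le hn1 hl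
  have e1 : (n : ℝ) ^ (ρ - 1 + 2 * l) = a * b ^ 2 := by
    rw [two_mul, Real.rpow_add hn0, Real.rpow_add hn0]; ring
  have e2 : (n : ℝ) ^ (2 * l) = b ^ 2 := by rw [two_mul, Real.rpow_add hn0]; ring
  have e3 : (n : ℝ) ^ (ρ - 1 + l) = a * b := by rw [Real.rpow_add hn0]
  rw [e1, e2]
  rw [e3] at hNN
  rw [e2] at hNl
  have hv0 : 0 ≤ EE p n (fun c => gt p m n c ^ 2) := EE_nonneg P.p0' n fun c => sq_nonneg _
  have hv : EE p n (fun c => gt p m n c ^ 2) ≤ 2 * C * b ^ 2 := by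
    have := (abs_le.1 hNN).2
    have : C * (a * b) ≤ C * b ^ 2 := by rw [sq]; gcongr
    linarith
  refine ⟨?_, ?_, hv⟩
  · have hpt : ∀ c : Fin n → Fin A, |gt p m n c - ∑ k, xx p m n (c k)| * (gt p m n c ^ 2 + (∑ k, xx p m n (c k)) ^ 2) ≤
        5 * C ^ 3 * (a * b ^ 2) * Ud p n c ^ 12 := by
      intro c
      have hU1 := Ud_one_le p n c
      set U := Ud p n c
      set L := ∑ k, xx p m n (c k)
      set g := gt p m n c
      have h1 : |L| ≤ C * b * U ^ 4 := (hL c).trans (by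
        gcongr; calc U = U ^ 1 := (pow_one U).symm
          _ ≤ U ^ 4 := pow_le_pow_right₀ hU1 (by norm_num))
      have h2 : |g - L| ≤ C * a * U ^ 4 := hR c
      have h3 : |g - L| ≤ C * b * U ^ 4 := h2.trans (by gcongr)
      have h4 : L ^ 2 ≤ (C * b * U ^ 4) ^ 2 := by rw [← sq_abs]; gcongr
      have h5 : (g - L) ^ 2 ≤ (C * b * U ^ 4) ^ 2 := by rw [← sq_abs]; gcongr
      have h6 : g ^ 2 + L ^ 2 ≤ 5 * (C * b * U ^ 4) ^ 2 := by nlinarith [sq_nonneg (g - 2 * L)]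
      calc _ ≤ (C * a * U ^ 4) * (5 * (C * b * U ^ 4) ^ 2) := by gcongr
        _ = _ := by ring
    refine (EE_mono P.p0' n hpt).trans ?_
    rw [EE_mul]
    calc _ ≤ 5 * C ^ 3 * (a * b ^ 2) * CU := by gcongr
      _ = _ := by ring
  · have h1 : √(EE p n (fun c => gt p m n c ^ 2) + N) ≤ √(3 * C) * b := by
      rw [← Real.sqrt_sq hb0.le, ← Real.sqrt_mul (by positivity)]
      apply Real.sqrt_le_sqrt; linarith
    calc _ ≤ (C * (a * b)) * (√(3 * C) * b) := by gcongr
      _ = _ := by ring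

theorem tollK (R : Rec M A p ρ α β γ m V) {η : ℝ} (h1 : (∀ j, p j = 1 / (A : ℝ)) → η = ρ) (h2 : (¬ ∀ j, p j = 1 / (A : ℝ)) → η = 2 * ρ - 1) :
    ∃ C > 0, ∃ e, e < 3 * η / 2 ∧ ∀ n : ℕ, 1 ≤ n →
      (∀ t : ℝ, ‖EE p n (fun c => Complex.exp (Complex.I * ((t * ∑ k, xx p m n (c k) : ℝ) : ℂ))) -
        ((Real.exp (-((n * ∑ j, p j * xx p m n j ^ 2) * (t ^ 2 / 2))) : ℝ) : ℂ)‖ ≤ C * (n : ℝ) ^ e * |t| ^ 3) ∧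
      EE p n (fun c => |gt p m n c - ∑ k, xx p m n (c k)| * (gt p m n c ^ 2 + (∑ k, xx p m n (c k)) ^ 2)) ≤ C * (n : ℝ) ^ e ∧
      |EE p n (fun c => gt p m n c ^ 2) - (n * ∑ j, p j * xx p m n j ^ 2)| *
        √(EE p n (fun c => gt p m n c ^ 2) + (n * ∑ j, p j * xx p m n j ^ 2)) ≤ C * (n : ℝ) ^ e ∧
      EE p n (fun c => gt p m n c ^ 2) ≤ C * (n : ℝ) ^ η := by
  have P := R.P
  have r1 := P.r1
  have r2 := P.r2
  obtain ⟨C1, hC1, hdec⟩ := R.decomp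
  obtain ⟨C2, hC2, hsec⟩ := R.second
  obtain ⟨CU, hCU, hU⟩ := Ud_moment P.p0' P.p1' P.ps 12
  set C := C1 + C2 + C1 ^ 2 with hCd
  have hC : 0 < C := by positivity
  set C' := 5 * C ^ 3 * CU + C * √(3 * C) + 2 * C + 3 * C1 ^ 3 with hC'
  have hC'0 : 0 < C' := by positivity
  have fin : ∀ {n : ℕ} {X c e : ℝ}, X ≤ c * (n : ℝ) ^ e → c ≤ C' → X ≤ C' * (n : ℝ) ^ e := fun h h' =>
    h.trans (mul_le_mul_of_nonneg_right h' (by positivity))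
  have i1 : 0 ≤ 5 * C ^ 3 * CU := by positivity
  have i2 : 0 ≤ C * √(3 * C) := by positivity
  have i3 : 0 ≤ 3 * C1 ^ 3 := by positivity
  by_cases hu : ∀ j, p j = 1 / (A : ℝ)
  · refine ⟨C', hC'0, ρ - 1 + 2 * (ρ - 1), by rw [h1 hu]; linarith, fun n hn => ?_⟩
    have hn1 : (1 : ℝ) ≤ n := by exact_mod_cast hn
    obtain ⟨hx, hL, hR⟩ := hdec n hn
    have hx0 : ∀ j, xx p m n j = 0 := xx_unif P.ps m n hu
    obtain ⟨a1, a2, a3⟩ := R.tollK_aux (C := C) (l := ρ - 1) (N := n * ∑ j, p j * xx p m n j ^ 2) hC hn le_rfl (hU n hn)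
      (by intro c; simp only [hx0, Finset.sum_const_zero, abs_zero]
          have := Ud_one_le p n c; positivity)
      (by intro c; refine (hR c).trans ?_
          have := Ud_one_le p n c
          gcongr; rw [hCd]; nlinarith [sq_nonneg C1]) rfl
      (by simp only [hx0]
          have := (hsec n hn).2 hu
          simp only [ne_eq, OfNat.ofNat_ne_zero, not_false_eq_true, zero_pow, mul_zero, Finset.sum_const_zero, sub_zero]
          rw [abs_of_nonneg (EE_nonneg P.p0' n fun c => sq_nonneg _), show ρ - 1 + (ρ - 1) = 2 * ρ - 2 by ring]
          refine this.trans ?_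
          gcongr; rw [hCd]; nlinarith [sq_nonneg C1])
      (by simp only [hx0, ne_eq, OfNat.ofNat_ne_zero, not_false_eq_true, zero_pow, mul_zero, Finset.sum_const_zero]
          positivity)
    refine ⟨fun t => ?_, fin a1 (by linarith), fin a2 (by linarith), ?_⟩
    · refine (iid_char P.p0' P.ps (xx p m n) (xx_mean P.ps m n) (X := 0) (by intro j; simp [hx0]) le_rfl n t).trans ?_
      have : 0 ≤ C' * (n : ℝ) ^ (ρ - 1 + 2 * (ρ - 1)) * |t| ^ 3 := by positivity
      simpa using this
    · rw [h1 hu]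
      refine fin (a3.trans ?_) (by linarith : 2 * C ≤ C')
      gcongr
      linarith
  · refine ⟨C', hC'0, ρ - 1 + 2 * (ρ - 1/2), by rw [h2 hu]; linarith, fun n hn => ?_⟩
    have hn1 : (1 : ℝ) ≤ n := by exact_mod_cast hn
    have hn0 : (0 : ℝ) < n := by linarith
    obtain ⟨hx, hL, hR⟩ := hdec n hn
    have hCC : C1 ≤ C := by rw [hCd]; nlinarith [sq_nonneg C1]
    obtain ⟨a1, a2, a3⟩ := R.tollK_aux (C := C) (l := ρ - 1/2) (N := n * ∑ j, p j * xx p m n j ^ 2) hC hn (by linarith) (hU n hn)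
      (by intro c; refine (hL c).trans ?_
          have := Ud_one_le p n c
          gcongr)
      (by intro c; refine (hR c).trans ?_
          have := Ud_one_le p n c
          gcongr) rfl
      (by have := (hsec n hn).1
          rw [show ρ - 1 + (ρ - 1/2) = 2 * ρ - 3/2 by ring]
          refine this.trans ?_
          gcongr; rw [hCd]; nlinarith [sq_nonneg C1])
      (by have e : (n : ℝ) ^ (2 * (ρ - 1/2)) = n * ((n : ℝ) ^ (ρ - 1)) ^ 2 := by
            rw [show 2 * (ρ - 1/2) = 1 + ((ρ - 1) + (ρ - 1)) by ring, Real.rpow_add hn0, Real.rpow_add hn0, Real.rpow_one]; ring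
          rw [e]
          have : ∑ j, p j * xx p m n j ^ 2 ≤ C1 ^ 2 * ((n : ℝ) ^ (ρ - 1)) ^ 2 := by
            calc _ ≤ ∑ j, p j * (C1 ^ 2 * ((n : ℝ) ^ (ρ - 1)) ^ 2) := Finset.sum_le_sum fun j _ => by
                  apply mul_le_mul_of_nonneg_left _ (P.p0' j)
                  rw [← sq_abs, ← mul_pow]; exact pow_le_pow_left₀ (abs_nonneg _) (hx j) 2
              _ = _ := by rw [← Finset.sum_mul, P.ps, one_mul]
          calc _ ≤ (n : ℝ) * (C1 ^ 2 * ((n : ℝ) ^ (ρ - 1)) ^ 2) := by gcongr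
            _ = C1 ^ 2 * (n * ((n : ℝ) ^ (ρ - 1)) ^ 2) := by ring
            _ ≤ _ := by gcongr; rw [hCd]; linarith)
    refine ⟨fun t => ?_, fin a1 (by linarith), fin a2 (by linarith), ?_⟩
    · refine (iid_char P.p0' P.ps (xx p m n) (xx_mean P.ps m n) hx (by positivity) n t).trans ?_
      refine mul_le_mul_of_nonneg_right (fin (le_of_eq ?_) (by linarith : 3 * C1 ^ 3 ≤ C')) (by positivity)
      rw [show ρ - 1 + 2 * (ρ - 1/2) = 1 + ((ρ - 1) + ((ρ - 1) + (ρ - 1))) by ring, Real.rpow_add hn0, Real.rpow_add hn0, Real.rpow_add hn0, Real.rpow_one]; ring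
    · rw [h2 hu]
      refine fin (le_of_le_of_eq a3 ?_) (by linarith : 2 * C ≤ C')
      rw [show 2 * (ρ - 1/2) = 2 * ρ - 1 by ring]

theorem gt_mean (R : Rec M A p ρ α β γ m V) (n : ℕ) : EE p n (gt p m n) = 0 := by
  unfold gt
  rw [EE_sub, EE_const R.P.ps, sub_self]

theorem W_mean (R : Rec M A p ρ α β γ m V) (n : ℕ) : EE p n (fun c => ∑ j, V (cnt c j)) = ∑ j, Eb (p j) n V := by
  rw [EE_sum]
  exact Finset.sum_congr rfl fun j _ => EE_cnt R.P.ps j n V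

theorem W_var (R : Rec M A p ρ α β γ m V) {d η : ℝ} {Q : ℝ → ℝ} (hd : 0 < d) (hη : 0 ≤ η) (hV : AsyQ p d η V Q) {ε : ℝ} (hε : 0 < ε) :
    ∀ᶠ n : ℕ in atTop, EE p n (fun c => (∑ j, V (cnt c j) - ∑ j, Eb (p j) n V) ^ 2) ≤ ε * ((n : ℝ) ^ η) ^ 2 := by
  have P := R.P
  have hA : (0 : ℝ) < A := by have := P.hA; positivity
  have h1 : ∀ᶠ n : ℕ in atTop, ∀ j, Eb (p j) n (fun k => (V k - V ⌊(n : ℝ) * p j⌋₊) ^ 2) ≤ ε / A ^ 2 * ((n : ℝ) ^ η) ^ 2 :=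
    eventually_all.2 fun j => conc P hd hη hV j (by positivity)
  filter_upwards [h1] with n h1
  set W := fun c : Fin n → Fin A => ∑ j, V (cnt c j) with hW
  set κ := ∑ j, V ⌊(n : ℝ) * p j⌋₊ with hκ
  rw [← R.W_mean]
  set w := EE p n W with hw
  have e1 : EE p n (fun c => (W c - w) ^ 2) = EE p n (fun c => (W c - κ) ^ 2) - (w - κ) ^ 2 := by
    have : (fun c => (W c - w) ^ 2) = fun c => (W c - κ) ^ 2 + ((-2 * (w - κ)) * W c + (w ^ 2 - κ ^ 2)) := by funext c; ring
    rw [this, EE_add, EE_add, EE_mul, EE_const P.ps, ← hw]; ring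
  have e2 : EE p n (fun c => (W c - κ) ^ 2) ≤ EE p n (fun c => (A : ℝ) * ∑ j, (V (cnt c j) - V ⌊(n : ℝ) * p j⌋₊) ^ 2) := by
    apply EE_mono P.p0'
    intro c
    rw [hW, hκ]
    simp only
    rw [← Finset.sum_sub_distrib]
    have := sq_sum_le_card_mul_sum_sq (s := (univ : Finset (Fin A))) (f := fun j => V (cnt c j) - V ⌊(n : ℝ) * p j⌋₊)
    simpa using this
  rw [EE_mul, EE_sum] at e2
  have e3 : ∑ j, EE p n (fun c => (V (cnt c j) - V ⌊(n : ℝ) * p j⌋₊) ^ 2) ≤ ∑ j : Fin A, ε / A ^ 2 * ((n : ℝ) ^ η) ^ 2 := by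
    apply Finset.sum_le_sum; intro j _
    rw [EE_cnt P.ps j n (fun k => (V k - V ⌊(n : ℝ) * p j⌋₊) ^ 2)]
    exact h1 j
  rw [Finset.sum_const, Finset.card_univ, Fintype.card_fin, nsmul_eq_mul] at e3
  have e4 : (A : ℝ) * (A * (ε / A ^ 2 * ((n : ℝ) ^ η) ^ 2)) = ε * ((n : ℝ) ^ η) ^ 2 := by field_simp
  have e5 := mul_le_mul_of_nonneg_left e3 hA.le
  nlinarith [sq_nonneg (w - κ)]

theorem toll (R : Rec M A p ρ α β γ m V) {d η : ℝ} {Q : ℝ → ℝ} (hd : 0 < d) (hV : AsyQ p d η V Q)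
    (h1 : (∀ j, p j = 1 / (A : ℝ)) → η = ρ) (h2 : (¬ ∀ j, p j = 1 / (A : ℝ)) → η = 2 * ρ - 1) :
    ∃ T : ℕ → ℝ, (∀ ε > 0, ∀ᶠ n : ℕ in atTop, T n ≤ ε * (n : ℝ) ^ (3 * η / 2)) ∧
      ∀ n : ℕ, 1 ≤ n → ∀ t : ℝ, ‖EE p n (fun c => ((Real.exp (-((∑ j, V (cnt c j)) * (t ^ 2 / 2))) : ℝ) : ℂ) *
          Complex.exp (Complex.I * ((t * gt p m n c : ℝ) : ℂ))) -
        ((Real.exp (-((∑ j, Eb (p j) n V + EE p n (fun c => gt p m n c ^ 2)) * (t ^ 2 / 2))) : ℝ) : ℂ)‖ ≤ T n * |t| ^ 3 := by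
  have P := R.P
  have r1 := P.r1
  have hη : 1 ≤ η := by
    by_cases hu : ∀ j, p j = 1 / (A : ℝ)
    · rw [h1 hu]; exact r1
    · rw [h2 hu]; linarith
  obtain ⟨C, hC, e, he, hK⟩ := R.tollK h1 h2
  set v := fun n : ℕ => EE p n (fun c => (∑ j, V (cnt c j) - ∑ j, Eb (p j) n V) ^ 2) with hv
  have hv0 : ∀ n, 0 ≤ v n := fun n => EE_nonneg P.p0' n fun c => sq_nonneg _
  set Λ := fun n => √(v n) + 1 with hΛ
  have hΛ1 : ∀ n, 1 ≤ Λ n := fun n => by have := Real.sqrt_nonneg (v n); simp only [hΛ]; linarith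
  have hΛlim : Tendsto (fun n : ℕ => Λ n / (n : ℝ) ^ η) atTop (𝓝 0) := by
    have t1 : Tendsto (fun n : ℕ => (n : ℝ) ^ (-η)) atTop (𝓝 0) :=
      (tendsto_rpow_neg_atTop (by linarith)).comp tendsto_natCast_atTop_atTop
    have t2 : Tendsto (fun n : ℕ => √(v n) / (n : ℝ) ^ η) atTop (𝓝 0) := by
      rw [Metric.tendsto_nhds]
      intro ε hε
      filter_upwards [R.W_var hd (by linarith) hV (ε := (ε/2)^2) (by positivity), eventually_ge_atTop 1] with n h3 hn
      have hn0 : (0 : ℝ) < n := by exact_mod_cast hn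
      have hX : 0 < (n : ℝ) ^ η := by positivity
      rw [Real.dist_eq, sub_zero, abs_of_nonneg (by positivity), div_lt_iff₀ hX]
      have : √(v n) ≤ ε / 2 * (n : ℝ) ^ η := by
        apply Real.sqrt_le_iff.2 ⟨by positivity, ?_⟩
        rw [mul_pow]; exact h3
      nlinarith
    have := t2.add t1
    rw [add_zero] at this
    refine this.congr' ?_
    filter_upwards [eventually_ge_atTop 1] with n hn
    have hn0 : (0 : ℝ) < n := by exact_mod_cast hn
    rw [Real.rpow_neg hn0.le]; simp only [hΛ]; ring
  refine ⟨fun n => Λ n * √(EE p n (fun c => gt p m n c ^ 2)) + 2 * (Λ n * √(Λ n)) + 4 * (C * (n : ℝ) ^ e), ?_, ?_⟩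
  · have tl : Tendsto (fun n : ℕ => Λ n / (n : ℝ) ^ η * √C + 2 * (Λ n / (n : ℝ) ^ η * √(Λ n / (n : ℝ) ^ η)) +
        4 * (C * (n : ℝ) ^ (-(3 * η / 2 - e)))) atTop (𝓝 (0 * √C + 2 * (0 * √0) + 4 * (C * 0))) := by
      refine ((hΛlim.mul_const _).add ((hΛlim.mul hΛlim.sqrt).const_mul 2)).add ((Tendsto.const_mul C ?_).const_mul 4)
      exact (tendsto_rpow_neg_atTop (by linarith)).comp tendsto_natCast_atTop_atTop
    rw [show 0 * √C + 2 * (0 * √0) + 4 * (C * 0) = 0 by simp] at tl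
    intro ε hε
    filter_upwards [tl.eventually (gt_mem_nhds hε), eventually_ge_atTop 1] with n h3 hn
    have hn0 : (0 : ℝ) < n := by exact_mod_cast hn
    set X := (n : ℝ) ^ η with hXd
    have hX : 0 < X := by positivity
    have eX : (n : ℝ) ^ (3 * η / 2) = X * √X := by
      rw [hXd, Real.sqrt_eq_rpow, ← Real.rpow_mul hn0.le, ← Real.rpow_add hn0]; congr 1; ring
    have hsX : 0 < √X := Real.sqrt_pos.2 hX
    have b1 : √(EE p n (fun c => gt p m n c ^ 2)) ≤ √C * √X := by
      rw [← Real.sqrt_mul hC.le]; exact Real.sqrt_le_sqrt (hK n hn).2.2.2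
    have hΛ0 : 0 ≤ Λ n := by linarith [hΛ1 n]
    have b2 : Λ n * √(EE p n (fun c => gt p m n c ^ 2)) ≤ (Λ n / X * √C) * (X * √X) := by
      calc _ ≤ Λ n * (√C * √X) := by gcongr
        _ = _ := by field_simp
    have b3 : Λ n * √(Λ n) = (Λ n / X * √(Λ n / X)) * (X * √X) := by
      rw [Real.sqrt_div hΛ0]; field_simp
    have b4 : C * (n : ℝ) ^ e = (C * (n : ℝ) ^ (-(3 * η / 2 - e))) * (X * √X) := by
      rw [← eX, mul_assoc, ← Real.rpow_add hn0]; congr 2; ring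
    rw [eX, b3, b4]
    have := mul_le_mul_of_nonneg_right h3.le (by positivity : 0 ≤ X * √X)
    linarith
  · intro n hn t
    obtain ⟨k1, k2, k3, -⟩ := hK n hn
    have hl := EE_lin_sq P.ps (xx p m n) (xx_mean P.ps m n) n
    refine clt_step P.p0' P.ps (gt p m n) (fun c => ∑ k, xx p m n (c k)) (fun c => ∑ j, V (cnt c j)) (by linarith [hΛ1 n])
      (fun c => Finset.sum_nonneg fun j _ => R.Vnn _)
      (Finset.sum_nonneg fun j _ => Eb_nonneg (P.p0' j) (P.p1' j) n fun k _ => R.Vnn k)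
      (R.gt_mean n) rfl hl.1 hl.2 (R.W_mean n) ?_ k1 k2 k3 t
    have hs := Real.sq_sqrt (hv0 n)
    have := Real.sqrt_nonneg (v n)
    simp only [hΛ]
    simp only [hv] at hs this ⊢
    nlinarith

theorem clt (R : Rec M A p ρ α β γ m V) {d η : ℝ} {Q : ℝ → ℝ} (hd : 0 < d) (hV : AsyQ p d η V Q)
    (h1 : (∀ j, p j = 1 / (A : ℝ)) → η = ρ) (h2 : (¬ ∀ j, p j = 1 / (A : ℝ)) → η = 2 * ρ - 1)
    {a : ℕ → ℝ → ℂ} (ha : ∀ n t, ‖a n t‖ ≤ 1) (a0 : ∀ t, a 0 t = 1) (a1 : ∀ t, a 1 t = 1)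
    (ar : ∀ n ≥ 2, ∀ t, a n t = (EE p n (fun c => (∏ j, a (cnt c j) t) * Complex.exp (Complex.I * ((t * gt p m n c : ℝ) : ℂ)))) ^ M) :
    ∃ b : ℕ → ℝ, (∀ ε > 0, ∀ᶠ n : ℕ in atTop, b n ≤ ε * (n : ℝ) ^ (3 * η / 2)) ∧
      ∀ n t, ‖a n t - ((Real.exp (-(V n * (t ^ 2 / 2))) : ℝ) : ℂ)‖ ≤ |t| ^ 3 * b n := by
  have P := R.P
  have r1 := P.r1
  have hM := P.Mpos
  have hη : ρ < 3 * η / 2 := by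
    by_cases hu : ∀ j, p j = 1 / (A : ℝ)
    · rw [h1 hu]; linarith
    · rw [h2 hu]; linarith
  obtain ⟨T, hT, hstep⟩ := R.toll hd hV h1 h2
  obtain ⟨b, hb0, hb⟩ := exists_sol (p := p) (c := fun _ => (M : ℝ)) (n0 := 2) (fun n hn => P.powlt hn) (fun n => M * T n)
  refine ⟨b, ?_, ?_⟩
  · apply contraction P hη (a := fun n => M * T n) (hb0 0 (by norm_num)).le (hb0 1 (by norm_num)).le (fun n hn => (hb n hn).le)
    intro ε hε
    filter_upwards [hT (ε / M) (by positivity)] with n hn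
    have := mul_le_mul_of_nonneg_left hn hM.le
    refine this.trans (le_of_eq ?_)
    field_simp
  · intro n t
    revert n
    set s := t ^ 2 / 2 with hs
    have hs0 : 0 ≤ s := by positivity
    have hexp : ∀ k, ‖((Real.exp (-(V k * s)) : ℝ) : ℂ)‖ ≤ 1 := by
      intro k
      rw [Complex.norm_real, Real.norm_of_nonneg (Real.exp_pos _).le]
      exact Real.exp_le_one_iff.2 (by have := mul_nonneg (R.Vnn k) hs0; linarith)
    apply comparison' (c := fun _ => (M : ℝ)) (a := fun n => |t| ^ 3 * (M * T n)) (n0 := 2)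
      (f := fun n => ‖a n t - ((Real.exp (-(V n * s)) : ℝ) : ℂ)‖) (b := fun n => |t| ^ 3 * b n)
      P.p0' P.p1' (fun _ => P.Mpos.le) (fun n hn => P.powlt hn)
    · intro n hn
      have hn1 : 1 ≤ n := by omega
      set w := ((Real.exp (-((∑ j, Eb (p j) n V + EE p n (fun c => gt p m n c ^ 2)) * s)) : ℝ) : ℂ) with hw
      have ew : ((Real.exp (-(V n * s)) : ℝ) : ℂ) = w ^ M := by
        rw [hw, ← Complex.ofReal_pow, ← Real.exp_nat_mul, R.Vr n hn, ← Finset.mul_sum]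
        congr 2; ring
      rw [ar n hn t, ew]
      set g := fun c : Fin n → Fin A => Complex.exp (Complex.I * ((t * gt p m n c : ℝ) : ℂ)) with hg
      have hg1 : ∀ c, ‖g c‖ = 1 := by
        intro c; simp only [hg]; rw [mul_comm, Complex.norm_exp_ofReal_mul_I]
      have hpa : ∀ c : Fin n → Fin A, ‖∏ j, a (cnt c j) t‖ ≤ 1 := fun c => by
        rw [norm_prod]; exact Finset.prod_le_one (fun _ _ => norm_nonneg _) fun i _ => ha _ _
      set z := EE p n (fun c => (∏ j, a (cnt c j) t) * g c) with hz
      have hz1 : ‖z‖ ≤ 1 := by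
        refine (EE_norm_le P.p0' n _).trans ?_
        rw [← EE_const P.ps n (1 : ℝ)]
        apply EE_mono P.p0'
        intro c
        rw [norm_mul, hg1, mul_one]; exact hpa c
      have hw1 : ‖w‖ ≤ 1 := by
        rw [hw, Complex.norm_real, Real.norm_of_nonneg (Real.exp_pos _).le]
        refine Real.exp_le_one_iff.2 ?_
        have k1 : 0 ≤ ∑ j, Eb (p j) n V := Finset.sum_nonneg fun j _ => Eb_nonneg (P.p0' j) (P.p1' j) n fun k _ => R.Vnn k
        have k2 : 0 ≤ EE p n (fun c => gt p m n c ^ 2) := EE_nonneg P.p0' n fun c => sq_nonneg _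
        have := mul_nonneg (add_nonneg k1 k2) hs0
        linarith
      refine (pow_sub_le hz1 hw1 M).trans ?_
      set y := EE p n (fun c => ((Real.exp (-((∑ j, V (cnt c j)) * s)) : ℝ) : ℂ) * g c) with hy
      have b1 : ‖y - w‖ ≤ T n * |t| ^ 3 := hstep n hn1 t
      have b2 : ‖z - y‖ ≤ ∑ j, Eb (p j) n (fun n => ‖a n t - ((Real.exp (-(V n * s)) : ℝ) : ℂ)‖) := by
        rw [hz, hy, ← EE_sub]
        refine (EE_norm_le P.p0' n _).trans ?_
        have : ∀ j, Eb (p j) n (fun n => ‖a n t - ((Real.exp (-(V n * s)) : ℝ) : ℂ)‖) =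
          EE p n (fun c => (fun n => ‖a n t - ((Real.exp (-(V n * s)) : ℝ) : ℂ)‖) (cnt c j)) := fun j =>
          (EE_cnt P.ps j n (fun n => ‖a n t - ((Real.exp (-(V n * s)) : ℝ) : ℂ)‖)).symm
        rw [Finset.sum_congr rfl fun j _ => this j, ← EE_sum]
        apply EE_mono P.p0'
        intro c
        rw [← sub_mul, norm_mul, hg1, mul_one]
        have e : ((Real.exp (-((∑ j, V (cnt c j)) * s)) : ℝ) : ℂ) = ∏ j, ((Real.exp (-(V (cnt c j) * s)) : ℝ) : ℂ) := by
          rw [← Complex.ofReal_prod, ← Real.exp_sum, Finset.sum_neg_distrib, Finset.sum_mul]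
        rw [e]
        exact prod_sub_le univ _ _ (fun j => ha _ _) (fun j => hexp _)
      have b3 : ‖z - w‖ ≤ ‖z - y‖ + ‖y - w‖ := norm_sub_le_norm_sub_add_norm_sub _ _ _
      rw [← Finset.mul_sum]
      calc (M : ℝ) * ‖z - w‖ ≤ M * (∑ j, Eb (p j) n (fun n => ‖a n t - ((Real.exp (-(V n * s)) : ℝ) : ℂ)‖) + T n * |t| ^ 3) := by
            gcongr; linarith
        _ = _ := by ring
    · intro n hn
      rw [hb n hn]
      simp only [Eb_smul]
      have : ∑ j, (M : ℝ) * (|t| ^ 3 * Eb (p j) n b) = |t| ^ 3 * ∑ j, (M : ℝ) * Eb (p j) n b := by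
        rw [Finset.mul_sum]; exact Finset.sum_congr rfl fun j _ => by ring
      rw [this, mul_add]
    · intro n hn
      rw [hb0 n hn]
      interval_cases n
      · rw [a0, R.V0]; simp
      · rw [a1, R.V1]; simp

end Rec
end Part14

section Part15
open Finset MeasureTheory Filter Topology

section Blocks
open ProbabilityTheory

theorem indep_blocks {X κ J : Type} {E : J → Type} [MeasurableSpace X] [Inhabited X] [∀ j, MeasurableSpace (E j)]
    (ν : Measure X) [IsProbabilityMeasure ν] (b : κ → J) (G : ∀ j, (κ → X) → E j)
    (hG : ∀ j, Measurable (G j))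
    (dep : ∀ j ω ω', (∀ x, b x = j → ω x = ω' x) → G j ω = G j ω') :
    iIndepFun G (Measure.infinitePi fun _ : κ => ν) := by
  classical
  have key : iIndepFun (fun j (ω : κ → X) (x : {x // b x = j}) => ω x.1) (Measure.infinitePi fun _ : κ => ν) := by
    rw [iIndepFun_iff_map_fun_eq_infinitePi_map (by fun_prop)]
    have h1 := Measure.map_infinitePi_infinitePi_of_inj (P := fun _ : κ => ν)
      (f := fun s : (Σ j, {x // b x = j}) => s.2.1) (by
        rintro ⟨j, x, hx⟩ ⟨j', x', hx'⟩ h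
        simp only at h
        subst h; subst hx; subst hx'; rfl)
    have h2 := Measure.infinitePi_map_piCurry (fun (j : J) (_ : {x // b x = j}) => ν)
    rw [← h1, Measure.map_map (by fun_prop) (by fun_prop)] at h2
    refine h2.trans ?_
    congr 1
    funext j
    exact (Measure.map_infinitePi_infinitePi_of_inj (P := fun _ : κ => ν)
      (f := fun x : {x // b x = j} => x.1) Subtype.val_injective).symm
  have := key.comp (fun j (y : {x // b x = j} → X) => G j (fun x => if h : b x = j then y ⟨x, h⟩ else default))
    (fun j => (hG j).comp (measurable_pi_lambda _ fun x => by
      by_cases h : b x = j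
      · simp only [h, dite_true]; exact measurable_pi_apply _
      · simp only [h, dite_false]; exact measurable_const))
  refine this.congr fun j => Eventually.of_forall fun ω => ?_
  simp only [Function.comp_def]
  exact dep j _ _ fun x hx => by simp [hx]

end Blocks

section Trie
open ProbabilityTheory
variable {M A : ℕ}

/-- shift to the subtree `i` -/
def sh {n : ℕ} (i : Fin M) (ω : Fin n × List (Fin M) → Fin A) : Fin n × List (Fin M) → Fin A :=
  fun x => ω (x.1, i :: x.2)

/-- local value -/
noncomputable def vv (α β γ : ℝ) (k : ℕ) : ℝ := if k = 0 then α else if k = 1 then β else γ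

/-- depth-truncated functional -/
noncomputable def TT (α β γ : ℝ) {n : ℕ} : ℕ → Finset (Fin n) → (Fin n × List (Fin M) → Fin A) → ℝ
  | 0, _, _ => 0
  | h + 1, S, ω => vv α β γ S.card + if 2 ≤ S.card then
      ∑ i : Fin M, ∑ j : Fin A, TT α β γ h (S.filter fun k => ω (k, [i]) = j) (sh i ω) else 0

/-- contribution of one branch -/
noncomputable def YY (α β γ : ℝ) {n : ℕ} (h : ℕ) (S : Finset (Fin n)) (ω : Fin n × List (Fin M) → Fin A) : ℝ :=
  ∑ j : Fin A, TT α β γ h (S.filter fun k => ω (k, []) = j) ω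

variable {α β γ : ℝ} {n : ℕ}

theorem TT_succ (h : ℕ) (S : Finset (Fin n)) (ω : Fin n × List (Fin M) → Fin A) :
    TT α β γ (h + 1) S ω = vv α β γ S.card + if 2 ≤ S.card then ∑ i : Fin M, YY α β γ h S (sh i ω) else 0 := rfl

theorem sh_meas (i : Fin M) : Measurable (sh (A := A) (n := n) i) :=
  measurable_pi_lambda _ fun x => measurable_pi_apply _

theorem TT_meas (h : ℕ) : ∀ S : Finset (Fin n), Measurable (TT (M := M) (A := A) α β γ h S) := by
  induction h with
  | zero => intro S; exact measurable_const
  | succ h ih =>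
    intro S
    refine measurable_const.add ?_
    split_ifs
    · refine Finset.measurable_fun_sum _ fun i _ => Finset.measurable_fun_sum _ fun j _ => ?_
      have : Measurable (fun x : (Fin n → Fin A) × (Fin n × List (Fin M) → Fin A) =>
          TT α β γ h (S.filter fun k => x.1 k = j) x.2) :=
        measurable_from_prod_countable_right fun c => ih (S.filter fun k => c k = j)
      exact this.comp ((measurable_pi_lambda (fun ω k => ω (k, [i])) fun k => measurable_pi_apply _).prodMk (sh_meas i))
    · exact measurable_const

theorem YY_meas (h : ℕ) (S : Finset (Fin n)) : Measurable (YY (M := M) (A := A) α β γ h S) := by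
  refine Finset.measurable_fun_sum _ fun j _ => ?_
  have : Measurable (fun x : (Fin n → Fin A) × (Fin n × List (Fin M) → Fin A) =>
      TT α β γ h (S.filter fun k => x.1 k = j) x.2) :=
    measurable_from_prod_countable_right fun c => TT_meas h (S.filter fun k => c k = j)
  exact this.comp ((measurable_pi_lambda (fun ω k => ω (k, [])) fun k => measurable_pi_apply _).prodMk measurable_id)

theorem vv_nonneg (ha : 0 ≤ α) (hb : 0 ≤ β) (hg : 0 ≤ γ) (k : ℕ) : 0 ≤ vv α β γ k := by
  unfold vv; split_ifs <;> assumption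

theorem TT_nonneg (ha : 0 ≤ α) (hb : 0 ≤ β) (hg : 0 ≤ γ) (h : ℕ) : ∀ (S : Finset (Fin n)) (ω : Fin n × List (Fin M) → Fin A),
    0 ≤ TT α β γ h S ω := by
  induction h with
  | zero => intro S ω; exact le_rfl
  | succ h ih =>
    intro S ω
    refine add_nonneg (vv_nonneg ha hb hg _) ?_
    split_ifs
    · exact Finset.sum_nonneg fun i _ => Finset.sum_nonneg fun j _ => ih _ _
    · exact le_rfl

theorem TT_mono (ha : 0 ≤ α) (hb : 0 ≤ β) (hg : 0 ≤ γ) (h : ℕ) : ∀ (S : Finset (Fin n)) (ω : Fin n × List (Fin M) → Fin A),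
    TT α β γ h S ω ≤ TT α β γ (h + 1) S ω := by
  induction h with
  | zero => intro S ω; exact TT_nonneg ha hb hg _ _ _
  | succ h ih =>
    intro S ω
    refine add_le_add le_rfl ?_
    split_ifs
    · exact Finset.sum_le_sum fun i _ => Finset.sum_le_sum fun j _ => ih _ _
    · exact le_rfl

theorem TT_bdd (h : ℕ) : ∃ B : ℝ, ∀ (S : Finset (Fin n)) (ω : Fin n × List (Fin M) → Fin A), |TT α β γ h S ω| ≤ B := by
  induction h with
  | zero => exact ⟨0, fun S ω => by simp [TT]⟩
  | succ h ih =>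
    obtain ⟨B, hB⟩ := ih
    have hv : ∀ k, |vv α β γ k| ≤ |α| + |β| + |γ| := fun k => by
      unfold vv; split_ifs <;> [skip; skip; skip] <;> linarith [abs_nonneg α, abs_nonneg β, abs_nonneg γ]
    refine ⟨|α| + |β| + |γ| + ∑ i : Fin M, ∑ j : Fin A, B, fun S ω => ?_⟩
    rw [TT_succ]
    refine (abs_add_le _ _).trans (add_le_add (hv _) ?_)
    split_ifs
    · exact (Finset.abs_sum_le_sum_abs _ _).trans (Finset.sum_le_sum fun i _ =>
        (Finset.abs_sum_le_sum_abs _ _).trans (Finset.sum_le_sum fun j _ => hB _ _))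
    · rw [abs_zero]; exact Finset.sum_nonneg fun i _ => Finset.sum_nonneg fun j _ => (abs_nonneg _).trans (hB S ω)

/-- `TT` depends only on the coordinates `(k, i :: w)`, `k ∈ S`. -/
theorem TT_dep (h : ℕ) : ∀ (S : Finset (Fin n)) (ω ω' : Fin n × List (Fin M) → Fin A),
    (∀ k ∈ S, ∀ i w, ω (k, i :: w) = ω' (k, i :: w)) → TT α β γ h S ω = TT α β γ h S ω' := by
  induction h with
  | zero => intro S ω ω' _; rfl
  | succ h ih =>
    intro S ω ω' H
    unfold TT
    congr 1
    split_ifs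
    · refine Finset.sum_congr rfl fun i _ => Finset.sum_congr rfl fun j _ => ?_
      rw [Finset.filter_congr (q := fun k => ω' (k, [i]) = j) fun k hk => by rw [H k hk]]
      exact ih _ _ _ fun k hk i' w => H k (Finset.mem_filter.1 hk).1 i _
    · rfl

/-- reindexing -/
theorem TT_map {s : ℕ} (g : Fin s ↪ Fin n) (h : ℕ) : ∀ (U : Finset (Fin s)) (ω : Fin n × List (Fin M) → Fin A),
    TT α β γ h (U.map g) ω = TT α β γ h U (fun x => ω (g x.1, x.2)) := by
  induction h with
  | zero => intro U ω; rfl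
  | succ h ih =>
    intro U ω
    unfold TT
    rw [Finset.card_map]
    congr 1
    split_ifs
    · refine Finset.sum_congr rfl fun i _ => Finset.sum_congr rfl fun j _ => ?_
      rw [Finset.filter_map, ih]
      rfl
    · rfl

end Trie
end Part15

section Part16
open Finset MeasureTheory Filter Topology

section TrieProb
open ProbabilityTheory
variable {M A : ℕ} {α β γ : ℝ} {n : ℕ} {p : Fin A → ℝ}
  (ν : Measure (Fin A)) [IsProbabilityMeasure ν]

/-- the law of `n` random labelings (uncurried) -/
noncomputable def QQ (M : ℕ) (ν : Measure (Fin A)) [IsProbabilityMeasure ν] (n : ℕ) :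
    Measure (Fin n × List (Fin M) → Fin A) :=
  Measure.infinitePi fun _ => ν

instance : IsProbabilityMeasure (QQ M ν n) := by unfold QQ; infer_instance

theorem bdd_int {Ω E : Type*} [MeasurableSpace Ω] [NormedAddCommGroup E] [NormedSpace ℝ E] {P : Measure Ω} [IsProbabilityMeasure P]
    {X : Ω → ℝ} (hX : Measurable X) {B : ℝ} (hB : ∀ ω, |X ω| ≤ B) {F : ℝ → E} (hF : Continuous F) :
    Integrable (fun ω => F (X ω)) P := by
  obtain ⟨C, hC⟩ := (isCompact_Icc (a := -B) (b := B)).exists_bound_of_continuousOn hF.continuousOn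
  exact Integrable.of_bound (hF.comp_aestronglyMeasurable hX.aestronglyMeasurable) C
    (Eventually.of_forall fun ω => hC _ (abs_le.1 (hB ω)))

theorem bdd_mem {Ω : Type*} [MeasurableSpace Ω] {P : Measure Ω} [IsProbabilityMeasure P]
    {X : Ω → ℝ} (hX : Measurable X) {B : ℝ} (hB : ∀ ω, |X ω| ≤ B) : MemLp X 2 P :=
  MemLp.of_bound hX.aestronglyMeasurable B (Eventually.of_forall hB)

theorem law_card {E : Type*} [NormedAddCommGroup E] [NormedSpace ℝ E] {F : ℝ → E} (hF : Continuous F) (h : ℕ) (S : Finset (Fin n)) :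
    ∫ ω, F (TT α β γ h S ω) ∂(QQ M ν n) = ∫ ω, F (TT α β γ h univ ω) ∂(QQ M ν S.card) := by
  have e : S = univ.map (S.orderEmbOfFin rfl).toEmbedding := (Finset.map_orderEmbOfFin_univ S rfl).symm
  have h1 := Measure.map_infinitePi_infinitePi_of_inj (P := fun _ : Fin n × List (Fin M) => ν)
      (f := fun x : Fin S.card × List (Fin M) => ((S.orderEmbOfFin rfl).toEmbedding x.1, x.2)) (by
        rintro ⟨a, b⟩ ⟨a', b'⟩ h
        simp only [Prod.mk.injEq, EmbeddingLike.apply_eq_iff_eq] at h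
        rw [h.1, h.2])
  conv_lhs => rw [e]
  simp only [TT_map]
  conv_rhs => rw [QQ, ← h1]
  have gm : Measurable (fun (ω : Fin n × List (Fin M) → Fin A) (x : Fin S.card × List (Fin M)) =>
      ω ((S.orderEmbOfFin rfl).toEmbedding x.1, x.2)) := measurable_pi_lambda _ fun x => measurable_pi_apply _
  rw [integral_map gm.aemeasurable (hF.comp_aestronglyMeasurable (TT_meas h _).aestronglyMeasurable)]
  rfl

theorem law_sh (i : Fin M) : (QQ M ν n).map (sh i) = QQ M ν n :=
  Measure.map_infinitePi_infinitePi_of_inj (P := fun _ : Fin n × List (Fin M) => ν)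
      (f := fun x : Fin n × List (Fin M) => (x.1, i :: x.2)) (by
        rintro ⟨a, b⟩ ⟨a', b'⟩ h
        simp only [Prod.mk.injEq, List.cons.injEq, true_and] at h
        rw [h.1, h.2])

theorem law_YY {E : Type*} [NormedAddCommGroup E] [NormedSpace ℝ E] {F : ℝ → E} (hF : Continuous F) (h : ℕ) (S : Finset (Fin n)) (i : Fin M) :
    ∫ ω, F (YY α β γ h S (sh i ω)) ∂(QQ M ν n) = ∫ ω, F (YY α β γ h S ω) ∂(QQ M ν n) := by
  conv_rhs => rw [← law_sh ν i]
  rw [integral_map (sh_meas i).aemeasurable (hF.comp_aestronglyMeasurable (YY_meas h _).aestronglyMeasurable)]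

theorem YY_bdd (h : ℕ) : ∃ B : ℝ, ∀ (S : Finset (Fin n)) (ω : Fin n × List (Fin M) → Fin A), |YY α β γ h S ω| ≤ B := by
  obtain ⟨B, hB⟩ := TT_bdd (M := M) (A := A) (α := α) (β := β) (γ := γ) (n := n) h
  exact ⟨∑ j : Fin A, B, fun S ω => (Finset.abs_sum_le_sum_abs _ _).trans (Finset.sum_le_sum fun j _ => hB _ _)⟩

/-- the branch contribution with frozen colors -/
noncomputable def ZZ (α β γ : ℝ) (h : ℕ) (c : Fin n → Fin A) (ω : Fin n × List (Fin M) → Fin A) : ℝ :=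
  ∑ j : Fin A, TT α β γ h (univ.filter fun k => c k = j) ω

theorem ZZ_meas (h : ℕ) (c : Fin n → Fin A) : Measurable (ZZ (M := M) α β γ h c) :=
  Finset.measurable_fun_sum _ fun j _ => TT_meas h _

theorem root_law [Inhabited (Fin A)] (hν : ∀ j, ν.real {j} = p j) {E : Type*} [NormedAddCommGroup E] [NormedSpace ℝ E] {F : ℝ → E}
    (hF : Continuous F) (h : ℕ) :
    ∫ ω, F (YY α β γ h univ ω) ∂(QQ M ν n) = EE p n (fun c => ∫ ω, F (ZZ α β γ h c ω) ∂(QQ M ν n)) := by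
  set r : (Fin n × List (Fin M) → Fin A) → (Fin n → Fin A) := fun ω k => ω (k, []) with hr
  have rm : Measurable r := measurable_pi_lambda _ fun k => measurable_pi_apply _
  obtain ⟨B, hB⟩ := YY_bdd (M := M) (A := A) (α := α) (β := β) (γ := γ) (n := n) h
  have hu : (⋃ c, r ⁻¹' {c}) = Set.univ := by ext ω; simp
  rw [← setIntegral_univ, ← hu, integral_iUnion_fintype]
  rotate_left
  · exact fun c => rm (measurableSet_singleton c)
  · exact fun c c' hc => Disjoint.preimage _ (by simpa using hc)
  · exact fun c => (bdd_int (YY_meas h _) (hB _) hF).integrableOn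
  unfold EE
  refine Finset.sum_congr rfl fun c _ => ?_
  have e1 : ∫ ω in r ⁻¹' {c}, F (YY α β γ h univ ω) ∂(QQ M ν n) = ∫ ω in r ⁻¹' {c}, F (ZZ α β γ h c ω) ∂(QQ M ν n) := by
    refine setIntegral_congr_fun (rm (measurableSet_singleton c)) fun ω hω => ?_
    have hω' : r ω = c := hω
    simp only [YY, ZZ, ← hω', hr]
  have ind : IndepFun r (ZZ α β γ h c) (QQ M ν n) := by
    have := indep_blocks (X := Fin A) (E := fun _ : Bool => (Fin n → Fin A) × ℝ) ν
      (fun x : Fin n × List (Fin M) => decide (x.2 = []))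
      (fun b ω => if b then (r ω, 0) else (c, ZZ α β γ h c ω))
      (by
        intro b
        cases b
        · exact measurable_const.prodMk (ZZ_meas h c)
        · exact rm.prodMk measurable_const)
      (by
        intro b ω ω' H
        cases b
        · have : ZZ α β γ h c ω = ZZ α β γ h c ω' := Finset.sum_congr rfl fun j _ =>
            TT_dep h _ _ _ fun k _ i w => H (k, i :: w) (by simp)
          simp [this]
        · have : r ω = r ω' := funext fun k => H (k, []) (by simp)
          simp [this])
    exact (this.indepFun (i := true) (j := false) (by simp)).comp measurable_fst measurable_snd
  rw [e1, Indep.setIntegral_eq_smul (m := MeasurableSpace.comap r inferInstance) (X := ZZ α β γ h c) (f := F) rm.comap_le ind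
    (ZZ_meas h c).aemeasurable ⟨{c}, measurableSet_singleton c, rfl⟩ hF.aestronglyMeasurable]
  congr 1
  rw [← map_measureReal_apply rm (measurableSet_singleton c)]
  have h1 := Measure.map_infinitePi_infinitePi_of_inj (P := fun _ : Fin n × List (Fin M) => ν)
      (f := fun k : Fin n => (k, ([] : List (Fin M)))) (by intro a b hab; simpa using hab)
  have h2 : (QQ M ν n).map r = Measure.infinitePi fun _ : Fin n => ν := h1
  rw [h2, Measure.real, Measure.infinitePi_singleton_of_fintype, ENNReal.toReal_prod]
  exact Finset.prod_congr rfl fun k _ => hν _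

theorem ind_j [Inhabited (Fin A)] (h : ℕ) (c : Fin n → Fin A) :
    iIndepFun (fun j => TT (M := M) α β γ h (univ.filter fun k => c k = j)) (QQ M ν n) :=
  indep_blocks (E := fun _ => ℝ) ν (fun x : Fin n × List (Fin M) => c x.1) _ (fun j => TT_meas h _)
    fun j ω ω' H => TT_dep h _ _ _ fun k hk i w => H _ (by simpa using hk)

theorem ind_i [Inhabited (Fin A)] [NeZero M] (h : ℕ) (S : Finset (Fin n)) :
    iIndepFun (fun i : Fin M => fun ω => YY (A := A) α β γ h S (sh i ω)) (QQ M ν n) :=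
  indep_blocks (E := fun _ => ℝ) ν (fun x : Fin n × List (Fin M) => x.2.headD 0) _ (fun j => (YY_meas h _).comp (sh_meas j))
    fun j ω ω' H => by
      have : sh j ω = sh j ω' := funext fun x => H _ (by simp)
      simp only [this]

/-- mean, second central moment, characteristic function of the truncated functional -/
noncomputable def mh (M : ℕ) (α β γ : ℝ) (ν : Measure (Fin A)) [IsProbabilityMeasure ν] (h n : ℕ) : ℝ :=
  ∫ ω, TT α β γ h univ ω ∂(QQ M ν n)
noncomputable def Vh (M : ℕ) (α β γ : ℝ) (ν : Measure (Fin A)) [IsProbabilityMeasure ν] (h n : ℕ) : ℝ :=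
  variance (TT α β γ h univ) (QQ M ν n)
noncomputable def ch (M : ℕ) (α β γ : ℝ) (ν : Measure (Fin A)) [IsProbabilityMeasure ν] (h n : ℕ) (t : ℝ) : ℂ :=
  ∫ ω, Complex.exp (Complex.I * ((t * TT α β γ h univ ω : ℝ) : ℂ)) ∂(QQ M ν n)

theorem TT_succ2 (hn : 2 ≤ n) (h : ℕ) (ω : Fin n × List (Fin M) → Fin A) :
    TT α β γ (h + 1) univ ω = γ + ∑ i : Fin M, YY α β γ h univ (sh i ω) := by
  rw [TT_succ, Finset.card_fin, if_pos hn, vv, if_neg (by omega), if_neg (by omega)]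

theorem TT_succ1 (hn : n < 2) (h : ℕ) (ω : Fin n × List (Fin M) → Fin A) :
    TT α β γ (h + 1) univ ω = vv α β γ n := by
  rw [TT_succ, Finset.card_fin, if_neg (by omega), add_zero]

theorem mh_card (h : ℕ) (S : Finset (Fin n)) : ∫ ω, TT α β γ h S ω ∂(QQ M ν n) = mh M α β γ ν h S.card :=
  law_card ν continuous_id h S

theorem Vh_card (h : ℕ) (S : Finset (Fin n)) : variance (TT α β γ h S) (QQ M ν n) = Vh M α β γ ν h S.card := by
  obtain ⟨B, hB⟩ := TT_bdd (M := M) (A := A) (α := α) (β := β) (γ := γ) (n := n) h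
  obtain ⟨B', hB'⟩ := TT_bdd (M := M) (A := A) (α := α) (β := β) (γ := γ) (n := S.card) h
  rw [Vh, variance_eq_sub (bdd_mem (TT_meas h _) (hB _)), variance_eq_sub (bdd_mem (TT_meas h _) (hB' _))]
  congr 1
  · exact law_card ν (continuous_pow 2) h S
  · exact congrArg (· ^ 2) (law_card ν continuous_id h S)

theorem mh_ZZ (h : ℕ) (c : Fin n → Fin A) : ∫ ω, ZZ α β γ h c ω ∂(QQ M ν n) = ∑ j, mh M α β γ ν h (cnt c j) := by
  obtain ⟨B, hB⟩ := TT_bdd (M := M) (A := A) (α := α) (β := β) (γ := γ) (n := n) h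
  have hi : ∀ j, Integrable (TT α β γ h (univ.filter fun k => c k = j)) (QQ M ν n) := fun j => bdd_int (TT_meas h _) (hB _) continuous_id
  unfold ZZ
  rw [integral_finsetSum _ fun j _ => hi j]
  exact Finset.sum_congr rfl fun j _ => mh_card ν h _

theorem mh_rec [Inhabited (Fin A)] (hν : ∀ j, ν.real {j} = p j) (hn : 2 ≤ n) (h : ℕ) :
    mh M α β γ ν (h + 1) n = γ + M * EE p n (fun c => ∑ j, mh M α β γ ν h (cnt c j)) := by
  obtain ⟨B, hB⟩ := YY_bdd (M := M) (A := A) (α := α) (β := β) (γ := γ) (n := n) h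
  have hi : ∀ i : Fin M, Integrable (fun ω => YY α β γ h univ (sh i ω)) (QQ M ν n) := fun i =>
    bdd_int ((YY_meas h _).comp (sh_meas i)) (fun ω => hB _ _) continuous_id
  have e := root_law (M := M) (n := n) (α := α) (β := β) (γ := γ) ν hν continuous_id h
  simp only [id_eq] at e
  have e2 := fun i => law_YY (M := M) (n := n) (α := α) (β := β) (γ := γ) ν continuous_id h univ i
  simp only [id_eq] at e2
  unfold mh
  simp only [TT_succ2 hn]
  rw [integral_add (integrable_const _) (integrable_finsetSum _ fun i _ => hi i), integral_finsetSum _ fun i _ => hi i]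
  simp only [e2, e, mh_ZZ]
  simp [mh]

theorem ch_rec [Inhabited (Fin A)] [NeZero M] (hν : ∀ j, ν.real {j} = p j) (hn : 2 ≤ n) (h : ℕ) (t : ℝ) :
    ch M α β γ ν (h + 1) n t = Complex.exp (Complex.I * ((t * γ : ℝ) : ℂ)) *
      (EE p n (fun c => ∏ j, ch M α β γ ν h (cnt c j) t)) ^ M := by
  set F : ℝ → ℂ := fun x => Complex.exp (Complex.I * ((t * x : ℝ) : ℂ)) with hFd
  have hF : Continuous F := by fun_prop
  have Fadd : ∀ x y, F (x + y) = F x * F y := fun x y => by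
    simp only [hFd]; rw [← Complex.exp_add]; congr 1; push_cast; ring
  have Fsum : ∀ {k : ℕ} (f : Fin k → ℝ), F (∑ i, f i) = ∏ i, F (f i) := fun f => by
    simp only [hFd]; rw [← Complex.exp_sum]; congr 1; push_cast; simp [Finset.mul_sum]
  have e1 : ∫ ω, F (TT α β γ (h + 1) univ ω) ∂(QQ M ν n) = F γ * ∏ i : Fin M, ∫ ω, F (YY α β γ h univ (sh i ω)) ∂(QQ M ν n) := by
    simp only [TT_succ2 hn, Fadd, Fsum]
    rw [integral_const_mul, (ind_i (α := α) (β := β) (γ := γ) ν h univ).integral_fun_prod_comp (f := fun _ => F)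
      (fun i => ((YY_meas h _).comp (sh_meas i)).aemeasurable) (fun i => hF.aestronglyMeasurable)]
  have e2 : ∀ c : Fin n → Fin A, ∫ ω, F (ZZ α β γ h c ω) ∂(QQ M ν n) = ∏ j, ch M α β γ ν h (cnt c j) t := fun c => by
    unfold ZZ
    simp only [Fsum]
    rw [(ind_j (α := α) (β := β) (γ := γ) ν h c).integral_fun_prod_comp (f := fun _ => F)
      (fun i => (TT_meas h _).aemeasurable) (fun i => hF.aestronglyMeasurable)]
    exact Finset.prod_congr rfl fun j _ => law_card ν hF h _
  have e3 := root_law (M := M) (n := n) (α := α) (β := β) (γ := γ) ν hν hF h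
  refine e1.trans ?_
  simp only [law_YY ν hF, e3, e2]
  simp [hFd]

theorem Vh_rec [Inhabited (Fin A)] [NeZero M] (hν : ∀ j, ν.real {j} = p j) (hps : ∑ j, p j = 1) (hn : 2 ≤ n) (h : ℕ) :
    Vh M α β γ ν (h + 1) n = M * (EE p n (fun c => ∑ j, Vh M α β γ ν h (cnt c j)) +
      EE p n (fun c => gt p (mh M α β γ ν h) n c ^ 2)) := by
  obtain ⟨B, hB⟩ := YY_bdd (M := M) (A := A) (α := α) (β := β) (γ := γ) (n := n) h
  obtain ⟨B1, hB1⟩ := TT_bdd (M := M) (A := A) (α := α) (β := β) (γ := γ) (n := n) h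
  have hm : ∀ i : Fin M, MemLp (fun ω => YY α β γ h univ (sh i ω)) 2 (QQ M ν n) := fun i =>
    bdd_mem ((YY_meas h _).comp (sh_meas i)) (fun ω => hB _ _)
  have hmY : MemLp (YY α β γ h univ) 2 (QQ M ν n) := bdd_mem (YY_meas h _) (fun ω => hB _ _)
  have e : TT (M := M) (A := A) α β γ (h + 1) (univ : Finset (Fin n)) = fun ω => γ + (∑ i : Fin M, fun ω => YY α β γ h univ (sh i ω)) ω := by
    funext ω; rw [TT_succ2 hn, Finset.sum_apply]
  have v1 : ∀ i : Fin M, variance (fun ω => YY α β γ h univ (sh i ω)) (QQ M ν n) = variance (YY α β γ h univ) (QQ M ν n) := fun i => by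
    rw [variance_eq_sub (hm i), variance_eq_sub hmY]
    congr 1
    · exact law_YY ν (continuous_pow 2) h univ i
    · exact congrArg (· ^ 2) (law_YY ν continuous_id h univ i)
  unfold Vh
  rw [e, variance_const_add (Finset.aestronglyMeasurable_sum _ fun i _ => (hm i).1),
    IndepFun.variance_sum (fun i _ => hm i) (fun i _ j _ hij => (ind_i (α := α) (β := β) (γ := γ) ν h univ).indepFun hij),
    Finset.sum_congr rfl fun i _ => v1 i, Finset.sum_const, Finset.card_fin, nsmul_eq_mul]
  congr 1
  have z2 : ∀ c : Fin n → Fin A, ∫ ω, (ZZ α β γ h c ω) ^ 2 ∂(QQ M ν n) =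
      ∑ j, Vh M α β γ ν h (cnt c j) + (∑ j, mh M α β γ ν h (cnt c j)) ^ 2 := fun c => by
    have hz : MemLp (ZZ α β γ h c) 2 (QQ M ν n) := memLp_finsetSum _ fun j _ => bdd_mem (TT_meas h _) (hB1 _)
    have := variance_eq_sub hz
    rw [mh_ZZ] at this
    have v2 : variance (ZZ α β γ h c) (QQ M ν n) = ∑ j, Vh M α β γ ν h (cnt c j) := by
      have e5 : ZZ (M := M) α β γ h c = ∑ j, TT α β γ h (univ.filter fun k => c k = j) := by
        funext ω; rw [Finset.sum_apply]; rfl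
      rw [e5, IndepFun.variance_sum (fun j _ => bdd_mem (TT_meas h _) (hB1 _))
        (fun i _ j _ hij => (ind_j (α := α) (β := β) (γ := γ) ν h c).indepFun hij)]
      exact Finset.sum_congr rfl fun j _ => Vh_card ν h _
    rw [v2] at this
    simp only [Pi.pow_apply] at this
    linarith
  rw [variance_eq_sub hmY]
  have r2 := root_law (M := M) (n := n) (α := α) (β := β) (γ := γ) ν hν (continuous_pow 2) h
  have r1 := root_law (M := M) (n := n) (α := α) (β := β) (γ := γ) ν hν continuous_id h
  simp only [id_eq, mh_ZZ] at r1
  simp only [z2] at r2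
  simp only [Pi.pow_apply]
  rw [r2, r1, EE_add]
  unfold gt
  set μ' := EE p n (fun c => ∑ j, mh M α β γ ν h (cnt c j))
  have : EE p n (fun c => (∑ j, mh M α β γ ν h (cnt c j) - μ') ^ 2) = EE p n (fun c => (∑ j, mh M α β γ ν h (cnt c j)) ^ 2) - μ' ^ 2 := by
    have : ∀ c : Fin n → Fin A, (∑ j, mh M α β γ ν h (cnt c j) - μ') ^ 2 = (∑ j, mh M α β γ ν h (cnt c j)) ^ 2 - (2 * μ') * (∑ j, mh M α β γ ν h (cnt c j)) + μ' ^ 2 := fun c => by ring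
    simp only [this]
    rw [EE_add, EE_sub, EE_mul, EE_const hps]
    ring
  rw [this]
  simp only [Vh]
  ring

end TrieProb
end Part16

section Part17
open Finset MeasureTheory Filter Topology

section TrieComb
open Classical
variable {M A : ℕ} {α β γ : ℝ} {n : ℕ}

/-- prepending a letter -/
def consEmb (M A : ℕ) : ((Fin M × Fin A) × List (Fin M × Fin A)) ↪ List (Fin M × Fin A) where
  toFun x := x.1 :: x.2
  inj' := by
    intro x y h
    exact Prod.ext (List.cons.inj h).1 (List.cons.inj h).2

theorem consEmb_apply (x : (Fin M × Fin A) × List (Fin M × Fin A)) : consEmb M A x = x.1 :: x.2 := rfl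

/-- words of length less than `h` -/
def WW (M A : ℕ) : ℕ → Finset (List (Fin M × Fin A))
  | 0 => ∅
  | h + 1 => Finset.cons [] ((univ ×ˢ WW M A h).map (consEmb M A)) (by simp [consEmb_apply])

theorem mem_WW (h : ℕ) : ∀ w : List (Fin M × Fin A), w ∈ WW M A h ↔ w.length < h := by
  induction h with
  | zero => intro w; simp [WW]
  | succ h ih => intro w; cases w <;> simp [WW, ih, consEmb_apply]

noncomputable def occS (S : Finset (Fin n)) (ω : Fin n × List (Fin M) → Fin A) (w : List (Fin M × Fin A)) : ℕ :=
  (S.filter fun k => Occurs (fun v => ω (k, v)) w).card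

def ES (S : Finset (Fin n)) (ω : Fin n × List (Fin M) → Fin A) (w : List (Fin M × Fin A)) : Prop :=
  ∀ u, u <+: w → u ≠ w → 2 ≤ occS S ω u

theorem Occurs_cons (L : List (Fin M) → Fin A) (i : Fin M) (j : Fin A) (w : List (Fin M × Fin A)) :
    Occurs L ((i, j) :: w) ↔ L [i] = j ∧ Occurs (fun v => L (i :: v)) w := by
  unfold Occurs
  constructor
  · intro H
    refine ⟨by simpa using H ⟨0, by simp⟩, fun t => ?_⟩
    simpa using H ⟨t.1 + 1, by simp⟩
  · rintro ⟨h0, H⟩ ⟨t, ht⟩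
    cases t with
    | zero => simpa using h0
    | succ t => simpa using H ⟨t, by simpa using ht⟩

theorem occS_nil (S : Finset (Fin n)) (ω : Fin n × List (Fin M) → Fin A) : occS S ω [] = S.card := by
  unfold occS
  rw [Finset.filter_true_of_mem]
  intro k _ t
  exact t.elim0

theorem occS_cons (S : Finset (Fin n)) (ω : Fin n × List (Fin M) → Fin A) (i : Fin M) (j : Fin A) (w : List (Fin M × Fin A)) :
    occS S ω ((i, j) :: w) = occS (S.filter fun k => ω (k, [i]) = j) (sh i ω) w := by
  unfold occS
  rw [Finset.filter_filter]
  simp only [Occurs_cons]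
  rfl

theorem ES_nil (S : Finset (Fin n)) (ω : Fin n × List (Fin M) → Fin A) : ES S ω [] := by
  intro u hu hne
  exact absurd (List.prefix_nil.1 hu) hne

theorem ES_cons (S : Finset (Fin n)) (ω : Fin n × List (Fin M) → Fin A) (i : Fin M) (j : Fin A) (w : List (Fin M × Fin A)) :
    ES S ω ((i, j) :: w) ↔ 2 ≤ S.card ∧ ES (S.filter fun k => ω (k, [i]) = j) (sh i ω) w := by
  constructor
  · intro H
    refine ⟨by simpa [occS_nil] using H [] (List.nil_prefix) (by simp), fun u hu hne => ?_⟩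
    rw [← occS_cons]
    exact H _ (by simpa using hu) (by simpa using hne)
  · rintro ⟨h0, H⟩ u hu hne
    cases u with
    | nil => rwa [occS_nil]
    | cons x u =>
      obtain ⟨hx, hu'⟩ := List.cons_prefix_cons.1 hu
      subst hx
      rw [occS_cons]
      exact H u hu' (fun e => hne (by rw [e]))

theorem TT_eq (h : ℕ) : ∀ (S : Finset (Fin n)) (ω : Fin n × List (Fin M) → Fin A),
    TT α β γ h S ω = ∑ w ∈ WW M A h, if ES S ω w then vv α β γ (occS S ω w) else 0 := by
  induction h with
  | zero => intro S ω; rfl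
  | succ h ih =>
    intro S ω
    unfold WW
    rw [Finset.sum_cons, Finset.sum_map, Finset.sum_product, Fintype.sum_prod_type]
    simp only [ES_nil, occS_nil, consEmb_apply, ES_cons, occS_cons, if_true]
    unfold TT
    congr 1
    split_ifs with hS
    · simp only [hS, true_and, ih]
    · simp [hS]

theorem occS_anti (S : Finset (Fin n)) (ω : Fin n × List (Fin M) → Fin A) {u w : List (Fin M × Fin A)} (h : u <+: w) :
    occS S ω w ≤ occS S ω u := by
  refine Finset.card_le_card (Finset.monotone_filter_right _ fun k _ hk => ?_)
  obtain ⟨v, rfl⟩ := h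
  intro t
  have := hk ⟨t.1, by simp; omega⟩
  have ht : t.1 + 1 ≤ u.length := t.2
  simpa [List.take_append_of_le_length ht] using this

theorem fin_of_bdd (ω : Fin n × List (Fin M) → Fin A) (B : ℝ) (hB : ∀ h, TT 1 1 1 h univ ω ≤ B) :
    ∃ h0, ∀ w, ES univ ω w → w ∈ WW M A h0 := by
  have hcard : ∀ h, TT 1 1 1 h univ ω = ((WW M A h).filter (ES univ ω)).card := fun h => by
    rw [TT_eq, Finset.card_filter]; push_cast
    refine Finset.sum_congr rfl fun w _ => ?_
    simp [vv]
  have sub : ∀ t : Finset (List (Fin M × Fin A)), ∃ h, t ⊆ WW M A h := fun t =>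
    ⟨t.sup List.length + 1, fun w hw => (mem_WW _ _).2 (Nat.lt_succ_of_le (Finset.le_sup (f := List.length) hw))⟩
  have hf : {w | ES univ ω w}.Finite := by
    by_contra hinf
    obtain ⟨t, ht, hc⟩ := Set.Infinite.exists_subset_card_eq hinf (⌈B⌉₊ + 1)
    obtain ⟨h, hh⟩ := sub t
    have h1 : t ⊆ (WW M A h).filter (ES univ ω) := fun w hw => Finset.mem_filter.2 ⟨hh hw, ht hw⟩
    have h2 := Finset.card_le_card h1
    have h3 := hB h
    rw [hcard] at h3
    have h4 := Nat.le_ceil B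
    have h5 : ((⌈B⌉₊ + 1 : ℕ) : ℝ) ≤ (((WW M A h).filter (ES univ ω)).card : ℝ) := by rw [← hc]; exact_mod_cast h2
    push_cast at h5
    linarith
  obtain ⟨h, hh⟩ := sub hf.toFinset
  exact ⟨h, fun w hw => hh (by simpa using hw)⟩

theorem N_eq (ω : Fin n × List (Fin M) → Fin A) {h0 : ℕ} (H : ∀ w, ES univ ω w → w ∈ WW M A h0) {h : ℕ} (hh : h0 ≤ h) :
    α * extZeroCount (fun k v => ω (k, v)) + β * extOneCount (fun k v => ω (k, v)) + γ * gtrieSize (fun k v => ω (k, v)) =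
      TT α β γ h univ ω := by
  have H' : ∀ w, ES univ ω w → w ∈ WW M A h := fun w hw =>
    (mem_WW _ _).2 (lt_of_lt_of_le ((mem_WW _ _).1 (H w hw)) hh)
  have occ : ∀ w, occCount (fun k v => ω (k, v)) w = occS univ ω w := fun w => by
    unfold occCount occS
    rw [Nat.card_eq_fintype_card, Fintype.card_subtype]
  have nc : ∀ (P : List (Fin M × Fin A) → Prop) (T : Set (List (Fin M × Fin A))), (∀ w, w ∈ T ↔ ES univ ω w ∧ P w) →
      (T.ncard : ℝ) = ∑ w ∈ WW M A h, if ES univ ω w ∧ P w then 1 else 0 := fun P T hT => by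
    have : T = ((WW M A h).filter fun w => ES univ ω w ∧ P w : Finset _) := by
      ext w; simp only [Finset.coe_filter, Set.mem_ofPred_eq, hT]
      exact ⟨fun hw => ⟨H' w hw.1, hw⟩, fun hw => hw.2⟩
    rw [this, Set.ncard_coe_finset, Finset.card_filter]; push_cast; rfl
  have e0 := nc (fun w => occS univ ω w = 0) {w | IsExternalNode (fun k v => ω (k, v)) w ∧ occCount (fun k v => ω (k, v)) w = 0}
    (fun w => by
      simp only [IsExternalNode, occ, Set.mem_ofPred_eq, ES]
      constructor
      · rintro ⟨⟨_, h2⟩, h3⟩; exact ⟨h2, h3⟩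
      · rintro ⟨h2, h3⟩; exact ⟨⟨by omega, h2⟩, h3⟩)
  have e1 := nc (fun w => occS univ ω w = 1) {w | IsExternalNode (fun k v => ω (k, v)) w ∧ occCount (fun k v => ω (k, v)) w = 1}
    (fun w => by
      simp only [IsExternalNode, occ, Set.mem_ofPred_eq, ES]
      constructor
      · rintro ⟨⟨_, h2⟩, h3⟩; exact ⟨h2, h3⟩
      · rintro ⟨h2, h3⟩; exact ⟨⟨by omega, h2⟩, h3⟩)
  have e2 := nc (fun w => 2 ≤ occS univ ω w) (GTrie (fun k v => ω (k, v)))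
    (fun w => by
      simp only [GTrie, occ, Set.mem_ofPred_eq]
      exact ⟨fun h2 => ⟨fun u hu _ => h2.trans (occS_anti _ _ hu), h2⟩, fun h2 => h2.2⟩)
  unfold extZeroCount extOneCount gtrieSize
  rw [e0, e1, e2, TT_eq, Finset.mul_sum, Finset.mul_sum, Finset.mul_sum, ← Finset.sum_add_distrib, ← Finset.sum_add_distrib]
  refine Finset.sum_congr rfl fun w _ => ?_
  by_cases hE : ES univ ω w
  · simp only [hE, true_and, if_true, vv]
    rcases Nat.lt_or_ge (occS univ ω w) 2 with h2 | h2
    · interval_cases occS univ ω w <;> simp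
    · simp [h2, show occS univ ω w ≠ 0 by omega, show occS univ ω w ≠ 1 by omega]
  · simp [hE]

end TrieComb
end Part17

section Part18
open Finset MeasureTheory ProbabilityTheory Filter Topology

section TrieLim
variable {M A : ℕ} {α β γ : ℝ} {p : Fin A → ℝ} {ρ : ℝ}

theorem EEb (hps : ∑ j, p j = 1) (n : ℕ) (f : ℕ → ℝ) :
    (M : ℝ) * EE p n (fun c => ∑ j, f (cnt c j)) = ∑ j, (M : ℝ) * Eb (p j) n f := by
  rw [EE_sum, Finset.mul_sum]
  exact Finset.sum_congr rfl fun j _ => by rw [EE_cnt hps]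

theorem sup_sol (P : Par M A p ρ) {a : ℕ → ℝ} (ha : ∀ n, 0 ≤ a n) {K : ℝ} (hK : 0 ≤ K) :
    ∃ b : ℕ → ℝ, (∀ n, K ≤ b n) ∧ ∀ n ≥ 2, ∑ j, (M : ℝ) * Eb (p j) n b + a n ≤ b n := by
  have hMp := P.Mpos
  obtain ⟨f, f0, fr⟩ := exists_sol (p := p) (c := fun _ => (M : ℝ)) (n0 := 2) (fun n hn => P.powlt hn)
    (fun n => a n + ∑ j : Fin A, (M : ℝ) * K)
  have hSK : 0 ≤ ∑ j : Fin A, (M : ℝ) * K := Finset.sum_nonneg fun _ _ => by positivity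
  have fnn : ∀ n, 0 ≤ f n := comparison' (p := p) (c := fun _ => (M : ℝ)) (n0 := 2) P.p0' P.p1' (fun _ => hMp.le)
    (fun n hn => P.powlt hn) (f := fun _ => 0) (a := fun n => a n + ∑ j : Fin A, (M : ℝ) * K)
    (fun n _ => by simp only [Eb_const, mul_zero, Finset.sum_const_zero, zero_add]; linarith [ha n])
    (fun n hn => (fr n hn).ge) (fun n hn => (f0 n hn).ge)
  refine ⟨fun n => f n + K, fun n => by linarith [fnn n], fun n hn => ?_⟩
  have : ∑ j, (M : ℝ) * Eb (p j) n (fun n => f n + K) = ∑ j, (M : ℝ) * Eb (p j) n f + ∑ j : Fin A, (M : ℝ) * K := by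
    rw [← Finset.sum_add_distrib]
    exact Finset.sum_congr rfl fun j _ => by rw [Eb_add, Eb_const]; ring
  rw [this]
  have := fr n hn
  simp only at this ⊢
  linarith

theorem EE_tendsto {E : Type*} [NormedAddCommGroup E] [NormedSpace ℝ E] {n : ℕ}
    {F : ℕ → (Fin n → Fin A) → E} {G : (Fin n → Fin A) → E} (H : ∀ c, Tendsto (fun h => F h c) atTop (𝓝 (G c))) :
    Tendsto (fun h => EE p n (F h)) atTop (𝓝 (EE p n G)) := by
  unfold EE
  exact tendsto_finsetSum _ fun c _ => (H c).const_smul _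

theorem EE_center (hps : ∑ j, p j = 1) {n : ℕ} (X : (Fin n → Fin A) → ℝ) :
    EE p n (fun c => (X c - EE p n X) ^ 2) = EE p n (fun c => X c ^ 2) - (EE p n X) ^ 2 := by
  have : (fun c => (X c - EE p n X) ^ 2) = fun c => (X c ^ 2 + (EE p n X) ^ 2) - (2 * EE p n X) * X c := by
    funext c; ring
  rw [this, EE_sub, EE_add, EE_mul, EE_const hps]; ring

variable (ν : Measure (Fin A)) [IsProbabilityMeasure ν]

theorem mh_nonneg (ha : 0 ≤ α) (hb : 0 ≤ β) (hg : 0 ≤ γ) (h n : ℕ) : 0 ≤ mh M α β γ ν h n :=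
  integral_nonneg fun ω => TT_nonneg ha hb hg h _ ω

theorem vv_le (ha : 0 ≤ α) (hb : 0 ≤ β) {n : ℕ} (hn : n < 2) : vv α β γ n ≤ α + β := by
  unfold vv; interval_cases n <;> simp [ha, hb]

theorem mh_bd (P : Par M A p ρ) [Inhabited (Fin A)] (hν : ∀ j, ν.real {j} = p j) (ha : 0 ≤ α) (hb : 0 ≤ β) (hg : 0 ≤ γ) :
    ∃ b : ℕ → ℝ, (∀ n, 0 ≤ b n) ∧ ∀ h n, mh M α β γ ν h n ≤ b n := by
  obtain ⟨b, b0, br⟩ := sup_sol P (a := fun _ => γ) (fun _ => hg) (add_nonneg ha hb)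
  have bn : ∀ n, 0 ≤ b n := fun n => (add_nonneg ha hb).trans (b0 n)
  refine ⟨b, bn, fun h => ?_⟩
  induction h with
  | zero => intro n; simp [mh, TT, bn]
  | succ h ih =>
    intro n
    rcases Nat.lt_or_ge n 2 with hn | hn
    · have : mh M α β γ ν (h + 1) n = vv α β γ n := by simp [mh, TT_succ1 hn]
      rw [this]
      exact (vv_le ha hb hn).trans (b0 n)
    · rw [mh_rec ν hν hn]
      refine le_trans ?_ (br n hn)
      rw [← EEb P.ps, add_comm]
      refine add_le_add (mul_le_mul_of_nonneg_left ?_ P.Mpos.le) le_rfl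
      exact EE_mono P.p0' n fun c => Finset.sum_le_sum fun j _ => ih _

theorem Vh_bd (P : Par M A p ρ) [Inhabited (Fin A)] [NeZero M] (hν : ∀ j, ν.real {j} = p j) (ha : 0 ≤ α) (hb : 0 ≤ β) (hg : 0 ≤ γ) :
    ∃ b : ℕ → ℝ, ∀ h n, Vh M α β γ ν h n ≤ b n := by
  obtain ⟨m, m0, mb⟩ := mh_bd ν P hν ha hb hg (M := M)
  have hMp := P.Mpos
  obtain ⟨b, b0, br⟩ := sup_sol P (a := fun n => (M : ℝ) * EE p n (fun c => (∑ j, m (cnt c j)) ^ 2))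
    (fun n => mul_nonneg hMp.le (EE_nonneg P.p0' n fun c => sq_nonneg _)) le_rfl
  refine ⟨b, fun h => ?_⟩
  induction h with
  | zero => intro n; simp only [Vh, TT]; rw [show (fun _ : Fin n × List (Fin M) → Fin A => (0:ℝ)) = 0 from rfl, variance_zero]; exact b0 n
  | succ h ih =>
    intro n
    rcases Nat.lt_or_ge n 2 with hn | hn
    · have e : (TT α β γ (h + 1) univ : (Fin n × List (Fin M) → Fin A) → ℝ) = fun _ => vv α β γ n := funext fun ω => TT_succ1 hn h ω
      have : Vh M α β γ ν (h + 1) n = 0 := by rw [Vh, e]; simp [variance_eq_integral]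
      rw [this]; exact b0 n
    · rw [Vh_rec ν hν P.ps hn, mul_add, ]
      refine le_trans ?_ (br n hn)
      rw [← EEb P.ps]
      refine add_le_add (mul_le_mul_of_nonneg_left ?_ hMp.le) (mul_le_mul_of_nonneg_left ?_ hMp.le)
      · exact EE_mono P.p0' n fun c => Finset.sum_le_sum fun j _ => ih _
      · have := EE_center P.ps (fun c : Fin n → Fin A => ∑ j, mh M α β γ ν h (cnt c j))
        unfold gt
        rw [this]
        refine (sub_le_self _ (sq_nonneg _)).trans (EE_mono P.p0' n fun c => ?_)
        exact pow_le_pow_left₀ (Finset.sum_nonneg fun j _ => mh_nonneg ν ha hb hg _ _) (Finset.sum_le_sum fun j _ => mb _ _) 2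

/-- the functional on the uncurried space -/
noncomputable def NN (α β γ : ℝ) {n : ℕ} (ω : Fin n × List (Fin M) → Fin A) : ℝ :=
  α * extZeroCount (fun k v => ω (k, v)) + β * extOneCount (fun k v => ω (k, v)) + γ * gtrieSize (fun k v => ω (k, v))

theorem TT_monotone (ha : 0 ≤ α) (hb : 0 ≤ β) (hg : 0 ≤ γ) {n : ℕ} (ω : Fin n × List (Fin M) → Fin A) :
    Monotone fun h => TT α β γ h univ ω :=
  monotone_nat_of_le_succ fun h => TT_mono ha hb hg h _ ω

theorem TT_event (P : Par M A p ρ) [Inhabited (Fin A)] (hν : ∀ j, ν.real {j} = p j) (n : ℕ) :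
    ∀ᵐ ω ∂(QQ M ν n), ∀ α β γ : ℝ, ∀ᶠ h in atTop, TT α β γ h univ ω = NN α β γ ω := by
  obtain ⟨b, b0, hb⟩ := mh_bd ν P hν (M := M) zero_le_one zero_le_one zero_le_one
  have h1 := lintegral_iSup (μ := QQ M ν n) (f := fun h ω => ENNReal.ofReal (TT 1 1 1 h univ ω))
    (fun h => (TT_meas h _).ennreal_ofReal)
    (fun i j hij ω => ENNReal.ofReal_le_ofReal (TT_monotone zero_le_one zero_le_one zero_le_one ω hij))
  have h2 : ∀ h, ∫⁻ ω, ENNReal.ofReal (TT 1 1 1 h univ ω) ∂(QQ M ν n) = ENNReal.ofReal (mh M 1 1 1 ν h n) := fun h => by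
    obtain ⟨B, hB⟩ := TT_bdd (M := M) (A := A) (α := 1) (β := 1) (γ := 1) (n := n) h
    have hi : Integrable (TT 1 1 1 h univ) (QQ M ν n) := bdd_int (TT_meas h _) (hB _) continuous_id
    rw [mh, ofReal_integral_eq_lintegral_ofReal hi
      (Eventually.of_forall fun ω => TT_nonneg zero_le_one zero_le_one zero_le_one h _ ω)]
  have h3 : ∫⁻ ω, ⨆ h, ENNReal.ofReal (TT 1 1 1 h univ ω) ∂(QQ M ν n) ≠ ⊤ := by
    rw [h1]
    refine ne_top_of_le_ne_top (b := ENNReal.ofReal (b n)) ENNReal.ofReal_ne_top (iSup_le fun h => ?_)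
    rw [h2]; exact ENNReal.ofReal_le_ofReal (hb h n)
  filter_upwards [ae_lt_top (Measurable.iSup fun h => (TT_meas h _).ennreal_ofReal) h3] with ω hω α β γ
  obtain ⟨h0, H⟩ := fin_of_bdd ω (⨆ h, ENNReal.ofReal (TT 1 1 1 h univ ω)).toReal (fun h =>
    (ENNReal.ofReal_le_iff_le_toReal hω.ne).1 (le_iSup (fun h => ENNReal.ofReal (TT 1 1 1 h univ ω)) h))
  filter_upwards [eventually_ge_atTop h0] with h hh
  exact (N_eq ω H hh).symm

theorem lim_abs {Ω : Type*} [MeasurableSpace Ω] {Q : Measure Ω} [IsProbabilityMeasure Q] {X : ℕ → Ω → ℝ} {Y : Ω → ℝ}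
    (hX : ∀ h, MemLp (X h) 2 Q) (hX0 : ∀ h ω, 0 ≤ X h ω) (hmono : ∀ ω, Monotone fun h => X h ω)
    (hlim : ∀ᵐ ω ∂Q, Tendsto (fun h => X h ω) atTop (𝓝 (Y ω))) {B : ℝ} (hB : ∀ h, ∫ ω, X h ω ^ 2 ∂Q ≤ B) :
    MemLp Y 2 Q ∧ Tendsto (fun h => ∫ ω, X h ω ∂Q) atTop (𝓝 (∫ ω, Y ω ∂Q)) ∧
    Tendsto (fun h => variance (X h) Q) atTop (𝓝 (variance Y Q)) ∧
    ∀ t : ℝ, Tendsto (fun h => ∫ ω, Complex.exp (Complex.I * ((t * X h ω : ℝ) : ℂ)) ∂Q) atTop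
      (𝓝 (∫ ω, Complex.exp (Complex.I * ((t * Y ω : ℝ) : ℂ)) ∂Q)) := by
  have Ym : AEStronglyMeasurable Y Q := aestronglyMeasurable_of_tendsto_ae atTop (fun h => (hX h).1) hlim
  have hY : MemLp Y 2 Q := by
    refine ⟨Ym, ?_⟩
    have h1 := Lp.eLpNorm_lim_le_liminf_eLpNorm (p := 2) (fun h => (hX h).1) Y hlim
    refine lt_of_le_of_lt h1 ?_
    have h2 : ∀ h, eLpNorm (X h) 2 Q ≤ ENNReal.ofReal (B ^ (2⁻¹ : ℝ)) := fun h => by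
      rw [(hX h).eLpNorm_eq_integral_rpow_norm (by norm_num) (by norm_num)]
      refine ENNReal.ofReal_le_ofReal ?_
      simp only [ENNReal.toReal_ofNat]
      refine Real.rpow_le_rpow (integral_nonneg fun ω => by positivity) ?_ (by norm_num)
      refine le_trans (le_of_eq ?_) (hB h)
      refine integral_congr_ae (Eventually.of_forall fun ω => ?_)
      simp only [Real.rpow_two, Real.norm_eq_abs, sq_abs]
    refine lt_of_le_of_lt (liminf_le_of_frequently_le' (Eventually.of_forall h2).frequently) ENNReal.ofReal_lt_top
  have hle : ∀ᵐ ω ∂Q, ∀ h, X h ω ≤ Y ω := by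
    filter_upwards [hlim] with ω hω h
    exact (hmono ω).ge_of_tendsto hω h
  have m1 : Tendsto (fun h => ∫ ω, X h ω ∂Q) atTop (𝓝 (∫ ω, Y ω ∂Q)) := by
    refine tendsto_integral_of_dominated_convergence Y (fun h => (hX h).1) (hY.integrable (by norm_num)) (fun h => ?_) hlim
    filter_upwards [hle] with ω hω
    rw [Real.norm_eq_abs, abs_of_nonneg (hX0 h ω)]; exact hω h
  have m2 : Tendsto (fun h => ∫ ω, X h ω ^ 2 ∂Q) atTop (𝓝 (∫ ω, Y ω ^ 2 ∂Q)) := by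
    refine tendsto_integral_of_dominated_convergence (fun ω => Y ω ^ 2) (fun h => (hX h).1.pow 2) hY.integrable_sq (fun h => ?_) ?_
    · filter_upwards [hle] with ω hω
      rw [Real.norm_eq_abs, abs_of_nonneg (by positivity)]; exact pow_le_pow_left₀ (hX0 h ω) (hω h) 2
    · filter_upwards [hlim] with ω hω
      exact hω.pow 2
  refine ⟨hY, m1, ?_, fun t => ?_⟩
  · rw [variance_eq_sub hY]
    refine (m2.sub (m1.pow 2)).congr fun h => ?_
    rw [variance_eq_sub (hX h)]; rfl
  · have hF : Continuous fun x : ℝ => Complex.exp (Complex.I * ((t * x : ℝ) : ℂ)) := by fun_prop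
    refine tendsto_integral_of_dominated_convergence (fun _ => 1) (fun h => hF.comp_aestronglyMeasurable (hX h).1) (integrable_const _) (fun h => ?_) ?_
    · refine Eventually.of_forall fun ω => ?_
      rw [mul_comm, Complex.norm_exp_ofReal_mul_I]
    · filter_upwards [hlim] with ω hω
      exact (hF.tendsto _).comp hω

theorem NN_lim (P : Par M A p ρ) [Inhabited (Fin A)] [NeZero M] (hν : ∀ j, ν.real {j} = p j) (ha : 0 ≤ α) (hb : 0 ≤ β) (hg : 0 ≤ γ) (n : ℕ) :
    MemLp (NN α β γ) 2 (QQ M ν n) ∧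
    Tendsto (fun h => mh M α β γ ν h n) atTop (𝓝 (∫ ω, NN α β γ ω ∂(QQ M ν n))) ∧
    Tendsto (fun h => Vh M α β γ ν h n) atTop (𝓝 (variance (NN α β γ) (QQ M ν n))) ∧
    ∀ t : ℝ, Tendsto (fun h => ch M α β γ ν h n t) atTop
      (𝓝 (∫ ω, Complex.exp (Complex.I * ((t * NN α β γ ω : ℝ) : ℂ)) ∂(QQ M ν n))) := by
  obtain ⟨m, m0, mb⟩ := mh_bd ν P hν ha hb hg (M := M)
  obtain ⟨V, Vb⟩ := Vh_bd ν P hν ha hb hg (M := M)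
  have hmem : ∀ h, MemLp (TT α β γ h univ) 2 (QQ M ν n) := fun h => by
    obtain ⟨B, hB⟩ := TT_bdd (M := M) (A := A) (α := α) (β := β) (γ := γ) (n := n) h
    exact bdd_mem (TT_meas h _) (hB _)
  refine lim_abs hmem (fun h ω => TT_nonneg ha hb hg h _ ω) (TT_monotone ha hb hg) ?_ (B := V n + m n ^ 2) fun h => ?_
  · filter_upwards [TT_event ν P hν n] with ω hω
    exact tendsto_nhds_of_eventually_eq (hω α β γ)
  · have h1 := Vb h n
    rw [Vh, variance_eq_sub (hmem h)] at h1
    have h2 := mb h n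
    have h3 := pow_le_pow_left₀ (mh_nonneg ν ha hb hg h n) h2 2
    rw [mh] at h3
    simp only [Pi.pow_apply] at h1
    linarith

end TrieLim
end Part18

section Part19
open Finset MeasureTheory ProbabilityTheory Filter Topology

section TrieRec
variable {M A : ℕ} {α β γ : ℝ} {p : Fin A → ℝ} {ρ : ℝ}
variable (ν : Measure (Fin A)) [IsProbabilityMeasure ν]

theorem NN_rec (P : Par M A p ρ) [Inhabited (Fin A)] [NeZero M] (hν : ∀ j, ν.real {j} = p j)
    (ha : 0 ≤ α) (hb : 0 ≤ β) (hg : 0 ≤ γ) (hnz : ¬(α = 0 ∧ β = 0 ∧ γ = 0)) (hdeg : ¬(ρ = 1 ∧ α = 0 ∧ γ = 0))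
    {m V : ℕ → ℝ} (hm : ∀ n, m n = ∫ ω, NN α β γ ω ∂(QQ M ν n)) (hV : ∀ n, V n = variance (NN α β γ) (QQ M ν n)) :
    Rec M A p ρ α β γ m V := by
  have L := NN_lim ν P hν ha hb hg (M := M)
  have Lm : ∀ n, Tendsto (fun h => mh M α β γ ν h n) atTop (𝓝 (m n)) := fun n => by rw [hm]; exact (L n).2.1
  have LV : ∀ n, Tendsto (fun h => Vh M α β γ ν h n) atTop (𝓝 (V n)) := fun n => by rw [hV]; exact (L n).2.2.1
  have sm : ∀ n, n < 2 → m n = vv α β γ n := fun n hn => by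
    refine tendsto_nhds_unique ((tendsto_add_atTop_iff_nat 1).2 (Lm n)) (tendsto_const_nhds.congr fun h => ?_)
    simp [mh, TT_succ1 hn]
  have sV : ∀ n, n < 2 → V n = 0 := fun n hn => by
    refine tendsto_nhds_unique ((tendsto_add_atTop_iff_nat 1).2 (LV n)) (tendsto_const_nhds.congr fun h => ?_)
    have e : (TT α β γ (h + 1) univ : (Fin n × List (Fin M) → Fin A) → ℝ) = fun _ => vv α β γ n := funext fun ω => TT_succ1 hn h ω
    rw [Vh, e]; simp [variance_eq_integral]
  have Lsum : ∀ n, Tendsto (fun h => EE p n (fun c => ∑ j, mh M α β γ ν h (cnt c j))) atTop (𝓝 (EE p n (fun c => ∑ j, m (cnt c j)))) :=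
    fun n => EE_tendsto fun c => tendsto_finsetSum _ fun j _ => Lm _
  refine ⟨P, ha, hb, hg, hnz, hdeg, by rw [sm 0 (by norm_num)]; simp [vv], by rw [sm 1 (by norm_num)]; simp [vv], fun n hn => ?_,
    sV 0 (by norm_num), sV 1 (by norm_num), fun n hn => ?_⟩
  · rw [← EEb P.ps, add_comm]
    refine tendsto_nhds_unique ((tendsto_add_atTop_iff_nat 1).2 (Lm n)) ?_
    simp only [mh_rec ν hν hn]
    exact ((Lsum n).const_mul _).const_add _
  · rw [← EEb P.ps, ← mul_add]
    refine tendsto_nhds_unique ((tendsto_add_atTop_iff_nat 1).2 (LV n)) ?_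
    simp only [Vh_rec ν hν P.ps hn]
    refine (Tendsto.add (EE_tendsto fun c => tendsto_finsetSum _ fun j _ => LV _) (EE_tendsto fun c => ?_)).const_mul _
    unfold gt
    exact ((tendsto_finsetSum _ fun j _ => Lm _).sub (Lsum n)).pow 2

/-- characteristic function of the centered functional -/
noncomputable def aa (M : ℕ) (α β γ : ℝ) (ν : Measure (Fin A)) [IsProbabilityMeasure ν] (m : ℕ → ℝ) (n : ℕ) (t : ℝ) : ℂ :=
  ∫ ω, Complex.exp (Complex.I * ((t * (NN (M := M) α β γ ω - m n) : ℝ) : ℂ)) ∂(QQ M ν n)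

theorem aa_eq (m : ℕ → ℝ) (n : ℕ) (t : ℝ) : aa M α β γ ν m n t =
    Complex.exp (-(Complex.I * ((t * m n : ℝ) : ℂ))) * ∫ ω, Complex.exp (Complex.I * ((t * NN α β γ ω : ℝ) : ℂ)) ∂(QQ M ν n) := by
  unfold aa
  rw [← integral_const_mul]
  congr 1; funext ω
  rw [← Complex.exp_add]; congr 1; push_cast; ring

theorem aa_norm (m : ℕ → ℝ) (n : ℕ) (t : ℝ) : ‖aa M α β γ ν m n t‖ ≤ 1 := by
  unfold aa
  refine (norm_integral_le_of_norm_le_const (C := 1) (Eventually.of_forall fun ω => ?_)).trans (by simp)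
  rw [mul_comm, Complex.norm_exp_ofReal_mul_I]

theorem aa_rec (P : Par M A p ρ) [Inhabited (Fin A)] [NeZero M] (hν : ∀ j, ν.real {j} = p j)
    {m V : ℕ → ℝ} (R : Rec M A p ρ α β γ m V) :
    (∀ t, aa M α β γ ν m 0 t = 1) ∧ (∀ t, aa M α β γ ν m 1 t = 1) ∧
    ∀ n ≥ 2, ∀ t, aa M α β γ ν m n t = (EE p n (fun c => (∏ j, aa M α β γ ν m (cnt c j) t) * Complex.exp (Complex.I * ((t * gt p m n c : ℝ) : ℂ)))) ^ M := by
  have L := NN_lim ν P hν R.ha R.hb R.hg (M := M)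
  have small : ∀ n, n < 2 → m n = vv α β γ n → ∀ t, aa M α β γ ν m n t = 1 := fun n hn e t => by
    have := tendsto_nhds_unique ((tendsto_add_atTop_iff_nat 1).2 ((L n).2.2.2 t))
      (tendsto_const_nhds (x := Complex.exp (Complex.I * ((t * vv α β γ n : ℝ) : ℂ))) |>.congr fun h => by simp [ch, TT_succ1 hn])
    rw [aa_eq, this, e, ← Complex.exp_add]; simp
  refine ⟨small 0 (by norm_num) (by rw [R.m0]; simp [vv]), small 1 (by norm_num) (by rw [R.m1]; simp [vv]), fun n hn t => ?_⟩
  set φ : ℕ → ℂ := fun n => ∫ ω, Complex.exp (Complex.I * ((t * NN α β γ ω : ℝ) : ℂ)) ∂(QQ M ν n) with hφ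
  have Lc : ∀ n, Tendsto (fun h => ch M α β γ ν h n t) atTop (𝓝 (φ n)) := fun n => (L n).2.2.2 t
  have φr : φ n = Complex.exp (Complex.I * ((t * γ : ℝ) : ℂ)) * (EE p n (fun c => ∏ j, φ (cnt c j))) ^ M := by
    refine tendsto_nhds_unique ((tendsto_add_atTop_iff_nat 1).2 (Lc n)) ?_
    simp only [ch_rec ν hν hn]
    exact ((EE_tendsto fun c => tendsto_finsetProd _ fun j _ => Lc _).pow M).const_mul _
  set e := EE p n (fun c => ∑ j, m (cnt c j)) with he
  have hmn : m n = M * e + γ := by rw [R.mr n hn, ← EEb P.ps]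
  have hin : ∀ c : Fin n → Fin A, (∏ j, aa M α β γ ν m (cnt c j) t) * Complex.exp (Complex.I * ((t * gt p m n c : ℝ) : ℂ)) =
      Complex.exp (-(Complex.I * ((t * e : ℝ) : ℂ))) * ∏ j, φ (cnt c j) := fun c => by
    simp only [aa_eq]
    rw [Finset.prod_mul_distrib, ← Complex.exp_sum, mul_right_comm, ← Complex.exp_add]
    congr 2
    rw [gt, ← he, Finset.sum_neg_distrib, ← Finset.mul_sum]
    push_cast
    rw [← Finset.mul_sum]; ring
  simp only [hin]
  rw [EE_mulC, mul_pow, ← Complex.exp_nat_mul, aa_eq]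
  change _ * φ n = _
  rw [φr, ← mul_assoc, ← Complex.exp_add, hmn]
  congr 2
  push_cast; ring

end TrieRec
end Part19

section Part20
open Finset MeasureTheory ProbabilityTheory Filter Topology

section Assembly
variable {M A : ℕ} {α β γ : ℝ} {p : Fin A → ℝ} {ρ : ℝ}

theorem label_eq [Inhabited (Fin A)] (ν : Measure (Fin A)) [IsProbabilityMeasure ν]
    (hν : ∀ j, ν {j} = ENNReal.ofReal (p j)) (μL : Measure (List (Fin M) → Fin A)) [IsProbabilityMeasure μL]
    (hμL : IsLabelingMeasure p μL) : μL = Measure.infinitePi fun _ => ν := by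
  classical
  refine ((Measure.isProjectiveLimit_infinitePi (fun _ : List (Fin M) => ν)).unique fun s => ?_).symm
  refine Measure.ext_of_singleton fun g => ?_
  rw [Measure.pi_singleton, Measure.map_apply (measurable_restrict s) (measurableSet_singleton g)]
  have h1 := hμL s (fun w => if h : w ∈ s then g ⟨w, h⟩ else default)
  have h2 : (s.restrict : (List (Fin M) → Fin A) → (s → Fin A)) ⁻¹' {g} = {L : List (Fin M) → Fin A | ∀ w ∈ s, L w = if h : w ∈ s then g ⟨w, h⟩ else default} := by
    ext L
    simp only [Set.mem_preimage, Set.mem_singleton_iff, Set.mem_ofPred_eq, funext_iff, Finset.restrict, Subtype.forall]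
    refine forall_congr' fun w => forall_congr' fun hw => ?_
    rw [dif_pos hw]
  rw [h2, h1, ← Finset.prod_coe_sort]
  refine Finset.prod_congr rfl fun w _ => ?_
  rw [dif_pos w.2, hν]

theorem asy_form {d θ : ℝ} (hd : 0 < d) {f : ℕ → ℝ} {Q : ℝ → ℝ} (h : AsyQ p d θ f Q) (hQ : ∀ s, 0 < Q s) :
    ∃ e : ℕ → ℝ, Tendsto e atTop (𝓝 0) ∧
      ∀ᶠ n : ℕ in atTop, f n = Q (d * Real.logb (Real.exp d) n) * (n : ℝ) ^ θ * (1 + e n) := by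
  obtain ⟨⟨B, hB, hb⟩, -⟩ := per_unif (Q := fun s => (Q s)⁻¹) hd (h.cont.inv₀ fun s => (hQ s).ne') (fun s => by simp only [h.per])
  refine ⟨fun n => (f n / (n : ℝ) ^ θ - Q (Real.log n)) * (Q (Real.log n))⁻¹, ?_, ?_⟩
  · refine squeeze_zero_norm (a := fun n : ℕ => |f n / (n : ℝ) ^ θ - Q (Real.log n)| * B) (fun n => ?_) ?_
    · rw [norm_mul]
      exact mul_le_mul_of_nonneg_left (hb _) (norm_nonneg _)
    · simpa using h.lim.abs.mul_const B
  · filter_upwards [eventually_gt_atTop 0] with n hn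
    have hn' : (0 : ℝ) < (n : ℝ) ^ θ := Real.rpow_pos_of_pos (by exact_mod_cast hn) _
    have : d * Real.logb (Real.exp d) n = Real.log n := by
      rw [Real.logb, Real.log_exp]; field_simp
    rw [this]
    have := (hQ (Real.log n)).ne'
    field_simp
    ring

theorem asy_low {d θ : ℝ} (hd : 0 < d) {f : ℕ → ℝ} {Q : ℝ → ℝ} (h : AsyQ p d θ f Q) (hQ : ∀ s, 0 < Q s) :
    ∃ c > 0, ∀ᶠ n : ℕ in atTop, c * (n : ℝ) ^ θ ≤ f n := by
  obtain ⟨⟨B, hB, hb⟩, -⟩ := per_unif (Q := fun s => (Q s)⁻¹) hd (h.cont.inv₀ fun s => (hQ s).ne') (fun s => by simp only [h.per])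
  have hc : 0 < B⁻¹ := inv_pos.2 hB
  refine ⟨B⁻¹ / 2, by positivity, ?_⟩
  have := h.lim.eventually (lt_mem_nhds (show -(B⁻¹ / 2) < 0 by linarith))
  filter_upwards [this, eventually_gt_atTop 0] with n h1 hn
  have hn' : (0 : ℝ) < (n : ℝ) ^ θ := Real.rpow_pos_of_pos (by exact_mod_cast hn) _
  have h2 : B⁻¹ ≤ Q (Real.log n) := by
    have h3 := hb (Real.log n)
    rw [abs_of_pos (inv_pos.2 (hQ _))] at h3
    exact inv_le_of_inv_le₀ (hQ _) h3
  rw [← le_div_iff₀ hn']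
  linarith

theorem clt_final (P : Par M A p ρ) [Inhabited (Fin A)] [NeZero M] (ν : Measure (Fin A)) [IsProbabilityMeasure ν]
    (hν : ∀ j, ν.real {j} = p j) {m V : ℕ → ℝ} (R : Rec M A p ρ α β γ m V)
    {d η : ℝ} {Q : ℝ → ℝ} (hd : 0 < d) (hV : AsyQ p d η V Q) (hQ : ∀ s, 0 < Q s)
    (h1 : (∀ j, p j = 1 / (A : ℝ)) → η = ρ) (h2 : (¬ ∀ j, p j = 1 / (A : ℝ)) → η = 2 * ρ - 1)
    (f : BoundedContinuousFunction ℝ ℝ) :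
    Tendsto (fun n => ∫ ω, f ((NN α β γ ω - m n) / Real.sqrt (V n)) ∂(QQ M ν n)) atTop
          (𝓝 (∫ x, f x ∂(gaussianReal 0 1))) := by
  obtain ⟨a0, a1, ar⟩ := aa_rec (M := M) ν P hν R
  obtain ⟨b, hb, hab⟩ := R.clt hd hV h1 h2 (aa_norm ν m) a0 a1 ar
  obtain ⟨c, hc, hlow⟩ := asy_low hd hV hQ
  have Xm : ∀ n, AEMeasurable (fun ω => (NN α β γ ω - m n) / Real.sqrt (V n)) (QQ M ν n) := fun n =>
    (((NN_lim ν P hν R.ha R.hb R.hg (M := M) n).1.1.aemeasurable).sub_const _).div_const _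
  let L : ℕ → ProbabilityMeasure ℝ := fun n => ⟨(QQ M ν n).map (fun ω => (NN α β γ ω - m n) / Real.sqrt (V n)), Measure.isProbabilityMeasure_map (Xm n)⟩
  let G : ProbabilityMeasure ℝ := ⟨gaussianReal 0 1, inferInstance⟩
  have key : Tendsto L atTop (𝓝 G) := by
    rw [ProbabilityMeasure.tendsto_iff_tendsto_charFun]
    intro t
    have hch : ∀ n, charFun (L n : Measure ℝ) t = aa M α β γ ν m n (t / Real.sqrt (V n)) := fun n => by
      rw [charFun_apply_real]
      change ∫ x : ℝ, Complex.exp (t * x * Complex.I) ∂((QQ M ν n).map _) = _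
      rw [integral_map (Xm n) (by fun_prop)]
      unfold aa
      congr 1; funext ω; congr 1; push_cast; ring
    have hG : charFun (G : Measure ℝ) t = ((Real.exp (-(t ^ 2 / 2)) : ℝ) : ℂ) := by
      change charFun (gaussianReal 0 1) t = _
      rw [charFun_gaussianReal]; push_cast; congr 1; simp
    simp only [hch, hG]
    rw [tendsto_iff_norm_sub_tendsto_zero, Metric.tendsto_atTop']
    intro ε hε
    set κ : ℝ := ε * (Real.sqrt c) ^ 3 / (|t| ^ 3 + 1) / 2 with hκ
    have hκ0 : 0 < κ := by positivity
    have ev : ∀ᶠ n : ℕ in atTop, ‖aa M α β γ ν m n (t / Real.sqrt (V n)) - ((Real.exp (-(t ^ 2 / 2)) : ℝ) : ℂ)‖ < ε := by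
      filter_upwards [hb κ hκ0, hlow, eventually_gt_atTop 0] with n hbn hln hn
      have hn0 : (0 : ℝ) < n := by exact_mod_cast hn
      have hn' : (0 : ℝ) < (n : ℝ) ^ η := Real.rpow_pos_of_pos hn0 _
      have hVp : 0 < V n := lt_of_lt_of_le (by positivity) hln
      have hs : 0 < Real.sqrt (V n) := Real.sqrt_pos.2 hVp
      have e1 : V n * ((t / Real.sqrt (V n)) ^ 2 / 2) = t ^ 2 / 2 := by
        rw [div_pow, Real.sq_sqrt hVp.le]; field_simp
      have := hab n (t / Real.sqrt (V n))
      rw [e1] at this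
      refine lt_of_le_of_lt this ?_
      have e2 : (n : ℝ) ^ (3 * η / 2) = (Real.sqrt ((n : ℝ) ^ η)) ^ 3 := by
        rw [Real.sqrt_eq_rpow, ← Real.rpow_natCast, ← Real.rpow_mul hn0.le, ← Real.rpow_mul hn0.le]
        congr 1; push_cast; ring
      have e3 : (Real.sqrt c) ^ 3 * (Real.sqrt ((n : ℝ) ^ η)) ^ 3 ≤ (Real.sqrt (V n)) ^ 3 := by
        rw [← mul_pow, ← Real.sqrt_mul hc.le]
        exact pow_le_pow_left₀ (Real.sqrt_nonneg _) (Real.sqrt_le_sqrt hln) 3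
      rw [e2] at hbn
      rw [abs_div, abs_of_pos hs, div_pow]
      have hs3 : 0 < Real.sqrt (V n) ^ 3 := by positivity
      rw [div_mul_eq_mul_div, div_lt_iff₀ hs3]
      have ht : 0 ≤ |t| ^ 3 := by positivity
      calc |t| ^ 3 * b n ≤ |t| ^ 3 * (κ * Real.sqrt ((n : ℝ) ^ η) ^ 3) := mul_le_mul_of_nonneg_left hbn ht
        _ = (|t| ^ 3 / (|t| ^ 3 + 1) * (ε / 2)) * ((Real.sqrt c) ^ 3 * (Real.sqrt ((n : ℝ) ^ η)) ^ 3) := by rw [hκ]; ring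
        _ ≤ (1 * (ε / 2)) * ((Real.sqrt c) ^ 3 * (Real.sqrt ((n : ℝ) ^ η)) ^ 3) := by
            gcongr
            rw [div_le_one (by positivity)]; linarith
        _ ≤ (1 * (ε / 2)) * (Real.sqrt (V n)) ^ 3 := by gcongr
        _ < ε * Real.sqrt (V n) ^ 3 := by
            have : 1 * (ε / 2) < ε := by linarith
            gcongr
    obtain ⟨N, hN⟩ := eventually_atTop.1 ev
    exact ⟨N, fun n hn => by simpa using hN n hn.le⟩
  rw [ProbabilityMeasure.tendsto_iff_forall_integral_tendsto] at key
  refine (key f).congr fun n => ?_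
  change ∫ x, f x ∂((QQ M ν n).map _) = _
  rw [integral_map (Xm n) f.continuous.aestronglyMeasurable]

end Assembly
end Part20

/-- **Mean, variance and CLT for `N_n = αR_n + βK_n + γS_n`** (Theorem 2). -/
theorem gtrie_additive_functional_asymptotics
    {M A : ℕ} (hM : 1 ≤ M) (hA : 2 ≤ A)
    (p : Fin A → ℝ) (hp0 : ∀ j, 0 < p j) (hp1 : ∀ j, p j < 1)
    (hpsum : ∑ j, p j = 1)
    (hnonexp : ∑ j, (p j) ^ 2 < 1 / (M : ℝ))
    (ρ : ℝ) (hρ : ∑ j, (p j) ^ ρ = 1 / (M : ℝ))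
    (α β γ : ℝ) (hα : 0 ≤ α) (hβ : 0 ≤ β) (hγ : 0 ≤ γ)
    (hnz : ¬(α = 0 ∧ β = 0 ∧ γ = 0))
    (hdeg : ¬(ρ = 1 ∧ α = 0 ∧ γ = 0))
    (μL : Measure (List (Fin M) → Fin A)) [IsProbabilityMeasure μL]
    (hμL : IsLabelingMeasure p μL)
    (μ : (n : ℕ) → Measure (Fin n → List (Fin M) → Fin A))
    (hμ : ∀ n, μ n = Measure.pi fun _ => μL)
    (N : (n : ℕ) → (Fin n → List (Fin M) → Fin A) → ℝ)
    (hN : ∀ n Ls, N n Ls = α * extZeroCount Ls + β * extOneCount Ls + γ * gtrieSize Ls)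
    (EN VN : ℕ → ℝ)
    (hEN : ∀ n, EN n = ∫ Ls, N n Ls ∂(μ n))
    (hVN : ∀ n, VN n = variance (N n) (μ n)) :
    ∃ a : ℝ, 1 < a ∧
    ∃ QE QV : ℝ → ℝ,
      Continuous QE ∧ (∀ x, QE (x + 1) = QE x) ∧ (∀ x, 0 < QE x) ∧
      Continuous QV ∧ (∀ x, QV (x + 1) = QV x) ∧ (∀ x, 0 < QV x) ∧
      (∃ e : ℕ → ℝ, Tendsto e atTop (𝓝 0) ∧
        ∀ᶠ n : ℕ in atTop, EN n = QE (Real.logb a n) * (n : ℝ) ^ ρ * (1 + e n)) ∧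
      ((∀ j, p j = 1 / (A : ℝ)) →
        ∃ e : ℕ → ℝ, Tendsto e atTop (𝓝 0) ∧
          ∀ᶠ n : ℕ in atTop, VN n = QV (Real.logb a n) * (n : ℝ) ^ ρ * (1 + e n)) ∧
      ((¬ ∀ j, p j = 1 / (A : ℝ)) →
        ∃ e : ℕ → ℝ, Tendsto e atTop (𝓝 0) ∧
          ∀ᶠ n : ℕ in atTop,
            VN n = QV (Real.logb a n) * (n : ℝ) ^ (2 * ρ - 1) * (1 + e n)) ∧
      ∀ f : BoundedContinuousFunction ℝ ℝ,
        Tendsto (fun n => ∫ Ls, f ((N n Ls - EN n) / Real.sqrt (VN n)) ∂(μ n)) atTop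
          (𝓝 (∫ x, f x ∂(gaussianReal 0 1))) := by
  have P : Par M A p ρ := Par.mk' hM hA hp0 hp1 hpsum hnonexp hρ
  haveI : Inhabited (Fin A) := ⟨⟨0, by omega⟩⟩
  haveI : NeZero M := ⟨by omega⟩
  have evm : Measurable (fun L : List (Fin M) → Fin A => L []) := measurable_pi_apply _
  set ν : Measure (Fin A) := μL.map (fun L => L []) with hνd
  haveI : IsProbabilityMeasure ν := Measure.isProbabilityMeasure_map evm.aemeasurable
  have hν1 : ∀ j, ν {j} = ENNReal.ofReal (p j) := fun j => by
    rw [hνd, Measure.map_apply evm (measurableSet_singleton j)]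
    have := hμL {[]} (fun _ => j)
    simp only [Finset.mem_singleton, forall_eq, Finset.prod_singleton] at this
    exact this
  have hν : ∀ j, ν.real {j} = p j := fun j => by
    rw [Measure.real, hν1, ENNReal.toReal_ofReal (hp0 j).le]
  have hL := label_eq ν hν1 μL hμL
  have hμQ : ∀ n, μ n = (QQ M ν n).map (MeasurableEquiv.curry (Fin n) (List (Fin M)) (Fin A)) := fun n => by
    rw [hμ, hL, ← Measure.infinitePi_eq_pi, QQ]
    exact (Measure.infinitePi_map_curry (ι := Fin n) (κ := List (Fin M)) (fun _ _ => ν)).symm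
  have hNN : ∀ n (ω : Fin n × List (Fin M) → Fin A), N n (MeasurableEquiv.curry (Fin n) (List (Fin M)) (Fin A) ω) = NN α β γ ω :=
    fun n ω => hN n _
  have hm : ∀ n, EN n = ∫ ω, NN α β γ ω ∂(QQ M ν n) := fun n => by
    rw [hEN, hμQ, integral_map_equiv]
    simp only [hNN]
  have hV : ∀ n, VN n = variance (NN α β γ) (QQ M ν n) := fun n => by
    rw [hVN, hμQ, variance_map_equiv]
    exact congrArg (fun X => variance X (QQ M ν n)) (funext fun ω => hNN n ω)
  have R : Rec M A p ρ α β γ EN VN := NN_rec ν P hν hα hβ hγ hnz hdeg hm hV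
  obtain ⟨d, hd⟩ := exists_ren P
  obtain ⟨QE, hQE⟩ := R.asyM hd
  obtain ⟨c0, hc0, hlow⟩ := R.mlow
  have QEpos : ∀ s, 0 < QE s := fun s => hQE.pos hd.1 hc0 (eventually_atTop.2 ⟨2, fun n hn => hlow n hn⟩) s
  obtain ⟨η, QV, hQV, QVpos, hη1, hη2⟩ := R.varQ hd
  refine ⟨Real.exp d, Real.one_lt_exp_iff.2 hd.1, fun x => QE (d * x), fun x => QV (d * x),
    hQE.cont.comp (continuous_const.mul continuous_id), fun x => ?_, fun x => QEpos _,
    hQV.cont.comp (continuous_const.mul continuous_id), fun x => ?_, fun x => QVpos _,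
    asy_form hd.1 hQE QEpos, fun h => ?_, fun h => ?_, fun f => ?_⟩
  · simp only [mul_add, mul_one]; exact hQE.per _
  · simp only [mul_add, mul_one]; exact hQV.per _
  · rw [← hη1 h]; exact asy_form hd.1 hQV QVpos
  · rw [← hη2 h]; exact asy_form hd.1 hQV QVpos
  · refine (clt_final P ν hν R hd.1 hQV QVpos hη1 hη2 f).congr fun n => ?_
    rw [hμQ, integral_map_equiv]
    simp only [hNN]
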